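/- For every L > 0 and W ∈ [0, ∞], the free energy F(Q) = ∫_Ω [(L/2)|∇Q|² + f(Q)] dx + (W/2)∫_{∂B₁}|Q_s − Q|² dA attains its infimum over H_∞ (in the case W = ∞ the surface term is replaced by the Dirichlet constraint Q = Q_s on ∂B₁): there exists Q ∈ H_∞ with F(Q) = inf_{H_∞} F. Moreover, any Q ∈ H_∞ solving the Euler–Lagrange equation L ΔQ = −aQ − b(Q² − (|Q|²/3)I) + c|Q|²Q in Ω satisfies the strong far-field condition Q(x) → Q_∞ as |x| → ∞. -/

import Mathlib

open MeasureTheory Filter Metric Real Set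
open scoped ENNReal NNReal
noncomputable section

abbrev E3 : Type := EuclideanSpace ℝ (Fin 3)
abbrev Mat3 : Type := Matrix (Fin 3) (Fin 3) ℝ

def isS0 (Q : Mat3) : Prop := Q.IsSymm ∧ Q.trace = 0
def minner (A B : Mat3) : ℝ := (A * B).trace
def mnormSq (A : Mat3) : ℝ := (A * A).trace
def mnorm (A : Mat3) : ℝ := Real.sqrt (mnormSq A)
def outer (u v : E3) : Mat3 := Matrix.of fun i j => u i * v j
def ez : E3 := EuclideanSpace.single 2 1
def er (x : E3) : E3 := ‖x‖⁻¹ • x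
def sstar (a b c : ℝ) : ℝ := (b + Real.sqrt (b ^ 2 + 24 * a * c)) / (4 * c)
def Qinf (a b c : ℝ) : Mat3 := sstar a b c • (outer ez ez - (1 / 3 : ℝ) • (1 : Mat3))
def Qsurf (a b c : ℝ) (x : E3) : Mat3 :=
  sstar a b c • (outer (er x) (er x) - (1 / 3 : ℝ) • (1 : Mat3))
def Omega : Set E3 := {x | 1 < ‖x‖}
def OmegaBar : Set E3 := {x | 1 ≤ ‖x‖}

def pd (g : E3 → ℝ) (k : Fin 3) : E3 → ℝ :=
  fun x => fderivWithin ℝ g OmegaBar x (EuclideanSpace.single k 1)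
def lap3 (g : E3 → ℝ) (x : E3) : ℝ := ∑ k, pd (pd g k) k x
def matLap (Q : E3 → Mat3) (x : E3) : Mat3 := Matrix.of fun i j => lap3 (fun y => Q y i j) x
def gradSq (Q : E3 → Mat3) (x : E3) : ℝ := ∑ i, ∑ j, ∑ k, (pd (fun y => Q y i j) k x) ^ 2
def nuDeriv (Q : E3 → Mat3) (x : E3) : Mat3 :=
  Matrix.of fun i j => fderivWithin ℝ (fun y => Q y i j) OmegaBar x (-(er x))

def gradf (a b c : ℝ) (Q : Mat3) : Mat3 :=
  (-a) • Q - b • (Q * Q - (mnormSq Q / 3) • (1 : Mat3)) + (c * mnormSq Q) • Q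

def gpot (a b c : ℝ) (Q : Mat3) : ℝ :=
  -(a / 2) * (Q * Q).trace - (b / 3) * (Q * Q * Q).trace + (c / 4) * ((Q * Q).trace) ^ 2
def Cconst (a b c : ℝ) : ℝ := -sInf (gpot a b c '' {Q | isS0 Q})
def fpot (a b c : ℝ) (Q : Mat3) : ℝ := gpot a b c Q + Cconst a b c

def RegC (m : ℕ) (Q : E3 → Mat3) : Prop :=
  ∀ i j, ContDiffOn ℝ m (fun x => Q x i j) OmegaBar

def memH (a b c : ℝ) (Q : E3 → Mat3) : Prop :=
  (∀ x ∈ OmegaBar, isS0 (Q x)) ∧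
  IntegrableOn (fun x => gradSq Q x) Omega volume ∧
  IntegrableOn (fun x => mnormSq (Q x - Qinf a b c) / ‖x‖ ^ 2) Omega volume

def isEL (a b c L : ℝ) (Q : E3 → Mat3) : Prop :=
  ∀ x ∈ Omega, L • matLap Q x = gradf a b c (Q x)

def weakAnchor (a b c L W : ℝ) (Q : E3 → Mat3) : Prop :=
  ∀ x : E3, ‖x‖ = 1 → (L / W) • nuDeriv Q x = Qsurf a b c x - Q x

def coef1 (w : ℝ≥0∞) : ℝ := if w = ⊤ then 1 else w.toReal / (1 + w.toReal)
def coef3 (w : ℝ≥0∞) : ℝ := if w = ⊤ then 1 else w.toReal / (3 + w.toReal)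

def Q0 (a b c : ℝ) (w : ℝ≥0∞) (x : E3) : Mat3 :=
  (sstar a b c * coef3 w / ‖x‖ ^ 3) • (outer (er x) (er x) - (1 / 3 : ℝ) • (1 : Mat3))
  + (sstar a b c * (1 - coef1 w / ‖x‖)) • (outer ez ez - (1 / 3 : ℝ) • (1 : Mat3))

def repeatedEig (Q : Mat3) : Prop := ∃ t : ℝ, 2 ≤ Polynomial.rootMultiplicity t (Matrix.charpoly Q)

def vec3 (p q r : ℝ) : E3 := (WithLp.equiv 2 (Fin 3 → ℝ)).symm ![p, q, r]

/-- Bulk part of the free energy, as an extended-real integral. -/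
def bulkE (a b c L : ℝ) (Q : E3 → Mat3) : ℝ≥0∞ :=
  ∫⁻ x in Omega, ENNReal.ofReal (L / 2 * gradSq Q x + fpot a b c (Q x))

/-- Surface anchoring energy `∫_{∂B₁} |Q_s − Q|² dA` with respect to the 2-dimensional
Hausdorff (area) measure on the unit sphere. -/
def surfE (a b c : ℝ) (Q : E3 → Mat3) : ℝ≥0∞ :=
  ∫⁻ x in Metric.sphere (0 : E3) 1, ENNReal.ofReal (mnormSq (Qsurf a b c x - Q x)) ∂ μH[2]

/-- The free energy with anchoring strength `W ∈ [0,∞]`; for `W = ∞` the surface term is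
dropped (it is replaced by the Dirichlet constraint, see `Adm`). -/
def FW (a b c L : ℝ) (W : ℝ≥0∞) (Q : E3 → Mat3) : ℝ≥0∞ :=
  bulkE a b c L Q + (if W = ⊤ then 0 else W / 2) * surfE a b c Q

/-- Admissible class: members of `H_∞`, subject to the Dirichlet constraint `Q = Q_s` on
the unit sphere in the strong anchoring case `W = ∞`. -/
def Adm (a b c : ℝ) (W : ℝ≥0∞) (Q : E3 → Mat3) : Prop :=
  RegC 1 Q ∧ memH a b c Q ∧ (W = ⊤ → ∀ x : E3, ‖x‖ = 1 → Q x = Qsurf a b c x)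

open scoped Topology ContDiff

/-- The standard basis of `E3`. -/
abbrev ek (k : Fin 3) : E3 := EuclideanSpace.single k 1

/-- Surface measure on the unit sphere obtained from Lebesgue measure in polar coordinates. -/
abbrev sph : Measure (sphere (0 : E3) 1) := (volume : Measure E3).toSphere

lemma finrank_E3 : Module.finrank ℝ E3 = 3 := by simp

theorem integral_polar {f : E3 → ℝ} (hf : Integrable f) :
    ∫ x, f x = ∫ w, ∫ r in Ioi (0 : ℝ), r ^ 2 * f (r • (w : E3)) ∂volume ∂sph := by
  have mp := (volume : Measure E3).measurePreserving_homeomorphUnitSphereProd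
  have me := (homeomorphUnitSphereProd E3).measurableEmbedding
  let F : sphere (0 : E3) 1 × Ioi (0 : ℝ) → ℝ := fun p => f ((p.2 : ℝ) • (p.1 : E3))
  have key : (fun x : ({(0)}ᶜ : Set E3) => f x) = F ∘ homeomorphUnitSphereProd E3 := by
    funext x
    have : ‖(x : E3)‖ ≠ 0 := norm_ne_zero_iff.2 x.2
    simp [F, smul_smul, this]
  have h1 : ∫ x, f x = ∫ x : ({(0)}ᶜ : Set E3), f x ∂((volume : Measure E3).comap (↑)) := by
    rw [integral_subtype_comap (measurableSet_singleton _).compl f, restrict_compl_singleton]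
  have hint : Integrable F
      ((volume : Measure E3).toSphere.prod (.volumeIoiPow (Module.finrank ℝ E3 - 1))) := by
    rw [← mp.integrable_comp_emb me, ← key]
    exact (integrableOn_iff_comap_subtypeVal (measurableSet_singleton _).compl).1 hf.integrableOn
  rw [h1, key, show ∫ x, (F ∘ homeomorphUnitSphereProd E3) x ∂_ = _ from mp.integral_comp me F,
    integral_prod _ hint]
  congr 1
  funext w
  simp only [finrank_E3, Measure.volumeIoiPow, ENNReal.ofReal]
  rw [integral_withDensity_eq_integral_smul
    ((measurable_subtype_coe.pow_const _).real_toNNReal),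
    integral_subtype_comap measurableSet_Ioi
      fun a : ℝ ↦ Real.toNNReal (a ^ (3 - 1)) • f (a • (w : E3))]
  refine setIntegral_congr_fun measurableSet_Ioi fun x hx ↦ ?_
  simp only [NNReal.smul_def, Real.coe_toNNReal _ (pow_nonneg (le_of_lt hx) _), smul_eq_mul]

lemma integrableOn_norm_pow_inv {n : ℕ} (hn : n ≤ 2) (R : ℝ) :
    IntegrableOn (fun x : E3 => (‖x‖ ^ n)⁻¹) (ball 0 R) := by
  rw [integrableOn_fun_norm_addHaar (μ := volume) (f := fun t : ℝ => (t ^ n)⁻¹)]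
  refine IntegrableOn.congr_fun (f := fun t => t ^ (2 - n)) ?_ (fun t ht => ?_) measurableSet_Ioo
  · exact ((continuous_pow _).integrableOn_Icc (a := 0) (b := R)).mono_set Ioo_subset_Icc_self
  · simp [pow_sub₀ t ht.1.ne' hn]

lemma integrableOn_norm_sq_inv (R : ℝ) : IntegrableOn (fun x : E3 => (‖x‖ ^ 2)⁻¹) (ball 0 R) :=
  integrableOn_norm_pow_inv le_rfl R

lemma integrableOn_norm_inv (R : ℝ) : IntegrableOn (fun x : E3 => ‖x‖⁻¹) (ball 0 R) := by
  simpa using integrableOn_norm_pow_inv one_le_two R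

lemma fderiv_eq_zero_of_far {g : E3 → ℝ} {R : ℝ} (hR : ∀ x, R ≤ ‖x‖ → g x = 0) {x : E3}
    (hx : R < ‖x‖) : fderiv ℝ g x = 0 := by
  have : g =ᶠ[𝓝 x] fun _ => 0 := by
    filter_upwards [(isOpen_lt continuous_const continuous_norm).mem_nhds hx] with y hy
    exact hR y (le_of_lt hy)
  rw [this.fderiv_eq]; simp

/-- Radial fundamental theorem of calculus in polar coordinates. -/
theorem integral_radial {X : E3 → ℝ} {r₀ M R : ℝ} (hr₀ : 0 ≤ r₀)
    (hd : ∀ x, r₀ < ‖x‖ → DifferentiableAt ℝ X x)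
    (hc : ∀ w : E3, ‖w‖ = 1 → ContinuousWithinAt (fun r : ℝ => X (r • w)) (Ici r₀) r₀)
    (hM : ∀ x, r₀ < ‖x‖ → ‖fderiv ℝ X x‖ ≤ M)
    (hR : ∀ x, R ≤ ‖x‖ → X x = 0) :
    IntegrableOn (fun x => fderiv ℝ X x x / ‖x‖ ^ 3) {x | r₀ < ‖x‖} ∧
    ∫ x in {x : E3 | r₀ < ‖x‖}, fderiv ℝ X x x / ‖x‖ ^ 3 = - ∫ w, X (r₀ • (w : E3)) ∂sph := by
  set S : Set E3 := {x | r₀ < ‖x‖}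
  have hS : MeasurableSet S := measurableSet_lt measurable_const measurable_norm
  have hint : IntegrableOn (fun x => fderiv ℝ X x x / ‖x‖ ^ 3) S := by
    have hball : IntegrableOn (fun x => fderiv ℝ X x x / ‖x‖ ^ 3) (S ∩ ball 0 (R + 1)) := by
      refine (((integrableOn_norm_sq_inv (R + 1)).mono_set inter_subset_right).const_mul M).mono'
        ?_ ((ae_restrict_iff' (hS.inter measurableSet_ball)).2 (Eventually.of_forall fun x hx => ?_))
      · exact (((isBoundedBilinearMap_apply (𝕜 := ℝ) (E := E3) (F := ℝ)).continuous.measurable.comp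
          ((measurable_fderiv ℝ X).prodMk measurable_id)).div
          (measurable_norm.pow_const 3)).aestronglyMeasurable
      · have hp : 0 < ‖x‖ := hr₀.trans_lt hx.1
        rw [norm_div, norm_pow, norm_norm, div_le_iff₀ (by positivity)]
        calc ‖fderiv ℝ X x x‖ ≤ M * ‖x‖ := (fderiv ℝ X x).le_of_opNorm_le (hM x hx.1) x
          _ = M * (‖x‖ ^ 2)⁻¹ * ‖x‖ ^ 3 := by field_simp
    refine hball.of_forall_sdiff_eq_zero hS fun x hx => ?_
    have hx2 : ¬ ‖x‖ < R + 1 := fun h => hx.2 ⟨hx.1, by simpa using h⟩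
    rw [fderiv_eq_zero_of_far hR (x := x) (by linarith)]
    simp
  refine ⟨hint, ?_⟩
  rw [← integral_indicator hS, integral_polar ((integrable_indicator_iff hS).2 hint),
    ← integral_neg]
  congr 1
  funext w
  have hw : ‖(w : E3)‖ = 1 := by simp
  have hder : ∀ r ∈ Ioi r₀, HasDerivAt (fun r : ℝ => X (r • (w : E3)))
      (fderiv ℝ X (r • (w : E3)) w) r := by
    intro r hr
    have hr' : r₀ < ‖r • (w : E3)‖ := by
      rw [norm_smul, hw, mul_one]; exact lt_of_lt_of_le hr (le_abs_self r)
    have h1 : HasDerivAt (fun r : ℝ => r • (w : E3)) (w : E3) r := by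
      simpa using (hasDerivAt_id r).smul_const (w : E3)
    exact (hd _ hr').hasFDerivAt.comp_hasDerivAt r h1
  have h2 : ∫ r in Ioi (0 : ℝ), r ^ 2 * S.indicator (fun x => fderiv ℝ X x x / ‖x‖ ^ 3)
      (r • (w : E3)) = ∫ r in Ioi r₀, fderiv ℝ X (r • (w : E3)) w := by
    have h3 : ∀ r ∈ Ioi (0 : ℝ), r ^ 2 * S.indicator (fun x => fderiv ℝ X x x / ‖x‖ ^ 3)
      (r • (w : E3)) = (Ioi r₀).indicator (fun r => fderiv ℝ X (r • (w : E3)) w) r := by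
      intro r hr
      have hr0 : (0 : ℝ) < r := hr
      have hn : ‖r • (w : E3)‖ = r := by rw [norm_smul, hw, mul_one, norm_of_nonneg hr0.le]
      by_cases h : r₀ < r
      · rw [indicator_of_mem (show r • (w : E3) ∈ S by simpa [S, hn] using h),
          indicator_of_mem (show r ∈ Ioi r₀ from h), hn, map_smul, smul_eq_mul]
        field_simp
      · rw [indicator_of_notMem (show r • (w : E3) ∉ S by simpa [S, hn] using h),
          indicator_of_notMem (show r ∉ Ioi r₀ from h), mul_zero]
    rw [setIntegral_congr_fun measurableSet_Ioi h3, setIntegral_indicator measurableSet_Ioi,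
      inter_eq_self_of_subset_right (Ioi_subset_Ioi hr₀)]
  rw [h2, ← zero_sub]
  refine integral_Ioi_of_hasDerivAt_of_tendsto (f := fun r : ℝ => X (r • (w : E3)))
    (hc w hw) hder ?_ ?_
  · have hlt : ∀ r, r₀ < r → ∀ s < r, s < ‖r • (w : E3)‖ := fun r hr s hs => by
      rwa [norm_smul, hw, mul_one, norm_of_nonneg (hr₀.trans hr.le)]
    refine (Measure.integrableOn_of_bounded (s := Ioc r₀ R) (M := M) (by simp)
      ((measurable_fderiv_apply_const ℝ X (w : E3)).comp
        (measurable_id.smul_const (w : E3))).aestronglyMeasurable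
      ((ae_restrict_iff' measurableSet_Ioc).2 (Eventually.of_forall fun r hr => ?_))
      ).of_forall_sdiff_eq_zero measurableSet_Ioi fun r hr => ?_
    · simpa [hw] using (fderiv ℝ X _).le_of_opNorm_le (hM _ (hlt r hr.1 _ hr.1)) (w : E3)
    · simp [fderiv_eq_zero_of_far hR (hlt r hr.1 _ (not_le.1 fun h => hr.2 ⟨hr.1, h⟩))]
  · refine tendsto_const_nhds.congr' ?_
    filter_upwards [eventually_ge_atTop (max R 0)] with r hr
    refine (hR _ ?_).symm
    rw [norm_smul, hw, mul_one, norm_of_nonneg ((le_max_right _ _).trans hr)]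
    exact (le_max_left _ _).trans hr

/-- Convolution of real functions on `E3`. -/
def cv (f g : E3 → ℝ) (x : E3) : ℝ := ∫ z, f z * g (x - z)

section
variable (χ : ContDiffBump (0 : E3))

/-- Regularised truncated Newton kernel; the Newton kernel itself for `ε = 0`. -/
def gamE (ε : ℝ) (z : E3) : ℝ := χ z * (Real.sqrt (ε ^ 2 + ‖z‖ ^ 2))⁻¹

abbrev gam : E3 → ℝ := gamE χ 0

lemma gam_apply (z : E3) : gam χ z = χ z * ‖z‖⁻¹ := by
  simp [gam, gamE, Real.sqrt_sq (norm_nonneg z)]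

lemma gamE_neg (ε : ℝ) (z : E3) : gamE χ ε (-z) = gamE χ ε z := by
  simp [gamE, χ.neg]

lemma reg_pos {ε : ℝ} {z : E3} (h : ε ≠ 0 ∨ z ≠ 0) : 0 < ε ^ 2 + ‖z‖ ^ 2 := by
  rcases h with h | h
  · positivity
  · have := norm_pos_iff.2 h
    positivity

lemma hasFDerivAt_gamE {ε : ℝ} {z : E3} (h : ε ≠ 0 ∨ z ≠ 0) :
    HasFDerivAt (gamE χ ε)
      (χ z • (-((Real.sqrt (ε ^ 2 + ‖z‖ ^ 2)) ^ 3)⁻¹ • innerSL ℝ z) +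
        (Real.sqrt (ε ^ 2 + ‖z‖ ^ 2))⁻¹ • fderiv ℝ χ z) z := by
  have hp := reg_pos h
  have hs := Real.sqrt_pos.2 hp
  have h1 : HasFDerivAt (fun z : E3 => ε ^ 2 + ‖z‖ ^ 2) (2 • innerSL ℝ z) z :=
    (hasStrictFDerivAt_norm_sq z).hasFDerivAt.const_add _
  have h2 := (hasDerivAt_inv hs.ne').comp_hasFDerivAt z (h1.sqrt hp.ne')
  have h3 : HasFDerivAt χ (fderiv ℝ χ z) z :=
    (χ.contDiff.differentiable (n := 1) one_ne_zero).differentiableAt.hasFDerivAt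
  refine (h3.mul h2).congr_fderiv ?_
  ext v
  simp
  field_simp
  simp

lemma contDiffAt_gamE {ε : ℝ} {z : E3} {n : ℕ∞}
    (h : ε ≠ 0 ∨ z ≠ 0) : ContDiffAt ℝ n (gamE χ ε) z := by
  have hp := reg_pos h
  have hs := Real.sqrt_pos.2 hp
  refine χ.contDiff.contDiffAt.mul (ContDiffAt.inv (ContDiffAt.sqrt ?_ hp.ne') hs.ne')
  exact contDiffAt_const.add (contDiff_norm_sq ℝ).contDiffAt

lemma bump_eq_zero {z : E3} (h : χ.rOut ≤ ‖z‖) : χ z = 0 :=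
  χ.zero_of_le_dist (by simpa using h)

lemma bump_fderiv_eq_zero {z : E3} (h : χ.rOut ≤ ‖z‖) :
    fderiv ℝ χ z = 0 := by
  have hm : IsLocalMin χ z := by
    refine Eventually.of_forall fun y => ?_
    rw [bump_eq_zero χ h]; exact χ.nonneg
  exact hm.fderiv_eq_zero

lemma bump_fderiv_bound : ∃ C, 0 ≤ C ∧ ∀ z, ‖fderiv ℝ χ z‖ ≤ C := by
  have hc : Continuous (fderiv ℝ χ) := (χ.contDiff (n := 1)).continuous_fderiv one_ne_zero
  obtain ⟨C, hC⟩ := (χ.hasCompactSupport.fderiv ℝ).exists_bound_of_continuous hc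
  exact ⟨C, (norm_nonneg _).trans (hC 0), hC⟩

lemma sqrt_reg_ge (ε : ℝ) (z : E3) : ‖z‖ ≤ Real.sqrt (ε ^ 2 + ‖z‖ ^ 2) :=
  Real.le_sqrt_of_sq_le (by nlinarith [sq_nonneg ε])

lemma norm_gamE_le {ε : ℝ} {z : E3} (hz : z ≠ 0) :
    ‖gamE χ ε z‖ ≤ (ball (0 : E3) χ.rOut).indicator (fun z => ‖z‖⁻¹) z := by
  have hz' := norm_pos_iff.2 hz
  by_cases h : ‖z‖ < χ.rOut
  · rw [indicator_of_mem (by simpa using h), gamE, norm_mul, norm_of_nonneg χ.nonneg, norm_inv,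
      norm_of_nonneg (Real.sqrt_nonneg _)]
    have := sqrt_reg_ge ε z
    calc χ z * (Real.sqrt (ε ^ 2 + ‖z‖ ^ 2))⁻¹ ≤ 1 * ‖z‖⁻¹ := by
          gcongr; exact χ.le_one
      _ = _ := one_mul _
  · rw [gamE, bump_eq_zero χ (not_lt.1 h), zero_mul, norm_zero]
    exact indicator_nonneg (fun _ _ => by positivity) _

/-- A dominating function for the gradients of the kernels `gamE χ ε`. -/
def kdom (C : ℝ) : E3 → ℝ :=
  (ball (0 : E3) χ.rOut).indicator (fun z => (‖z‖ ^ 2)⁻¹ + C * ‖z‖⁻¹)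

lemma kdom_nonneg {C : ℝ} (hC : 0 ≤ C) (z : E3) : 0 ≤ kdom χ C z :=
  indicator_nonneg (fun _ _ => by positivity) _

lemma integrable_kdom (C : ℝ) : Integrable (kdom χ C) :=
  (integrable_indicator_iff measurableSet_ball).2
    ((integrableOn_norm_sq_inv _).add ((integrableOn_norm_inv _).const_mul C))

lemma norm_fderiv_gamE_le {C : ℝ}
    (hC : ∀ z, ‖fderiv ℝ χ z‖ ≤ C) {ε : ℝ} {z : E3} (hz : z ≠ 0) :
    ‖fderiv ℝ (gamE χ ε) z‖ ≤ kdom χ C z := by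
  have hz' := norm_pos_iff.2 hz
  have hC0 : 0 ≤ C := (norm_nonneg _).trans (hC 0)
  rw [(hasFDerivAt_gamE χ (Or.inr hz)).fderiv]
  by_cases h : ‖z‖ < χ.rOut
  · rw [kdom, indicator_of_mem (by simpa using h)]
    have hs := sqrt_reg_ge ε z
    have hs' := hz'.trans_le hs
    refine (norm_add_le _ _).trans (add_le_add ?_ ?_)
    · rw [norm_smul, norm_smul, norm_of_nonneg χ.nonneg, norm_neg, norm_inv, norm_pow,
        norm_of_nonneg hs'.le, innerSL_apply_norm]
      calc χ z * (((Real.sqrt (ε ^ 2 + ‖z‖ ^ 2)) ^ 3)⁻¹ * ‖z‖) ≤ 1 * ((‖z‖ ^ 3)⁻¹ * ‖z‖) := by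
            gcongr; exact χ.le_one
        _ = (‖z‖ ^ 2)⁻¹ := by field_simp
    · rw [norm_smul, norm_inv, norm_of_nonneg hs'.le, mul_comm]
      gcongr
      exact hC z
  · rw [bump_eq_zero χ (not_lt.1 h), bump_fderiv_eq_zero χ (not_lt.1 h)]
    simpa using kdom_nonneg χ hC0 z

lemma measurable_gamE (ε : ℝ) : Measurable (gamE χ ε) := by
  have h1 : Measurable χ := χ.continuous.measurable
  unfold gamE
  fun_prop

lemma ae_ne_zero : ∀ᵐ z : E3, z ≠ 0 :=
  compl_mem_ae_iff.2 (measure_singleton _)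

lemma integrable_gamE (ε : ℝ) : Integrable (gamE χ ε) :=
  ((integrable_indicator_iff measurableSet_ball).2 (integrableOn_norm_inv χ.rOut)).mono'
    (measurable_gamE χ ε).aestronglyMeasurable (ae_ne_zero.mono fun _ hz => norm_gamE_le χ hz)

lemma integrable_fderiv_gamE (ε : ℝ) :
    Integrable (fderiv ℝ (gamE χ ε)) := by
  obtain ⟨C, -, hC⟩ := bump_fderiv_bound χ
  exact (integrable_kdom χ C).mono' (measurable_fderiv ℝ _).aestronglyMeasurable
    (ae_ne_zero.mono fun _ hz => norm_fderiv_gamE_le χ hC hz)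

lemma sqrt_reg_tendsto (z : E3) : Tendsto (fun n : ℕ => Real.sqrt ((1 / ((n : ℝ) + 1)) ^ 2 + ‖z‖ ^ 2))
    atTop (𝓝 (Real.sqrt ((0 : ℝ) ^ 2 + ‖z‖ ^ 2))) := by
  have h := tendsto_one_div_add_atTop_nhds_zero_nat (𝕜 := ℝ)
  exact (Real.continuous_sqrt.tendsto _).comp ((h.pow 2).add_const _)

lemma tendsto_integral_norm_sub_of_dominated {F : Type*} [NormedAddCommGroup F] {f : ℕ → E3 → F}
    {g : E3 → F} {B : E3 → ℝ} (hf : ∀ n, Integrable (f n)) (hg : Integrable g)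
    (hB : Integrable B) (hfB : ∀ n, ∀ z ≠ 0, ‖f n z‖ ≤ B z) (hgB : ∀ z ≠ 0, ‖g z‖ ≤ B z)
    (h : ∀ z ≠ 0, Tendsto (f · z) atTop (𝓝 (g z))) :
    Tendsto (fun n => ∫ z, ‖f n z - g z‖) atTop (𝓝 0) := by
  rw [← integral_zero E3 ℝ]
  refine tendsto_integral_of_dominated_convergence (fun z => B z + B z)
    (fun n => ((hf n).sub hg).norm.1) (hB.add hB) (fun n => ae_ne_zero.mono fun z hz => ?_)
    (ae_ne_zero.mono fun z hz => tendsto_iff_norm_sub_tendsto_zero.1 (h z hz))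
  rw [norm_norm]
  exact (norm_sub_le _ _).trans (add_le_add (hfB n z hz) (hgB z hz))

lemma tendsto_gamE :
    Tendsto (fun n : ℕ => ∫ z, ‖gamE χ (1 / ((n : ℝ) + 1)) z - gam χ z‖) atTop (𝓝 0) := by
  refine tendsto_integral_norm_sub_of_dominated (fun _ => integrable_gamE χ _)
    (integrable_gamE χ 0) ((integrableOn_norm_inv χ.rOut).integrable_indicator measurableSet_ball)
    (fun _ _ hz => norm_gamE_le χ hz) (fun _ hz => norm_gamE_le χ hz) fun z hz => ?_
  exact ((sqrt_reg_tendsto z).inv₀ (Real.sqrt_pos.2 (reg_pos (Or.inr hz))).ne').const_mul (χ z)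

lemma tendsto_fderiv_gamE :
    Tendsto (fun n : ℕ => ∫ z, ‖fderiv ℝ (gamE χ (1 / ((n : ℝ) + 1))) z - fderiv ℝ (gam χ) z‖)
      atTop (𝓝 0) := by
  obtain ⟨C, -, hC⟩ := bump_fderiv_bound χ
  refine tendsto_integral_norm_sub_of_dominated (fun _ => integrable_fderiv_gamE χ _)
    (integrable_fderiv_gamE χ 0) (integrable_kdom χ C)
    (fun _ _ hz => norm_fderiv_gamE_le χ hC hz) (fun _ hz => norm_fderiv_gamE_le χ hC hz)
    fun z hz => ?_
  have hs := (Real.sqrt_pos.2 (reg_pos (ε := 0) (Or.inr hz))).ne'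
  have h := sqrt_reg_tendsto z
  simp_rw [fun ε => (hasFDerivAt_gamE χ (ε := ε) (Or.inr hz)).fderiv]
  exact ((((h.pow 3).inv₀ (pow_ne_zero 3 hs)).neg.smul_const (innerSL ℝ z)).const_smul
    (χ z)).add ((h.inv₀ hs).smul_const (fderiv ℝ χ z))

lemma integrable_mul_shift {F : Type*} [NormedAddCommGroup F] [NormedSpace ℝ F]
    {f : E3 → F} (hf : Integrable f) {q : E3 → ℝ}
    (hq : Measurable q) {M : ℝ} (hM : ∀ x, |q x| ≤ M) (x : E3) :
    Integrable (fun z => q (x - z) • f z) := by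
  refine (hf.norm.const_mul M).mono' ?_ ?_
  · have : Measurable fun z => q (x - z) := hq.comp (by fun_prop)
    exact this.aestronglyMeasurable.smul hf.1
  · refine Eventually.of_forall fun z => ?_
    rw [norm_smul]
    gcongr
    exact hM _

lemma norm_integral_mul_shift_le {F : Type*} [NormedAddCommGroup F] [NormedSpace ℝ F]
    {f : E3 → F} (hf : Integrable f) {q : E3 → ℝ} {M : ℝ} (hM : ∀ x, |q x| ≤ M) (x : E3) :
    ‖∫ z, q (x - z) • f z‖ ≤ M * ∫ z, ‖f z‖ := by
  rw [← integral_const_mul]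
  refine norm_integral_le_of_norm_le (hf.norm.const_mul M) (Eventually.of_forall fun z => ?_)
  rw [norm_smul]
  gcongr
  exact hM _

lemma hasCompactSupport_gamE (ε : ℝ) : HasCompactSupport (gamE χ ε) :=
  χ.hasCompactSupport.mul_right

/-- The truncated Newton potential of a bounded function is continuously differentiable. -/
theorem hasFDerivAt_potential {q : E3 → ℝ} (hq : Measurable q)
    {M : ℝ} (hM : ∀ x, |q x| ≤ M) :
    (∀ x, HasFDerivAt (cv (gam χ) q) (∫ z, q (x - z) • fderiv ℝ (gam χ) z) x) ∧
    Continuous (fun x => ∫ z, q (x - z) • fderiv ℝ (gam χ) z) := by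
  set e : ℕ → ℝ := fun n => 1 / ((n : ℝ) + 1)
  have he : ∀ n, e n ≠ 0 := fun n => by positivity
  have hqi : LocallyIntegrable q := by
    refine (locallyIntegrable_const M).mono hq.aestronglyMeasurable ?_
    exact Eventually.of_forall fun x => (hM x).trans (le_abs_self M)
  have hC1 : ∀ n, ContDiff ℝ 1 (gamE χ (e n)) := fun n =>
    contDiff_iff_contDiffAt.2 fun z => contDiffAt_gamE (n := 1) χ (Or.inl (he n))
  have hder : ∀ n x, HasFDerivAt (cv (gamE χ (e n)) q)
      (∫ z, q (x - z) • fderiv ℝ (gamE χ (e n)) z) x := by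
    intro n x
    have := (hasCompactSupport_gamE χ (e n)).hasFDerivAt_convolution_left
      (ContinuousLinearMap.lsmul ℝ ℝ) (hC1 n) hqi x
    refine HasFDerivAt.congr_fderiv (f := cv (gamE χ (e n)) q) this ?_
    rw [convolution_def]
    congr 1
    funext z
    ext v
    simp [mul_comm]
  have hcont : ∀ n, Continuous (fun x => ∫ z, q (x - z) • fderiv ℝ (gamE χ (e n)) z) := by
    intro n
    have h1 : ContDiff ℝ 1 (cv (gamE χ (e n)) q) :=
      (hasCompactSupport_gamE χ (e n)).contDiff_convolution_left
        (ContinuousLinearMap.lsmul ℝ ℝ) (hC1 n) hqi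
    have h2 := h1.continuous_fderiv one_ne_zero
    exact h2.congr fun x => (hder n x).fderiv
  have hunif : TendstoUniformly (fun (n : ℕ) x => ∫ z, q (x - z) • fderiv ℝ (gamE χ (e n)) z)
      (fun x => ∫ z, q (x - z) • fderiv ℝ (gam χ) z) atTop := by
    rw [Metric.tendstoUniformly_iff]
    intro δ hδ
    have h1 := (tendsto_fderiv_gamE χ).const_mul M
    rw [mul_zero] at h1
    filter_upwards [h1.eventually (gt_mem_nhds hδ)] with n hn x
    rw [dist_comm, dist_eq_norm, ← integral_sub
      (integrable_mul_shift (integrable_fderiv_gamE χ _) hq hM x)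
      (integrable_mul_shift (integrable_fderiv_gamE χ _) hq hM x)]
    simp_rw [← smul_sub]
    exact (norm_integral_mul_shift_le
      ((integrable_fderiv_gamE χ _).sub (integrable_fderiv_gamE χ _)) hM x).trans_lt hn
  refine ⟨fun x => hasFDerivAt_of_tendstoUniformly hunif hder (fun x => ?_) x,
    hunif.continuous (Frequently.of_forall hcont)⟩
  have h1 := (tendsto_gamE χ).const_mul M
  rw [mul_zero] at h1
  rw [tendsto_iff_norm_sub_tendsto_zero]
  refine squeeze_zero (fun _ => norm_nonneg _) (fun n => ?_) h1
  have h2 : ∀ ε, cv (gamE χ ε) q x = ∫ z, q (x - z) • gamE χ ε z := fun ε => by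
    simp [cv, mul_comm]
  rw [h2, h2, ← integral_sub (integrable_mul_shift (integrable_gamE χ _) hq hM x)
      (integrable_mul_shift (integrable_gamE χ _) hq hM x)]
  simp_rw [← smul_sub]
  exact norm_integral_mul_shift_le ((integrable_gamE χ _).sub (integrable_gamE χ _)) hM x

end

/-- The constant `4π` in Newton's formula. -/
abbrev c0 : ℝ := sph.real univ

lemma c0_pos : 0 < c0 := by
  have : sph univ ≠ 0 := by
    rw [Ne, Measure.measure_univ_eq_zero]
    exact Measure.toSphere_ne_zero (volume : Measure E3)
  exact ENNReal.toReal_pos this (measure_ne_top _ _)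

section
variable (χ : ContDiffBump (0 : E3))

lemma bump_fderiv_zero_near {z : E3} (h : ‖z‖ < χ.rIn) :
    χ =ᶠ[𝓝 z] fun _ => (1 : ℝ) := by
  filter_upwards [(isOpen_lt continuous_norm continuous_const).mem_nhds h] with y hy
  exact χ.one_of_mem_closedBall (by simpa using le_of_lt hy)

lemma contDiff_of_near_zero {f : E3 → ℝ} {r : ℝ} (hr : 0 < r) (h0 : ∀ z, ‖z‖ < r → f z = 0)
    (h : ∀ z, z ≠ 0 → ContDiffAt ℝ ∞ f z) : ContDiff ℝ ∞ f := by
  refine contDiff_iff_contDiffAt.2 fun z => ?_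
  by_cases hz : z = 0
  · subst hz
    refine (contDiffAt_const (c := (0 : ℝ))).congr_of_eventuallyEq ?_
    filter_upwards [ball_mem_nhds (0 : E3) hr] with y hy
    exact h0 y (by simpa using hy)
  · exact h z hz

/-- The smooth error kernel produced by truncating the Newton kernel. -/
def errK (z : E3) : ℝ :=
  ∑ i, fderiv ℝ (fun z => ‖z‖⁻¹ * fderiv ℝ χ z (ek i)) z (ek i) - fderiv ℝ χ z z * (‖z‖ ^ 3)⁻¹

lemma contDiff_bump_fderiv : ContDiff ℝ ∞ (fderiv ℝ χ) :=
  (χ.contDiff (n := ⊤)).fderiv_right (by norm_num)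

lemma bump_fderiv_eq_zero_near {z : E3} (h : ‖z‖ < χ.rIn) :
    fderiv ℝ χ z = 0 := by
  rw [(bump_fderiv_zero_near χ h).fderiv_eq]; simp

lemma contDiff_errG (i : Fin 3) :
    ContDiff ℝ ∞ (fun z => ‖z‖⁻¹ * fderiv ℝ χ z (ek i)) := by
  refine contDiff_of_near_zero χ.rIn_pos (fun z hz => ?_) (fun z hz => ?_)
  · rw [bump_fderiv_eq_zero_near χ hz]; simp
  · exact ((contDiffAt_norm ℝ hz).inv (norm_ne_zero_iff.2 hz)).mul
      ((contDiff_bump_fderiv χ).clm_apply contDiff_const).contDiffAt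

lemma contDiff_errK : ContDiff ℝ ∞ (errK χ) := by
  refine ContDiff.sub (ContDiff.sum fun i _ => ?_) ?_
  · exact ((contDiff_errG χ i).fderiv_right (m := ∞) (by norm_num)).clm_apply contDiff_const
  · refine contDiff_of_near_zero χ.rIn_pos (fun z hz => ?_) (fun z hz => ?_)
    · rw [bump_fderiv_eq_zero_near χ hz]; simp
    · exact ((contDiff_bump_fderiv χ).clm_apply contDiff_id).contDiffAt.mul
        (((contDiffAt_norm ℝ hz).pow 3).inv (pow_ne_zero 3 (norm_ne_zero_iff.2 hz)))

lemma errG_eq_zero (i : Fin 3) {z : E3} (h : χ.rOut ≤ ‖z‖) :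
    ‖z‖⁻¹ * fderiv ℝ χ z (ek i) = 0 := by
  rw [bump_fderiv_eq_zero χ h]; simp

lemma hasCompactSupport_of_zero {F : Type*} [Zero F] {f : E3 → F} {R : ℝ}
    (h : ∀ z, R ≤ ‖z‖ → f z = 0) : HasCompactSupport f :=
  HasCompactSupport.intro (isCompact_closedBall (0 : E3) R) fun z hz =>
    h z (le_of_lt (by simpa using hz))

lemma hasCompactSupport_errG (i : Fin 3) :
    HasCompactSupport (fun z => ‖z‖⁻¹ * fderiv ℝ χ z (ek i)) :=
  hasCompactSupport_of_zero fun _ h => errG_eq_zero χ i h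

lemma errK_eq_zero {z : E3} (h : χ.rOut < ‖z‖) : errK χ z = 0 := by
  have h1 (i) : fderiv ℝ (fun z => ‖z‖⁻¹ * fderiv ℝ χ z (ek i)) z = 0 :=
    fderiv_eq_zero_of_far (fun _ => errG_eq_zero χ i) h
  simp [errK, h1, bump_fderiv_eq_zero χ h.le]

lemma hasCompactSupport_errK : HasCompactSupport (errK χ) :=
  hasCompactSupport_of_zero (R := χ.rOut + 1) fun z h => errK_eq_zero χ (by linarith)

lemma integral_fderiv_mul_of_compact {f g : E3 → ℝ} (hf : ContDiff ℝ 1 f) (hg : ContDiff ℝ 1 g)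
    (hc : HasCompactSupport f) (v : E3) :
    ∫ x, fderiv ℝ f x v * g x = - ∫ x, f x * fderiv ℝ g x v := by
  have hf' : Continuous fun x => fderiv ℝ f x v :=
    (hf.continuous_fderiv one_ne_zero).clm_apply continuous_const
  have hg' : Continuous fun x => fderiv ℝ g x v :=
    (hg.continuous_fderiv one_ne_zero).clm_apply continuous_const
  have hcf : HasCompactSupport fun x => fderiv ℝ f x v := hc.fderiv_apply ℝ v
  have := integral_mul_fderiv_eq_neg_fderiv_mul_of_integrable (𝕜 := ℝ) (μ := volume)
    (f := f) (g := g) (v := v)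
    ((hf'.mul hg.continuous).integrable_of_hasCompactSupport hcf.mul_right)
    ((hf.continuous.mul hg').integrable_of_hasCompactSupport hc.mul_right)
    ((hf.continuous.mul hg.continuous).integrable_of_hasCompactSupport hc.mul_right)
    (fun x _ => (hf.differentiable one_ne_zero).differentiableAt)
    (fun x _ => (hg.differentiable one_ne_zero).differentiableAt)
  rw [this, neg_neg]

lemma fderiv_refl_apply {η : E3 → ℝ} (hη : Differentiable ℝ η) (x z v : E3) :
    fderiv ℝ (fun z => η (x - z)) z v = - fderiv ℝ η (x - z) v := by
  have h1 : HasFDerivAt (fun z : E3 => x - z) (-(ContinuousLinearMap.id ℝ E3)) z :=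
    (hasFDerivAt_id z).const_sub x
  have h2 := (hη (x - z)).hasFDerivAt.comp z h1
  have h3 : fderiv ℝ (fun z => η (x - z)) z = _ := h2.fderiv
  rw [h3]; simp

lemma integrable_mul_bdd {f g : E3 → ℝ} (hf : Integrable f) (hg : Continuous g) {M : ℝ}
    (hM : ∀ x, |g x| ≤ M) : Integrable (fun z => f z * g z) :=
  hf.mul_bdd hg.aestronglyMeasurable (Eventually.of_forall hM)

lemma exists_abs_bound {g : E3 → ℝ} (hg : Continuous g) (hc : HasCompactSupport g) :
    ∃ M, 0 ≤ M ∧ ∀ x, |g x| ≤ M := by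
  obtain ⟨C, hC⟩ := hc.exists_bound_of_continuous hg
  exact ⟨C, (norm_nonneg _).trans (hC 0), hC⟩

lemma clm_eq_sum (A : E3 →L[ℝ] ℝ) (z : E3) : A z = ∑ i, z i * A (ek i) := by
  have : z = ∑ i, z i • ek i := by
    ext j; fin_cases j <;> simp [Fin.sum_univ_three]
  conv_lhs => rw [this, map_sum]
  simp

/-- Newton's formula for the truncated kernel. -/
theorem newton_identity {η : E3 → ℝ} (hη : ContDiff ℝ 1 η)
    (hc : HasCompactSupport η) (x : E3) :
    ∑ i, ∫ z, fderiv ℝ (gam χ) z (ek i) * fderiv ℝ η (x - z) (ek i) =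
      - (c0 * η x) + cv (errK χ) η x := by
  have hd := hη.differentiable one_ne_zero
  have hη' : ∀ i, Continuous fun z => fderiv ℝ η (x - z) (ek i) := fun i =>
    ((hη.continuous_fderiv one_ne_zero).comp (continuous_const.sub continuous_id)).clm_apply
      continuous_const
  have hs : Continuous fun z => η (x - z) := hη.continuous.comp (continuous_const.sub continuous_id)
  obtain ⟨M, -, hM⟩ := exists_abs_bound hη.continuous hc
  choose Mi _ hMi using fun i => exists_abs_bound
    ((hη.continuous_fderiv one_ne_zero).clm_apply (continuous_const (y := ek i)))
    (hc.fderiv_apply ℝ (ek i))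
  have hKi : ∀ i, Integrable fun z => fderiv ℝ (gam χ) z (ek i) := fun i =>
    (ContinuousLinearMap.apply ℝ ℝ (ek i)).integrable_comp (integrable_fderiv_gamE χ 0)
  have hI : ∀ i, Integrable fun z => fderiv ℝ (gam χ) z (ek i) * fderiv ℝ η (x - z) (ek i) :=
    fun i => integrable_mul_bdd (hKi i) (hη' i) (fun z => hMi i _)
  set X : E3 → ℝ := fun z => χ z * η (x - z) with hX
  have hχ1 : ContDiff ℝ 1 χ := χ.contDiff
  have hs1 : ContDiff ℝ 1 fun z => η (x - z) := hη.comp (contDiff_const.sub contDiff_id)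
  have hXC : ContDiff ℝ 1 X := hχ1.mul hs1
  have hXc : HasCompactSupport X := χ.hasCompactSupport.mul_right
  obtain ⟨MX, hMX⟩ := (hXc.fderiv ℝ).exists_bound_of_continuous (hXC.continuous_fderiv one_ne_zero)
  have hrad := integral_radial (X := X) (r₀ := 0) (M := MX) (R := χ.rOut) le_rfl
    (fun z _ => (hXC.differentiable one_ne_zero).differentiableAt)
    (fun w _ => (hXC.continuous.comp (by fun_prop)).continuousWithinAt)
    (fun z _ => hMX z) (fun z hz => by simp [hX, bump_eq_zero χ hz])
  have hset : {x : E3 | 0 < ‖x‖} = {0}ᶜ := by ext; simp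
  rw [hset, restrict_compl_singleton] at hrad
  have hradI : Integrable fun z => fderiv ℝ X z z / ‖z‖ ^ 3 := by
    have := hrad.1
    rwa [IntegrableOn, restrict_compl_singleton] at this
  have hX0 : ∫ w, X ((0 : ℝ) • (w : E3)) ∂sph = c0 * η x := by
    simp [hX, χ.one_of_mem_closedBall (x := (0 : E3)) (by simp [χ.rIn_pos.le])]
  rw [hX0] at hrad
  have hG : ∀ i, ∫ z, (‖z‖⁻¹ * fderiv ℝ χ z (ek i)) * fderiv ℝ η (x - z) (ek i) =
      ∫ z, fderiv ℝ (fun z => ‖z‖⁻¹ * fderiv ℝ χ z (ek i)) z (ek i) * η (x - z) := by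
    intro i
    rw [integral_fderiv_mul_of_compact ((contDiff_errG χ i).of_le (by norm_num)) hs1
      (hasCompactSupport_errG χ i), ← integral_neg]
    congr 1; funext z
    rw [fderiv_refl_apply hd]; ring
  have hGI : ∀ i, Integrable fun z =>
      fderiv ℝ (fun z => ‖z‖⁻¹ * fderiv ℝ χ z (ek i)) z (ek i) * η (x - z) := fun i =>
    ((((contDiff_errG χ i).continuous_fderiv (by norm_num)).clm_apply continuous_const).mul
      hs).integrable_of_hasCompactSupport ((hasCompactSupport_errG χ i).fderiv_apply ℝ (ek i)).mul_right
  have hGI' : ∀ i, Integrable fun z =>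
      (‖z‖⁻¹ * fderiv ℝ χ z (ek i)) * fderiv ℝ η (x - z) (ek i) := fun i =>
    ((contDiff_errG χ i).continuous.mul (hη' i)).integrable_of_hasCompactSupport
      (hasCompactSupport_errG χ i).mul_right
  have hEI : Integrable fun z => errK χ z * η (x - z) :=
    ((contDiff_errK χ).continuous.mul hs).integrable_of_hasCompactSupport
      (hasCompactSupport_errK χ).mul_right
  let D (i : Fin 3) (z : E3) : ℝ := (‖z‖⁻¹ * fderiv ℝ χ z (ek i)) * fderiv ℝ η (x - z) (ek i) -
    fderiv ℝ (fun z => ‖z‖⁻¹ * fderiv ℝ χ z (ek i)) z (ek i) * η (x - z)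
  have hD (i) : Integrable (D i) := (hGI' i).sub (hGI i)
  have hD0 (i) : ∫ z, D i z = 0 := by rw [integral_sub (hGI' i) (hGI i), hG i, sub_self]
  have hDS : Integrable fun z => ∑ i, D i z := integrable_finsetSum _ fun i _ => hD i
  have hpt : ∀ᵐ z : E3, ∑ i, fderiv ℝ (gam χ) z (ek i) * fderiv ℝ η (x - z) (ek i) =
      fderiv ℝ X z z / ‖z‖ ^ 3 + (errK χ z * η (x - z) + ∑ i, D i z) := by
    refine ae_ne_zero.mono fun z hz => ?_
    have hz' : ‖z‖ ≠ 0 := norm_ne_zero_iff.2 hz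
    have h1 : fderiv ℝ X z z = χ z * - fderiv ℝ η (x - z) z + η (x - z) * fderiv ℝ χ z z := by
      have := (((hχ1.differentiable one_ne_zero) z).hasFDerivAt.mul
        ((hs1.differentiable one_ne_zero) z).hasFDerivAt).fderiv
      rw [hX]
      change fderiv ℝ ((χ : E3 → ℝ) * fun z => η (x - z)) z z = _
      rw [this]
      simp only [_root_.add_apply, _root_.smul_apply, smul_eq_mul]
      rw [fderiv_refl_apply hd]
    have h2 := clm_eq_sum (fderiv ℝ η (x - z)) z
    have h3 : ∀ i, fderiv ℝ (gam χ) z (ek i) =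
        - χ z * (‖z‖ ^ 3)⁻¹ * z i + ‖z‖⁻¹ * fderiv ℝ χ z (ek i) := by
      intro i
      rw [(hasFDerivAt_gamE χ (Or.inr hz)).fderiv]
      simp [Real.sqrt_sq (norm_nonneg z), EuclideanSpace.inner_single_right]
      ring
    rw [h1, h2, errK, Finset.sum_sub_distrib, sub_mul, Finset.sum_mul, Finset.sum_congr rfl
      (fun i _ => by rw [h3 i])]
    simp_rw [add_mul, Finset.sum_add_distrib]
    have h4 : ∑ i, - χ z * (‖z‖ ^ 3)⁻¹ * z i * fderiv ℝ η (x - z) (ek i) =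
      - χ z * (‖z‖ ^ 3)⁻¹ * ∑ i, z i * fderiv ℝ η (x - z) (ek i) := by
      rw [Finset.mul_sum]; exact Finset.sum_congr rfl fun i _ => by ring
    rw [h4]
    field_simp
    ring
  rw [← integral_finsetSum _ (fun i _ => hI i), integral_congr_ae hpt,
    integral_add hradI (hEI.add hDS : Integrable fun z => errK χ z * η (x - z) + _),
    integral_add hEI hDS, integral_finsetSum _ (fun i _ => hD i), hrad.2]
  simp [hD0, cv]

lemma hasFDerivAt_cv {f : E3 → ℝ} (hf : Integrable f) {η : E3 → ℝ} (hη : ContDiff ℝ 1 η)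
    (hc : HasCompactSupport η) (x v : E3) :
    DifferentiableAt ℝ (cv f η) x ∧
    fderiv ℝ (cv f η) x v = cv f (fun y => fderiv ℝ η y v) x := by
  have h := hc.hasFDerivAt_convolution_right (ContinuousLinearMap.lsmul ℝ ℝ)
    hf.locallyIntegrable hη x
  have h1 : HasFDerivAt (cv f η) _ x := h
  refine ⟨h1.differentiableAt, ?_⟩
  rw [h1.fderiv, convolution_precompR_apply _ hf.locallyIntegrable (hc.fderiv ℝ)
    (hη.continuous_fderiv one_ne_zero)]
  rfl

lemma contDiff_cv {f : E3 → ℝ} (hf : Integrable f) {η : E3 → ℝ} {n : ℕ∞} (hη : ContDiff ℝ n η)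
    (hc : HasCompactSupport η) : ContDiff ℝ n (cv f η) :=
  hc.contDiff_convolution_right (ContinuousLinearMap.lsmul ℝ ℝ) hf.locallyIntegrable hη

lemma cv_gam_fderiv {η : E3 → ℝ} (hη : ContDiff ℝ 1 η)
    (hc : HasCompactSupport η) (x v : E3) :
    cv (gam χ) (fun y => fderiv ℝ η y v) x = cv (fun z => fderiv ℝ (gam χ) z v) η x := by
  obtain ⟨M, -, hM⟩ := exists_abs_bound hη.continuous hc
  rw [← (hasFDerivAt_cv (integrable_gamE χ 0) hη hc x v).2,
    ((hasFDerivAt_potential χ hη.continuous.measurable hM).1 x).fderiv,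
    ContinuousLinearMap.integral_apply]
  · simp [cv, mul_comm]
  · exact integrable_mul_shift (integrable_fderiv_gamE χ 0) hη.continuous.measurable hM x

/-- The Laplacian of the truncated Newton potential of a test function. -/
theorem laplacian_potential {η : E3 → ℝ} (hη : ContDiff ℝ 2 η)
    (hc : HasCompactSupport η) (x : E3) :
    ∑ i, fderiv ℝ (fun y => fderiv ℝ (cv (gam χ) η) y (ek i)) x (ek i) =
      - (c0 * η x) + cv (errK χ) η x := by
  have h1 : ContDiff ℝ 1 η := hη.of_le (by norm_num)
  rw [← newton_identity χ h1 hc]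
  refine Finset.sum_congr rfl fun i _ => ?_
  have h2 : ContDiff ℝ 1 fun y => fderiv ℝ η y (ek i) :=
    (hη.fderiv_right (m := 1) (by norm_num)).clm_apply contDiff_const
  have h3 : (fun y => fderiv ℝ (cv (gam χ) η) y (ek i)) =
      cv (gam χ) fun y => fderiv ℝ η y (ek i) := by
    funext y
    exact (hasFDerivAt_cv (integrable_gamE χ 0) h1 hc y (ek i)).2
  rw [h3, (hasFDerivAt_cv (integrable_gamE χ 0) h2 (hc.fderiv_apply ℝ (ek i)) x (ek i)).2,
    cv_gam_fderiv χ h2 (hc.fderiv_apply ℝ (ek i))]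
  rfl

end

/-- The correlation `y ↦ ∫ f(z) q(y+z) dz`. -/
def corr (f q : E3 → ℝ) (y : E3) : ℝ := ∫ z, f z * q (y + z)

lemma corr_eq_cv (f q : E3 → ℝ) (y : E3) : corr f q y = cv (fun z => f (-z)) q y := by
  rw [corr, cv, ← integral_neg_eq_self]
  simp [sub_eq_add_neg]

lemma corr_of_even {f : E3 → ℝ} (hf : ∀ z, f (-z) = f z) (q : E3 → ℝ) (y : E3) :
    corr f q y = cv f q y := by
  rw [corr_eq_cv]; simp [hf]

lemma integrable_corr {f q : E3 → ℝ} (hf : Integrable f) (hq : Integrable q) :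
    Integrable (corr f q) := by
  have := (hf.comp_neg).integrable_convolution (ContinuousLinearMap.lsmul ℝ ℝ) hq
  refine this.congr (Eventually.of_forall fun y => ?_)
  rw [corr_eq_cv]; rfl

lemma corr_adjoint_of_integrable {f q η : E3 → ℝ} (hf : Integrable f) (hq : Integrable q)
    (hη : Continuous η) (hc : HasCompactSupport η) :
    ∫ x, q x * cv f η x = ∫ y, corr f q y * η y := by
  obtain ⟨M, -, hM⟩ := exists_abs_bound hη hc
  have h1 : Integrable (fun p : E3 × E3 => q p.1 * f p.2) (volume.prod volume) := hq.mul_prod hf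
  have h2 : Integrable (fun p : E3 × E3 => q p.1 * f p.2 * η (p.1 - p.2)) (volume.prod volume) := by
    refine h1.mul_bdd (c := M) (hη.comp (by fun_prop)).aestronglyMeasurable
      (Eventually.of_forall fun p => hM _)
  have h3 : ∫ x, q x * cv f η x = ∫ x, ∫ z, q x * f z * η (x - z) := by
    congr 1; funext x
    rw [cv, ← integral_const_mul]
    congr 1; funext z; ring
  have h4 : ∀ z, ∫ x, q x * f z * η (x - z) = ∫ y, f z * q (y + z) * η y := by
    intro z
    rw [← integral_add_right_eq_self _ z]
    congr 1; funext y
    rw [add_sub_cancel_right]; ring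
  have h5 : Integrable (fun p : E3 × E3 => f p.1 * q (p.2 + p.1) * η p.2)
      (volume.prod volume) := by
    have h6 : Integrable (fun p : E3 × E3 => f p.1 * q (p.2 + p.1)) (volume.prod volume) := by
      have hmp : MeasurePreserving (fun p : E3 × E3 => (p.1, p.2 + p.1))
          (volume.prod volume) (volume.prod volume) := by
        simpa [add_comm] using (measurePreserving_prod_add (volume : Measure E3) volume)
      exact hmp.integrable_comp_of_integrable (hf.mul_prod hq)
    exact h6.mul_bdd (c := M) (hη.comp (by fun_prop)).aestronglyMeasurable
      (Eventually.of_forall fun p => hM _)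
  rw [h3, integral_integral_swap h2]
  simp_rw [h4]
  rw [integral_integral_swap h5]
  congr 1; funext y
  rw [integral_mul_const, corr]

lemma corr_indicator {f q : E3 → ℝ} (hf0 : ∀ z, 1 ≤ ‖z‖ → f z = 0) {R : ℝ} {y : E3} (hy : ‖y‖ ≤ R) :
    corr f ((ball (0 : E3) (R + 1)).indicator q) y = corr f q y := by
  rw [corr, corr]
  congr 1; funext z
  by_cases hz : 1 ≤ ‖z‖
  · simp [hf0 z hz]
  · rw [indicator_of_mem]
    rw [mem_ball_zero_iff]
    exact (norm_add_le _ _).trans_lt (by push Not at hz; linarith)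

lemma locallyIntegrable_corr {f q : E3 → ℝ} (hf : Integrable f) (hf0 : ∀ z, 1 ≤ ‖z‖ → f z = 0)
    (hq : LocallyIntegrable q) : LocallyIntegrable (corr f q) := by
  rw [locallyIntegrable_iff]
  intro k hk
  obtain ⟨R, hR⟩ := hk.isBounded.exists_norm_le
  have h1 : Integrable ((ball (0 : E3) (R + 1)).indicator q) :=
    (integrable_indicator_iff measurableSet_ball).2
      ((hq.integrableOn_isCompact (isCompact_closedBall 0 (R + 1))).mono_set ball_subset_closedBall)
  refine ((integrable_corr hf h1).integrableOn (s := k)).congr_fun ?_ hk.measurableSet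
  exact fun y hy => corr_indicator hf0 (hR y hy)

lemma corr_adjoint {f q η : E3 → ℝ} (hf : Integrable f) (hf0 : ∀ z, 1 ≤ ‖z‖ → f z = 0)
    (hq : LocallyIntegrable q) (hη : Continuous η) (hc : HasCompactSupport η) :
    ∫ x, q x * cv f η x = ∫ y, corr f q y * η y := by
  obtain ⟨R, hR⟩ := hc.isCompact.isBounded.exists_norm_le
  have h1 : Integrable ((ball (0 : E3) (R + 1)).indicator q) :=
    (integrable_indicator_iff measurableSet_ball).2
      ((hq.integrableOn_isCompact (isCompact_closedBall 0 (R + 1))).mono_set ball_subset_closedBall)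
  have h2 := corr_adjoint_of_integrable hf h1 hη hc
  have h3 : ∀ x, (ball (0 : E3) (R + 1)).indicator q x * cv f η x = q x * cv f η x := by
    intro x
    by_cases hx : x ∈ ball (0 : E3) (R + 1)
    · rw [indicator_of_mem hx]
    · have : cv f η x = 0 := by
        rw [cv]
        refine (integral_congr_ae (Eventually.of_forall fun z => ?_)).trans (integral_zero _ _)
        by_cases hz : 1 ≤ ‖z‖
        · simp [hf0 z hz]
        · have h : x - z ∉ tsupport η := fun hm => hx <| by
            rw [mem_ball_zero_iff]
            have := hR _ hm
            have h4 := norm_add_le (x - z) z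
            rw [sub_add_cancel] at h4
            push Not at hz
            linarith
          simp [image_eq_zero_of_notMem_tsupport h]
      rw [this, mul_zero, mul_zero]
  have h4 : ∀ y, corr f ((ball (0 : E3) (R + 1)).indicator q) y * η y = corr f q y * η y := by
    intro y
    by_cases hy : y ∈ tsupport η
    · rw [corr_indicator hf0 (hR y hy)]
    · rw [image_eq_zero_of_notMem_tsupport hy, mul_zero, mul_zero]
  simpa only [h3, h4] using h2

lemma integrable_mul_test {q k : E3 → ℝ} (hq : LocallyIntegrable q) (hk : Continuous k)
    (hc : HasCompactSupport k) : Integrable fun x => q x * k x := by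
  simpa [mul_comm] using hq.integrable_smul_left_of_hasCompactSupport hk hc

lemma hasCompactSupport_cv {f η : E3 → ℝ} (hf0 : ∀ z, 1 ≤ ‖z‖ → f z = 0)
    (hc : HasCompactSupport η) : HasCompactSupport (cv f η) := by
  obtain ⟨R, hR⟩ := hc.isCompact.isBounded.exists_norm_le
  refine hasCompactSupport_of_zero (R := R + 1) fun x hx => ?_
  rw [cv]
  refine (integral_congr_ae (Eventually.of_forall fun z => ?_)).trans (integral_zero _ _)
  by_cases hz : 1 ≤ ‖z‖
  · simp [hf0 z hz]
  · have h : x - z ∉ tsupport η := fun hm => by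
      have := hR _ hm
      have h4 := norm_add_le (x - z) z
      rw [sub_add_cancel] at h4
      push Not at hz
      linarith
    simp [image_eq_zero_of_notMem_tsupport h]

/-- Test functions supported away from the ball of radius `r`. -/
def IsTest (r : ℝ) (k : E3 → ℝ) : Prop :=
  ContDiff ℝ ∞ k ∧ HasCompactSupport k ∧ ∀ x, ‖x‖ ≤ r → k x = 0

lemma IsTest.fderiv {r : ℝ} (hr : 0 < r) {k : E3 → ℝ} (hk : IsTest r k) (v : E3) :
    IsTest r fun x => fderiv ℝ k x v := by
  have h1 : ContDiff ℝ ∞ fun x => _root_.fderiv ℝ k x v :=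
    (hk.1.fderiv_right (m := ∞) (by norm_num)).clm_apply contDiff_const
  refine ⟨h1, hk.2.1.fderiv_apply ℝ v, fun x hx => ?_⟩
  have h2 : IsClosed {x | _root_.fderiv ℝ k x v = 0} := isClosed_eq h1.continuous continuous_const
  have h3 : ball (0 : E3) r ⊆ {x | _root_.fderiv ℝ k x v = 0} := fun y hy => by
    have : k =ᶠ[𝓝 y] fun _ => 0 := by
      filter_upwards [isOpen_ball.mem_nhds hy] with z hz
      exact hk.2.2 z (mem_ball_zero_iff.1 hz).le
    simp [this.fderiv_eq]
  have h4 := h2.closure_subset_iff.2 h3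
  rw [closure_ball _ hr.ne'] at h4
  exact h4 (mem_closedBall_zero_iff.2 hx)

lemma IsTest.cv {r ρ : ℝ} (hρ : ρ ≤ 1) {f η : E3 → ℝ} (hf : Integrable f)
    (hf0 : ∀ z, ρ ≤ ‖z‖ → f z = 0) (hη : IsTest (r + ρ) η) : IsTest r (cv f η) := by
  refine ⟨contDiff_cv (n := ⊤) hf hη.1 hη.2.1,
    hasCompactSupport_cv (fun z hz => hf0 z (hρ.trans hz)) hη.2.1, fun x hx => ?_⟩
  rw [_root_.cv]
  refine (integral_congr_ae (Eventually.of_forall fun z => ?_)).trans (integral_zero _ _)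
  by_cases hz : ρ ≤ ‖z‖
  · simp [hf0 z hz]
  · push Not at hz
    have := norm_sub_le x z
    have h0 : η (x - z) = 0 := hη.2.2 (x - z) (by linarith)
    simp [h0]

lemma ae_eq_zero_of_tests {r : ℝ} {f : E3 → ℝ} (hf : LocallyIntegrable f)
    (h : ∀ η, ContDiff ℝ ∞ η → HasCompactSupport η → tsupport η ⊆ {x | r < ‖x‖} →
      ∫ x, f x * η x = 0) : ∀ᵐ x : E3, r < ‖x‖ → f x = 0 := by
  refine (isOpen_lt continuous_const continuous_norm).ae_eq_zero_of_integral_contDiff_smul_eq_zero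
    (hf.locallyIntegrableOn _) fun g hg hc hs => ?_
  simpa [mul_comm] using h g hg hc hs

/-- Weak solutions `v` of `-div F = q`, `F = ∇v` in `{|x| > 1/2}` with `q` of linear growth in `F`. -/
structure WeakSol (v : E3 → ℝ) (F : Fin 3 → E3 → ℝ) (q : E3 → ℝ) : Prop where
  mv : Measurable v
  mF : ∀ i, Measurable (F i)
  mq : Measurable q
  bv : ∃ M, ∀ x, |v x| ≤ M
  bF : ∃ A : E3 → ℝ, Integrable A ∧ ∃ C, ∀ x i, F i x ^ 2 ≤ A x + C
  bq : ∃ C Λ : ℝ, 0 ≤ C ∧ 0 ≤ Λ ∧ ∀ x, |q x| ≤ C + Λ * ∑ i, |F i x|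
  eqn : ∀ k, IsTest (1 / 2) k → ∫ x, ∑ i, F i x * fderiv ℝ k x (ek i) = ∫ x, q x * k x
  grad : ∀ k, IsTest (1 / 2) k → ∀ j, ∫ x, v x * fderiv ℝ k x (ek j) = - ∫ x, F j x * k x

namespace WeakSol
variable {v : E3 → ℝ} {F : Fin 3 → E3 → ℝ} {q : E3 → ℝ}

lemma locInt_v (h : WeakSol v F q) : LocallyIntegrable v := by
  obtain ⟨M, hM⟩ := h.bv
  exact (locallyIntegrable_const M).mono h.mv.aestronglyMeasurable
    (Eventually.of_forall fun x => (hM x).trans (le_abs_self M))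

lemma locInt_F (h : WeakSol v F q) (i : Fin 3) : LocallyIntegrable (F i) := by
  obtain ⟨A, hA, C, hC⟩ := h.bF
  have : LocallyIntegrable fun x => A x + C + 1 := (hA.locallyIntegrable.add
    (locallyIntegrable_const C)).add (locallyIntegrable_const 1)
  refine this.mono (h.mF i).aestronglyMeasurable (Eventually.of_forall fun x => ?_)
  rw [Real.norm_eq_abs, Real.norm_eq_abs]
  refine le_trans ?_ (le_abs_self _)
  nlinarith [hC x i, sq_abs (F i x), sq_nonneg (|F i x| - 1)]

lemma locInt_q (h : WeakSol v F q) : LocallyIntegrable q := by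
  obtain ⟨C, Λ, hC, hΛ, hq⟩ := h.bq
  have ha : ∀ i, LocallyIntegrable fun x => |F i x| := fun i =>
    (h.locInt_F i).mono (h.mF i).abs.aestronglyMeasurable (Eventually.of_forall fun x => by simp)
  have h1 : LocallyIntegrable fun x => ∑ i, |F i x| := by
    have : LocallyIntegrable fun x => |F 0 x| + |F 1 x| + |F 2 x| :=
      ((ha 0).add (ha 1)).add (ha 2)
    simpa [Fin.sum_univ_three] using this
  have : LocallyIntegrable fun x => C + Λ * ∑ i, |F i x| :=
    (locallyIntegrable_const C).add (h1.smul Λ)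
  exact this.mono h.mq.aestronglyMeasurable
    (Eventually.of_forall fun x => (hq x).trans (le_abs_self _))

variable (χ : ContDiffBump (0 : E3))

lemma test_identity (h : WeakSol v F q) (hχ : χ.rOut < 1 / 16) {η : E3 → ℝ}
    (hη : IsTest (9 / 16) η) :
    c0 * ∫ x, v x * η x = (∫ x, v x * cv (errK χ) η x) + ∫ x, q x * cv (gam χ) η x := by
  have hk : IsTest (1 / 2) (cv (gam χ) η) :=
    IsTest.cv (ρ := 1 / 16) (by norm_num) (integrable_gamE χ 0)
      (fun z hz => by rw [gam_apply, bump_eq_zero χ (hχ.le.trans hz), zero_mul])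
      (by norm_num; exact hη)
  have hw : ∀ i, IsTest (1 / 2) fun y => fderiv ℝ (cv (gam χ) η) y (ek i) := fun i =>
    hk.fderiv (by norm_num) _
  have hw2 : ∀ i, IsTest (1 / 2)
      fun x => fderiv ℝ (fun y => fderiv ℝ (cv (gam χ) η) y (ek i)) x (ek i) := fun i =>
    (hw i).fderiv (by norm_num) _
  have h1 := h.eqn _ hk
  rw [integral_finsetSum _ fun i _ => integrable_mul_test (h.locInt_F i) (hw i).1.continuous
    (hw i).2.1] at h1
  have h2 := fun i => h.grad _ (hw i) i
  have h3 : ∑ i, ∫ x, v x * fderiv ℝ (fun y => fderiv ℝ (cv (gam χ) η) y (ek i)) x (ek i) =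
      - ∫ x, q x * cv (gam χ) η x := by
    rw [← h1, Finset.sum_congr rfl fun i _ => h2 i, Finset.sum_neg_distrib]
  have hi2 : ∀ i, Integrable fun x => v x *
      fderiv ℝ (fun y => fderiv ℝ (cv (gam χ) η) y (ek i)) x (ek i) := fun i =>
    integrable_mul_test h.locInt_v (hw2 i).1.continuous (hw2 i).2.1
  rw [← integral_finsetSum _ fun i _ => hi2 i] at h3
  simp_rw [← Finset.mul_sum, laplacian_potential χ (hη.1.of_le (by norm_cast)) hη.2.1] at h3
  have hE : Integrable fun x => v x * cv (errK χ) η x := by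
    have hi : Integrable (errK χ) := (contDiff_errK χ).continuous.integrable_of_hasCompactSupport
      (hasCompactSupport_errK χ)
    refine integrable_mul_test h.locInt_v (contDiff_cv (n := ⊤) hi hη.1 hη.2.1).continuous
      (hasCompactSupport_cv (fun z hz => errK_eq_zero χ ?_) hη.2.1)
    linarith
  have hI := integrable_mul_test h.locInt_v hη.1.continuous hη.2.1
  have h4 : ∫ x, v x * (-(c0 * η x) + cv (errK χ) η x) =
      - c0 * (∫ x, v x * η x) + ∫ x, v x * cv (errK χ) η x := by
    rw [← integral_const_mul, ← integral_add (hI.const_mul _) hE]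
    congr 1; funext x; ring
  linarith

lemma integrable_errK : Integrable (errK χ) :=
  (contDiff_errK χ).continuous.integrable_of_hasCompactSupport (hasCompactSupport_errK χ)

lemma integrable_dgam (j : Fin 3) : Integrable fun z => fderiv ℝ (gam χ) z (ek j) :=
  (ContinuousLinearMap.apply ℝ ℝ (ek j)).integrable_comp (integrable_fderiv_gamE χ 0)

lemma gam_zero {z : E3} (hz : χ.rOut ≤ ‖z‖) : gam χ z = 0 := by
  rw [gam_apply, bump_eq_zero χ hz, zero_mul]

lemma fderiv_gam_zero {z : E3} (hz : χ.rOut ≤ ‖z‖) : fderiv ℝ (gam χ) z = 0 := by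
  have hz0 : z ≠ 0 := norm_pos_iff.1 (χ.rOut_pos.trans_le hz)
  obtain ⟨C, hC0, hC⟩ := bump_fderiv_bound χ
  have := norm_fderiv_gamE_le χ (ε := 0) hC hz0
  rw [kdom, indicator_of_notMem (by simpa using hz)] at this
  exact norm_le_zero_iff.1 this

lemma v_eq (h : WeakSol v F q) (hχ : χ.rOut < 1 / 16) :
    ∀ᵐ x : E3, 9 / 16 < ‖x‖ → c0 * v x = corr (errK χ) v x + corr (gam χ) q x := by
  have e0 : ∀ z : E3, 1 ≤ ‖z‖ → errK χ z = 0 := fun z hz => errK_eq_zero χ (by linarith)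
  have g0 : ∀ z : E3, 1 ≤ ‖z‖ → gam χ z = 0 := fun z hz => gam_zero χ (by linarith)
  have l1 := locallyIntegrable_corr (integrable_errK χ) e0 h.locInt_v
  have l2 := locallyIntegrable_corr (integrable_gamE χ 0) g0 h.locInt_q
  have := ae_eq_zero_of_tests (r := 9 / 16) (f := fun x => c0 • v x - (corr (errK χ) v x +
    corr (gam χ) q x)) ((h.locInt_v.smul c0).sub (l1.add l2)) fun η hη hc hs => ?_
  · filter_upwards [this] with x hx hx'
    exact sub_eq_zero.1 (hx hx')
  · have ht : IsTest (9 / 16) η := ⟨hη, hc, fun x hx =>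
      image_eq_zero_of_notMem_tsupport fun hm => not_lt.2 hx (hs hm)⟩
    have h1 := h.test_identity χ hχ ht
    rw [corr_adjoint (integrable_errK χ) e0 h.locInt_v hη.continuous hc,
      corr_adjoint (integrable_gamE χ 0) g0 h.locInt_q hη.continuous hc,
      ← integral_const_mul] at h1
    simp_rw [smul_eq_mul, sub_mul, add_mul, mul_assoc]
    have i1 := integrable_mul_test l1 hη.continuous hc
    have i2 := integrable_mul_test l2 hη.continuous hc
    have i3 : Integrable fun x => corr (errK χ) v x * η x + corr (gam χ) q x * η x := i1.add i2
    rw [integral_sub ((integrable_mul_test h.locInt_v hη.continuous hc).const_mul _) i3,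
      integral_add i1 i2, h1, sub_self]

lemma F_eq (h : WeakSol v F q) (hχ : χ.rOut < 1 / 16) (j : Fin 3) :
    ∀ᵐ x : E3, 9 / 16 < ‖x‖ → c0 * F j x =
      corr (errK χ) (F j) x - corr (fun z => fderiv ℝ (gam χ) z (ek j)) q x := by
  have e0 : ∀ z : E3, 1 ≤ ‖z‖ → errK χ z = 0 := fun z hz => errK_eq_zero χ (by linarith)
  have g0 : ∀ z : E3, 1 ≤ ‖z‖ → fderiv ℝ (gam χ) z (ek j) = 0 := fun z hz => by
    rw [fderiv_gam_zero χ (by linarith)]; rfl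
  have l1 := locallyIntegrable_corr (integrable_errK χ) e0 (h.locInt_F j)
  have l2 := locallyIntegrable_corr (integrable_dgam χ j) g0 h.locInt_q
  have := ae_eq_zero_of_tests (r := 9 / 16) (f := fun x => c0 • F j x - (corr (errK χ) (F j) x -
    corr (fun z => fderiv ℝ (gam χ) z (ek j)) q x)) (((h.locInt_F j).smul c0).sub (l1.sub l2))
    fun η hη hc hs => ?_
  · filter_upwards [this] with x hx hx'
    exact sub_eq_zero.1 (hx hx')
  · have ht : IsTest (9 / 16) η := ⟨hη, hc, fun x hx =>
      image_eq_zero_of_notMem_tsupport fun hm => not_lt.2 hx (hs hm)⟩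
    have ht1 : IsTest (1 / 2) η := ⟨hη, hc, fun x hx => ht.2.2 x (by linarith)⟩
    have h1 := h.test_identity χ hχ (ht.fderiv (by norm_num) (ek j))
    have hη1 : ContDiff ℝ 1 η := hη.of_le (by norm_cast)
    have hk : IsTest (1 / 2) (cv (errK χ) η) :=
      IsTest.cv (ρ := 1 / 16 ) (by norm_num) (integrable_errK χ)
        (fun z hz => errK_eq_zero χ (hχ.trans_le hz)) (by norm_num; exact ht)
    have h2 : cv (errK χ) (fun y => fderiv ℝ η y (ek j)) =
        fun x => fderiv ℝ (cv (errK χ) η) x (ek j) := by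
      funext x
      exact (hasFDerivAt_cv (integrable_errK χ) hη1 hc x (ek j)).2.symm
    have h3 : cv (gam χ) (fun y => fderiv ℝ η y (ek j)) =
        cv (fun z => fderiv ℝ (gam χ) z (ek j)) η := by
      funext x
      exact cv_gam_fderiv χ hη1 hc x (ek j)
    rw [h2, h3, h.grad _ hk j, h.grad _ ht1 j,
      corr_adjoint (integrable_errK χ) e0 (h.locInt_F j) hη.continuous hc,
      corr_adjoint (integrable_dgam χ j) g0 h.locInt_q hη.continuous hc] at h1
    simp_rw [smul_eq_mul, sub_mul, mul_assoc]
    have i1 := integrable_mul_test l1 hη.continuous hc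
    have i2 := integrable_mul_test l2 hη.continuous hc
    have i3 : Integrable fun x => corr (errK χ) (F j) x * η x -
      corr (fun z => fderiv ℝ (gam χ) z (ek j)) q x * η x := i1.sub i2
    rw [integral_sub ((integrable_mul_test (h.locInt_F j) hη.continuous hc).const_mul _)
      i3, integral_sub i1 i2, integral_const_mul]
    linarith

end WeakSol

/-- The weight `‖z‖^(-1/4)`. -/
def pw (z : E3) : ℝ≥0∞ := ENNReal.ofReal (‖z‖ ^ (-(1 / 4) : ℝ))

lemma measurable_pw : Measurable pw := by unfold pw; fun_prop

lemma lintegral_pw_lt_top {n : ℕ} (hn : n ≤ 11) : ∫⁻ z in ball (0 : E3) 1, pw z ^ n < ⊤ := by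
  have h : IntegrableOn (fun z : E3 => (‖z‖ ^ (-(1 / 4) : ℝ)) ^ n) (ball 0 1) := by
    rw [integrableOn_fun_norm_addHaar (μ := volume) (f := fun t : ℝ => (t ^ (-(1 / 4) : ℝ)) ^ n)]
    refine IntegrableOn.congr_fun (f := fun t : ℝ => t ^ (2 - n / 4 : ℝ)) ?_ ?_ measurableSet_Ioo
    · rw [intervalIntegral.integrableOn_Ioo_rpow_iff one_pos]
      have : (n : ℝ) ≤ 11 := by exact_mod_cast hn
      linarith
    · intro y hy
      simp only [finrank_E3, smul_eq_mul]
      norm_num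
      rw [← Real.rpow_natCast (y ^ (-(1 / 4) : ℝ)), ← Real.rpow_mul hy.1.le,
        sub_eq_add_neg, Real.rpow_add hy.1, Real.rpow_two]
      congr 2; ring
  have := h.lintegral_lt_top
  refine (lintegral_congr fun z => ?_).trans_lt this
  rw [pw, ENNReal.ofReal_pow (by positivity)]

lemma pw_eight {z : E3} : pw z ^ 8 = ENNReal.ofReal ((‖z‖ ^ 2)⁻¹) := by
  rw [pw, ← ENNReal.ofReal_pow (by positivity), ← Real.rpow_natCast (‖z‖ ^ (-(1 / 4) : ℝ)),
    ← Real.rpow_mul (norm_nonneg z)]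
  norm_num

lemma ennreal_am_gm (p q N : ℝ≥0∞) :
    p ^ 8 * (q ^ 8 * N) ≤ p ^ 11 * q ^ 11 + (p ^ 10 * N ^ 2 + q ^ 10 * N ^ 2) := by
  rcases le_total N ((p * q) ^ 3) with h | h
  · calc p ^ 8 * (q ^ 8 * N) ≤ p ^ 8 * (q ^ 8 * (p * q) ^ 3) := by gcongr
      _ = p ^ 11 * q ^ 11 := by ring
      _ ≤ _ := le_self_add
  · have h1 : p ^ 8 * (q ^ 8 * N) ≤ (p * q) ^ 5 * N ^ 2 := by
      calc p ^ 8 * (q ^ 8 * N) = (p * q) ^ 5 * ((p * q) ^ 3 * N) := by ring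
        _ ≤ (p * q) ^ 5 * (N * N) := by gcongr
        _ = _ := by ring
    have h2 : (p * q) ^ 5 ≤ p ^ 10 + q ^ 10 := by
      rcases le_total p q with h | h
      · calc (p * q) ^ 5 ≤ (q * q) ^ 5 := by gcongr
          _ = q ^ 10 := by ring
          _ ≤ _ := le_add_self
      · calc (p * q) ^ 5 ≤ (p * p) ^ 5 := by gcongr
          _ = p ^ 10 := by ring
          _ ≤ _ := le_self_add
    calc p ^ 8 * (q ^ 8 * N) ≤ (p * q) ^ 5 * N ^ 2 := h1
      _ ≤ (p ^ 10 + q ^ 10) * N ^ 2 := by gcongr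
      _ = p ^ 10 * N ^ 2 + q ^ 10 * N ^ 2 := by ring
      _ ≤ _ := le_add_self

/-- Two applications of an integral inequality with kernel `K ‖z‖⁻²` turn local square
integrability into boundedness. -/
theorem ae_bounded_of_kernel {N κ : E3 → ℝ≥0∞} (hN : Measurable N)
    {r ρ : ℝ} (h0 : 0 ≤ ρ) (hρ : ρ ≤ 1) {K C1 C2 B : ℝ≥0∞} (hK : K ≠ ⊤) (hC1 : C1 ≠ ⊤) (hC2 : C2 ≠ ⊤) (hB : B ≠ ⊤)
    (hκ : ∀ z, κ z ≤ K * (ball (0 : E3) ρ).indicator (fun z => pw z ^ 8) z)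
    (hle : ∀ᵐ y : E3, r < ‖y‖ → N y ≤ C1 + C2 * ∫⁻ z, κ z * N (y + z))
    (hN2 : ∀ y, ∫⁻ z in ball (0 : E3) 1, N (y + z) ^ 2 ≤ B) :
    ∃ M : ℝ≥0∞, M ≠ ⊤ ∧ ∀ᵐ y : E3, r + ρ < ‖y‖ → N y ≤ M := by
  set β : Set E3 := ball 0 1
  set P := ∫⁻ z in β, pw z ^ 11
  set R := ∫⁻ z in β, pw z ^ 10
  set T := ∫⁻ z in β, pw z ^ 8
  have hP : P ≠ ⊤ := (lintegral_pw_lt_top (by norm_num)).ne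
  have hR : R ≠ ⊤ := (lintegral_pw_lt_top (by norm_num)).ne
  have hT : T ≠ ⊤ := (lintegral_pw_lt_top (by norm_num)).ne
  have hm := measurable_pw
  have hker : ∀ g : E3 → ℝ≥0∞, ∫⁻ z, κ z * g z ≤ K * ∫⁻ z in β, pw z ^ 8 * g z := by
    intro g
    rw [← lintegral_indicator measurableSet_ball, ← lintegral_const_mul' _ _ hK]
    refine lintegral_mono fun z => ?_
    by_cases hz : z ∈ ball (0 : E3) ρ
    · have h1 := hκ z
      rw [indicator_of_mem hz] at h1
      rw [indicator_of_mem (ball_subset_ball hρ hz), ← mul_assoc]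
      gcongr
    · have h1 := hκ z
      rw [indicator_of_notMem hz, mul_zero, nonpos_iff_eq_zero] at h1
      simp [h1]
  have hdouble : ∀ y, ∫⁻ z in β, pw z ^ 8 * ∫⁻ w in β, pw w ^ 8 * N (y + z + w) ≤
      P * P + (R * B + R * B) := by
    intro y
    have hNm : Measurable fun x : E3 × E3 => N (y + x.1 + x.2) := hN.comp (by fun_prop)
    calc ∫⁻ z in β, pw z ^ 8 * ∫⁻ w in β, pw w ^ 8 * N (y + z + w)
        = ∫⁻ z in β, ∫⁻ w in β, pw z ^ 8 * (pw w ^ 8 * N (y + z + w)) := by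
          refine lintegral_congr fun z => ?_
          rw [lintegral_const_mul _ (by fun_prop)]
      _ ≤ ∫⁻ z in β, ∫⁻ w in β, (pw z ^ 11 * pw w ^ 11 + (pw z ^ 10 * N (y + z + w) ^ 2 +
          pw w ^ 10 * N (y + z + w) ^ 2)) := by
          gcongr with z w
          exact ennreal_am_gm _ _ _
      _ = (∫⁻ z in β, ∫⁻ w in β, pw z ^ 11 * pw w ^ 11) +
          ((∫⁻ z in β, ∫⁻ w in β, pw z ^ 10 * N (y + z + w) ^ 2) +
          ∫⁻ z in β, ∫⁻ w in β, pw w ^ 10 * N (y + z + w) ^ 2) := by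
          have m1 : Measurable fun z : E3 => ∫⁻ w in β, pw z ^ 11 * pw w ^ 11 :=
            Measurable.lintegral_prod_right' (ν := volume.restrict β) (f := fun x : E3 × E3 =>
              pw x.1 ^ 11 * pw x.2 ^ 11) (by fun_prop)
          have m2 : Measurable fun z : E3 => ∫⁻ w in β, pw z ^ 10 * N (y + z + w) ^ 2 :=
            Measurable.lintegral_prod_right' (ν := volume.restrict β) (f := fun x : E3 × E3 =>
              pw x.1 ^ 10 * N (y + x.1 + x.2) ^ 2) (by fun_prop)
          rw [← lintegral_add_left m2, ← lintegral_add_left m1]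
          refine lintegral_congr fun z => ?_
          rw [lintegral_add_left (by fun_prop), lintegral_add_left (by fun_prop)]
      _ ≤ P * P + (R * B + R * B) := by
          gcongr
          · refine le_of_eq ?_
            simp_rw [lintegral_const_mul' _ _ (ENNReal.pow_ne_top ENNReal.ofReal_ne_top :
              pw _ ^ 11 ≠ ⊤)]
            rw [lintegral_mul_const' _ _ hP]
          · simp_rw [lintegral_const_mul' _ _ (ENNReal.pow_ne_top ENNReal.ofReal_ne_top :
              pw _ ^ 10 ≠ ⊤)]
            rw [← lintegral_mul_const' _ _ hB]
            gcongr with z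
            exact hN2 _
          · rw [lintegral_lintegral_swap (by fun_prop)]
            simp_rw [lintegral_const_mul' _ _ (ENNReal.pow_ne_top ENNReal.ofReal_ne_top :
              pw _ ^ 10 ≠ ⊤)]
            rw [← lintegral_mul_const' _ _ hB]
            gcongr with w
            refine le_trans (le_of_eq (lintegral_congr fun z => ?_)) (hN2 (y + w))
            rw [add_right_comm]
  refine ⟨C1 + C2 * (K * (C1 * T + C2 * (K * (P * P + (R * B + R * B))))), ?_, ?_⟩
  · finiteness
  · filter_upwards [hle] with y hy hy'
    refine (hy (by linarith)).trans ?_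
    gcongr
    calc ∫⁻ z, κ z * N (y + z) ≤
        ∫⁻ z, κ z * (C1 + C2 * ∫⁻ w, κ w * N (y + z + w)) := by
          refine lintegral_mono_ae ?_
          have := (quasiMeasurePreserving_add_left (volume : Measure E3) y).ae hle
          filter_upwards [this] with z hz
          by_cases hzρ : z ∈ ball (0 : E3) ρ
          · gcongr
            refine hz ?_
            have := norm_sub_le (y + z) z
            rw [add_sub_cancel_right] at this
            rw [mem_ball_zero_iff] at hzρ
            linarith
          · have h1 := hκ z
            rw [indicator_of_notMem hzρ, mul_zero, nonpos_iff_eq_zero] at h1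
            simp [h1]
      _ ≤ K * ∫⁻ z in β, pw z ^ 8 * (C1 + C2 * (K * ∫⁻ w in β, pw w ^ 8 * N (y + z + w))) := by
          refine (hker _).trans ?_
          gcongr
          exact hker _
      _ = K * (C1 * T + C2 * (K * ∫⁻ z in β, pw z ^ 8 * ∫⁻ w in β, pw w ^ 8 * N (y + z + w))) := by
          congr 1
          rw [← lintegral_const_mul' _ _ hC1, ← lintegral_const_mul' _ _ hK,
            ← lintegral_const_mul' _ _ hC2, ← lintegral_add_left (by fun_prop)]
          refine lintegral_congr fun z => ?_
          ring
      _ ≤ _ := by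
          gcongr
          exact hdouble y

namespace WeakSol
variable {v : E3 → ℝ} {F : Fin 3 → E3 → ℝ} {q : E3 → ℝ}

lemma enorm_corr_le (f q : E3 → ℝ) (y : E3) : ‖corr f q y‖ₑ ≤ ∫⁻ z, ‖f z‖ₑ * ‖q (y + z)‖ₑ := by
  refine (enorm_integral_le_lintegral_enorm _).trans (le_of_eq ?_)
  simp_rw [enorm_mul]

lemma norm_dgam_le (χ : ContDiffBump (0 : E3)) (hχ : χ.rOut ≤ 1) :
    ∃ K : ℝ≥0∞, K ≠ ⊤ ∧ ∀ j, ∀ᵐ z : E3, ‖fderiv ℝ (gam χ) z (ek j)‖ₑ ≤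
      K * (ball (0 : E3) χ.rOut).indicator (fun z => pw z ^ 8) z := by
  obtain ⟨C, hC0, hC⟩ := bump_fderiv_bound χ
  refine ⟨ENNReal.ofReal (1 + C), ENNReal.ofReal_ne_top, fun j => ae_ne_zero.mono fun z hz => ?_⟩
  by_cases hzb : z ∈ ball (0 : E3) χ.rOut
  · rw [indicator_of_mem hzb, pw_eight, ← ENNReal.ofReal_mul (by positivity),
      ← ofReal_norm]
    refine ENNReal.ofReal_le_ofReal ?_
    have h1 := norm_fderiv_gamE_le χ (ε := 0) hC hz
    rw [kdom, indicator_of_mem hzb] at h1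
    have h2 : ‖fderiv ℝ (gam χ) z (ek j)‖ ≤ ‖fderiv ℝ (gam χ) z‖ := by
      simpa using (fderiv ℝ (gam χ) z).le_opNorm (ek j)
    have hp : 0 < ‖z‖ := norm_pos_iff.2 hz
    have hz1 : ‖z‖ ≤ 1 := ((mem_ball_zero_iff.1 hzb).le).trans hχ
    have h3 : ‖z‖⁻¹ ≤ (‖z‖ ^ 2)⁻¹ := by
      apply inv_anti₀ (by positivity); nlinarith
    nlinarith
  · rw [fderiv_gam_zero χ (by simpa using hzb)]
    simp

lemma exists_sq_bound (h : WeakSol v F q) : ∃ B : ℝ≥0∞, B ≠ ⊤ ∧ ∀ y,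
    ∫⁻ z in ball (0 : E3) 1, ENNReal.ofReal (∑ i, |F i (y + z)|) ^ 2 ≤ B := by
  obtain ⟨A, hA, C, hC⟩ := h.bF
  refine ⟨9 * (∫⁻ z, ‖A z‖ₑ) + 9 * (ENNReal.ofReal C * volume (ball (0 : E3) 1)), ?_, fun y => ?_⟩
  · have := hA.2
    have h2 : volume (ball (0 : E3) 1) ≠ ⊤ := measure_ball_lt_top.ne
    rw [HasFiniteIntegral] at this
    finiteness
  · calc ∫⁻ z in ball (0 : E3) 1, ENNReal.ofReal (∑ i, |F i (y + z)|) ^ 2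
        ≤ ∫⁻ z in ball (0 : E3) 1, (9 * ‖A (y + z)‖ₑ + 9 * ENNReal.ofReal C) := by
          refine lintegral_mono fun z => ?_
          rw [← ENNReal.ofReal_pow (by positivity), ← ofReal_norm]
          have h9 : (9 : ℝ≥0∞) = ENNReal.ofReal 9 := by norm_num
          rw [h9, ← ENNReal.ofReal_mul (by norm_num), ← ENNReal.ofReal_mul (by norm_num)]
          refine le_trans ?_ (ENNReal.ofReal_add_le)
          refine ENNReal.ofReal_le_ofReal ?_
          rw [Fin.sum_univ_three, Real.norm_eq_abs]
          have h0 := hC (y + z) 0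
          have h1 := hC (y + z) 1
          have h2 := hC (y + z) 2
          rw [← sq_abs] at h0 h1 h2
          have := le_abs_self (A (y + z))
          nlinarith [sq_nonneg (|F 0 (y + z)| - |F 1 (y + z)|),
            sq_nonneg (|F 1 (y + z)| - |F 2 (y + z)|), sq_nonneg (|F 0 (y + z)| - |F 2 (y + z)|)]
      _ = 9 * (∫⁻ z in ball (0 : E3) 1, ‖A (y + z)‖ₑ) +
          9 * (ENNReal.ofReal C * volume (ball (0 : E3) 1)) := by
          rw [lintegral_add_right _ measurable_const, lintegral_const_mul' _ _ (by norm_num)]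
          simp [mul_assoc]
      _ ≤ _ := by
          refine add_le_add (mul_le_mul_right ?_ _) le_rfl
          refine (setLIntegral_le_lintegral _ _).trans (le_of_eq ?_)
          exact lintegral_add_left_eq_self (fun z => ‖A z‖ₑ) y

/-- The gradient of a weak solution is locally bounded. -/
lemma ae_bounded (h : WeakSol v F q) (χ : ContDiffBump (0 : E3)) (hχ : χ.rOut < 1 / 16) :
    ∃ M : ℝ, ∀ᵐ x : E3, 10 / 16 < ‖x‖ → |q x| ≤ M := by
  obtain ⟨B, hB, hBle⟩ := h.exists_sq_bound
  obtain ⟨K, hK, hKle⟩ := norm_dgam_le χ (by linarith)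
  obtain ⟨C, Λ, hC, hΛ, hq⟩ := h.bq
  obtain ⟨Me, -, hMe⟩ := exists_abs_bound (contDiff_errK χ).continuous (hasCompactSupport_errK χ)
  set N : E3 → ℝ≥0∞ := fun x => ENNReal.ofReal (∑ i, |F i x|) with hN
  have hmF := h.mF
  have hNm : Measurable N := by
    have := fun i => (hmF i).abs
    simp only [hN]
    fun_prop
  set κ : E3 → ℝ≥0∞ := fun z => K * (ball (0 : E3) χ.rOut).indicator (fun z => pw z ^ 8) z with hκ
  have hmpw := measurable_pw
  have hκm : Measurable κ := by
    have := (hmpw.pow_const 8).indicator (measurableSet_ball (x := (0 : E3)) (ε := χ.rOut))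
    exact this.const_mul K
  have hκI : ∫⁻ z, κ z ≠ ⊤ := by
    simp only [hκ]
    rw [lintegral_const_mul' _ _ hK, lintegral_indicator measurableSet_ball]
    have : ∫⁻ z in ball (0 : E3) χ.rOut, pw z ^ 8 ≠ ⊤ :=
      ((lintegral_mono_set (ball_subset_ball (by linarith))).trans_lt
        (lintegral_pw_lt_top (by norm_num))).ne
    finiteness
  have hvol : volume (ball (0 : E3) 1) ≠ ⊤ := measure_ball_lt_top.ne
  have hFN : ∀ j x, ‖F j x‖ₑ ≤ N x := fun j x => by
    rw [← ofReal_norm]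
    refine ENNReal.ofReal_le_ofReal ?_
    exact Finset.single_le_sum (f := fun i => |F i x|) (fun i _ => abs_nonneg _) (Finset.mem_univ j)
  have hE : ∀ j y, ‖corr (errK χ) (F j) y‖ₑ ≤
      ENNReal.ofReal Me * (volume (ball (0 : E3) 1) + B) := by
    intro j y
    calc ‖corr (errK χ) (F j) y‖ₑ ≤ ∫⁻ z, ‖errK χ z‖ₑ * ‖F j (y + z)‖ₑ := enorm_corr_le _ _ _
      _ ≤ ∫⁻ z in ball (0 : E3) 1, ENNReal.ofReal Me * (1 + N (y + z) ^ 2) := by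
          rw [← lintegral_indicator measurableSet_ball]
          refine lintegral_mono fun z => ?_
          by_cases hz : z ∈ ball (0 : E3) 1
          · rw [indicator_of_mem hz]
            gcongr
            · rw [← ofReal_norm]
              exact ENNReal.ofReal_le_ofReal (hMe z)
            · refine (hFN j _).trans ?_
              rcases le_total (N (y + z)) 1 with h1 | h1
              · exact h1.trans le_self_add
              · calc N (y + z) = N (y + z) * 1 := (mul_one _).symm
                  _ ≤ N (y + z) * N (y + z) := by gcongr
                  _ ≤ _ := by rw [sq]; exact le_add_self
          · rw [errK_eq_zero χ (by
              rw [mem_ball_zero_iff, not_lt] at hz; linarith)]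
            simp
      _ ≤ _ := by
          rw [lintegral_const_mul' _ _ ENNReal.ofReal_ne_top, lintegral_add_left measurable_const]
          gcongr
          · simp
          · exact hBle y
  have hQ : ∀ j y, ‖corr (fun z => fderiv ℝ (gam χ) z (ek j)) q y‖ₑ ≤
      ENNReal.ofReal C * (∫⁻ z, κ z) + ENNReal.ofReal Λ * ∫⁻ z, κ z * N (y + z) := by
    intro j y
    refine (enorm_corr_le _ _ _).trans ?_
    rw [← lintegral_const_mul' _ _ ENNReal.ofReal_ne_top,
      ← lintegral_const_mul' _ _ ENNReal.ofReal_ne_top, ← lintegral_add_left (hκm.const_mul _)]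
    refine lintegral_mono_ae ((hKle j).mono fun z hz => ?_)
    calc _ ≤ κ z * (ENNReal.ofReal C + ENNReal.ofReal Λ * N (y + z)) := by
          refine mul_le_mul' hz ?_
          · rw [← ofReal_norm, ← ENNReal.ofReal_mul hΛ, ← ENNReal.ofReal_add hC]
            · exact ENNReal.ofReal_le_ofReal (hq _)
            · positivity
      _ = _ := by ring
  have hc0 : ENNReal.ofReal c0 ≠ 0 := (ENNReal.ofReal_pos.2 c0_pos).ne'
  set D : ℝ≥0∞ := 3 * (ENNReal.ofReal c0)⁻¹
  have hD : D ≠ ⊤ := by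
    have := ENNReal.inv_ne_top.2 hc0
    finiteness
  have hle : ∀ᵐ y : E3, 9 / 16 < ‖y‖ → N y ≤
      D * (ENNReal.ofReal Me * (volume (ball (0 : E3) 1) + B) + ENNReal.ofReal C * (∫⁻ z, κ z)) +
        (D * ENNReal.ofReal Λ) * ∫⁻ z, κ z * N (y + z) := by
    filter_upwards [ae_all_iff.2 fun j => h.F_eq χ hχ j] with y hy hy'
    have h1 : ∀ j, ‖F j y‖ₑ ≤ (ENNReal.ofReal c0)⁻¹ *
        (ENNReal.ofReal Me * (volume (ball (0 : E3) 1) + B) +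
        (ENNReal.ofReal C * (∫⁻ z, κ z) + ENNReal.ofReal Λ * ∫⁻ z, κ z * N (y + z))) := by
      intro j
      rw [mul_comm, ← div_eq_mul_inv, ENNReal.le_div_iff_mul_le (Or.inl hc0)
        (Or.inl ENNReal.ofReal_ne_top), mul_comm]
      have h2 : ENNReal.ofReal c0 * ‖F j y‖ₑ = ‖c0 * F j y‖ₑ := by
        rw [enorm_mul, Real.enorm_of_nonneg c0_pos.le]
      rw [h2, hy j hy']
      refine (enorm_sub_le).trans ?_
      gcongr
      · exact hE j y
      · exact hQ j y
    have h3 : N y = ∑ j, ‖F j y‖ₑ := by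
      simp only [hN]
      rw [ENNReal.ofReal_sum_of_nonneg (fun i _ => abs_nonneg _)]
      refine Finset.sum_congr rfl fun i _ => ?_
      rw [← ofReal_norm, Real.norm_eq_abs]
    rw [h3]
    refine (Finset.sum_le_sum fun j _ => h1 j).trans (le_of_eq ?_)
    simp only [Finset.sum_const, Finset.card_univ, Fintype.card_fin, nsmul_eq_mul, D]
    push_cast
    ring
  obtain ⟨M, hM, hMle⟩ := ae_bounded_of_kernel hNm (ρ := χ.rOut) χ.rOut_pos.le (by linarith) hK
    (by finiteness) (by finiteness) hB (fun z => le_rfl) hle hBle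
  refine ⟨C + Λ * M.toReal, hMle.mono fun x hx hx' => ?_⟩
  refine (hq x).trans ?_
  gcongr
  rw [← ENNReal.ofReal_le_iff_le_toReal hM]
  exact hx (by linarith)

/-- Interior regularity: a weak solution has a continuously differentiable representative. -/
theorem exists_contDiff (h : WeakSol v F q) : ∃ Φ : E3 → ℝ, ContDiff ℝ 1 Φ ∧
    ∀ᵐ x : E3, 3 / 4 < ‖x‖ → v x = Φ x ∧ ∀ i, F i x = fderiv ℝ Φ x (ek i) := by
  let χ : ContDiffBump (0 : E3) := ⟨1 / 64, 1 / 32, by norm_num, by norm_num⟩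
  have hχ : χ.rOut < 1 / 16 := by norm_num [χ]
  obtain ⟨M, hM⟩ := h.ae_bounded χ hχ
  set q' : E3 → ℝ := fun x => if |q x| ≤ M then q x else 0 with hq'
  have hq'm : Measurable q' :=
    Measurable.ite (measurableSet_le h.mq.abs measurable_const) h.mq measurable_const
  have hq'b : ∀ x, |q' x| ≤ |M| := fun x => by
    simp only [hq']
    split_ifs with h1
    · exact h1.trans (le_abs_self M)
    · simp
  have hqq : ∀ᵐ x : E3, 10 / 16 < ‖x‖ → q x = q' x := hM.mono fun x hx hx' => by
    simp [hq', hx hx']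
  obtain ⟨p1, p2⟩ := hasFDerivAt_potential χ hq'm hq'b
  have c1 : ContDiff ℝ 1 (cv (gam χ) q') := by
    rw [contDiff_one_iff_fderiv]
    refine ⟨fun x => (p1 x).differentiableAt, ?_⟩
    exact p2.congr fun x => (p1 x).fderiv.symm
  have c2 : ContDiff ℝ 1 (corr (errK χ) v) := by
    have h1 : ContDiff ℝ 1 fun z => errK χ (-z) :=
      ((contDiff_errK χ).of_le (by norm_cast)).comp contDiff_neg
    have h2 : HasCompactSupport fun z => errK χ (-z) :=
      (hasCompactSupport_errK χ).comp_homeomorph (Homeomorph.neg E3)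
    have := h2.contDiff_convolution_left (n := 1) (ContinuousLinearMap.lsmul ℝ ℝ) h1 h.locInt_v
      (μ := volume)
    have e : corr (errK χ) v = convolution (fun z => errK χ (-z)) v
        (ContinuousLinearMap.lsmul ℝ ℝ) volume := funext fun y => corr_eq_cv _ _ y
    rw [e]; exact this
  set Φ : E3 → ℝ := fun x => c0⁻¹ * (corr (errK χ) v x + cv (gam χ) q' x) with hΦ
  have hΦ1 : ContDiff ℝ 1 Φ := contDiff_const.mul (c2.add c1)
  have hv : ∀ᵐ x : E3, 3 / 4 < ‖x‖ → v x = Φ x := by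
    filter_upwards [h.v_eq χ hχ] with x hx hx'
    have h1 : corr (gam χ) q x = cv (gam χ) q' x := by
      rw [corr_of_even (gamE_neg χ 0)]
      refine integral_congr_ae ?_
      have := (quasiMeasurePreserving_sub_left (volume : Measure E3) x).ae hqq
      filter_upwards [this] with z hz
      by_cases hz' : χ.rOut ≤ ‖z‖
      · simp [gam_zero χ hz']
      · rw [hz]
        have := norm_add_le (x - z) z
        rw [sub_add_cancel] at this
        have h3 := (not_le.1 hz').trans hχ
        linarith
    have h2 := hx (by linarith)
    simp only [hΦ]
    rw [← h1, ← h2, inv_mul_cancel_left₀ c0_pos.ne']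
  have hF : ∀ i, ∀ᵐ x : E3, 3 / 4 < ‖x‖ → F i x = fderiv ℝ Φ x (ek i) := by
    intro i
    have hcd : Continuous fun x => fderiv ℝ Φ x (ek i) :=
      (hΦ1.continuous_fderiv one_ne_zero).clm_apply continuous_const
    have := ae_eq_zero_of_tests (r := 3 / 4) ((h.locInt_F i).sub hcd.locallyIntegrable)
      fun η hη hc hs => ?_
    · filter_upwards [this] with x hx hx'
      exact sub_eq_zero.1 (hx hx')
    · have ht : ∀ x, ‖x‖ ≤ 3 / 4 → η x = 0 := fun x hx =>
        image_eq_zero_of_notMem_tsupport fun hm => not_lt.2 hx (hs hm)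
      have ht1 : IsTest (1 / 2) η := ⟨hη, hc, fun x hx => ht x (by linarith)⟩
      have ht2 : IsTest (3 / 4) fun x => fderiv ℝ η x (ek i) :=
        IsTest.fderiv (by norm_num) ⟨hη, hc, ht⟩ _
      have g1 := h.grad η ht1 i
      have g2 : ∫ x, v x * fderiv ℝ η x (ek i) = ∫ x, fderiv ℝ η x (ek i) * Φ x := by
        refine integral_congr_ae (hv.mono fun x hx => ?_)
        by_cases hx' : 3 / 4 < ‖x‖
        · simp only [hx hx', mul_comm]
        · simp only [ht2.2.2 x (not_lt.1 hx'), mul_zero, zero_mul]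
      rw [integral_fderiv_mul_of_compact (hη.of_le (by norm_cast)) hΦ1 hc] at g2
      simp only [Pi.sub_apply, sub_mul]
      have i1 := integrable_mul_test (h.locInt_F i) hη.continuous hc
      have i2 := integrable_mul_test hcd.locallyIntegrable hη.continuous hc
      rw [integral_sub i1 i2]
      have : ∫ x, η x * fderiv ℝ Φ x (ek i) = ∫ x, fderiv ℝ Φ x (ek i) * η x := by
        simp_rw [mul_comm]
      linarith
  refine ⟨Φ, hΦ1, ?_⟩
  filter_upwards [hv, ae_all_iff.2 hF] with x h1 h2 hx
  exact ⟨h1 hx, fun i => h2 i hx⟩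

end WeakSol

lemma Omega_isOpen : IsOpen Omega := isOpen_lt continuous_const continuous_norm

lemma OmegaBar_mem_nhds {x : E3} (hx : x ∈ Omega) : OmegaBar ∈ 𝓝 x :=
  Filter.mem_of_superset (Omega_isOpen.mem_nhds hx) fun _ hy => (show 1 < ‖_‖ from hy).le

lemma pd_eq {g : E3 → ℝ} {x : E3} (hx : x ∈ Omega) (k : Fin 3) : pd g k x = fderiv ℝ g x (ek k) := by
  rw [pd, fderivWithin_of_mem_nhds (OmegaBar_mem_nhds hx)]

lemma lap3_eq {g : E3 → ℝ} {x : E3} (hx : x ∈ Omega) :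
    lap3 g x = ∑ k, fderiv ℝ (fun y => fderiv ℝ g y (ek k)) x (ek k) := by
  refine Finset.sum_congr rfl fun k _ => ?_
  rw [pd_eq hx]
  congr 1
  refine Filter.EventuallyEq.fderiv_eq ?_
  filter_upwards [Omega_isOpen.mem_nhds hx] with y hy
  exact pd_eq hy k

lemma contDiffAt_of_regC {n : ℕ} {g : E3 → ℝ} (hg : ContDiffOn ℝ n g OmegaBar) {x : E3}
    (hx : x ∈ Omega) : ContDiffAt ℝ n g x := hg.contDiffAt (OmegaBar_mem_nhds hx)

/-- Multiplying by a cutoff supported where `u` is regular. -/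
lemma contDiff_mul_cutoff {n : ℕ∞} {u ψ : E3 → ℝ} (hψ : ContDiff ℝ n ψ)
    (h : ∀ x ∈ tsupport ψ, ContDiffAt ℝ n u x) : ContDiff ℝ n fun x => u x * ψ x := by
  rw [contDiff_iff_contDiffAt]
  intro x
  by_cases hx : x ∈ tsupport ψ
  · exact (h x hx).mul hψ.contDiffAt
  · have : (fun x => u x * ψ x) =ᶠ[𝓝 x] fun _ => 0 := by
      filter_upwards [(isClosed_tsupport ψ).isOpen_compl.mem_nhds hx] with y hy
      rw [image_eq_zero_of_notMem_tsupport hy, mul_zero]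
    exact contDiffAt_const.congr_of_eventuallyEq this

/-- Newton representation of a `C²` function with compact support. -/
lemma newton_representation (χ : ContDiffBump (0 : E3)) {η : E3 → ℝ} (hη : ContDiff ℝ 2 η)
    (hc : HasCompactSupport η) (x : E3) :
    c0 * η x = cv (errK χ) η x -
      cv (gam χ) (fun y => ∑ i, fderiv ℝ (fun y => fderiv ℝ η y (ek i)) y (ek i)) x := by
  have h2 : ∀ i, ContDiff ℝ 1 fun y => fderiv ℝ η y (ek i) := fun i =>
    (hη.fderiv_right (m := 1) (by norm_num)).clm_apply contDiff_const
  have h3 := newton_identity χ (hη.of_le (by norm_num)) hc x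
  have h4 : ∀ i, ∫ z, fderiv ℝ (gam χ) z (ek i) * fderiv ℝ η (x - z) (ek i) =
      cv (gam χ) (fun y => fderiv ℝ (fun y => fderiv ℝ η y (ek i)) y (ek i)) x := fun i =>
    (cv_gam_fderiv χ (h2 i) (hc.fderiv_apply ℝ (ek i)) x (ek i)).symm
  rw [Finset.sum_congr rfl fun i _ => h4 i] at h3
  have h5 : cv (gam χ) (fun y => ∑ i, fderiv ℝ (fun y => fderiv ℝ η y (ek i)) y (ek i)) x =
      ∑ i, cv (gam χ) (fun y => fderiv ℝ (fun y => fderiv ℝ η y (ek i)) y (ek i)) x := by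
    simp only [cv, Finset.mul_sum]
    refine integral_finsetSum _ fun i _ => ?_
    have hcont : Continuous fun y => fderiv ℝ (fun y => fderiv ℝ η y (ek i)) y (ek i) :=
      ((h2 i).continuous_fderiv one_ne_zero).clm_apply continuous_const
    obtain ⟨M, -, hM⟩ := exists_abs_bound hcont ((hc.fderiv_apply ℝ (ek i)).fderiv_apply ℝ (ek i))
    exact integrable_mul_bdd (integrable_gamE χ 0) (hcont.comp (by fun_prop)) fun z => hM _
  rw [h5]; linarith

lemma gam_nonneg (χ : ContDiffBump (0 : E3)) (z : E3) : 0 ≤ gam χ z := by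
  rw [gam_apply]; exact mul_nonneg χ.nonneg (by positivity)

lemma gam_le (χ : ContDiffBump (0 : E3)) (z : E3) : gam χ z ≤ ‖z‖⁻¹ := by
  rw [gam_apply]
  exact mul_le_of_le_one_left (by positivity) χ.le_one

lemma young_cube {u δ : ℝ} (hu : 0 ≤ u) (hδ : 0 < δ) : u ≤ δ + (δ ^ 2)⁻¹ * u ^ 3 := by
  obtain ⟨t, rfl⟩ : ∃ t, u = δ * t := ⟨u / δ, by field_simp⟩
  have ht : 0 ≤ t := nonneg_of_mul_nonneg_right hu hδ
  have h : (δ ^ 2)⁻¹ * (δ * t) ^ 3 = δ * t ^ 3 := by field_simp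
  nlinarith [mul_nonneg hδ.le (mul_nonneg (add_nonneg ht zero_le_one) (sq_nonneg (t - 1)))]

lemma young_kernel {N u δ : ℝ} (hu : 0 ≤ u) (hδ : 0 < δ) :
    N * u ≤ δ * N ^ 2 + (δ + (δ ^ 2)⁻¹ * u ^ 3) := by
  obtain ⟨t, rfl⟩ : ∃ t, u = δ * t := ⟨u / δ, by field_simp⟩
  have ht : 0 ≤ t := nonneg_of_mul_nonneg_right hu hδ
  have h : (δ ^ 2)⁻¹ * (δ * t) ^ 3 = δ * t ^ 3 := by field_simp
  have h1 : N * t ≤ N ^ 2 + (1 + t ^ 3) := by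
    nlinarith [mul_nonneg (add_nonneg ht zero_le_one) (sq_nonneg (t - 1)), sq_nonneg (N - t / 2)]
  nlinarith [mul_le_mul_of_nonneg_left h1 hδ.le]

/-- Local sup bound for nonnegative functions with `Δu ≥ -C u`. -/
theorem sup_bound (C : ℝ) (hC : 0 ≤ C) : ∃ K, 0 ≤ K ∧ ∀ (u : E3 → ℝ) (x₀ : E3), (∀ x, 0 ≤ u x) →
    (∀ x ∈ closedBall x₀ 2, ContDiffAt ℝ 2 u x) →
    (∀ x ∈ ball x₀ 1, - C * u x ≤ ∑ i, fderiv ℝ (fun y => fderiv ℝ u y (ek i)) x (ek i)) →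
    ∀ δ, 0 < δ → u x₀ ≤ K * (δ + (δ ^ 2)⁻¹ * ∫ z in ball x₀ 1, u z ^ 3) := by
  let χ : ContDiffBump (0 : E3) := ⟨1 / 4, 1 / 2, by norm_num, by norm_num⟩
  have hχ : χ.rOut = 1 / 2 := rfl
  obtain ⟨Me, hMe0, hMe⟩ := exists_abs_bound (contDiff_errK χ).continuous (hasCompactSupport_errK χ)
  set β : Set E3 := ball 0 1
  set V := volume.real β
  set T := ∫ z in β, (‖z‖ ^ 2)⁻¹
  have hT : 0 ≤ T := integral_nonneg fun z => by positivity
  refine ⟨c0⁻¹ * (Me * (V + 1) + C * (T + V + 1)), by have := c0_pos; positivity,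
    fun u x₀ hu hreg hsub δ hδ => ?_⟩
  let ψ : ContDiffBump x₀ := ⟨1, 2, by norm_num, by norm_num⟩
  have hψt : tsupport ψ = closedBall x₀ 2 := ψ.tsupport_eq
  have hηC : ContDiff ℝ 2 fun x => u x * ψ x :=
    contDiff_mul_cutoff (n := 2) ψ.contDiff fun x hx => hreg x (hψt ▸ hx)
  have hηc : HasCompactSupport fun x => u x * ψ x := ψ.hasCompactSupport.mul_left
  have hη1 : ∀ x ∈ ball x₀ 1, (fun x => u x * ψ x) =ᶠ[𝓝 x] u := fun x hx => by
    filter_upwards [isOpen_ball.mem_nhds hx] with y hy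
    simp [ψ.one_of_mem_closedBall (ball_subset_closedBall hy)]
  have hη0 := (hη1 x₀ (by simp)).self_of_nhds
  have hrep := newton_representation χ hηC hηc x₀
  simp only [] at hη0
  rw [hη0] at hrep
  set η : E3 → ℝ := fun x => u x * ψ x with hη
  have hmem : ∀ z ∈ β, x₀ - z ∈ ball x₀ 1 := fun z hz => by
    simpa [β, dist_eq_norm] using hz
  have hηu : ∀ z ∈ β, η (x₀ - z) = u (x₀ - z) := fun z hz => (hη1 _ (hmem z hz)).self_of_nhds
  have hη3 : Integrable fun z => η (x₀ - z) ^ 3 := by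
    have : Integrable fun z => η z ^ 3 := (hηC.continuous.pow 3).integrable_of_hasCompactSupport
      (hηc.mono fun z hz => ne_zero_pow three_ne_zero hz)
    exact this.comp_sub_left x₀
  have hu3 : IntegrableOn (fun z => u (x₀ - z) ^ 3) β := by
    refine hη3.integrableOn.congr_fun (fun z hz => ?_) measurableSet_ball
    simp only [hηu z hz]
  set I := ∫ z in ball x₀ 1, u z ^ 3
  have hI : ∫ z in β, u (x₀ - z) ^ 3 = I := by
    have h1 : β = (fun z => x₀ - z) ⁻¹' ball x₀ 1 := by ext z; simp [β, dist_eq_norm]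
    have h2 := (Measure.measurePreserving_sub_left (volume : Measure E3) x₀).setIntegral_preimage_emb
      (MeasurableEquiv.subLeft x₀).measurableEmbedding (fun z => u z ^ 3) (ball x₀ 1)
    rwa [← h1] at h2
  have hI0 : 0 ≤ I := integral_nonneg fun z => pow_nonneg (hu z) 3
  have hVc : ∀ c : ℝ, ∫ z in β, c = c * V := fun c => by
    rw [setIntegral_const, smul_eq_mul, mul_comm]
  have hic : ∀ c : ℝ, IntegrableOn (fun _ : E3 => c) β := fun c => integrableOn_const (by
    exact measure_ball_lt_top.ne)
  have hi1 : IntegrableOn (fun z => δ + (δ ^ 2)⁻¹ * u (x₀ - z) ^ 3) β :=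
    (hic δ).add (hu3.const_mul _)
  have hi1v : ∫ z in β, (δ + (δ ^ 2)⁻¹ * u (x₀ - z) ^ 3) = δ * V + (δ ^ 2)⁻¹ * I := by
    rw [integral_add (hic δ) (hu3.const_mul _), integral_const_mul, hI, hVc]
  have hi2 : IntegrableOn (fun z : E3 => δ * (‖z‖ ^ 2)⁻¹) β :=
    (integrableOn_norm_sq_inv 1).const_mul δ
  have b1 : cv (errK χ) η x₀ ≤ Me * (δ * V + (δ ^ 2)⁻¹ * I) := by
    rw [← hi1v, ← integral_const_mul, cv, ← integral_indicator measurableSet_ball]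
    have hint : Integrable fun z => errK χ z * η (x₀ - z) := by
      obtain ⟨M, -, hM⟩ := exists_abs_bound hηC.continuous hηc
      exact integrable_mul_bdd ((contDiff_errK χ).continuous.integrable_of_hasCompactSupport
        (hasCompactSupport_errK χ)) (hηC.continuous.comp (by fun_prop)) fun z => hM _
    refine integral_mono hint ((integrable_indicator_iff measurableSet_ball).2
      (hi1.const_mul Me)) fun z => ?_
    by_cases hz : z ∈ β
    · rw [indicator_of_mem hz]
      change errK χ z * η (x₀ - z) ≤ _
      rw [hηu z hz]
      exact mul_le_mul ((le_abs_self _).trans (hMe z)) (young_cube (hu _) hδ) (hu _) hMe0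
    · rw [indicator_of_notMem hz]
      have : χ.rOut < ‖z‖ := by
        rw [mem_ball_zero_iff, not_lt] at hz; rw [hχ]; linarith
      simp [errK_eq_zero χ this]
  have b2 : - cv (gam χ) (fun y => ∑ i, fderiv ℝ (fun y => fderiv ℝ η y (ek i)) y (ek i)) x₀ ≤
      C * (δ * T + (δ * V + (δ ^ 2)⁻¹ * I)) := by
    have hT' : ∫ z in β, δ * (‖z‖ ^ 2)⁻¹ = δ * T := integral_const_mul _ _
    rw [← hi1v, ← hT', ← integral_add hi2 hi1, ← integral_const_mul, cv, ← integral_neg,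
      ← integral_indicator measurableSet_ball]
    have hcont : Continuous fun y => ∑ i, fderiv ℝ (fun y => fderiv ℝ η y (ek i)) y (ek i) :=
      continuous_finsetSum _ fun i _ => ((((hηC.fderiv_right (m := 1) (by norm_num)).clm_apply
        contDiff_const).continuous_fderiv one_ne_zero).clm_apply continuous_const)
    have hsup : HasCompactSupport fun y => ∑ i, fderiv ℝ (fun y => fderiv ℝ η y (ek i)) y (ek i) := by
      have h i := (hηc.fderiv_apply ℝ (ek i)).fderiv_apply ℝ (ek i)
      simp only [Fin.sum_univ_three]
      exact ((h 0).add (h 1)).add (h 2)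
    obtain ⟨M, -, hM⟩ := exists_abs_bound hcont hsup
    refine integral_mono (integrable_mul_bdd (integrable_gamE χ 0) (hcont.comp
      (continuous_const.sub continuous_id)) fun z => hM _).neg
      ((integrable_indicator_iff measurableSet_ball).2 ((hi2.add hi1).const_mul C)) fun z => ?_
    by_cases hz : z ∈ β
    · rw [indicator_of_mem hz]
      have h1 : ∑ i, fderiv ℝ (fun y => fderiv ℝ η y (ek i)) (x₀ - z) (ek i) =
          ∑ i, fderiv ℝ (fun y => fderiv ℝ u y (ek i)) (x₀ - z) (ek i) := by
        refine Finset.sum_congr rfl fun i _ => ?_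
        have : (fun y => fderiv ℝ η y (ek i)) =ᶠ[𝓝 (x₀ - z)] fun y => fderiv ℝ u y (ek i) := by
          filter_upwards [(hη1 _ (hmem z hz)).eventuallyEq_nhds] with y hy
          rw [hy.fderiv_eq]
        rw [this.fderiv_eq]
      have h2 := hsub _ (hmem z hz)
      rw [← h1] at h2
      set D := ∑ i, fderiv ℝ (fun y => fderiv ℝ η y (ek i)) (x₀ - z) (ek i) with hD
      change -(gam χ z * D) ≤ C * (δ * (‖z‖ ^ 2)⁻¹ + (δ + (δ ^ 2)⁻¹ * u (x₀ - z) ^ 3))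
      have h3 := young_kernel (N := ‖z‖⁻¹) (hu (x₀ - z)) hδ
      rw [inv_pow] at h3
      have h4 : gam χ z * (-D) ≤ gam χ z * (C * u (x₀ - z)) :=
        mul_le_mul_of_nonneg_left (by linarith) (gam_nonneg χ z)
      have h5 : gam χ z * (C * u (x₀ - z)) ≤ ‖z‖⁻¹ * (C * u (x₀ - z)) :=
        mul_le_mul_of_nonneg_right (gam_le χ z) (mul_nonneg hC (hu _))
      have h6 := mul_le_mul_of_nonneg_left h3 hC
      linarith
    · rw [indicator_of_notMem hz]
      have : χ.rOut ≤ ‖z‖ := by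
        rw [mem_ball_zero_iff, not_lt] at hz; rw [hχ]; linarith
      have h0 : gam χ z = 0 := by rw [gam_apply, bump_eq_zero χ this, zero_mul]
      change -(gam χ z * _) ≤ 0
      rw [h0, zero_mul, neg_zero]
  have hV : 0 ≤ V := measureReal_nonneg
  have hδI : 0 ≤ (δ ^ 2)⁻¹ * I := by positivity
  have hfin : c0 * u x₀ ≤ (Me * (V + 1) + C * (T + V + 1)) * (δ + (δ ^ 2)⁻¹ * I) := by
    have e1 : Me * (δ * V + (δ ^ 2)⁻¹ * I) ≤ Me * ((V + 1) * (δ + (δ ^ 2)⁻¹ * I)) := by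
      gcongr; nlinarith
    have e2 : C * (δ * T + (δ * V + (δ ^ 2)⁻¹ * I)) ≤ C * ((T + V + 1) * (δ + (δ ^ 2)⁻¹ * I)) := by
      gcongr; nlinarith [mul_nonneg hT hδI, mul_nonneg hV hδI]
    linarith
  rw [mul_assoc, le_inv_mul_iff₀ c0_pos]
  exact hfin

/-- A fixed smooth bump, equal to `1` on the unit ball and supported in the ball of radius `2`. -/
def bump12 : ContDiffBump (0 : E3) := ⟨1, 2, by norm_num, by norm_num⟩

def cut (R : ℝ) (x : E3) : ℝ := bump12 (R⁻¹ • x)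

lemma contDiff_cut (R : ℝ) {n : ℕ∞} : ContDiff ℝ n (cut R) :=
  bump12.contDiff.comp (contDiff_const_smul R⁻¹)

lemma cut_nonneg (R : ℝ) (x : E3) : 0 ≤ cut R x := bump12.nonneg

lemma cut_le_one (R : ℝ) (x : E3) : cut R x ≤ 1 := bump12.le_one

lemma cut_eq_one {R : ℝ} (hR : 0 < R) {x : E3} (hx : ‖x‖ ≤ R) : cut R x = 1 := by
  refine bump12.one_of_mem_closedBall ?_
  rw [mem_closedBall_zero_iff, norm_smul, norm_inv, Real.norm_of_nonneg hR.le]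
  exact (inv_mul_le_iff₀ hR).2 (by rw [mul_comm]; simpa [bump12] using hx)

lemma cut_eq_zero {R : ℝ} (hR : 0 < R) {x : E3} (hx : 2 * R ≤ ‖x‖) : cut R x = 0 := by
  refine bump_eq_zero bump12 ?_
  rw [norm_smul, norm_inv, Real.norm_of_nonneg hR.le, le_inv_mul_iff₀ hR]
  change R * 2 ≤ _
  linarith

lemma hasCompactSupport_cut {R : ℝ} (hR : 0 < R) : HasCompactSupport (cut R) :=
  hasCompactSupport_of_zero (R := 2 * R) fun _ hx => cut_eq_zero hR hx

lemma fderiv_cut (R : ℝ) (x : E3) : fderiv ℝ (cut R) x = R⁻¹ • fderiv ℝ bump12 (R⁻¹ • x) :=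
  fderiv_comp_smul (𝕜 := ℝ) R⁻¹

lemma exists_fderiv_cut_bound : ∃ C, 0 ≤ C ∧ ∀ R, 0 < R → ∀ x : E3,
    ‖fderiv ℝ (cut R) x‖ * ‖x‖ ≤ C ∧ ‖fderiv ℝ (cut R) x‖ ≤ C * R⁻¹ := by
  obtain ⟨C, hC0, hC⟩ := bump_fderiv_bound bump12
  refine ⟨2 * C, by positivity, fun R hR x => ?_⟩
  have h1 : ‖fderiv ℝ (cut R) x‖ ≤ C * R⁻¹ := by
    rw [fderiv_cut, norm_smul, norm_inv, Real.norm_of_nonneg hR.le, mul_comm]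
    exact mul_le_mul_of_nonneg_right (hC _) (by positivity)
  have hR' : 0 < R⁻¹ := by positivity
  refine ⟨?_, h1.trans (by nlinarith)⟩
  rcases le_or_gt (2 * R) ‖x‖ with h | h
  · have : fderiv ℝ bump12 (R⁻¹ • x) = 0 := by
      refine bump_fderiv_eq_zero bump12 ?_
      rw [norm_smul, norm_inv, Real.norm_of_nonneg hR.le, le_inv_mul_iff₀ hR]
      change R * 2 ≤ _
      linarith
    rw [fderiv_cut, this, smul_zero, norm_zero, zero_mul]; positivity
  · calc ‖fderiv ℝ (cut R) x‖ * ‖x‖ ≤ C * R⁻¹ * (2 * R) := by gcongr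
      _ = 2 * C := by field_simp

lemma fderiv_cut_eq_zero {R : ℝ} (hR : 0 < R) {x : E3} (hx : ‖x‖ < R) : fderiv ℝ (cut R) x = 0 := by
  have : cut R =ᶠ[𝓝 x] fun _ => 1 := by
    filter_upwards [(isOpen_lt continuous_norm continuous_const).mem_nhds hx] with y hy
    exact cut_eq_one hR (le_of_lt hy)
  rw [this.fderiv_eq]; simp

/-- `g ^ 6` is integrable at infinity when `g / |x|` and `∇g` are square integrable. -/
theorem integrableOn_pow_six {g : E3 → ℝ} (hg : ContDiffOn ℝ 1 g OmegaBar)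
    (h1 : IntegrableOn (fun x => ‖fderiv ℝ g x‖ ^ 2) Omega)
    (h2 : IntegrableOn (fun x => g x ^ 2 / ‖x‖ ^ 2) Omega) :
    IntegrableOn (fun x => g x ^ 6) {x | 3 < ‖x‖} := by
  obtain ⟨C, hC0, hcut⟩ := exists_fderiv_cut_bound
  let ψ : ℕ → E3 → ℝ := fun n x => cut (n + 2) x - cut (3 / 2) x
  let w : ℕ → E3 → ℝ := fun n x => g x * ψ n x
  have hn0 : ∀ n : ℕ, (0 : ℝ) < n + 2 := fun n => by positivity
  have hψC : ∀ n, ContDiff ℝ 1 (ψ n) := fun n => (contDiff_cut _).sub (contDiff_cut _)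
  have hψt : ∀ n, ∀ x ∈ tsupport (ψ n), x ∈ Omega := by
    intro n x hx
    have : tsupport (ψ n) ⊆ {x : E3 | 3 / 2 ≤ ‖x‖} := closure_minimal (fun y hy => by
      by_contra hlt
      have hlt : ‖y‖ < 3 / 2 := not_le.1 hlt
      refine hy (sub_eq_zero.2 ?_)
      rw [cut_eq_one (hn0 n) (by linarith [n.cast_nonneg (α := ℝ)]),
        cut_eq_one (by norm_num) hlt.le]) (isClosed_le continuous_const continuous_norm)
    have h3 : 3 / 2 ≤ ‖x‖ := this hx
    change 1 < ‖x‖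
    linarith
  have hwC : ∀ n, ContDiff ℝ 1 (w n) := fun n => contDiff_mul_cutoff (n := 1) (hψC n) fun x hx =>
    contDiffAt_of_regC (n := 1) hg (hψt n x hx)
  have hwc : ∀ n, HasCompactSupport (w n) := fun n =>
    ((hasCompactSupport_cut (hn0 n)).sub (hasCompactSupport_cut (by norm_num))).mul_left
  have hψ1 : ∀ n x, |ψ n x| ≤ 1 := fun n x => abs_sub_le_of_nonneg_of_le
    (cut_nonneg _ _) (cut_le_one _ _) (cut_nonneg _ _) (cut_le_one _ _)
  have hψ2 : ∀ n, ∀ x ∈ Omega, ‖fderiv ℝ (ψ n) x‖ ≤ 2 * C * ‖x‖⁻¹ := by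
    intro n x hx
    rw [← div_eq_mul_inv, le_div_iff₀ (zero_lt_one.trans hx), fderiv_fun_sub
      ((contDiff_cut (n := 1) _).differentiable one_ne_zero x)
      ((contDiff_cut (n := 1) _).differentiable one_ne_zero x)]
    have := norm_sub_le (fderiv ℝ (cut (n + 2)) x) (fderiv ℝ (cut (3 / 2)) x)
    nlinarith [(hcut _ (hn0 n) x).1, (hcut (3 / 2) (by norm_num) x).1, norm_nonneg x]
  set G : E3 → ℝ := fun x => 8 * C ^ 2 * (g x ^ 2 / ‖x‖ ^ 2) + 2 * ‖fderiv ℝ g x‖ ^ 2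
  have hG : Integrable (Omega.indicator G) :=
    IntegrableOn.integrable_indicator ((h2.const_mul _).add (h1.const_mul _))
      Omega_isOpen.measurableSet
  have hG0 : ∀ x, 0 ≤ Omega.indicator G x := fun x => indicator_nonneg (fun x _ => by positivity) x
  have hw2 : ∀ n x, ‖fderiv ℝ (w n) x‖ ≤ √(Omega.indicator G x) := by
    intro n x
    refine Real.le_sqrt_of_sq_le ?_
    by_cases hx : x ∈ Omega
    · rw [indicator_of_mem hx]
      have e1 : DifferentiableAt ℝ g x := (contDiffAt_of_regC (n := 1) hg hx).differentiableAt
        one_ne_zero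
      have e3 : fderiv ℝ (w n) x = g x • fderiv ℝ (ψ n) x + ψ n x • fderiv ℝ g x :=
        fderiv_fun_mul e1 ((hψC n).differentiable one_ne_zero x)
      have f1 : ‖fderiv ℝ (w n) x‖ ≤ |g x| * (2 * C * ‖x‖⁻¹) + ‖fderiv ℝ g x‖ := by
        rw [e3]
        refine (norm_add_le _ _).trans (add_le_add ?_ ?_)
        · rw [norm_smul]; exact mul_le_mul_of_nonneg_left (hψ2 n x hx) (norm_nonneg _)
        · rw [norm_smul]; exact mul_le_of_le_one_left (norm_nonneg _) (hψ1 n x)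
      have f2 : (|g x| * (2 * C * ‖x‖⁻¹)) ^ 2 = 4 * C ^ 2 * (g x ^ 2 / ‖x‖ ^ 2) := by
        rw [mul_pow, sq_abs, mul_pow, inv_pow]; ring
      have f3 := pow_le_pow_left₀ (norm_nonneg _) f1 2
      have f4 := sq_nonneg (|g x| * (2 * C * ‖x‖⁻¹) - ‖fderiv ℝ g x‖)
      simp only [G]
      nlinarith
    · have : w n =ᶠ[𝓝 x] fun _ => 0 := notMem_tsupport_iff_eventuallyEq.1 fun h =>
        hx (hψt n x (closure_mono (Function.support_mul_subset_right _ _) h))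
      rw [indicator_of_notMem hx, this.fderiv_eq]; simp
  have hH : MemLp (fun x => √(Omega.indicator G x)) 2 :=
    (memLp_two_iff_integrable_sq (continuous_sqrt.comp_aestronglyMeasurable hG.1)).2
      (by simpa only [Real.sq_sqrt (hG0 _)] using hG)
  have hm : MeasurableSet {x : E3 | 3 < ‖x‖} :=
    (isOpen_lt continuous_const continuous_norm).measurableSet
  have hlim : ∀ x ∈ {x : E3 | 3 < ‖x‖}, Tendsto (fun n => w n x) atTop (𝓝 (g x)) := by
    intro x (hx : 3 < ‖x‖)
    refine tendsto_const_nhds.congr' ?_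
    filter_upwards [eventually_ge_atTop ⌈‖x‖⌉₊] with n hn
    have e1 : ‖x‖ ≤ n + 2 := ((Nat.le_ceil _).trans (Nat.cast_le.2 hn)).trans (by linarith)
    simp [w, ψ, cut_eq_one (hn0 n) e1, cut_eq_zero (R := 3 / 2) (by norm_num) (x := x) (by linarith)]
  have hsub : {x : E3 | 3 < ‖x‖} ⊆ OmegaBar := fun x (hx : 3 < ‖x‖) => by
    change 1 ≤ ‖x‖; linarith
  have hL : MemLp g 6 (volume.restrict {x : E3 | 3 < ‖x‖}) := by
    refine ⟨(hg.continuousOn.mono hsub).aestronglyMeasurable hm,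
      (Lp.eLpNorm_lim_le_liminf_eLpNorm (fun n => (hwC n).continuous.aestronglyMeasurable) g
        ((ae_restrict_iff' hm).2 (Eventually.of_forall hlim))).trans_lt ?_⟩
    refine (liminf_le_of_le (by isBoundedDefault) fun b hb => ?_).trans_lt
      (ENNReal.mul_lt_top (ENNReal.coe_lt_top
        (r := SNormLESNormFDerivOfEqConst ℝ (volume : Measure E3) 2)) hH.2)
    obtain ⟨n, hn⟩ := hb.exists
    refine hn.trans ((eLpNorm_restrict_le _ _ _ _).trans ((eLpNorm_le_eLpNorm_fderiv_of_eq
      (F := ℝ) volume (p := 2) (p' := 6) (hwC n) (hwc n) (by norm_num)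
      (by rw [finrank_E3]; norm_num) (by rw [finrank_E3]; norm_num)).trans ?_))
    exact mul_le_mul' le_rfl (eLpNorm_mono_real (hw2 n))
  have := hL.integrable_norm_pow (p := 6) (by norm_num)
  simpa only [IntegrableOn, Real.norm_eq_abs, Even.pow_abs (show Even 6 by decide)] using this

/-- Frobenius inner product. -/
def fr (A B : Mat3) : ℝ := ∑ i, ∑ j, A i j * B i j

lemma trace_mul_eq_fr (A B : Mat3) : (A * B).trace = fr A B.transpose := by
  simp [Matrix.trace, Matrix.mul_apply, fr]

lemma fr_self_nonneg (A : Mat3) : 0 ≤ fr A A :=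
  Finset.sum_nonneg fun _ _ => Finset.sum_nonneg fun _ _ => mul_self_nonneg _

lemma fr_comm (A B : Mat3) : fr A B = fr B A := by simp [fr, mul_comm]

lemma fr_add_left (A B D : Mat3) : fr (A + B) D = fr A D + fr B D := by
  simp [fr, add_mul, Finset.sum_add_distrib]

lemma fr_sub_left (A B D : Mat3) : fr (A - B) D = fr A D - fr B D := by
  simp [fr, sub_mul, Finset.sum_sub_distrib]

lemma fr_smul_left (t : ℝ) (A D : Mat3) : fr (t • A) D = t * fr A D := by
  simp [fr, mul_assoc, Finset.mul_sum]

lemma fr_add_right (A B D : Mat3) : fr D (A + B) = fr D A + fr D B := by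
  simp [fr, mul_add, Finset.sum_add_distrib]

lemma fr_sub_right (A B D : Mat3) : fr D (A - B) = fr D A - fr D B := by
  simp [fr, mul_sub, Finset.sum_sub_distrib]

lemma fr_smul_right (t : ℝ) (A D : Mat3) : fr D (t • A) = t * fr D A := by
  rw [fr_comm, fr_smul_left, fr_comm]

lemma fr_one_right (A : Mat3) : fr A 1 = A.trace := by
  rw [← Matrix.transpose_one, ← trace_mul_eq_fr, mul_one]

lemma mnormSq_eq_fr {A : Mat3} (hA : A.IsSymm) : mnormSq A = fr A A := by
  rw [mnormSq, trace_mul_eq_fr, hA.eq]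

lemma sum_prod_eq (F : Fin 3 → Fin 3 → ℝ) : ∑ i, ∑ j, F i j = ∑ p : Fin 3 × Fin 3, F p.1 p.2 :=
  (Fintype.sum_prod_type' F).symm

lemma fr_sq_le (A B : Mat3) : fr A B ^ 2 ≤ fr A A * fr B B := by
  simp only [fr, sum_prod_eq]
  simpa only [← sq] using Finset.sum_mul_sq_le_sq_mul_sq Finset.univ
    (fun p : Fin 3 × Fin 3 => A p.1 p.2) fun p => B p.1 p.2

lemma fr_mul_le (A B : Mat3) : fr (A * B) (A * B) ≤ fr A A * fr B B := by
  have h : ∀ i j, (A * B) i j * (A * B) i j ≤ (∑ k, A i k ^ 2) * ∑ k, B k j ^ 2 := fun i j => by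
    rw [Matrix.mul_apply, ← sq]
    exact Finset.sum_mul_sq_le_sq_mul_sq _ _ _
  calc fr (A * B) (A * B) ≤ ∑ i, ∑ j, (∑ k, A i k ^ 2) * ∑ k, B k j ^ 2 :=
        Finset.sum_le_sum fun i _ => Finset.sum_le_sum fun j _ => h i j
    _ = fr A A * fr B B := by
        simp only [← Finset.mul_sum, ← Finset.sum_mul]
        rw [Finset.sum_comm (f := fun i j => B j i ^ 2)]
        simp [fr, sq]

lemma abs_fr_le {A B : Mat3} {α β : ℝ} (hα : 0 ≤ α) (hβ : 0 ≤ β) (hA : fr A A ≤ α ^ 2)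
    (hB : fr B B ≤ β ^ 2) : |fr A B| ≤ α * β := by
  refine abs_le_of_sq_le_sq ?_ (by positivity)
  rw [mul_pow]
  exact (fr_sq_le A B).trans (mul_le_mul hA hB (fr_self_nonneg _) (by positivity))

lemma sstar_eq {a b c : ℝ} (ha : 0 ≤ a) (hc : 0 < c) :
    2 * c * sstar a b c ^ 2 = b * sstar a b c + 3 * a := by
  have h1 : Real.sqrt (b ^ 2 + 24 * a * c) ^ 2 = b ^ 2 + 24 * a * c := Real.sq_sqrt (by positivity)
  rw [sstar]
  generalize Real.sqrt (b ^ 2 + 24 * a * c) = r at h1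
  field_simp
  linear_combination 2 * h1

lemma sstar_pos {a b c : ℝ} (hb : 0 < b) (hc : 0 < c) : 0 < sstar a b c := by
  have := Real.sqrt_nonneg (b ^ 2 + 24 * a * c)
  rw [sstar]; positivity

lemma Qinf_eq (a b c : ℝ) : Qinf a b c =
    sstar a b c • Matrix.diagonal ![-1 / 3, -1 / 3, 2 / 3] := by
  rw [Qinf]
  congr 1
  ext i j
  fin_cases i <;> fin_cases j <;> norm_num [outer, ez, Matrix.diagonal, Fin.ext_iff]

lemma isS0_Qinf (a b c : ℝ) : isS0 (Qinf a b c) := by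
  rw [Qinf_eq]
  refine ⟨?_, ?_⟩
  · rw [Matrix.IsSymm, Matrix.transpose_smul, Matrix.diagonal_transpose]
  · rw [Matrix.trace_smul, Matrix.trace_diagonal]
    simp [Fin.sum_univ_three]; norm_num

lemma fr_Qinf (a b c : ℝ) : fr (Qinf a b c) (Qinf a b c) = 2 / 3 * sstar a b c ^ 2 := by
  rw [Qinf_eq, fr_smul_left, fr_smul_right]
  simp [fr, Fin.sum_univ_three, Matrix.diagonal]
  ring

lemma gradf_Qinf {a b c : ℝ} (ha : 0 ≤ a) (hc : 0 < c) : gradf a b c (Qinf a b c) = 0 := by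
  have h := sstar_eq (b := b) ha hc
  have h1 : mnormSq (Qinf a b c) = 2 / 3 * sstar a b c ^ 2 := by
    rw [mnormSq_eq_fr (isS0_Qinf a b c).1, fr_Qinf]
  rw [gradf, h1, Qinf_eq]
  set s := sstar a b c
  ext i j
  fin_cases i <;> fin_cases j <;>
    simp [Matrix.diagonal, Matrix.mul_apply] <;> grind

/-- Monotonicity-type lower bound for the bulk gradient around an equilibrium. -/
lemma exists_gradf_lower {a b c : ℝ} (ha : 0 ≤ a) (hb : 0 < b) (hc : 0 < c) :
    ∃ C, 0 ≤ C ∧ ∀ Q, isS0 Q → -C * fr (Q - Qinf a b c) (Q - Qinf a b c) ≤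
      fr (Q - Qinf a b c) (gradf a b c Q) := by
  set R := Qinf a b c with hR
  have hRS := isS0_Qinf a b c
  obtain ⟨ρ, hρ0, hρ⟩ : ∃ ρ, 0 ≤ ρ ∧ fr R R = ρ ^ 2 := 
    ⟨√(fr R R), Real.sqrt_nonneg _, (Real.sq_sqrt (fr_self_nonneg _)).symm⟩
  refine ⟨a + 2 * b * ρ + b ^ 2 / (2 * c) + 3 * c * ρ ^ 2, by positivity, fun Q hQ => ?_⟩
  set P := Q - R with hP
  have hQP : Q = R + P := by rw [hP]; abel
  have hPS : P.IsSymm := hQ.1.sub hRS.1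
  have hPt : fr P 1 = 0 := by
    rw [fr_one_right, hP, Matrix.trace_sub, hQ.2, hRS.2, sub_zero]
  obtain ⟨p, hp0, hp⟩ : ∃ p, 0 ≤ p ∧ fr P P = p ^ 2 := 
    ⟨√(fr P P), Real.sqrt_nonneg _, (Real.sq_sqrt (fr_self_nonneg _)).symm⟩
  have h0 : fr P (gradf a b c R) = 0 := by
    rw [hR, gradf_Qinf ha hc]; simp [fr]
  set t := fr P R with ht
  have hPP : fr (P * P) (P * P) ≤ (p ^ 2) ^ 2 := by
    have := fr_mul_le P P
    rw [hp] at this; linarith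
  have h1 : |fr P (P * P)| ≤ p * p ^ 2 := abs_fr_le hp0 (by positivity) hp.le hPP
  have h2 : |fr R (P * P)| ≤ ρ * p ^ 2 := abs_fr_le hρ0 (by positivity) hρ.le hPP
  have h3 : |t| ≤ p * ρ := abs_fr_le hp0 hρ0 hp.le hρ.le
  have s1 := hPS.apply 0 1
  have s2 := hPS.apply 0 2
  have s3 := hPS.apply 1 2
  have e1 : fr P (R * P) = fr R (P * P) := by
    simp only [fr, Matrix.mul_apply, Fin.sum_univ_three, s1, s2, s3]; ring
  have e2 : fr P (P * R) = fr R (P * P) := by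
    simp only [fr, Matrix.mul_apply, Fin.sum_univ_three, s1, s2, s3]; ring
  have hmQ : mnormSq Q = ρ ^ 2 + 2 * t + p ^ 2 := by
    rw [mnormSq_eq_fr hQ.1, hQP, fr_add_left, fr_add_right, fr_add_right, hρ, hp, fr_comm R P]
    ring
  have hmR : mnormSq R = ρ ^ 2 := by rw [mnormSq_eq_fr hRS.1, hρ]
  have key : fr P (gradf a b c Q) = -a * p ^ 2 - b * (2 * fr R (P * P) + fr P (P * P)) +
      c * (ρ ^ 2 * p ^ 2 + 2 * t ^ 2 + 3 * t * p ^ 2 + p ^ 4) := by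
    have e3 : fr P (gradf a b c Q) = -a * (t + p ^ 2) - b * (fr P (R * R) + 2 * fr R (P * P) +
        fr P (P * P)) + c * (ρ ^ 2 + 2 * t + p ^ 2) * (t + p ^ 2) := by
      rw [gradf, hmQ]
      nth_rw 1 2 3 4 [hQP]
      simp only [fr_add_right, fr_sub_right, fr_smul_right, hPt, add_mul, mul_add, e1, e2, hp, ← ht]
      ring
    have e4 : 0 = -a * t - b * fr P (R * R) + c * ρ ^ 2 * t := by
      rw [← h0, gradf, hmR]
      simp only [fr_add_right, fr_sub_right, fr_smul_right, hPt, ← ht]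
      ring
    rw [e3]; linear_combination -e4
  rw [key, hp]
  have g1 := abs_le.1 h1
  have g2 := abs_le.1 h2
  have g3 : t ^ 2 ≤ ρ ^ 2 * p ^ 2 := by
    have := sq_le_sq' (abs_le.1 h3).1 (abs_le.1 h3).2
    nlinarith
  have g4 : b * (p * p ^ 2) ≤ b ^ 2 / (2 * c) * p ^ 2 + c / 2 * p ^ 4 := by
    have : b ^ 2 / (2 * c) * p ^ 2 + c / 2 * p ^ 4 - b * (p * p ^ 2) =
        p ^ 2 * (b - c * p) ^ 2 / (2 * c) := by field_simp; ring
    have : 0 ≤ p ^ 2 * (b - c * p) ^ 2 / (2 * c) := by positivity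
    linarith
  have g5 : 0 ≤ c * (p ^ 4 / 2 + 3 * t * p ^ 2 + 9 / 2 * t ^ 2) := by
    have : p ^ 4 / 2 + 3 * t * p ^ 2 + 9 / 2 * t ^ 2 = (p ^ 2 + 3 * t) ^ 2 / 2 := by ring
    rw [this]; positivity
  have g6 := mul_le_mul_of_nonneg_left g3 hc.le
  have g7 := mul_le_mul_of_nonneg_left g2.2 hb.le
  have g8 := mul_le_mul_of_nonneg_left g1.2 hb.le
  nlinarith [mul_nonneg hc.le (sq_nonneg (ρ * p))]

lemma norm_sq_le_sum (A : E3 →L[ℝ] ℝ) : ‖A‖ ^ 2 ≤ ∑ k, A (ek k) ^ 2 := by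
  have h : ‖A‖ ≤ √(∑ k, A (ek k) ^ 2) := by
    refine A.opNorm_le_bound (Real.sqrt_nonneg _) fun z => ?_
    rw [clm_eq_sum A z, Real.norm_eq_abs, EuclideanSpace.norm_eq, mul_comm]
    refine abs_le_of_sq_le_sq ?_ (by positivity)
    rw [mul_pow, Real.sq_sqrt (Finset.sum_nonneg fun _ _ => by positivity),
      Real.sq_sqrt (Finset.sum_nonneg fun _ _ => by positivity)]
    simpa using Finset.sum_mul_sq_le_sq_mul_sq Finset.univ (fun i => z i) fun i => A (ek i)
  calc ‖A‖ ^ 2 ≤ √(∑ k, A (ek k) ^ 2) ^ 2 := by gcongr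
    _ = _ := Real.sq_sqrt (Finset.sum_nonneg fun _ _ => by positivity)

lemma Omega_subset : Omega ⊆ OmegaBar := fun _ hx => (show 1 < ‖_‖ from hx).le

lemma measurableSet_Omega : MeasurableSet Omega := Omega_isOpen.measurableSet

lemma continuousOn_pd {g : E3 → ℝ} (hg : ContDiffOn ℝ 1 g OmegaBar) (k : Fin 3) :
    ContinuousOn (pd g k) Omega := by
  have : ContinuousOn (fun x => fderiv ℝ g x (ek k)) Omega :=
    ((hg.mono Omega_subset).continuousOn_fderiv_of_isOpen Omega_isOpen le_rfl).clm_apply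
      continuousOn_const
  exact this.congr fun x hx => pd_eq hx k

lemma sq_entry_le (A : Mat3) (i j : Fin 3) : A i j ^ 2 ≤ fr A A := by
  rw [fr, sum_prod_eq, sq]
  exact Finset.single_le_sum (f := fun p : Fin 3 × Fin 3 => A p.1 p.2 * A p.1 p.2)
    (fun p _ => mul_self_nonneg _) (Finset.mem_univ (i, j))

lemma sq_pd_le_gradSq (Q : E3 → Mat3) (x : E3) (i j k : Fin 3) :
    pd (fun y => Q y i j) k x ^ 2 ≤ gradSq Q x := by
  have h1 : pd (fun y => Q y i j) k x ^ 2 ≤ ∑ k, pd (fun y => Q y i j) k x ^ 2 :=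
    Finset.single_le_sum (f := fun k => pd (fun y => Q y i j) k x ^ 2)
      (fun _ _ => sq_nonneg _) (Finset.mem_univ k)
  refine h1.trans ?_
  rw [gradSq, sum_prod_eq]
  exact Finset.single_le_sum (f := fun p : Fin 3 × Fin 3 => ∑ k, pd (fun y => Q y p.1 p.2) k x ^ 2)
    (fun p _ => Finset.sum_nonneg fun _ _ => sq_nonneg _) (Finset.mem_univ (i, j))

section
variable {a b c : ℝ} {Q : E3 → Mat3}

lemma memH.mnormSq_eq (h : memH a b c Q) {x : E3} (hx : x ∈ OmegaBar) :
    mnormSq (Q x - Qinf a b c) = fr (Q x - Qinf a b c) (Q x - Qinf a b c) :=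
  mnormSq_eq_fr ((h.1 x hx).1.sub (isS0_Qinf a b c).1)

lemma memH.integrable_pd_sq (hr : RegC 1 Q) (h : memH a b c Q) (i j k : Fin 3) :
    IntegrableOn (fun x => pd (fun y => Q y i j) k x ^ 2) Omega := by
  refine h.2.1.mono' (((continuousOn_pd (hr i j) k).pow 2).aestronglyMeasurable
    measurableSet_Omega) (Eventually.of_forall fun x => ?_)
  rw [Real.norm_of_nonneg (sq_nonneg _)]
  exact sq_pd_le_gradSq Q x i j k

lemma memH.integrable_entry (hr : RegC 1 Q) (h : memH a b c Q) (i j : Fin 3) :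
    IntegrableOn (fun x => (Q x i j - Qinf a b c i j) ^ 2 / ‖x‖ ^ 2) Omega := by
  refine h.2.2.mono' (ContinuousOn.aestronglyMeasurable ?_ measurableSet_Omega) ?_
  · refine ContinuousOn.div ?_ (by fun_prop) fun x hx => ?_
    · exact (((hr i j).continuousOn.mono Omega_subset).sub continuousOn_const).pow 2
    · have : 1 < ‖x‖ := hx
      positivity
  · filter_upwards [ae_restrict_mem measurableSet_Omega] with x hx
    rw [Real.norm_of_nonneg (by positivity), h.mnormSq_eq (Omega_subset hx)]
    gcongr
    exact sq_entry_le (Q x - Qinf a b c) i j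

lemma RegC.mono {m n : ℕ} (hr : RegC n Q) (hmn : m ≤ n) : RegC m Q := fun i j =>
  (hr i j).of_le (by exact_mod_cast hmn)

lemma memH.integrable_norm_fderiv_sq (hr : RegC 1 Q) (h : memH a b c Q)
    (i j : Fin 3) :
    IntegrableOn (fun x => ‖fderiv ℝ (fun y => Q y i j - Qinf a b c i j) x‖ ^ 2) Omega := by
  have h1 : IntegrableOn (fun x => ∑ k, pd (fun y => Q y i j) k x ^ 2) Omega :=
    integrable_finsetSum _ fun k _ => h.integrable_pd_sq hr i j k
  have h2 : ∀ x ∈ Omega, ∀ k, fderiv ℝ (fun y => Q y i j - Qinf a b c i j) x (ek k) =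
      pd (fun y => Q y i j) k x := fun x hx k => by
    rw [pd_eq hx, fderiv_sub_const]
  refine h1.mono' ?_ ?_
  · refine ContinuousOn.aestronglyMeasurable ?_ measurableSet_Omega
    exact (((((hr i j).sub contDiffOn_const).mono Omega_subset).continuousOn_fderiv_of_isOpen
      Omega_isOpen le_rfl).norm).pow 2
  · filter_upwards [ae_restrict_mem measurableSet_Omega] with x hx
    rw [Real.norm_of_nonneg (by positivity)]
    refine (norm_sq_le_sum _).trans_eq (Finset.sum_congr rfl fun k _ => by rw [h2 x hx k])

lemma memH.integrable_pow_six (hr : RegC 1 Q) (h : memH a b c Q) (i j : Fin 3) :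
    IntegrableOn (fun x => (Q x i j - Qinf a b c i j) ^ 6) {x | 3 < ‖x‖} :=
  integrableOn_pow_six ((hr i j).sub contDiffOn_const) (h.integrable_norm_fderiv_sq hr i j)
    (h.integrable_entry hr i j)

end

/-- Second derivative of a square along a coordinate direction. -/
lemma fderiv_fderiv_sq {g : E3 → ℝ} {x : E3} (hg : ContDiffAt ℝ 2 g x) (v : E3) :
    fderiv ℝ (fun y => fderiv ℝ (fun z => g z ^ 2) y v) x v =
      2 * fderiv ℝ g x v ^ 2 + 2 * g x * fderiv ℝ (fun y => fderiv ℝ g y v) x v := by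
  have h1 : ∀ᶠ y in 𝓝 x, ContDiffAt ℝ 2 g y := hg.eventually (by simp)
  have h2 : (fun y => fderiv ℝ (fun z => g z ^ 2) y v) =ᶠ[𝓝 x] fun y => 2 * g y * fderiv ℝ g y v := by
    filter_upwards [h1] with y hy
    have := (hy.differentiableAt (by norm_num)).hasFDerivAt.pow 2
    rw [this.fderiv]
    simp
  have h3 : DifferentiableAt ℝ (fun y => fderiv ℝ g y v) x :=
    (((hg.fderiv_right (m := 1) (by norm_num)).clm_apply contDiffAt_const).differentiableAt
      one_ne_zero)
  have h4 := (((hg.differentiableAt (by norm_num)).hasFDerivAt.const_mul 2).mul h3.hasFDerivAt)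
  rw [h2.fderiv_eq]
  have h5 : fderiv ℝ (fun y => 2 * g y * fderiv ℝ g y v) x = _ := h4.fderiv
  rw [h5]
  simp
  ring

lemma fderiv_fderiv_sum {ι : Type*} [Fintype ι] {g : ι → E3 → ℝ} {x : E3}
    (hg : ∀ i, ContDiffAt ℝ 2 (g i) x) (v : E3) :
    fderiv ℝ (fun y => fderiv ℝ (fun z => ∑ i, g i z) y v) x v =
      ∑ i, fderiv ℝ (fun y => fderiv ℝ (g i) y v) x v := by
  have h : (fun y => fderiv ℝ (fun z => ∑ i, g i z) y v) =ᶠ[𝓝 x] fun y => ∑ i, fderiv ℝ (g i) y v := by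
    filter_upwards [eventually_all.2 fun i => (hg i).eventually (by simp)] with y hy
    rw [fderiv_fun_sum fun i _ => (hy i).differentiableAt two_ne_zero, _root_.sum_apply]
  rw [h.fderiv_eq, fderiv_fun_sum fun i _ => (((hg i).fderiv_right (m := 1) le_rfl).clm_apply
    contDiffAt_const).differentiableAt one_ne_zero, _root_.sum_apply]

theorem farfield {a b c L : ℝ} (ha : 0 ≤ a) (hb : 0 < b) (hc : 0 < c) (hL : 0 < L)
    {Q : E3 → Mat3} (hr : RegC 2 Q) (hQ : memH a b c Q) (hEL : isEL a b c L Q) {ε : ℝ}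
    (hε : 0 < ε) : ∃ R : ℝ, ∀ x : E3, R ≤ ‖x‖ → mnorm (Q x - Qinf a b c) ≤ ε := by
  obtain ⟨C, hC0, hC⟩ := exists_gradf_lower ha hb hc
  obtain ⟨K, hK0, hK⟩ := sup_bound (2 * (L⁻¹ * C)) (by positivity)
  set P : Fin 3 → Fin 3 → E3 → ℝ := fun i j x => Q x i j - Qinf a b c i j with hP
  set u : E3 → ℝ := fun x => ∑ i, ∑ j, P i j x ^ 2 with hu
  have hu0 : ∀ x, 0 ≤ u x := fun x => Finset.sum_nonneg fun _ _ => Finset.sum_nonneg fun _ _ =>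
    sq_nonneg _
  have hufr : ∀ x, u x = fr (Q x - Qinf a b c) (Q x - Qinf a b c) := fun x => by
    simp [hu, fr, hP, sq]
  have hPC : ∀ x ∈ Omega, ∀ i j, ContDiffAt ℝ 2 (P i j) x := fun x hx i j =>
    (contDiffAt_of_regC (hr i j) hx).sub contDiffAt_const
  have huC : ∀ x ∈ Omega, ContDiffAt ℝ 2 u x := fun x hx =>
    ContDiffAt.sum fun i _ => ContDiffAt.sum fun j _ => (hPC x hx i j).pow 2
  have hlapu : ∀ x ∈ Omega, -(2 * (L⁻¹ * C)) * u x ≤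
      ∑ k, fderiv ℝ (fun y => fderiv ℝ u y (ek k)) x (ek k) := by
    intro x hx
    have e1 : ∀ k, fderiv ℝ (fun y => fderiv ℝ u y (ek k)) x (ek k) = ∑ i, ∑ j,
        fderiv ℝ (fun y => fderiv ℝ (fun z => P i j z ^ 2) y (ek k)) x (ek k) := by
      intro k
      have d : ∀ i j, ContDiffAt ℝ 2 (fun z => P i j z ^ 2) x := fun i j => (hPC x hx i j).pow 2
      rw [hu, fderiv_fderiv_sum fun i => ContDiffAt.sum fun j _ => d i j]
      exact Finset.sum_congr rfl fun i _ => fderiv_fderiv_sum (d i) _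
    have e2 : ∀ i j, 2 * P i j x * (L⁻¹ * gradf a b c (Q x) i j) ≤ ∑ k,
        fderiv ℝ (fun y => fderiv ℝ (fun z => P i j z ^ 2) y (ek k)) x (ek k) := by
      intro i j
      have f1 : lap3 (fun y => Q y i j) x =
          ∑ k, fderiv ℝ (fun y => fderiv ℝ (P i j) y (ek k)) x (ek k) := by
        rw [lap3_eq hx]
        simp only [hP, fderiv_sub_const]
      have f2 : L⁻¹ * gradf a b c (Q x) i j = lap3 (fun y => Q y i j) x := by
        rw [← hEL x hx]
        simp [matLap, hL.ne']
      rw [f2, f1, Finset.mul_sum]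
      refine Finset.sum_le_sum fun k _ => ?_
      rw [fderiv_fderiv_sq (hPC x hx i j)]
      have := sq_nonneg (fderiv ℝ (P i j) x (ek k))
      linarith
    calc -(2 * (L⁻¹ * C)) * u x = 2 * L⁻¹ * (-C * u x) := by ring
      _ ≤ 2 * L⁻¹ * fr (Q x - Qinf a b c) (gradf a b c (Q x)) := by
          rw [hufr]
          exact mul_le_mul_of_nonneg_left (hC _ (hQ.1 x (Omega_subset hx))) (by positivity)
      _ = ∑ i, ∑ j, 2 * P i j x * (L⁻¹ * gradf a b c (Q x) i j) := by
          simp only [fr, Finset.mul_sum]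
          refine Finset.sum_congr rfl fun i _ => Finset.sum_congr rfl fun j _ => ?_
          simp only [hP, Matrix.sub_apply]; ring
      _ ≤ ∑ i, ∑ j, ∑ k, fderiv ℝ (fun y => fderiv ℝ (fun z => P i j z ^ 2) y (ek k)) x (ek k) :=
          Finset.sum_le_sum fun i _ => Finset.sum_le_sum fun j _ => e2 i j
      _ = _ := by
          simp only [e1]
          rw [Finset.sum_congr rfl fun i _ => Finset.sum_comm, Finset.sum_comm]
  have hmeas : ∀ t : ℝ, MeasurableSet {x : E3 | t < ‖x‖} := fun t =>
    (isOpen_lt continuous_const continuous_norm).measurableSet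
  have hcube : ∀ x, u x ^ 3 ≤ 81 * ∑ i, ∑ j, P i j x ^ 6 := by
    intro x
    have := pow_sum_div_card_le_sum_pow (s := Finset.univ) (n := 2)
      (f := fun p : Fin 3 × Fin 3 => P p.1 p.2 x ^ 2) fun p _ => sq_nonneg _
    rw [div_le_iff₀ (by simp)] at this
    simp only [hu, sum_prod_eq]
    refine this.trans_eq ?_
    simp only [← pow_mul]
    norm_num
    ring
  have hu3 : IntegrableOn (fun x => u x ^ 3) {x | 3 < ‖x‖} := by
    have h6 : IntegrableOn (fun x => 81 * ∑ i, ∑ j, P i j x ^ 6) {x | 3 < ‖x‖} :=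
      Integrable.const_mul (integrable_finsetSum _ fun i _ => integrable_finsetSum _ fun j _ =>
        hQ.integrable_pow_six (hr.mono (by norm_num)) i j) 81
    refine h6.mono' ?_ (Eventually.of_forall fun x => ?_)
    · refine ContinuousOn.aestronglyMeasurable (fun x hx => ?_) (hmeas 3)
      have hx' : x ∈ Omega := by
        have : 3 < ‖x‖ := hx
        change 1 < ‖x‖; linarith
      exact ((huC x hx').continuousAt.pow 3).continuousWithinAt
    · rw [Real.norm_of_nonneg (pow_nonneg (hu0 x) 3)]
      exact hcube x
  have htail : Tendsto (fun n : ℕ => ∫ x in {x : E3 | (n : ℝ) < ‖x‖}, u x ^ 3) atTop (𝓝 0) := by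
    have := tendsto_setIntegral_of_antitone (μ := (volume : Measure E3)) (f := fun x => u x ^ 3)
      (s := fun n : ℕ => {x : E3 | (n : ℝ) < ‖x‖}) (fun n => hmeas n)
      (fun m n hmn x hx => lt_of_le_of_lt (Nat.cast_le.2 hmn) (show (n : ℝ) < ‖x‖ from hx))
      ⟨3, by simpa using hu3⟩
    have h0 : ⋂ n : ℕ, {x : E3 | (n : ℝ) < ‖x‖} = ∅ := by
      refine eq_empty_of_forall_notMem fun x hx => ?_
      obtain ⟨n, hn⟩ := exists_nat_ge ‖x‖
      exact absurd (mem_iInter.1 hx n) (not_lt.2 hn)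
    rwa [h0, setIntegral_empty] at this
  set δ := ε ^ 2 / (2 * (K + 1)) with hδ
  have hδ0 : 0 < δ := by positivity
  obtain ⟨n, hn⟩ := ((htail.eventually (gt_mem_nhds (show (0 : ℝ) < δ ^ 3 by positivity))).and
    (eventually_ge_atTop 3)).exists
  refine ⟨n + 4, fun x hx => ?_⟩
  have hn2 : (3 : ℝ) ≤ n := by exact_mod_cast hn.2
  have hball : ∀ r : ℝ, r ≤ 2 → ∀ y ∈ closedBall x r, (n : ℝ) + 2 ≤ ‖y‖ := fun r hr2 y hy => by
    rw [mem_closedBall, dist_comm, dist_eq_norm] at hy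
    have := norm_sub_norm_le x y
    linarith
  have h1 := hK u x hu0 (fun y hy => huC y (by
    have := hball 2 le_rfl y hy
    change 1 < ‖y‖; linarith)) (fun y hy => hlapu y (by
    have := hball 1 (by norm_num) y (ball_subset_closedBall hy)
    change 1 < ‖y‖; linarith)) δ hδ0
  have h2 : ∫ z in ball x 1, u z ^ 3 ≤ δ ^ 3 := by
    refine (setIntegral_mono_set ?_ ?_ ?_).trans hn.1.le
    · exact hu3.mono_set fun y hy => lt_of_le_of_lt hn2 hy
    · exact Eventually.of_forall fun y => pow_nonneg (hu0 y) 3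
    · refine Eventually.of_forall fun y hy => ?_
      have := hball 1 (by norm_num) y (ball_subset_closedBall hy)
      change (n : ℝ) < ‖y‖; linarith
  have h3 : (δ ^ 2)⁻¹ * ∫ z in ball x 1, u z ^ 3 ≤ δ := by
    rw [inv_mul_le_iff₀ (by positivity)]
    linarith [h2, show δ ^ 2 * δ = δ ^ 3 by ring]
  have h4 : u x ≤ ε ^ 2 := by
    calc u x ≤ K * (δ + δ) := h1.trans (mul_le_mul_of_nonneg_left (by linarith) hK0)
      _ ≤ (K + 1) * (δ + δ) := by nlinarith
      _ = ε ^ 2 := by rw [hδ]; field_simp; ring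
  have hxB : x ∈ OmegaBar := by change 1 ≤ ‖x‖; linarith
  rw [mnorm, hQ.mnormSq_eq hxB, ← hufr]
  exact Real.sqrt_le_iff.2 ⟨hε.le, h4⟩

/-- Two finite measures, carried by a set `S` and giving the same mass to all balls of a given
radius centred in `S`, are proportional. -/
theorem eq_smul_of_closedBall (μ ν : Measure E3) [IsFiniteMeasure μ] [IsFiniteMeasure ν]
    {S : Set E3} {x₀ : E3} (h₀ : x₀ ∈ S) (hμS : ∀ᵐ x ∂μ, x ∈ S) (hνS : ∀ᵐ x ∂ν, x ∈ S)
    (hμ : ∀ x ∈ S, ∀ y ∈ S, ∀ r, μ (closedBall x r) = μ (closedBall y r))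
    (hν : ∀ x ∈ S, ∀ y ∈ S, ∀ r, ν (closedBall x r) = ν (closedBall y r))
    (hpos : ∀ r > 0, μ (closedBall x₀ r) ≠ 0) : ∃ κ : ℝ≥0, ν = κ • μ := by
  have hμ0 : μ univ ≠ 0 := fun h => hpos 1 one_pos (measure_mono_null (subset_univ _) h)
  have hprod : ∀ x ∈ S, ∀ r, ν (closedBall x r) * μ univ = ν univ * μ (closedBall x r) := by
    intro x hx r
    have hm : MeasurableSet {p : E3 × E3 | dist p.1 p.2 ≤ r} :=
      (isClosed_le continuous_dist continuous_const).measurableSet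
    have e1 : ∀ᵐ y ∂μ, ν (Prod.mk y ⁻¹' {p : E3 × E3 | dist p.1 p.2 ≤ r})
        = ν (closedBall x r) := by
      filter_upwards [hμS] with y hy
      rw [← hν y hy x hx r]
      congr 1; ext z; simp [dist_comm]
    have e2 : ∀ᵐ y ∂ν, μ ((·, y) ⁻¹' {p : E3 × E3 | dist p.1 p.2 ≤ r}) = μ (closedBall x r) := by
      filter_upwards [hνS] with y hy using hμ y hy x hx r
    have := Measure.prod_apply (μ := μ) (ν := ν) hm
    rw [Measure.prod_apply_symm hm, lintegral_congr_ae e1, lintegral_congr_ae e2,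
      lintegral_const, lintegral_const] at this
    rw [← this, mul_comm]
  obtain ⟨κ, hκ⟩ : ∃ κ : ℝ≥0, ν univ / μ univ = κ :=
    ⟨_, (ENNReal.coe_toNNReal (ENNReal.div_ne_top (measure_ne_top _ _) hμ0)).symm⟩
  have hrn : ν.rnDeriv μ =ᵐ[μ] fun _ => (κ : ℝ≥0∞) := by
    filter_upwards [Besicovitch.ae_tendsto_rnDeriv ν μ, hμS] with x hx hxS
    refine tendsto_nhds_unique (hx.congr' ?_) tendsto_const_nhds
    filter_upwards [self_mem_nhdsWithin] with r hr
    have := hpos r hr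
    rw [hμ x₀ h₀ x hxS] at this
    rw [← hκ, ENNReal.div_eq_div_iff hμ0 (measure_ne_top _ _) this (measure_ne_top _ _),
      mul_comm, hprod x hxS, mul_comm]
  refine ⟨κ, (Measure.eq_of_le_of_measure_univ_eq ?_ ?_).symm⟩
  · rw [← Measure.coe_nnreal_smul, ← withDensity_const, ← withDensity_congr_ae hrn]
    exact Measure.withDensity_rnDeriv_le _ _
  · rw [Measure.smul_apply, ENNReal.smul_def, smul_eq_mul, ← hκ,
      ENNReal.div_mul_cancel hμ0 (measure_ne_top _ _)]

lemma exists_isometry_sphere {x y : E3} (hx : x ∈ sphere (0 : E3) 1)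
    (hy : y ∈ sphere (0 : E3) 1) (r : ℝ) : ∃ R : E3 ≃ₗᵢ[ℝ] E3,
      R '' (closedBall x r ∩ sphere 0 1) = closedBall y r ∩ sphere 0 1 := by
  refine ⟨Submodule.reflection (ℝ ∙ (x - y))ᗮ, ?_⟩
  rw [image_inter (LinearIsometryEquiv.injective _), LinearIsometryEquiv.image_closedBall,
    LinearIsometryEquiv.image_sphere, map_zero, Submodule.reflection_sub
      ((mem_sphere_zero_iff_norm.1 hx).trans (mem_sphere_zero_iff_norm.1 hy).symm)]

open scoped Pointwise in
lemma map_sph_closedBall {x y : E3} (hx : x ∈ sphere (0 : E3) 1) (hy : y ∈ sphere (0 : E3) 1)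
    (r : ℝ) : sph.map (↑) (closedBall x r) = sph.map (↑) (closedBall y r) := by
  obtain ⟨R, hR⟩ := exists_isometry_sphere hx hy r
  have hm (z : E3) : MeasurableSet ((↑) ⁻¹' closedBall z r : Set (sphere (0 : E3) 1)) :=
    measurable_subtype_coe measurableSet_closedBall
  rw [Measure.map_apply measurable_subtype_coe measurableSet_closedBall,
    Measure.map_apply measurable_subtype_coe measurableSet_closedBall,
    Measure.toSphere_apply' _ (hm x), Measure.toSphere_apply' _ (hm y)]
  simp only [Subtype.image_preimage_coe]
  rw [inter_comm, inter_comm _ (closedBall y r), ← hR]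
  have h : R '' (Ioo (0 : ℝ) 1 • (closedBall x r ∩ sphere 0 1))
      = Ioo (0 : ℝ) 1 • (R '' (closedBall x r ∩ sphere 0 1)) :=
    image_image2_distrib_right fun t z => map_smul R t z
  rw [← h, ← R.measurePreserving.measure_preimage_emb R.toHomeomorph.measurableEmbedding (R '' _)]
  congr 2
  exact (R.injective.preimage_image _).symm

/-- Spherical coordinates. -/
def sphCoord (p : Fin 2 → ℝ) : E3 :=
  !₂[sin (p 0) * cos (p 1), sin (p 0) * sin (p 1), cos (p 0)]

lemma contDiff_sphCoord : ContDiff ℝ 1 sphCoord := by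
  rw [contDiff_euclidean]
  intro i
  fin_cases i <;> simp [sphCoord] <;> fun_prop

lemma sphere_subset_image : sphere (0 : E3) 1 ⊆ sphCoord '' (Icc (fun _ => -π) (fun _ => π)) := by
  intro x hx
  have hn : x 0 ^ 2 + x 1 ^ 2 + x 2 ^ 2 = 1 := by
    have := mem_sphere_zero_iff_norm.1 hx
    rw [EuclideanSpace.norm_eq, Real.sqrt_eq_one, Fin.sum_univ_three] at this
    simpa using this
  set z : ℂ := ⟨x 0, x 1⟩
  have hz : ‖z‖ = √(1 - x 2 ^ 2) := by
    rw [Complex.norm_eq_sqrt_sq_add_sq]; congr 1; simp [z]; linarith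
  refine ⟨![arccos (x 2), z.arg], ?_, ?_⟩
  · rw [mem_Icc, Pi.le_def, Pi.le_def]
    refine ⟨fun i => ?_, fun i => ?_⟩ <;> fin_cases i
    · have := arccos_nonneg (x 2); have := pi_pos; simp; linarith
    · simpa using (Complex.neg_pi_lt_arg z).le
    · simpa using arccos_le_pi (x 2)
    · simpa using Complex.arg_le_pi z
  · ext i
    fin_cases i
    · simp [sphCoord, sin_arccos, ← hz, Complex.norm_mul_cos_arg]; rfl
    · simp [sphCoord, sin_arccos, ← hz, Complex.norm_mul_sin_arg]; rfl
    · simp [sphCoord]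
      rw [cos_arccos] <;> nlinarith [sq_nonneg (x 0), sq_nonneg (x 1)]

lemma hausdorff_sphere_lt_top : (μH[2] : Measure E3) (sphere 0 1) < ⊤ := by
  obtain ⟨K, hK⟩ := contDiff_sphCoord.contDiffOn.exists_lipschitzOnWith (by norm_num)
    (convex_Icc (fun _ : Fin 2 => -π) (fun _ => π)) isCompact_Icc
  refine (measure_mono sphere_subset_image).trans_lt ?_
  refine (hK.hausdorffMeasure_image_le (by norm_num)).trans_lt ?_
  have : (μH[2] : Measure (Fin 2 → ℝ)) = volume := by
    have := hausdorffMeasure_pi_real (ι := Fin 2)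
    simpa using this
  rw [this]
  exact ENNReal.mul_lt_top (by simp) (isCompact_Icc.measure_lt_top)

/-- The area measure of the unit sphere is a multiple of `sph`. -/
theorem exists_area_eq : ∃ κ : ℝ≥0, ∀ f : E3 → ℝ≥0∞,
    ∫⁻ x in sphere (0 : E3) 1, f x ∂μH[2] = κ * ∫⁻ w, f w ∂sph := by
  have hS := (isClosed_sphere (x := (0 : E3)) (ε := 1)).measurableSet
  have me := MeasurableEmbedding.subtype_coe hS
  have : Fact ((μH[2] : Measure E3) (sphere 0 1) < ⊤) := ⟨hausdorff_sphere_lt_top⟩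
  have h₀ : ek 0 ∈ sphere (0 : E3) 1 := by simp
  obtain ⟨κ, hκ⟩ := eq_smul_of_closedBall (sph.map (↑)) ((μH[2] : Measure E3).restrict (sphere 0 1)) h₀
    (me.ae_map_iff.2 (Eventually.of_forall fun w => w.2)) (ae_restrict_mem hS)
    (fun x hx y hy r => map_sph_closedBall hx hy r) (fun x hx y hy r => by
      obtain ⟨R, hR⟩ := exists_isometry_sphere hx hy r
      rw [Measure.restrict_apply measurableSet_closedBall,
        Measure.restrict_apply measurableSet_closedBall, ← hR,
        R.isometry.hausdorffMeasure_image (Or.inl (by norm_num))])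
    (fun r hr => by
      rw [me.map_apply]
      refine (Measure.measure_pos_of_mem_nhds sph (x := ⟨_, h₀⟩) ?_).ne'
      exact continuous_subtype_val.continuousAt.preimage_mem_nhds (closedBall_mem_nhds _ hr))
  refine ⟨κ, fun f => ?_⟩
  rw [hκ, lintegral_smul_measure, me.lintegral_map]
  rfl

/-- The cube of a traceless symmetric matrix has trace `≤ |Q|³/√6`. -/
lemma trace_cube_sq_le {Q : Mat3} (hQ : isS0 Q) :
    6 * (Q * Q * Q).trace ^ 2 ≤ fr Q Q ^ 3 := by
  have s1 := hQ.1.apply 0 1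
  have s2 := hQ.1.apply 0 2
  have s3 := hQ.1.apply 1 2
  have t : Q 2 2 = - Q 0 0 - Q 1 1 := by
    have := hQ.2
    simp only [Matrix.trace, Matrix.diag, Fin.sum_univ_three] at this
    linarith
  set B : Mat3 := Q * Q - (fr Q Q / 3) • (1 : Mat3) with hB
  have h1 : fr B Q = (Q * Q * Q).trace := by
    rw [hB, fr_sub_left, fr_smul_left, fr_comm 1 Q, fr_one_right, hQ.2, trace_mul_eq_fr, hQ.1.eq]
    ring
  have h2 : fr B B = fr Q Q ^ 2 / 6 := by
    have e1 : fr (Q * Q) (Q * Q) = fr Q Q ^ 2 / 2 := by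
      simp only [fr, Matrix.mul_apply, Fin.sum_univ_three, s1, s2, s3, t]
      ring
    have e2 : fr (Q * Q) 1 = fr Q Q := by rw [fr_one_right, trace_mul_eq_fr, hQ.1.eq]
    have e3 : fr (1 : Mat3) 1 = 3 := by rw [fr_one_right]; simp
    rw [hB, fr_sub_left, fr_sub_right, fr_sub_right, fr_smul_left, fr_smul_left, fr_smul_right,
      fr_smul_right, fr_comm 1 (Q * Q), e1, e2, e3]
    ring
  have := fr_sq_le B Q
  rw [h1, h2] at this
  nlinarith

lemma trace_cube_le {Q : Mat3} (hQ : isS0 Q) {s : ℝ} (hs : 0 ≤ s) (h : fr Q Q = 2 / 3 * s ^ 2) :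
    (Q * Q * Q).trace ≤ 2 / 9 * s ^ 3 := by
  have := trace_cube_sq_le hQ
  rw [h] at this
  refine abs_le_of_sq_le_sq' ?_ (by positivity) |>.2
  nlinarith

lemma gpot_eq {a b c : ℝ} {Q : Mat3} (hQ : isS0 Q) : gpot a b c Q =
    -(a / 2) * fr Q Q - (b / 3) * (Q * Q * Q).trace + (c / 4) * fr Q Q ^ 2 := by
  rw [gpot, trace_mul_eq_fr, hQ.1.eq]

/-- The scalar profile of the bulk potential. -/
lemma profile_sub {a b c : ℝ} (ha : 0 ≤ a) (hc : 0 < c) (s : ℝ) :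
    (-(a / 3) * s ^ 2 - 2 * b / 27 * s ^ 3 + c / 9 * s ^ 4)
      - (-(a / 3) * sstar a b c ^ 2 - 2 * b / 27 * sstar a b c ^ 3 + c / 9 * sstar a b c ^ 4)
    = (s - sstar a b c) ^ 2 * (c / 9 * (s + sstar a b c) ^ 2 - b / 27 * (2 * s + sstar a b c)) := by
  have h := sstar_eq (b := b) ha hc
  set σ := sstar a b c
  have : a = (2 * c * σ ^ 2 - b * σ) / 3 := by linarith
  rw [this]; ring

lemma two_c_sstar_ge {a b c : ℝ} (ha : 0 ≤ a) (hb : 0 < b) (hc : 0 < c) :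
    b ≤ 2 * c * sstar a b c := by
  have h := sstar_eq (b := b) ha hc
  have := sstar_pos (a := a) hb hc
  nlinarith

lemma profile_bracket_nonneg {a b c : ℝ} (ha : 0 ≤ a) (hb : 0 < b) (hc : 0 < c) {s : ℝ}
    (hs : 0 ≤ s) :
    0 ≤ c / 9 * (s + sstar a b c) ^ 2 - b / 27 * (2 * s + sstar a b c) := by
  have h1 := two_c_sstar_ge ha hb hc
  have h2 := sstar_pos (a := a) hb hc
  set σ := sstar a b c
  have h3 : b * (2 * s + σ) ≤ 2 * c * σ * (2 * s + σ) :=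
    mul_le_mul_of_nonneg_right h1 (by positivity)
  have h4 : 0 ≤ c * (3 * s ^ 2 + 2 * s * σ + σ ^ 2) := by positivity
  nlinarith

lemma gpot_Qinf {a b c : ℝ} : gpot a b c (Qinf a b c) =
    -(a / 3) * sstar a b c ^ 2 - 2 * b / 27 * sstar a b c ^ 3 + c / 9 * sstar a b c ^ 4 := by
  have h : (Qinf a b c * Qinf a b c * Qinf a b c).trace = 2 / 9 * sstar a b c ^ 3 := by
    rw [Qinf_eq]
    simp only [Matrix.smul_mul, Matrix.mul_smul, Matrix.diagonal_mul_diagonal, Matrix.trace_smul,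
      Matrix.trace_diagonal, Fin.sum_univ_three, smul_eq_mul]
    simp; ring
  rw [gpot_eq (isS0_Qinf a b c), fr_Qinf, h]
  ring

lemma exists_scalar (Q : Mat3) : ∃ s, 0 ≤ s ∧ fr Q Q = 2 / 3 * s ^ 2 :=
  ⟨√(3 / 2 * fr Q Q), Real.sqrt_nonneg _, by
    rw [Real.sq_sqrt (mul_nonneg (by norm_num) (fr_self_nonneg _))]; ring⟩

lemma gpot_Qinf_le {a b c : ℝ} (ha : 0 ≤ a) (hb : 0 < b) (hc : 0 < c) {Q : Mat3} (hQ : isS0 Q) :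
    gpot a b c (Qinf a b c) ≤ gpot a b c Q := by
  obtain ⟨s, hs, h⟩ := exists_scalar Q
  have h1 := trace_cube_le hQ hs h
  have h2 := profile_sub (b := b) ha hc s
  have h3 := mul_nonneg (sq_nonneg (s - sstar a b c)) (profile_bracket_nonneg ha hb hc hs)
  rw [gpot_Qinf, gpot_eq hQ, h]
  nlinarith

lemma fpot_eq {a b c : ℝ} (ha : 0 ≤ a) (hb : 0 < b) (hc : 0 < c) (Q : Mat3) :
    fpot a b c Q = gpot a b c Q - gpot a b c (Qinf a b c) := by
  have : IsLeast (gpot a b c '' {Q | isS0 Q}) (gpot a b c (Qinf a b c)) :=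
    ⟨⟨_, isS0_Qinf a b c, rfl⟩, by rintro _ ⟨Q, hQ, rfl⟩; exact gpot_Qinf_le ha hb hc hQ⟩
  rw [fpot, Cconst, this.csInf_eq]; ring

lemma fpot_nonneg {a b c : ℝ} (ha : 0 ≤ a) (hb : 0 < b) (hc : 0 < c) {Q : Mat3} (hQ : isS0 Q) :
    0 ≤ fpot a b c Q := by
  rw [fpot_eq ha hb hc]
  have := gpot_Qinf_le ha hb hc hQ
  linarith

/-! ### Truncation -/

/-- The scaling factor of the truncation at level `s₀`. -/
def trunc (s₀ T : ℝ) : ℝ := √√(s₀ ^ 2 / (s₀ ^ 2 + max (T - s₀) 0 ^ 2))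

lemma hasDerivAt_max_sq (t : ℝ) : HasDerivAt (fun t : ℝ => max t 0 ^ 2) (2 * max t 0) t := by
  have key : ∀ t : ℝ, t ≠ 0 → HasDerivAt (fun t : ℝ => max t 0 ^ 2) (2 * max t 0) t := by
    intro t ht
    rcases ht.lt_or_gt with h | h
    · rw [max_eq_right h.le, mul_zero]
      refine (hasDerivAt_const t (0 : ℝ)).congr_of_eventuallyEq ?_
      filter_upwards [gt_mem_nhds h] with u hu
      simp [max_eq_right (le_of_lt hu)]
    · rw [max_eq_left h.le]
      refine (by simpa using hasDerivAt_pow 2 t : HasDerivAt (fun t : ℝ => t ^ 2) (2 * t) t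
        ).congr_of_eventuallyEq ?_
      filter_upwards [lt_mem_nhds h] with u hu
      simp [max_eq_left (le_of_lt hu)]
  rcases eq_or_ne t 0 with rfl | h
  · exact hasDerivAt_of_hasDerivAt_of_ne (g := fun t => 2 * max t 0) (fun y hy => key y hy)
      (by fun_prop) (by fun_prop)
  · exact key t h

lemma contDiff_max_sq : ContDiff ℝ 1 (fun t : ℝ => max t 0 ^ 2) := by
  rw [contDiff_one_iff_deriv]
  refine ⟨fun t => (hasDerivAt_max_sq t).differentiableAt, ?_⟩
  rw [funext fun t => (hasDerivAt_max_sq t).deriv]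
  fun_prop

lemma trunc_arg_pos {s₀ : ℝ} (h : 0 < s₀) (T : ℝ) : 0 < s₀ ^ 2 / (s₀ ^ 2 + max (T - s₀) 0 ^ 2) := by
  positivity

lemma contDiff_trunc {s₀ : ℝ} (h : 0 < s₀) : ContDiff ℝ 1 (trunc s₀) := by
  have h1 : ContDiff ℝ 1 (fun T : ℝ => s₀ ^ 2 / (s₀ ^ 2 + max (T - s₀) 0 ^ 2)) := by
    refine contDiff_const.div (contDiff_const.add
      (contDiff_max_sq.comp (contDiff_id.sub contDiff_const))) fun T => ?_
    positivity
  refine (h1.sqrt fun T => (trunc_arg_pos h T).ne').sqrt fun T => ?_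
  exact (Real.sqrt_pos.2 (trunc_arg_pos h T)).ne'

lemma trunc_pos {s₀ : ℝ} (h : 0 < s₀) (T : ℝ) : 0 < trunc s₀ T :=
  Real.sqrt_pos.2 (Real.sqrt_pos.2 (trunc_arg_pos h T))

lemma trunc_pow_four {s₀ : ℝ} (h : 0 < s₀) (T : ℝ) :
    trunc s₀ T ^ 4 * (s₀ ^ 2 + max (T - s₀) 0 ^ 2) = s₀ ^ 2 := by
  have : trunc s₀ T ^ 4 = s₀ ^ 2 / (s₀ ^ 2 + max (T - s₀) 0 ^ 2) := by
    rw [trunc, show ∀ x : ℝ, x ^ 4 = (x ^ 2) ^ 2 from fun x => by ring,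
      Real.sq_sqrt (Real.sqrt_nonneg _), Real.sq_sqrt (trunc_arg_pos h T).le]
  rw [this]
  have : s₀ ^ 2 + max (T - s₀) 0 ^ 2 ≠ 0 := by positivity
  field_simp

lemma trunc_le_one {s₀ : ℝ} (h : 0 < s₀) (T : ℝ) : trunc s₀ T ≤ 1 := by
  refine Real.sqrt_le_one.2 (Real.sqrt_le_one.2 ?_)
  exact div_le_one_of_le₀ (by nlinarith [sq_nonneg (max (T - s₀) 0)]) (by positivity)

lemma trunc_eq_one {s₀ : ℝ} (h : 0 < s₀) {T : ℝ} (hT : T ≤ s₀) : trunc s₀ T = 1 := by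
  rw [trunc, max_eq_right (by linarith)]
  simp [h.ne']

lemma le_trunc_sq_mul {s₀ : ℝ} (h : 0 < s₀) {T : ℝ} (hT : s₀ ≤ T) : s₀ ≤ trunc s₀ T ^ 2 * T := by
  have h4 := trunc_pow_four h T
  rw [max_eq_left (by linarith)] at h4
  have hp := trunc_pos h T
  set θ := trunc s₀ T
  refine abs_le_of_sq_le_sq' ?_ (by nlinarith [sq_nonneg θ]) |>.2
  have : s₀ ^ 2 + (T - s₀) ^ 2 ≤ T ^ 2 := by nlinarith
  have h5 : θ ^ 4 * (s₀ ^ 2 + (T - s₀) ^ 2) ≤ θ ^ 4 * T ^ 2 :=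
    mul_le_mul_of_nonneg_left this (by positivity)
  nlinarith

lemma trunc_sq_mul_le {s₀ : ℝ} (h : 0 < s₀) {T : ℝ} (hT0 : 0 ≤ T) : trunc s₀ T ^ 2 * T ≤ 2 * s₀ := by
  have h4 := trunc_pow_four h T
  have hp := trunc_pos h T
  set θ := trunc s₀ T
  set m := max (T - s₀) 0
  have hm0 : 0 ≤ m := le_max_right _ _
  have hTm : T ≤ s₀ + m := by have := le_max_left (T - s₀) 0; linarith
  refine abs_le_of_sq_le_sq' ?_ (by positivity) |>.2
  have : T ^ 2 ≤ 2 * (s₀ ^ 2 + m ^ 2) := by nlinarith [sq_nonneg (s₀ - m), hT0]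
  have h5 : θ ^ 4 * T ^ 2 ≤ θ ^ 4 * (2 * (s₀ ^ 2 + m ^ 2)) :=
    mul_le_mul_of_nonneg_left this (by positivity)
  nlinarith

/-- The logarithmic derivative of the truncation factor. -/
lemma deriv_trunc_bounds {s₀ : ℝ} (h : 0 < s₀) (T : ℝ) :
    deriv (trunc s₀) T ≤ 0 ∧ 0 ≤ trunc s₀ T + deriv (trunc s₀) T * T := by
  have hd : HasDerivAt (trunc s₀) (deriv (trunc s₀) T) T :=
    ((contDiff_trunc h).differentiable one_ne_zero T).hasDerivAt
  have hp := trunc_pos h T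
  have hq : HasDerivAt (fun T : ℝ => s₀ ^ 2 + max (T - s₀) 0 ^ 2) (2 * max (T - s₀) 0) T := by
    have := (hasDerivAt_max_sq (T - s₀)).comp T ((hasDerivAt_id T).sub_const s₀)
    simpa [Function.comp_def] using this.const_add (s₀ ^ 2)
  have key : _ = (0 : ℝ) := ((hd.pow 4).mul hq).unique
    ((hasDerivAt_const T (s₀ ^ 2)).congr_of_eventuallyEq (.of_forall (trunc_pow_four h)))
  simp only [Nat.cast_ofNat, Nat.add_one_sub_one, Pi.pow_apply] at key
  set θ := trunc s₀ T
  set m := max (T - s₀) 0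
  have hm0 : 0 ≤ m := le_max_right _ _
  have hTm : T ≤ s₀ + m := by have := le_max_left (T - s₀) 0; linarith
  have e : deriv (trunc s₀) T = -(θ * m / (2 * (s₀ ^ 2 + m ^ 2))) := by
    field_simp
    refine mul_left_cancel₀ (pow_ne_zero 3 hp.ne') ?_
    linear_combination key / 2
  refine ⟨by rw [e]; exact neg_nonpos.2 (by positivity), ?_⟩
  rw [e, show θ + -(θ * m / (2 * (s₀ ^ 2 + m ^ 2))) * T =
    θ * (2 * (s₀ ^ 2 + m ^ 2) - m * T) / (2 * (s₀ ^ 2 + m ^ 2)) by field_simp; ring]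
  have : m * T ≤ m * (s₀ + m) := mul_le_mul_of_nonneg_left hTm hm0
  exact div_nonneg (mul_nonneg hp.le (by nlinarith [sq_nonneg (s₀ - m), sq_nonneg (s₀ + m)]))
    (by positivity)

lemma isS0_smul {Q : Mat3} (hQ : isS0 Q) (t : ℝ) : isS0 (t • Q) :=
  ⟨hQ.1.smul t, by rw [Matrix.trace_smul, hQ.2, smul_zero]⟩

lemma isS0_sub {Q P : Mat3} (hQ : isS0 Q) (hP : isS0 P) : isS0 (Q - P) :=
  ⟨hQ.1.sub hP.1, by rw [Matrix.trace_sub, hQ.2, hP.2, sub_zero]⟩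

lemma isS0_add {Q P : Mat3} (hQ : isS0 Q) (hP : isS0 P) : isS0 (Q + P) :=
  ⟨hQ.1.add hP.1, by rw [Matrix.trace_add, hQ.2, hP.2, add_zero]⟩

/-- Truncation does not increase the bulk potential. -/
lemma fpot_trunc_le {a b c : ℝ} (ha : 0 ≤ a) (hb : 0 < b) (hc : 0 < c) {Q : Mat3} (hQ : isS0 Q) :
    fpot a b c (trunc (2 / 3 * sstar a b c ^ 2) (fr Q Q) • Q) ≤ fpot a b c Q := by
  have hσ := sstar_pos (a := a) hb hc
  have hs0 : 0 < 2 / 3 * sstar a b c ^ 2 := by positivity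
  rcases le_total (fr Q Q) (2 / 3 * sstar a b c ^ 2) with h | h
  · rw [trunc_eq_one hs0 h, one_smul]
  have h1 := le_trunc_sq_mul hs0 h
  have hp := trunc_pos hs0 (fr Q Q)
  have hle := trunc_le_one hs0 (fr Q Q)
  obtain ⟨s, hs, hsQ⟩ := exists_scalar Q
  have hD := trace_cube_le hQ hs hsQ
  rw [fpot_eq ha hb hc, fpot_eq ha hb hc, sub_le_sub_iff_right, gpot_eq hQ, gpot_eq (isS0_smul hQ _)]
  set θ := trunc (2 / 3 * sstar a b c ^ 2) (fr Q Q)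
  simp only [fr_smul_left, fr_smul_right, Matrix.smul_mul, Matrix.mul_smul, Matrix.trace_smul,
    smul_eq_mul]
  rw [hsQ] at h1 ⊢
  set D := (Q * Q * Q).trace
  have hu : sstar a b c ≤ θ * s := abs_le_of_sq_le_sq' (by nlinarith) (by positivity) |>.2
  have hus : θ * s ≤ s := by nlinarith
  have p1 := profile_sub (b := b) ha hc s
  have p2 := profile_sub (b := b) ha hc (θ * s)
  have b0 := profile_bracket_nonneg ha hb hc (s := θ * s) (by positivity)
  have c0 := two_c_sstar_ge ha hb hc
  set σ := sstar a b c
  have b1 : c / 9 * (θ * s + σ) ^ 2 - b / 27 * (2 * (θ * s) + σ)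
      ≤ c / 9 * (s + σ) ^ 2 - b / 27 * (2 * s + σ) := by
    have : 0 ≤ (s - θ * s) * (c / 9 * (s + θ * s + 2 * σ) - 2 * b / 27) := by
      refine mul_nonneg (by linarith) ?_
      nlinarith [mul_nonneg hc.le hs, mul_nonneg hc.le (mul_nonneg hp.le hs)]
    nlinarith
  have b2 : (θ * s - σ) ^ 2 ≤ (s - σ) ^ 2 := by nlinarith
  have b3 := mul_le_mul b2 b1 b0 (sq_nonneg (s - σ))
  have b4 : 0 ≤ b / 3 * ((2 / 9 * s ^ 3 - D) * (1 - θ ^ 3)) := by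
    have : θ ^ 3 ≤ 1 := pow_le_one₀ hp.le hle
    exact mul_nonneg (by positivity) (mul_nonneg (by linarith) (by linarith))
  have e : (-(a / 3) * s ^ 2 - 2 * b / 27 * s ^ 3 + c / 9 * s ^ 4) -
      (-(a / 3) * (θ * s) ^ 2 - 2 * b / 27 * (θ * s) ^ 3 + c / 9 * (θ * s) ^ 4) ≥ 0 := by linarith
  nlinarith

/-- Truncation does not increase the distance to matrices of norm `√s₀`. -/
lemma fr_trunc_sub_le {s₀ : ℝ} (h : 0 < s₀) (Q : Mat3) {R : Mat3} (hR : fr R R = s₀) :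
    fr (trunc s₀ (fr Q Q) • Q - R) (trunc s₀ (fr Q Q) • Q - R) ≤ fr (Q - R) (Q - R) := by
  rcases le_total (fr Q Q) s₀ with hT | hT
  · rw [trunc_eq_one h hT, one_smul]
  have h1 := le_trunc_sq_mul h hT
  have hp := trunc_pos h (fr Q Q)
  have hle := trunc_le_one h (fr Q Q)
  have hc := fr_sq_le Q R
  rw [hR] at hc
  set θ := trunc s₀ (fr Q Q)
  simp only [fr_sub_left, fr_sub_right, fr_smul_left, fr_smul_right, fr_comm R Q, hR]
  set T := fr Q Q
  set p := fr Q R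
  have hT0 : 0 < T := by linarith
  have h2 : p ≤ T := abs_le_of_sq_le_sq' (by nlinarith) hT0.le |>.2
  have h3 : p ≤ θ * T := by
    refine abs_le_of_sq_le_sq' ?_ (by positivity) |>.2
    nlinarith
  nlinarith

/-- Truncation does not increase the length of tangent vectors. -/
lemma fr_trunc_deriv_le {s₀ : ℝ} (h : 0 < s₀) (Q D : Mat3) :
    fr (trunc s₀ (fr Q Q) • D + (deriv (trunc s₀) (fr Q Q) * (2 * fr Q D)) • Q)
      (trunc s₀ (fr Q Q) • D + (deriv (trunc s₀) (fr Q Q) * (2 * fr Q D)) • Q) ≤ fr D D := by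
  obtain ⟨h1, h2⟩ := deriv_trunc_bounds h (fr Q Q)
  have hp := trunc_pos h (fr Q Q)
  have hle := trunc_le_one h (fr Q Q)
  set θ := trunc s₀ (fr Q Q)
  set d := deriv (trunc s₀) (fr Q Q)
  simp only [fr_add_left, fr_add_right, fr_smul_left, fr_smul_right, fr_comm D Q]
  have hD := fr_self_nonneg D
  set T := fr Q Q
  set p := fr Q D
  have e1 : 0 ≤ (1 - θ ^ 2) * fr D D :=
    mul_nonneg (by nlinarith) hD
  have e2 : 0 ≤ (-d) * p ^ 2 * (θ + d * T) :=
    mul_nonneg (mul_nonneg (by linarith) (sq_nonneg _)) h2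
  nlinarith

/-! ### Taylor expansion -/

lemma gpot_taylor {a b c : ℝ} {Q H : Mat3} (hQ : isS0 Q) (hH : isS0 H) :
    gpot a b c (Q + H) - gpot a b c Q - fr (gradf a b c Q) H =
      -(a / 2) * fr H H - b * fr Q (H * H) - b / 3 * fr H (H * H)
        + c / 4 * ((2 * fr Q H + fr H H) ^ 2 + 2 * fr Q Q * fr H H) := by
  have t3 : fr (Q * Q) H * 3 + fr Q (H * H) * 3 + fr H (H * H) + (Q * Q * Q).trace
      = ((Q + H) * (Q + H) * (Q + H)).trace := by
    have s1 := hQ.1.apply 0 1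
    have s2 := hQ.1.apply 0 2
    have s3 := hQ.1.apply 1 2
    have r1 := hH.1.apply 0 1
    have r2 := hH.1.apply 0 2
    have r3 := hH.1.apply 1 2
    simp only [fr, Matrix.trace, Matrix.diag, Matrix.mul_apply, Fin.sum_univ_three,
      Matrix.add_apply, s1, s2, s3, r1, r2, r3]
    ring
  have e1 : fr (1 : Mat3) H = 0 := by rw [fr_comm, fr_one_right, hH.2]
  rw [gpot_eq (isS0_add hQ hH), gpot_eq hQ, ← t3, gradf, mnormSq_eq_fr hQ.1]
  simp only [fr_add_left, fr_add_right, fr_sub_left, fr_smul_left, e1, fr_comm H Q]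
  ring

lemma exists_taylor_bound {a b c : ℝ} (ha : 0 ≤ a) (hb : 0 < b) (hc : 0 < c) {M : ℝ} (hM : 0 ≤ M) :
    ∃ C, 0 ≤ C ∧ ∀ Q H, isS0 Q → isS0 H → fr Q Q ≤ M ^ 2 → fr H H ≤ M ^ 2 →
      |fpot a b c (Q + H) - fpot a b c Q - fr (gradf a b c Q) H| ≤ C * fr H H := by
  refine ⟨a / 2 + b * M + b / 3 * M + c / 4 * (10 * M ^ 2 + 2 * M ^ 2), by positivity,
    fun Q H hQ hH hQM hHM => ?_⟩
  have e : fpot a b c (Q + H) - fpot a b c Q = gpot a b c (Q + H) - gpot a b c Q := by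
    rw [fpot, fpot]; ring
  rw [e, gpot_taylor hQ hH]
  have h0 := fr_self_nonneg H
  have hHH : fr (H * H) (H * H) ≤ fr H H ^ 2 := by
    have := fr_mul_le H H
    nlinarith
  have b1 := abs_le.1 (abs_fr_le hM h0 hQM hHH)
  have b2 := abs_le.1 (abs_fr_le hM h0 hHM hHH)
  have b3 : fr Q H ^ 2 ≤ M ^ 2 * fr H H :=
    (fr_sq_le Q H).trans (mul_le_mul_of_nonneg_right hQM h0)
  set h := fr H H
  set p := fr Q H
  set x := fr Q (H * H)
  set y := fr H (H * H)
  set T := fr Q Q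
  have b4 : (2 * p + h) ^ 2 ≤ 10 * M ^ 2 * h := by
    nlinarith [sq_nonneg (2 * p - h), mul_le_mul_of_nonneg_right hHM h0]
  have b5 : 0 ≤ T * h := mul_nonneg (fr_self_nonneg Q) h0
  have b6 : T * h ≤ M ^ 2 * h := mul_le_mul_of_nonneg_right hQM h0
  rw [abs_le]
  constructor <;> nlinarith [mul_le_mul_of_nonneg_left b1.1 hb.le, sq_nonneg (2 * p + h),
    mul_le_mul_of_nonneg_left b1.2 hb.le, mul_le_mul_of_nonneg_left b2.1 hb.le,
    mul_le_mul_of_nonneg_left b2.2 hb.le, mul_nonneg ha h0,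
    mul_nonneg hc.le (sub_nonneg.2 b4), mul_nonneg hc.le (sq_nonneg (2 * p + h)),
    mul_nonneg hc.le b5, mul_nonneg hc.le (sub_nonneg.2 b6)]

lemma continuous_gradf (a b c : ℝ) : Continuous (gradf a b c) := by
  unfold gradf mnormSq
  fun_prop

lemma exists_gradf_bound (a b c M : ℝ) :
    ∃ C, 0 ≤ C ∧ ∀ Q, isS0 Q → fr Q Q ≤ M ^ 2 → fr (gradf a b c Q) (gradf a b c Q) ≤ C ^ 2 := by
  have hcont : Continuous fun Q => fr (gradf a b c Q) (gradf a b c Q) := by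
    have := continuous_gradf a b c
    unfold fr
    fun_prop
  obtain ⟨C, hC⟩ := (isCompact_univ_pi fun _ => isCompact_univ_pi fun _ => isCompact_Icc (a := -|M|)
    (b := |M|)).exists_bound_of_continuousOn hcont.continuousOn
  refine ⟨√|C|, Real.sqrt_nonneg _, fun Q _ hM => ?_⟩
  rw [Real.sq_sqrt (abs_nonneg _)]
  exact (le_abs_self _).trans ((hC Q fun i _ j _ =>
    abs_le.1 (sq_le_sq.1 ((sq_entry_le Q i j).trans hM))).trans (le_abs_self C))

lemma exists_fpot_lipschitz {a b c : ℝ} (ha : 0 ≤ a) (hb : 0 < b) (hc : 0 < c) {M : ℝ}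
    (hM : 0 ≤ M) :
    ∃ C, 0 ≤ C ∧ ∀ P Q, isS0 P → isS0 Q → fr P P ≤ M ^ 2 → fr Q Q ≤ M ^ 2 →
      |fpot a b c P - fpot a b c Q| ≤ C * √(fr (P - Q) (P - Q)) := by
  obtain ⟨C₁, hC₁, h₁⟩ := exists_taylor_bound ha hb hc (show 0 ≤ 2 * M by positivity)
  obtain ⟨C₂, hC₂, h₂⟩ := exists_gradf_bound a b c M
  refine ⟨C₁ * (2 * M) + C₂, by positivity, fun P Q hP hQ hPM hQM => ?_⟩
  have hH : fr (P - Q) (P - Q) ≤ (2 * M) ^ 2 := by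
    have := fr_self_nonneg (P + Q)
    simp only [fr_add_left, fr_add_right, fr_sub_left, fr_sub_right, fr_comm Q P] at this ⊢
    nlinarith
  have h := h₁ Q (P - Q) hQ (isS0_sub hP hQ) (by nlinarith) hH
  rw [add_sub_cancel] at h
  have hh := fr_self_nonneg (P - Q)
  have hs := Real.sq_sqrt hh
  have hs0 := Real.sqrt_nonneg (fr (P - Q) (P - Q))
  have g := abs_fr_le hC₂ hs0 (h₂ Q hQ hQM) hs.ge
  have hsM : √(fr (P - Q) (P - Q)) ≤ 2 * M := Real.sqrt_le_iff.2 ⟨by positivity, hH⟩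
  have k : C₁ * fr (P - Q) (P - Q) ≤ C₁ * (2 * M) * √(fr (P - Q) (P - Q)) := by
    rw [mul_assoc]
    refine mul_le_mul_of_nonneg_left ?_ hC₁
    nlinarith
  rw [abs_le] at h g ⊢
  constructor <;> linarith [h.1, h.2, g.1, g.2]

lemma uniqueDiffOn_OmegaBar : UniqueDiffOn ℝ OmegaBar := by
  intro x hx
  rcases (show 1 ≤ ‖x‖ from hx).lt_or_eq with h | h
  · exact uniqueDiffWithinAt_of_mem_nhds (OmegaBar_mem_nhds h)
  · set K : Set E3 := {y | 1 ≤ inner ℝ x y}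
    have hK : Convex ℝ K := by
      have : K = (fun y => inner ℝ x y) ⁻¹' Ici (1 : ℝ) := rfl
      rw [this]
      exact (convex_Ici (1 : ℝ)).is_linear_preimage (innerSL ℝ x).isBoundedLinearMap.toIsLinearMap
    have hKi : (interior K).Nonempty := by
      refine ⟨(2 : ℝ) • x, mem_interior.2 ⟨{y | 1 < inner ℝ x y}, fun y (hy : 1 < inner ℝ x y) => hy.le,
        isOpen_lt continuous_const (by fun_prop), ?_⟩⟩
      rw [mem_ofPred_eq, inner_smul_right, real_inner_self_eq_norm_sq, ← h]; norm_num
    have hxK : x ∈ K := by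
      change 1 ≤ inner ℝ x x
      rw [real_inner_self_eq_norm_sq, ← h]; norm_num
    refine (uniqueDiffOn_convex hK hKi x hxK).mono fun y hy => ?_
    have h1 : (1 : ℝ) ≤ inner ℝ x y := hy
    have h2 := real_inner_le_norm x y
    rw [← h, one_mul] at h2
    exact h1.trans h2

lemma isClosed_OmegaBar : IsClosed OmegaBar := isClosed_le continuous_const continuous_norm

lemma isCompact_annulus (R : ℝ) : IsCompact (OmegaBar ∩ closedBall (0 : E3) R) :=
  (isCompact_closedBall _ _).inter_left isClosed_OmegaBar

lemma exists_fderiv_bound {g : E3 → ℝ} (hg : ContDiffOn ℝ 1 g OmegaBar) (R : ℝ) :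
    ∃ M, 0 ≤ M ∧ (∀ x ∈ Omega, ‖x‖ ≤ R → ‖fderiv ℝ g x‖ ≤ M) ∧
      ∀ x ∈ OmegaBar, ‖x‖ ≤ R → |g x| ≤ M := by
  have hc := (hg.continuousOn_fderivWithin uniqueDiffOn_OmegaBar le_rfl).mono
    (inter_subset_left (t := closedBall (0 : E3) R))
  obtain ⟨M, hM⟩ := (isCompact_annulus R).exists_bound_of_continuousOn hc
  obtain ⟨M', hM'⟩ := (isCompact_annulus R).exists_bound_of_continuousOn
    (hg.continuousOn.mono inter_subset_left)
  refine ⟨max 0 (max M M'), le_max_left _ _, fun x hx hxR => ?_, fun x hx hxR => ?_⟩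
  · have := hM x ⟨Omega_subset hx, by simpa using hxR⟩
    rw [fderivWithin_of_mem_nhds (OmegaBar_mem_nhds hx)] at this
    exact this.trans ((le_max_left _ _).trans (le_max_right _ _))
  · exact (hM' x ⟨hx, by simpa using hxR⟩).trans ((le_max_right _ _).trans (le_max_right _ _))

lemma exists_fderiv_bound_of_far {g : E3 → ℝ} (hg : ContDiffOn ℝ 1 g OmegaBar) {R : ℝ}
    (hR : ∀ x, R ≤ ‖x‖ → g x = 0) :
    ∃ M, 0 ≤ M ∧ (∀ x ∈ Omega, ‖fderiv ℝ g x‖ ≤ M) ∧ ∀ x ∈ OmegaBar, |g x| ≤ M := by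
  obtain ⟨M, hM0, hM, hM'⟩ := exists_fderiv_bound hg R
  refine ⟨M, hM0, fun x hx => ?_, fun x hx => ?_⟩
  · rcases le_or_gt ‖x‖ R with h | h
    · exact hM x hx h
    · rw [fderiv_eq_zero_of_far hR h]; simpa using hM0
  · rcases le_or_gt ‖x‖ R with h | h
    · exact hM' x hx h
    · rw [hR x h.le]; simpa using hM0

/-- The surface integral over the unit sphere as a bulk integral. -/
theorem integral_sphere_eq {g : E3 → ℝ} (hg : ContDiffOn ℝ 1 g OmegaBar) {R : ℝ}
    (hR : ∀ x, R ≤ ‖x‖ → g x = 0) :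
    IntegrableOn (fun x => fderiv ℝ g x x / ‖x‖ ^ 3) Omega ∧
    ∫ x in Omega, fderiv ℝ g x x / ‖x‖ ^ 3 = - ∫ w, g w ∂sph := by
  obtain ⟨M, hM0, hM, -⟩ := exists_fderiv_bound_of_far hg hR
  have := integral_radial (X := g) (r₀ := 1) (M := M) (R := R) zero_le_one
    (fun x hx => (hg.contDiffAt (OmegaBar_mem_nhds hx)).differentiableAt one_ne_zero)
    (fun w hw => ?_) hM hR
  · simp only [one_smul] at this; exact this
  · have h1 : ContinuousWithinAt g OmegaBar ((1 : ℝ) • w) :=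
      hg.continuousOn _ (by simp [OmegaBar, hw])
    refine ContinuousWithinAt.comp (t := OmegaBar) h1 (by fun_prop) fun r hr => ?_
    have : (1 : ℝ) ≤ r := hr
    change 1 ≤ ‖r • w‖
    rw [norm_smul, hw, Real.norm_eq_abs, mul_one]
    exact this.trans (le_abs_self _)

lemma abs_clm_apply_le (A : E3 →L[ℝ] ℝ) (x : E3) : |A x| ≤ ‖A‖ * ‖x‖ := A.le_opNorm x

/-- Hardy's inequality in the exterior of the unit ball. -/
theorem hardy {g : E3 → ℝ} (hg : ContDiffOn ℝ 1 g OmegaBar)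
    (h1 : IntegrableOn (fun x => g x ^ 2 / ‖x‖ ^ 2) Omega)
    (h2 : IntegrableOn (fun x => ‖fderiv ℝ g x‖ ^ 2) Omega) :
    ∫ x in Omega, g x ^ 2 / ‖x‖ ^ 2 ≤ 4 * ∫ x in Omega, ‖fderiv ℝ g x‖ ^ 2 := by
  obtain ⟨C, -, hC⟩ := exists_fderiv_cut_bound
  let k : ℝ → E3 → ℝ := fun R x => cut R x - |fderiv ℝ (cut R) x x|
  have hkm : ∀ R, Continuous (k R) := fun R => (contDiff_cut (n := 1) R).continuous.sub
    (((contDiff_cut (n := 1) R).continuous_fderiv one_ne_zero).clm_apply continuous_id).abs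
  have hk : ∀ R > 0, ∀ x, ‖k R x‖ ≤ 1 + C := fun R hR x => by
    refine (norm_sub_le _ _).trans (add_le_add ?_ ?_)
    · rw [Real.norm_of_nonneg (cut_nonneg _ _)]; exact cut_le_one _ _
    · rw [Real.norm_eq_abs, abs_abs]; exact (abs_clm_apply_le _ _).trans (hC R hR x).1
  have step : ∀ R > 0, ∫ x in Omega, k R x * (g x ^ 2 / ‖x‖ ^ 2) ≤
      2⁻¹ * (∫ x in Omega, g x ^ 2 / ‖x‖ ^ 2) + 2 * ∫ x in Omega, ‖fderiv ℝ g x‖ ^ 2 := by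
    intro R hR
    have hn : ContDiffOn ℝ 1 (fun x : E3 => ‖x‖) OmegaBar := fun x hx =>
      (contDiffAt_norm ℝ (norm_pos_iff.1 (zero_lt_one.trans_le hx))).contDiffWithinAt
    have hX : ContDiffOn ℝ 1 (fun x => cut R x * g x ^ 2 * ‖x‖) OmegaBar :=
      ((contDiff_cut R).contDiffOn.mul (hg.pow 2)).mul hn
    obtain ⟨i1, i2⟩ := integral_sphere_eq (R := 2 * R) hX fun x hx => by
      simp [cut_eq_zero hR hx]
    have hpt : ∀ x ∈ Omega, k R x * (g x ^ 2 / ‖x‖ ^ 2) ≤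
        fderiv ℝ (fun x => cut R x * g x ^ 2 * ‖x‖) x x / ‖x‖ ^ 3 +
          (2⁻¹ * (g x ^ 2 / ‖x‖ ^ 2) + 2 * ‖fderiv ℝ g x‖ ^ 2) := by
      intro x hx
      have hx0 : 0 < ‖x‖ := zero_lt_one.trans hx
      have dg : HasFDerivAt g (fderiv ℝ g x) x :=
        ((hg.contDiffAt (OmegaBar_mem_nhds hx)).differentiableAt one_ne_zero).hasFDerivAt
      have dc : HasFDerivAt (cut R) (fderiv ℝ (cut R) x) x :=
        ((contDiff_cut (n := 1) R).differentiable one_ne_zero x).hasFDerivAt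
      have dn : DifferentiableAt ℝ (fun x : E3 => ‖x‖) x :=
        (contDiffAt_norm ℝ (n := 1) (norm_pos_iff.1 hx0)).differentiableAt one_ne_zero
      have e : fderiv ℝ (fun x => cut R x * g x ^ 2 * ‖x‖) x x / ‖x‖ ^ 3 =
          cut R x * (g x ^ 2 / ‖x‖ ^ 2) + 2 * cut R x * g x * fderiv ℝ g x x / ‖x‖ ^ 2 +
          fderiv ℝ (cut R) x x * (g x ^ 2 / ‖x‖ ^ 2) := by
        have := ((dc.mul (dg.pow 2)).mul dn.hasFDerivAt).fderiv
        simp only [Pi.mul_def] at this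
        rw [this]
        simp [dn.fderiv_norm_self]
        field_simp
        ring
      have a3 : |2 * cut R x * g x * fderiv ℝ g x x / ‖x‖ ^ 2| ≤
          2⁻¹ * (g x ^ 2 / ‖x‖ ^ 2) + 2 * ‖fderiv ℝ g x‖ ^ 2 := by
        rw [abs_div, abs_of_pos (by positivity : 0 < ‖x‖ ^ 2), div_le_iff₀ (by positivity)]
        have : (2⁻¹ * (g x ^ 2 / ‖x‖ ^ 2) + 2 * ‖fderiv ℝ g x‖ ^ 2) * ‖x‖ ^ 2 =
          2⁻¹ * g x ^ 2 + 2 * (‖fderiv ℝ g x‖ * ‖x‖) ^ 2 := by field_simp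
        have k0 := cut_nonneg R x
        rw [this, abs_mul, abs_mul, abs_of_nonneg (by positivity : 0 ≤ 2 * cut R x)]
        have b2 : |g x| * |fderiv ℝ g x x| ≤ |g x| * (‖fderiv ℝ g x‖ * ‖x‖) :=
          mul_le_mul_of_nonneg_left (abs_clm_apply_le (fderiv ℝ g x) x) (abs_nonneg _)
        have b3 : cut R x * (|g x| * |fderiv ℝ g x x|) ≤ |g x| * |fderiv ℝ g x x| :=
          mul_le_of_le_one_left (by positivity) (cut_le_one R x)
        nlinarith [sq_nonneg (|g x| - 2 * (‖fderiv ℝ g x‖ * ‖x‖)), sq_abs (g x)]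
      have a5 := mul_le_mul_of_nonneg_right (neg_abs_le (fderiv ℝ (cut R) x x))
        (by positivity : 0 ≤ g x ^ 2 / ‖x‖ ^ 2)
      rw [e, sub_mul]
      have := neg_abs_le (2 * cut R x * g x * fderiv ℝ g x x / ‖x‖ ^ 2)
      linarith
    have irhs := (h1.const_mul 2⁻¹).add (h2.const_mul 2)
    have hs : 0 ≤ ∫ w, cut R w * g w ^ 2 * ‖(w : E3)‖ ∂sph :=
      integral_nonneg fun w => mul_nonneg (mul_nonneg (cut_nonneg _ _) (sq_nonneg _))
        (norm_nonneg _)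
    refine (setIntegral_mono_on (h1.bdd_mul (hkm R).aestronglyMeasurable
      (Eventually.of_forall (hk R hR))) (i1.add irhs) measurableSet_Omega hpt).trans ?_
    rw [integral_add' i1 irhs, i2, integral_add' (h1.const_mul _) (h2.const_mul _),
      integral_const_mul, integral_const_mul]
    linarith
  have lim : Tendsto (fun n : ℕ => ∫ x in Omega, k (n + 1) x * (g x ^ 2 / ‖x‖ ^ 2)) atTop
      (𝓝 (∫ x in Omega, g x ^ 2 / ‖x‖ ^ 2)) := by
    refine tendsto_integral_of_dominated_convergence (fun x => (1 + C) * (g x ^ 2 / ‖x‖ ^ 2))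
      (fun n => (hkm _).aestronglyMeasurable.mul h1.1) (h1.const_mul _) ?_ ?_
    · refine fun n => Eventually.of_forall fun x => ?_
      rw [norm_mul, Real.norm_of_nonneg (by positivity : 0 ≤ g x ^ 2 / ‖x‖ ^ 2)]
      exact mul_le_mul_of_nonneg_right (hk _ (by positivity) x) (by positivity)
    · refine Eventually.of_forall fun x => tendsto_const_nhds.congr' ?_
      filter_upwards [eventually_ge_atTop ⌈‖x‖⌉₊] with n hn
      have : ‖x‖ < n + 1 := ((Nat.le_ceil _).trans (Nat.cast_le.2 hn)).trans_lt (by linarith)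
      simp [k, cut_eq_one (by positivity : (0 : ℝ) < n + 1) this.le,
        fderiv_cut_eq_zero (by positivity) this]
  linarith [le_of_tendsto lim (Eventually.of_forall fun n => step (n + 1) (by positivity))]

lemma finite_line_inter_sphere (x : E3) {d : E3} (hd : d ≠ 0) :
    {t : ℝ | ‖x + t • d‖ = 1}.Finite := by
  classical
  set p : Polynomial ℝ := Polynomial.C (‖d‖ ^ 2) * Polynomial.X ^ 2 +
    Polynomial.C (2 * inner ℝ x d) * Polynomial.X + Polynomial.C (‖x‖ ^ 2 - 1)
  have hp : p ≠ 0 := by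
    intro h
    have : p.coeff 2 = ‖d‖ ^ 2 := by
      simp only [p, Polynomial.coeff_add, Polynomial.coeff_C_mul, Polynomial.coeff_X_pow,
        Polynomial.coeff_X, Polynomial.coeff_C]
      norm_num
    rw [h] at this
    simp only [Polynomial.coeff_zero] at this
    exact hd (norm_eq_zero.1 (pow_eq_zero_iff two_ne_zero |>.1 this.symm))
  refine (p.roots.toFinset.finite_toSet).subset fun t ht => ?_
  have ht : ‖x + t • d‖ = 1 := ht
  simp only [Finset.mem_coe, Multiset.mem_toFinset, Polynomial.mem_roots hp, Polynomial.IsRoot]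
  have := norm_add_sq_real x (t • d)
  rw [ht, inner_smul_right, norm_smul, mul_pow, Real.norm_eq_abs, sq_abs] at this
  simp only [p, Polynomial.eval_add, Polynomial.eval_mul, Polynomial.eval_C, Polynomial.eval_pow,
    Polynomial.eval_X]
  linarith

lemma lipschitzWith_of_off_sphere {w : E3 → ℝ} (hw : Continuous w) {M : ℝ≥0}
    (hd : ∀ x, ‖x‖ ≠ 1 → DifferentiableAt ℝ w x) (hM : ∀ x, ‖x‖ ≠ 1 → ‖fderiv ℝ w x‖ ≤ M) :
    LipschitzWith M w := by
  refine LipschitzWith.of_dist_le_mul fun y x => ?_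
  rcases eq_or_ne y x with rfl | hne
  · simp
  set d := y - x
  have hd0 : d ≠ 0 := sub_ne_zero.2 hne
  set s : Set ℝ := {t | ‖x + t • d‖ = 1}
  have hs : s.Finite := finite_line_inter_sphere x hd0
  set h : ℝ → ℝ := fun t => w (x + t • d)
  have hder : ∀ t, t ∉ s → HasDerivAt h (fderiv ℝ w (x + t • d) d) t := by
    intro t ht
    have h1 : HasDerivAt (fun t : ℝ => x + t • d) d t := by
      simpa using ((hasDerivAt_id t).smul_const d).const_add x
    exact (hd _ ht).hasFDerivAt.comp_hasDerivAt t h1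
  set f' : ℝ → ℝ := sᶜ.indicator (deriv h)
  have hb : ∀ t, ‖f' t‖ ≤ M * ‖d‖ := by
    intro t
    by_cases ht : t ∈ s
    · simp only [f']; rw [indicator_of_notMem (by simpa using ht)]; simp; positivity
    · simp only [f']; rw [indicator_of_mem (by exact ht), (hder t ht).deriv]
      exact ((fderiv ℝ w (x + t • d)).le_opNorm d).trans (mul_le_mul_of_nonneg_right (hM _ ht)
        (norm_nonneg _))
  have hm : Measurable f' := (measurable_deriv h).indicator hs.measurableSet.compl
  have key := integral_eq_of_hasDerivAt_off_countable_of_le h f' zero_le_one hs.countable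
    (by fun_prop) (fun t ht => by
      have : t ∉ s := ht.2
      simp only [f']; rw [indicator_of_mem (by exact this), (hder t this).deriv]; exact hder t this)
    ((intervalIntegrable_const (c := M * ‖d‖)).mono_fun hm.aestronglyMeasurable
      (Eventually.of_forall fun t => by
        rw [Real.norm_of_nonneg (by positivity : 0 ≤ M * ‖d‖)]; exact hb t))
  have e : h 1 - h 0 = w y - w x := by simp [h, d]
  rw [dist_eq_norm, dist_eq_norm, ← e, ← key]
  simpa using intervalIntegral.norm_integral_le_of_norm_le_const (a := 0) (b := 1)
    (fun t _ => hb t)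

lemma integral_fderiv_eq_zero_of_off_sphere {w : E3 → ℝ} (hw : Continuous w)
    (hc : HasCompactSupport w) {M : ℝ≥0}
    (hd : ∀ x, ‖x‖ ≠ 1 → DifferentiableAt ℝ w x) (hM : ∀ x, ‖x‖ ≠ 1 → ‖fderiv ℝ w x‖ ≤ M)
    (v : E3) : ∫ x, fderiv ℝ w x v = 0 := by
  have h1 := LipschitzWith.integral_lineDeriv_mul_eq (μ := (volume : Measure E3)) (C := 0)
    (LipschitzWith.const (1 : ℝ)) (lipschitzWith_of_off_sphere hw hd hM) hc (-v)
  simp only [neg_neg, mul_one] at h1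
  have h2 : ∫ x, lineDeriv ℝ w x v = ∫ x, fderiv ℝ w x v := by
    refine integral_congr_ae ?_
    have : ∀ᵐ x : E3, x ∉ sphere (0 : E3) 1 :=
      measure_eq_zero_iff_ae_notMem.1 (Measure.addHaar_sphere _ _ _)
    filter_upwards [this] with x hx
    exact (hd x (by simpa using hx)).lineDeriv_eq_fderiv
  rw [← h2, ← h1]
  simp [lineDeriv]

/-- Inversion in the unit sphere. -/
def kel (x : E3) : E3 := (‖x‖ ^ 2)⁻¹ • x

lemma norm_kel {x : E3} (hx : x ≠ 0) : ‖kel x‖ = ‖x‖⁻¹ := by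
  have := norm_pos_iff.2 hx
  rw [kel, norm_smul, norm_inv, norm_pow, norm_norm]; field_simp

lemma kel_ne_zero {x : E3} (hx : x ≠ 0) : kel x ≠ 0 := by
  rw [← norm_pos_iff, norm_kel hx]; exact inv_pos.2 (norm_pos_iff.2 hx)

lemma kel_kel {x : E3} (hx : x ≠ 0) : kel (kel x) = x := by
  have := norm_pos_iff.2 hx
  rw [kel, norm_kel hx, kel, smul_smul]
  have : ((‖x‖⁻¹ ^ 2)⁻¹ * (‖x‖ ^ 2)⁻¹) = 1 := by field_simp
  rw [this, one_smul]

lemma kel_eq_self {x : E3} (hx : ‖x‖ = 1) : kel x = x := by simp [kel, hx]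

/-- The derivative of the inversion. -/
def kelD (x : E3) : E3 →L[ℝ] E3 :=
  (‖x‖ ^ 2)⁻¹ • (ContinuousLinearMap.id ℝ E3 -
    (2 * (‖x‖ ^ 2)⁻¹) • (innerSL ℝ x).smulRight x)

lemma kelD_apply (x h : E3) : kelD x h =
    (‖x‖ ^ 2)⁻¹ • (h - (2 * (‖x‖ ^ 2)⁻¹ * inner ℝ x h) • x) := by
  simp [kelD, smul_smul]

lemma hasFDerivAt_kel {x : E3} (hx : x ≠ 0) : HasFDerivAt kel (kelD x) x := by
  have hx0 : ‖x‖ ^ 2 ≠ 0 := by have := norm_pos_iff.2 hx; positivity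
  have h1 : HasFDerivAt (fun y : E3 => (‖y‖ ^ 2)⁻¹) _ x :=
    (hasDerivAt_inv hx0).comp_hasFDerivAt x (hasStrictFDerivAt_norm_sq x).hasFDerivAt
  have h2 := h1.smul (hasFDerivAt_id x)
  refine h2.congr_fderiv ?_
  ext1 h
  simp only [kelD_apply, id]
  simp [smul_smul, smul_sub]
  rw [sub_eq_add_neg, ← neg_smul]
  congr 1
  rw [← neg_smul]
  congr 1
  field_simp

lemma abs_det_kelD {x : E3} (hx : x ≠ 0) : |(kelD x).det| = (‖x‖ ^ 6)⁻¹ := by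
  have hx0 := norm_pos_iff.2 hx
  have e : EuclideanGeometry.inversion (0 : E3) 1 = kel := by
    funext y; simp [EuclideanGeometry.inversion, kel, inv_pow]
  have h1 := EuclideanGeometry.hasFDerivAt_inversion (R := 1) hx
  rw [e] at h1
  rw [(hasFDerivAt_kel hx).unique h1]
  rw [ContinuousLinearMap.det]
  simp only [ContinuousLinearMap.toLinearMap_smul, LinearMap.det_smul, finrank_E3]
  have := Submodule.det_reflection (ℝ ∙ (x - 0))ᗮ
  rw [abs_mul]
  have h3 : |LinearMap.det (((ℝ ∙ (x - 0))ᗮ.reflection : E3 →L[ℝ] E3) : E3 →ₗ[ℝ] E3)| = 1 := by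
    erw [this]; simp
  erw [h3]
  simp
  rw [← pow_mul]

lemma image_kel_Omega : kel '' Omega = {x : E3 | x ≠ 0 ∧ ‖x‖ < 1} := by
  ext y
  constructor
  · rintro ⟨x, hx, rfl⟩
    have hx1 : 1 < ‖x‖ := hx
    have hx0 : x ≠ 0 := norm_pos_iff.1 (zero_lt_one.trans hx1)
    exact ⟨kel_ne_zero hx0, by rw [norm_kel hx0]; exact inv_lt_one_of_one_lt₀ hx1⟩
  · rintro ⟨h0, h1⟩
    refine ⟨kel y, ?_, kel_kel h0⟩
    change 1 < ‖kel y‖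
    rw [norm_kel h0]; exact (one_lt_inv₀ (norm_pos_iff.2 h0)).2 h1

lemma ne_zero_of_Omega {x : E3} (hx : x ∈ Omega) : x ≠ 0 :=
  norm_pos_iff.1 (zero_lt_one.trans (show 1 < ‖x‖ from hx))

lemma injOn_kel : InjOn kel Omega := fun x hx y hy h => by
  rw [← kel_kel (ne_zero_of_Omega hx), h, kel_kel (ne_zero_of_Omega hy)]

lemma integrableOn_kel_iff (H : E3 → ℝ) :
    IntegrableOn H {x | x ≠ 0 ∧ ‖x‖ < 1} ↔
      IntegrableOn (fun x => (‖x‖ ^ 6)⁻¹ * H (kel x)) Omega := by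
  rw [← image_kel_Omega, integrableOn_image_iff_integrableOn_abs_det_fderiv_smul volume
    measurableSet_Omega (fun x hx => (hasFDerivAt_kel (ne_zero_of_Omega hx)).hasFDerivWithinAt)
    injOn_kel]
  refine integrableOn_congr_fun (fun x hx => ?_) measurableSet_Omega
  simp only [abs_det_kelD (ne_zero_of_Omega hx), smul_eq_mul]

lemma integral_kel (H : E3 → ℝ) :
    ∫ x in {x | x ≠ 0 ∧ ‖x‖ < 1}, H x = ∫ x in Omega, (‖x‖ ^ 6)⁻¹ * H (kel x) := by
  rw [← image_kel_Omega, integral_image_eq_integral_abs_det_fderiv_smul volume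
    measurableSet_Omega (fun x hx => (hasFDerivAt_kel (ne_zero_of_Omega hx)).hasFDerivWithinAt)
    injOn_kel]
  refine setIntegral_congr_fun measurableSet_Omega (fun x hx => ?_)
  simp only [abs_det_kelD (ne_zero_of_Omega hx), smul_eq_mul]

lemma measurableSet_punctured : MeasurableSet {x : E3 | x ≠ 0 ∧ ‖x‖ < 1} :=
  (measurableSet_singleton (0 : E3)).compl.inter (measurableSet_lt measurable_norm measurable_const)

lemma ae_Omega_or : ∀ᵐ x : E3, x ∈ Omega ∪ {x : E3 | x ≠ 0 ∧ ‖x‖ < 1} := by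
  have : ∀ᵐ x : E3, x ∉ sphere (0 : E3) 1 :=
    measure_eq_zero_iff_ae_notMem.1 (Measure.addHaar_sphere _ _ _)
  have h0 : ∀ᵐ x : E3, x ≠ 0 := ae_ne_zero
  filter_upwards [this, h0] with x hx hx0
  rcases lt_trichotomy ‖x‖ 1 with h | h | h
  · exact Or.inr ⟨hx0, h⟩
  · exact absurd (by simpa using h) hx
  · exact Or.inl h

lemma integrable_iff_refl (H : E3 → ℝ) : Integrable H ↔
    IntegrableOn H Omega ∧ IntegrableOn (fun x => (‖x‖ ^ 6)⁻¹ * H (kel x)) Omega := by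
  rw [← integrableOn_kel_iff, ← integrableOn_union, ← integrableOn_univ]
  refine integrableOn_congr_set_ae ?_
  filter_upwards [ae_Omega_or] with x hx
  exact propext ⟨fun _ => hx, fun _ => trivial⟩

lemma integral_eq_refl {H : E3 → ℝ} (hH : Integrable H) :
    ∫ x, H x = ∫ x in Omega, (H x + (‖x‖ ^ 6)⁻¹ * H (kel x)) := by
  obtain ⟨h1, h2⟩ := (integrable_iff_refl H).1 hH
  rw [integral_add h1 h2, ← integral_kel, ← setIntegral_union ?_ measurableSet_punctured h1
    ((integrableOn_kel_iff H).2 h2), ← setIntegral_univ]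
  · refine setIntegral_congr_set ?_
    filter_upwards [ae_Omega_or] with x hx
    exact propext ⟨fun _ => hx, fun _ => trivial⟩
  · refine disjoint_left.2 fun x hx hx' => ?_
    exact absurd hx'.2 (not_lt.2 (le_of_lt hx))

/-- Glues a function on the exterior domain with the pull-back of another one under inversion. -/
def hat (h h' : E3 → ℝ) (y : E3) : ℝ :=
  if 1 < ‖y‖ then h y else if 1 / 2 ≤ ‖y‖ ∧ ‖y‖ < 1 then h' (kel y) else 0

lemma hat_of_mem {h h' : E3 → ℝ} {x : E3} (hx : x ∈ Omega) : hat h h' x = h x := by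
  rw [hat, if_pos (show 1 < ‖x‖ from hx)]

lemma hat_kel {h h' : E3 → ℝ} {x : E3} (hx : x ∈ Omega) (h2 : 1 / 2 ≤ ‖kel x‖) :
    hat h h' (kel x) = h' x := by
  have hx1 : 1 < ‖x‖ := hx
  have : ‖kel x‖ < 1 := by
    rw [norm_kel (ne_zero_of_Omega hx)]; exact inv_lt_one_of_one_lt₀ hx1
  rw [hat, if_neg (not_lt.2 this.le), if_pos ⟨h2, this⟩, kel_kel (ne_zero_of_Omega hx)]

lemma measurable_kel : Measurable kel := by unfold kel; fun_prop

lemma measurable_hat {h h' : E3 → ℝ} (mh : Measurable h) (mh' : Measurable h') :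
    Measurable (hat h h') := by
  refine Measurable.ite (measurableSet_lt measurable_const measurable_norm) mh
    (Measurable.ite ?_ (mh'.comp measurable_kel) measurable_const)
  exact (measurableSet_le measurable_const measurable_norm).inter
    (measurableSet_lt measurable_norm measurable_const)

lemma hat_mul_kel {h h' a : E3 → ℝ} (ha : ∀ x, ‖x‖ < 1 / 2 → a x = 0) {x : E3} (hx : x ∈ Omega) :
    hat h h' (kel x) * a (kel x) = h' x * a (kel x) := by
  by_cases h2 : 1 / 2 ≤ ‖kel x‖
  · rw [hat_kel hx h2]
  · rw [ha _ (not_le.1 h2)]; simp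

lemma integrable_hat_mul {h h' a : E3 → ℝ} (ha : ∀ x, ‖x‖ < 1 / 2 → a x = 0)
    (i1 : IntegrableOn (fun x => h x * a x) Omega)
    (i2 : IntegrableOn (fun x => (‖x‖ ^ 6)⁻¹ * (h' x * a (kel x))) Omega) :
    Integrable (fun x => hat h h' x * a x) := by
  rw [integrable_iff_refl]
  refine ⟨i1.congr_fun (fun x hx => ?_) measurableSet_Omega,
    i2.congr_fun (fun x hx => ?_) measurableSet_Omega⟩
  · simp only [hat_of_mem hx]
  · simp only [hat_mul_kel ha hx]

lemma integral_hat_mul {h h' a : E3 → ℝ} (ha : ∀ x, ‖x‖ < 1 / 2 → a x = 0)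
    (i1 : IntegrableOn (fun x => h x * a x) Omega)
    (i2 : IntegrableOn (fun x => (‖x‖ ^ 6)⁻¹ * (h' x * a (kel x))) Omega) :
    ∫ x, hat h h' x * a x = ∫ x in Omega, (h x * a x + (‖x‖ ^ 6)⁻¹ * (h' x * a (kel x))) := by
  rw [integral_eq_refl (integrable_hat_mul ha i1 i2)]
  refine setIntegral_congr_fun measurableSet_Omega fun x hx => ?_
  simp only [hat_of_mem hx, hat_mul_kel ha hx]

/-- A function with square dominated by an integrable function plus a constant is integrable
against bounded functions of bounded support. -/
lemma integrableOn_mul_of_sq_le {F a A : E3 → ℝ} (mF : Measurable F) (ma : Measurable a)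
    (hA : Integrable A) {C K R : ℝ} (bF : ∀ x, F x ^ 2 ≤ A x + C)
    (ba : ∀ x ∈ Omega, |a x| ≤ K) (hR : ∀ x, R < ‖x‖ → a x = 0) :
    IntegrableOn (fun x => F x * a x) Omega := by
  have h0 : ∀ x, 0 ≤ A x + C := fun x => (sq_nonneg _).trans (bF x)
  have hdom : IntegrableOn (fun x => (closedBall (0 : E3) R).indicator
      (fun x => (1 + (A x + C)) * |K|) x) Omega := by
    refine Integrable.integrableOn ?_
    rw [integrable_indicator_iff measurableSet_closedBall]
    refine Integrable.mul_const ?_ _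
    refine (integrableOn_const (measure_closedBall_lt_top).ne).add
      (hA.integrableOn.add (integrableOn_const (measure_closedBall_lt_top).ne))
  refine hdom.mono' (mF.mul ma).aestronglyMeasurable ?_
  refine (ae_restrict_mem measurableSet_Omega).mono fun x hx => ?_
  rcases lt_or_ge R ‖x‖ with h | h
  · rw [hR x h, indicator_of_notMem (by simpa using h)]; simp
  · rw [indicator_of_mem (by simpa using h), norm_mul, Real.norm_eq_abs, Real.norm_eq_abs]
    refine mul_le_mul ?_ ((ba x hx).trans (le_abs_self _)) (abs_nonneg _) (by linarith [h0 x])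
    nlinarith [bF x, sq_abs (F x), sq_nonneg (|F x| - 1), abs_nonneg (F x)]

/-- Bounded measurable functions (on the exterior domain) of bounded support. -/
structure BS (a : E3 → ℝ) : Prop where
  meas : Measurable a
  bdd : ∃ K, ∀ x ∈ Omega, |a x| ≤ K
  far : ∃ R, ∀ x, R < ‖x‖ → a x = 0

/-- Measurable functions that are locally bounded on the closed exterior domain. -/
structure LB (m : E3 → ℝ) : Prop where
  meas : Measurable m
  bdd : ∀ R, ∃ K, ∀ x ∈ Omega, ‖x‖ ≤ R → |m x| ≤ K

/-- Functions integrable against all members of `BS`. -/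
def LI (h : E3 → ℝ) : Prop := ∀ a, BS a → IntegrableOn (fun x => h x * a x) Omega

lemma LB.of_continuousOn {m : E3 → ℝ} (h1 : Measurable m) (h2 : ContinuousOn m OmegaBar) :
    LB m := by
  refine ⟨h1, fun R => ?_⟩
  obtain ⟨K, hK⟩ := (isCompact_annulus R).exists_bound_of_continuousOn (h2.mono inter_subset_left)
  exact ⟨K, fun x hx hR => hK x ⟨Omega_subset hx, by simpa using hR⟩⟩

lemma LB.of_continuousAt {m : E3 → ℝ} (h1 : Measurable m) (h2 : ∀ x, x ≠ 0 → ContinuousAt m x) :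
    LB m :=
  .of_continuousOn h1 fun x hx => (h2 x (norm_pos_iff.1
    (zero_lt_one.trans_le (show 1 ≤ ‖x‖ from hx)))).continuousWithinAt

lemma LB.of_bounded {m : E3 → ℝ} (h1 : Measurable m) {M : ℝ} (h2 : ∀ x, |m x| ≤ M) : LB m :=
  ⟨h1, fun _ => ⟨M, fun x _ _ => h2 x⟩⟩

lemma LB.coord (i : Fin 3) : LB fun x : E3 => x i :=
  .of_continuousAt (by fun_prop) fun _ _ => by fun_prop

lemma LB.pow (n : ℕ) : LB fun x : E3 => ‖x‖ ^ n :=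
  .of_continuousAt (by fun_prop) fun _ _ => by fun_prop

lemma LB.inv_pow (n : ℕ) : LB fun x : E3 => (‖x‖ ^ n)⁻¹ :=
  .of_continuousAt (by fun_prop) fun x h => by
    have := norm_ne_zero_iff.2 h
    fun_prop (disch := positivity)

lemma LB.const (c : ℝ) : LB fun _ : E3 => c := .of_bounded measurable_const fun _ => le_rfl

lemma LB.mul {m m' : E3 → ℝ} (h : LB m) (h' : LB m') : LB fun x => m x * m' x := by
  refine ⟨h.meas.mul h'.meas, fun R => ?_⟩
  obtain ⟨K, hK⟩ := h.bdd R
  obtain ⟨K', hK'⟩ := h'.bdd R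
  refine ⟨|K| * |K'|, fun x hx hR => ?_⟩
  rw [abs_mul]
  exact mul_le_mul ((hK x hx hR).trans (le_abs_self _)) ((hK' x hx hR).trans (le_abs_self _))
    (abs_nonneg _) (abs_nonneg _)

lemma LB.add {m m' : E3 → ℝ} (h : LB m) (h' : LB m') : LB fun x => m x + m' x := by
  refine ⟨h.meas.add h'.meas, fun R => ?_⟩
  obtain ⟨K, hK⟩ := h.bdd R
  obtain ⟨K', hK'⟩ := h'.bdd R
  exact ⟨K + K', fun x hx hR => (abs_add_le _ _).trans (add_le_add (hK x hx hR) (hK' x hx hR))⟩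

lemma BS.mul {m a : E3 → ℝ} (ha : BS a) (hm : LB m) : BS fun x => m x * a x := by
  obtain ⟨h1, ⟨K, hK⟩, ⟨R, hR⟩⟩ := ha
  obtain ⟨K', hK'⟩ := hm.bdd R
  refine ⟨hm.meas.mul h1, ⟨|K'| * |K|, fun x hx => ?_⟩, ⟨R, fun x hx => by rw [hR x hx, mul_zero]⟩⟩
  rcases lt_or_ge R ‖x‖ with h | h
  · rw [hR x h]; simp; positivity
  · rw [abs_mul]
    exact mul_le_mul ((hK' x hx h).trans (le_abs_self _)) ((hK x hx).trans (le_abs_self _))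
      (abs_nonneg _) (abs_nonneg _)

lemma BS.add {a b : E3 → ℝ} (ha : BS a) (hb : BS b) : BS fun x => a x + b x := by
  obtain ⟨h1, ⟨K, hK⟩, ⟨R, hR⟩⟩ := ha
  obtain ⟨h1', ⟨K', hK'⟩, ⟨R', hR'⟩⟩ := hb
  refine ⟨h1.add h1', ⟨K + K', fun x hx => (abs_add_le _ _).trans (add_le_add (hK x hx) (hK' x hx))⟩,
    ⟨max R R', fun x hx => ?_⟩⟩
  rw [hR x ((le_max_left _ _).trans_lt hx), hR' x ((le_max_right _ _).trans_lt hx), add_zero]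

lemma BS.of_test {r : ℝ} {k : E3 → ℝ} (hk : IsTest r k) : BS k := by
  obtain ⟨K, -, hK⟩ := exists_abs_bound hk.1.continuous hk.2.1
  obtain ⟨R, hR⟩ := hk.2.1.isCompact.isBounded.subset_closedBall (0 : E3)
  refine ⟨hk.1.continuous.measurable, ⟨K, fun x _ => hK x⟩, ⟨R, fun x hx => ?_⟩⟩
  by_contra h
  have := hR (subset_tsupport k (Function.mem_support.2 h))
  rw [mem_closedBall_zero_iff] at this
  linarith

lemma norm_kel_lt {x : E3} (hx : 2 < ‖x‖) : ‖kel x‖ < 1 / 2 := by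
  rw [norm_kel (norm_pos_iff.1 (by linarith)), one_div]
  exact inv_strictAnti₀ two_pos hx

lemma BS.of_test_kel {k : E3 → ℝ} (hk : IsTest (1 / 2) k) : BS fun x => k (kel x) := by
  obtain ⟨K, -, hK⟩ := exists_abs_bound hk.1.continuous hk.2.1
  exact ⟨hk.1.continuous.measurable.comp measurable_kel, ⟨K, fun x _ => hK _⟩,
    ⟨2, fun x hx => hk.2.2 _ (norm_kel_lt hx).le⟩⟩

lemma LI.add {h h' : E3 → ℝ} (i : LI h) (i' : LI h') : LI fun x => h x + h' x := fun a ha =>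
  ((i a ha).add (i' a ha)).congr (Eventually.of_forall fun _ => (add_mul _ _ _).symm)

lemma LI.sub {h h' : E3 → ℝ} (i : LI h) (i' : LI h') : LI fun x => h x - h' x := fun a ha =>
  ((i a ha).sub (i' a ha)).congr (Eventually.of_forall fun _ => (sub_mul _ _ _).symm)

lemma LI.sum {ι : Type*} {s : Finset ι} {h : ι → E3 → ℝ} (i : ∀ j ∈ s, LI (h j)) :
    LI fun x => ∑ j ∈ s, h j x := fun a ha => by
  simp only [Finset.sum_mul]
  exact integrable_finsetSum _ fun j hj => i j hj a ha

lemma LI.mul {h m : E3 → ℝ} (i : LI h) (hm : LB m) : LI fun x => m x * h x := fun a ha =>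
  (i _ (ha.mul hm)).congr (Eventually.of_forall fun x => by ring)

lemma LI.of_sq_le {F A : E3 → ℝ} (mF : Measurable F) (hA : Integrable A) {C : ℝ}
    (bF : ∀ x, F x ^ 2 ≤ A x + C) : LI F := fun _ ⟨h1, ⟨_, hK⟩, ⟨_, hR⟩⟩ =>
  integrableOn_mul_of_sq_le mF h1 hA bF hK hR

lemma LI.of_bounded {F : E3 → ℝ} (mF : Measurable F) {M : ℝ} (h : ∀ x, |F x| ≤ M) : LI F :=
  .of_sq_le mF (integrable_zero _ _ _) (C := M ^ 2)
    fun x => by simpa using sq_le_sq' (abs_le.1 (h x)).1 (abs_le.1 (h x)).2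

/-- Reflection of a vector field under the inversion. -/
def kref (σ : ℝ) (F : Fin 3 → E3 → ℝ) (j : Fin 3) (x : E3) : ℝ :=
  σ * ‖x‖ ^ 2 * (F j x - 2 * (‖x‖ ^ 2)⁻¹ * x j * ∑ i, x i * F i x)

lemma abs_coord_le (x : E3) (i : Fin 3) : |x i| ≤ ‖x‖ := by
  simpa using PiLp.norm_apply_le x i

lemma norm_sq_eq_sum (x : E3) : ‖x‖ ^ 2 = ∑ i, x i ^ 2 := by
  rw [EuclideanSpace.norm_sq_eq]; simp

lemma abs_sum_coord_mul_le (x : E3) (f : Fin 3 → ℝ) :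
    |∑ i, x i * f i| ≤ ‖x‖ * ∑ i, |f i| := by
  rw [Finset.mul_sum]
  refine (Finset.abs_sum_le_sum_abs _ _).trans (Finset.sum_le_sum fun i _ => ?_)
  rw [abs_mul]
  exact mul_le_mul_of_nonneg_right (abs_coord_le x i) (abs_nonneg _)

lemma sum_sq_kref {σ : ℝ} (hσ : σ * σ = 1) (F : Fin 3 → E3 → ℝ) {x : E3} (hx : x ≠ 0) :
    ∑ i, kref σ F i x ^ 2 = ‖x‖ ^ 4 * ∑ i, F i x ^ 2 := by
  have h : ∀ i, kref σ F i x = σ * (‖x‖ ^ 2 * F i x - 2 * x i * ∑ i, x i * F i x) := fun i => by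
    have := norm_pos_iff.2 hx
    rw [kref]
    field_simp
  have hn := norm_sq_eq_sum x
  simp only [h, Fin.sum_univ_three] at hn ⊢
  rw [show ‖x‖ ^ 4 = (‖x‖ ^ 2) ^ 2 by ring, hn]
  linear_combination (exp := 1) (((x 0 ^ 2 + x 1 ^ 2 + x 2 ^ 2) ^ 2) *
    (F 0 x ^ 2 + F 1 x ^ 2 + F 2 x ^ 2)) * hσ

lemma sum_abs_le_kref {σ : ℝ} (hσ : σ * σ = 1) (F : Fin 3 → E3 → ℝ) {x : E3} (hx : x ∈ Omega) :
    ∑ i, |F i x| ≤ 2 * ∑ i, |kref σ F i x| := by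
  have h1 : (∑ i, |F i x|) ^ 2 ≤ 3 * ∑ i, F i x ^ 2 := by
    simpa using sq_sum_le_card_mul_sum_sq (s := Finset.univ) (f := fun i => |F i x|)
  have h2 := Finset.sum_sq_le_sq_sum_of_nonneg (s := Finset.univ) (f := fun i => |kref σ F i x|)
    (fun _ _ => abs_nonneg _)
  simp only [sq_abs, sum_sq_kref hσ F (ne_zero_of_Omega hx)] at h2
  have h3 : ∑ i, F i x ^ 2 ≤ ‖x‖ ^ 4 * ∑ i, F i x ^ 2 :=
    le_mul_of_one_le_left (Finset.sum_nonneg fun _ _ => sq_nonneg _)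
      (one_le_pow₀ (le_of_lt hx))
  exact le_of_sq_le_sq (by nlinarith) (by positivity)

lemma measurable_kref {σ : ℝ} {F : Fin 3 → E3 → ℝ} (mF : ∀ i, Measurable (F i)) (j : Fin 3) :
    Measurable (kref σ F j) := by
  unfold kref
  have : ∀ i, Measurable (F i) := mF
  fun_prop

lemma fderiv_kref_test {σ : ℝ} {k : E3 → ℝ} (hk : Differentiable ℝ k) {x : E3} (hx : x ≠ 0)
    (i : Fin 3) :
    fderiv ℝ (fun x => k x + σ * ((‖x‖ ^ 2)⁻¹ * k (kel x))) x (ek i) =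
      fderiv ℝ k x (ek i) + σ * ((‖x‖ ^ 4)⁻¹ * (fderiv ℝ k (kel x) (ek i) -
        2 * (‖x‖ ^ 2)⁻¹ * x i * ∑ j, x j * fderiv ℝ k (kel x) (ek j)) -
        2 * (‖x‖ ^ 4)⁻¹ * x i * k (kel x)) := by
  have hx0 : ‖x‖ ^ 2 ≠ 0 := by have := norm_pos_iff.2 hx; positivity
  have h1 : HasFDerivAt (fun y : E3 => (‖y‖ ^ 2)⁻¹) _ x :=
    (hasDerivAt_inv hx0).comp_hasFDerivAt x (hasStrictFDerivAt_norm_sq x).hasFDerivAt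
  have h2 : HasFDerivAt (fun y => k (kel y)) _ x :=
    (hk (kel x)).hasFDerivAt.comp x (hasFDerivAt_kel hx)
  have h3 := ((hk x).hasFDerivAt.add ((h1.mul h2).const_mul σ)).fderiv
  simp only [Pi.add_def, Pi.mul_def] at h3
  rw [h3]
  have hin : inner ℝ x (ek i) = x i := by
    simp [ek, EuclideanSpace.inner_single_right]
  simp only [_root_.add_apply, _root_.smul_apply, ContinuousLinearMap.comp_apply, kelD_apply, hin,
    map_smul, map_sub, smul_eq_mul, clm_eq_sum (fderiv ℝ k (kel x)) x, innerSL_apply_apply, nsmul_eq_mul]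
  field_simp
  push_cast
  ring

/-- Regularity up to the unit sphere for weak solutions in the exterior domain with natural
(`σ = 1`) or homogeneous Dirichlet (`σ = -1`) boundary conditions. -/
theorem boundary_regularity {V p : E3 → ℝ} {F B : Fin 3 → E3 → ℝ} {σ M C : ℝ} {A : E3 → ℝ}
    (hσ : |σ| = 1) (mV : Measurable V) (mp : Measurable p)
    (mF : ∀ i, Measurable (F i)) (mB : ∀ i, Measurable (B i)) (bV : ∀ x, |V x| ≤ M)
    (bp : ∀ x, |p x| ≤ M) (bB : ∀ i x, |B i x| ≤ M) (hA : Integrable A)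
    (bF : ∀ x i, F i x ^ 2 ≤ A x + C)
    (hEL : ∀ ζ : E3 → ℝ, ContDiffOn ℝ 1 ζ OmegaBar → (∃ R, ∀ x, R ≤ ‖x‖ → ζ x = 0) →
      (σ = -1 → ∀ x, ‖x‖ = 1 → ζ x = 0) →
      ∫ x in Omega, ∑ i, F i x * fderiv ℝ ζ x (ek i) =
        ∫ x in Omega, (∑ i, B i x * F i x - p x) * ζ x)
    (hG : ∀ k, IsTest (1 / 2) k → ∀ j,
      ∫ x in Omega, (V x * (fderiv ℝ k x (ek j) + (‖x‖ ^ 6)⁻¹ * (σ * fderiv ℝ k (kel x) (ek j))) +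
        (F j x * k x + (‖x‖ ^ 6)⁻¹ * (kref σ F j x * k (kel x)))) = 0) :
    ∃ Φ : E3 → ℝ, ContDiff ℝ 1 Φ ∧
      ∀ᵐ x, x ∈ Omega → V x = Φ x ∧ ∀ i, F i x = fderiv ℝ Φ x (ek i) := by
  have hss : σ * σ = 1 := by rw [← abs_mul_abs_self, hσ, one_mul]
  have hM : 0 ≤ M := (abs_nonneg _).trans (bV 0)
  set Q : E3 → ℝ := fun x => ∑ i, B i x * F i x - p x with hQ
  set S : E3 → ℝ := fun x => ∑ i, x i * F i x with hS
  set Q' : E3 → ℝ := fun x => σ * ‖x‖ ^ 6 * ((‖x‖ ^ 2)⁻¹ * Q x + 2 * (‖x‖ ^ 4)⁻¹ * S x) with hQ'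
  have mQ : Measurable Q := by simp only [hQ]; fun_prop
  have mS : Measurable S := by simp only [hS]; fun_prop
  have mQ' : Measurable Q' := by simp only [hQ']; fun_prop
  set A1 : E3 → ℝ := fun x => max (∑ i, F i x ^ 2 - 3 * C) 0 with hA1d
  have mA1 : Measurable A1 := by simp only [hA1d]; fun_prop
  have hA10 : ∀ x, 0 ≤ A1 x := fun x => le_max_right _ _
  have hS1 : ∀ x, ∑ i, F i x ^ 2 ≤ A1 x + 3 * C := fun x => by
    have := le_max_left (∑ i, F i x ^ 2 - 3 * C) 0
    simp only [hA1d]; linarith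
  have hF1 : ∀ x i, F i x ^ 2 ≤ A1 x + 3 * C := fun x i =>
    (Finset.single_le_sum (f := fun i => F i x ^ 2) (fun _ _ => sq_nonneg _)
      (Finset.mem_univ i)).trans (hS1 x)
  have LF : ∀ i, LI (F i) := fun i => .of_sq_le (mF i) hA fun x => bF x i
  have LV : LI V := .of_bounded mV bV
  have LS : LI S := .sum fun i _ => (LF i).mul (LB.coord i)
  have LQ : LI Q := (LI.sum fun i _ => (LF i).mul (.of_bounded (mB i) (bB i))).sub
    (.of_bounded mp bp)
  have LQ' : LI Q' := ((LQ.mul (LB.inv_pow 2)).add (LS.mul (LB.mul (LB.const 2) (LB.inv_pow 4)))).mul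
    (LB.mul (LB.const σ) (LB.pow 6))
  have LR : ∀ j, LI (kref σ F j) := fun j => ((LF j).sub (LS.mul
    (LB.mul (LB.mul (LB.const 2) (LB.inv_pow 2)) (LB.coord j)))).mul (LB.mul (LB.const σ) (LB.pow 2))
  have lt_test : ∀ {k : E3 → ℝ}, IsTest (1 / 2) k → ∀ x, ‖x‖ < 1 / 2 → k x = 0 :=
    fun hk x hx => hk.2.2 x hx.le
  have hatI : ∀ {h h' k : E3 → ℝ}, LI h → LI h' → IsTest (1 / 2) k →
      Integrable (fun x => hat h h' x * k x) ∧
      IntegrableOn (fun x => h x * k x) Omega ∧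
      IntegrableOn (fun x => (‖x‖ ^ 6)⁻¹ * (h' x * k (kel x))) Omega ∧
      ∫ x, hat h h' x * k x = ∫ x in Omega, (h x * k x + (‖x‖ ^ 6)⁻¹ * (h' x * k (kel x))) := by
    intro h h' k Lh Lh' hk
    have i1 := Lh k (.of_test hk)
    have i2 : IntegrableOn (fun x => (‖x‖ ^ 6)⁻¹ * (h' x * k (kel x))) Omega :=
      (Lh' _ ((BS.of_test_kel hk).mul (LB.inv_pow 6))).congr (Eventually.of_forall fun x => by ring)
    exact ⟨integrable_hat_mul (lt_test hk) i1 i2, i1, i2, integral_hat_mul (lt_test hk) i1 i2⟩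
  have tF : ∀ {k : E3 → ℝ}, IsTest (1 / 2) k → ∀ j, IsTest (1 / 2) fun x => fderiv ℝ k x (ek j) :=
    fun hk j => hk.fderiv (by norm_num) (ek j)
  have hkel0 : ∀ {y : E3}, 1 / 2 ≤ ‖y‖ ∧ ‖y‖ < 1 → kel y ∈ Omega ∧ ‖kel y‖ ≤ 2 := by
    intro y hy
    have hy0 : y ≠ 0 := norm_pos_iff.1 (by linarith [hy.1])
    refine ⟨?_, ?_⟩
    · change 1 < ‖kel y‖
      rw [norm_kel hy0]; exact (one_lt_inv₀ (norm_pos_iff.2 hy0)).2 hy.2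
    · rw [norm_kel hy0]
      have := inv_anti₀ (by norm_num) hy.1
      norm_num at this ⊢; exact this
  have hsol : WeakSol (hat V fun x => σ * V x) (fun i => hat (F i) (kref σ F i)) (hat Q Q') := by
    refine ⟨measurable_hat mV (mV.const_mul _), fun i => measurable_hat (mF i) (measurable_kref mF i),
      measurable_hat mQ mQ', ⟨M, fun x => ?_⟩, ?_, ?_, fun k hk => ?_, fun k hk j => ?_⟩
    · unfold hat
      split_ifs
      · exact bV x
      · rw [abs_mul, hσ, one_mul]; exact bV _
      · simpa using hM
    · have hA1 : Integrable A1 := by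
        refine (hA.abs.const_mul 3).mono' mA1.aestronglyMeasurable (Eventually.of_forall fun x => ?_)
        rw [Real.norm_of_nonneg (hA10 x)]
        refine max_le ?_ (by positivity)
        have := Finset.sum_le_sum fun i (_ : i ∈ Finset.univ) => bF x i
        simp only [Finset.sum_const, Finset.card_univ, Fintype.card_fin, nsmul_eq_mul] at this
        have := le_abs_self (A x)
        push_cast at *
        linarith
      refine ⟨hat A1 fun x => 16 * A1 x, ?_, 16 * |3 * C|, fun x i => ?_⟩
      · rw [integrable_iff_refl]
        refine ⟨hA1.integrableOn.congr_fun (fun x hx => (hat_of_mem hx).symm)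
          measurableSet_Omega, ?_⟩
        refine (hA1.const_mul 16).integrableOn.mono' (((measurable_norm.pow_const 6).inv.mul
          ((measurable_hat mA1 (mA1.const_mul _)).comp measurable_kel)).aestronglyMeasurable) ?_
        refine (ae_restrict_mem measurableSet_Omega).mono fun x hx => ?_
        have hx1 : 1 < ‖x‖ := hx
        rw [norm_mul, norm_inv, norm_pow, norm_norm]
        refine (mul_le_of_le_one_left (norm_nonneg _)
          (inv_le_one_of_one_le₀ (one_le_pow₀ hx1.le))).trans ?_
        by_cases h2 : 1 / 2 ≤ ‖kel x‖
        · rw [hat_kel hx h2, Real.norm_of_nonneg (mul_nonneg (by norm_num) (hA10 x))]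
        · have : ‖kel x‖ < 1 := by linarith [not_le.1 h2]
          rw [hat, if_neg (not_lt.2 this.le), if_neg (by tauto), norm_zero]
          exact mul_nonneg (by norm_num) (hA10 x)
      · unfold hat
        split_ifs with h1 h2
        · exact (hF1 x i).trans (by linarith [le_abs_self (3 * C), abs_nonneg (3 * C)])
        · obtain ⟨hk1, hk2⟩ := hkel0 h2
          have hk1' : 1 < ‖kel x‖ := hk1
          have b1 := Finset.single_le_sum (f := fun i => kref σ F i (kel x) ^ 2)
            (fun _ _ => sq_nonneg _) (Finset.mem_univ i)
          rw [sum_sq_kref hss F (ne_zero_of_Omega hk1)] at b1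
          calc _ ≤ 2 ^ 4 * ∑ i, F i (kel x) ^ 2 := b1.trans (by gcongr)
            _ ≤ _ := by linarith [hS1 (kel x), le_abs_self (3 * C)]
        · have := abs_nonneg (3 * C)
          simp
    · refine ⟨16 * M, 2 * (16 * M + 16), by positivity, by positivity, fun x => ?_⟩
      have bQ : ∀ x, |Q x| ≤ M + M * ∑ i, |F i x| := by
        intro x
        refine (abs_sub _ _).trans ?_
        have : |∑ i, B i x * F i x| ≤ M * ∑ i, |F i x| := by
          rw [Finset.mul_sum]
          refine (Finset.abs_sum_le_sum_abs _ _).trans (Finset.sum_le_sum fun i _ => ?_)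
          rw [abs_mul]
          exact mul_le_mul_of_nonneg_right (bB i x) (abs_nonneg _)
        linarith [bp x]
      unfold hat
      split_ifs with h1 h2
      · refine (bQ x).trans ?_
        have : 0 ≤ ∑ i, |F i x| := Finset.sum_nonneg fun _ _ => abs_nonneg _
        nlinarith [mul_nonneg hM this]
      · obtain ⟨hk1, hk2⟩ := hkel0 h2
        have hk1' : 1 < ‖kel x‖ := hk1
        have b1 := sum_abs_le_kref hss F hk1
        have b2 := bQ (kel x)
        have b3 := abs_sum_coord_mul_le (kel x) fun i => F i (kel x)
        have b0 : 0 ≤ ∑ i, |F i (kel x)| := Finset.sum_nonneg fun _ _ => abs_nonneg _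
        have eQ : Q' (kel x) = σ * (‖kel x‖ ^ 4 * Q (kel x) + 2 * ‖kel x‖ ^ 2 * S (kel x)) := by
          simp only [hQ']
          field_simp
        have b4 : |Q' (kel x)| ≤ 16 * |Q (kel x)| + 8 * |S (kel x)| := by
          rw [eQ, abs_mul, hσ, one_mul]
          refine (abs_add_le _ _).trans ?_
          rw [abs_mul, abs_mul, abs_of_nonneg (by positivity : 0 ≤ ‖kel x‖ ^ 4),
            abs_of_nonneg (by positivity : 0 ≤ 2 * ‖kel x‖ ^ 2)]
          have c1 : ‖kel x‖ ^ 4 ≤ 16 := (pow_le_pow_left₀ (norm_nonneg _) hk2 4).trans (by norm_num)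
          have c2 : 2 * ‖kel x‖ ^ 2 ≤ 8 := by nlinarith
          gcongr
        have b5 : |S (kel x)| ≤ 2 * ∑ i, |F i (kel x)| :=
          b3.trans (mul_le_mul_of_nonneg_right hk2 b0)
        calc |Q' (kel x)| ≤ 16 * M + (16 * M + 16) * ∑ i, |F i (kel x)| := by linarith
          _ ≤ 16 * M + (16 * M + 16) * (2 * ∑ i, |kref σ F i (kel x)|) := by gcongr
          _ = _ := by ring
      · simp only [abs_zero]; positivity
    · have iL : ∀ i, _ := fun i => hatI (LF i) (LR i) (tF hk i)
      have eR := hatI LQ LQ' hk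
      rw [integral_finsetSum _ fun i _ => (iL i).1, eR.2.2.2]
      simp_rw [fun i => (iL i).2.2.2]
      rw [← integral_finsetSum (f := fun i x => F i x * fderiv ℝ k x (ek i) +
        (‖x‖ ^ 6)⁻¹ * (kref σ F i x * fderiv ℝ k (kel x) (ek i))) _ fun i _ => (iL i).2.1.add (iL i).2.2.1]
      set ζ : E3 → ℝ := fun x => k x + σ * ((‖x‖ ^ 2)⁻¹ * k (kel x))
      have hkd : Differentiable ℝ k := hk.1.differentiable (by norm_num)
      have hζ1 : ContDiffOn ℝ 1 ζ OmegaBar := by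
        intro x hx
        have hx1 : 1 ≤ ‖x‖ := hx
        have hx00 : x ≠ 0 := norm_pos_iff.1 (by linarith)
        have hk1 : ContDiff ℝ 1 k := hk.1.of_le (by norm_num)
        have hi : ContDiffAt ℝ 1 (fun x : E3 => (‖x‖ ^ 2)⁻¹) x :=
          (contDiff_norm_sq ℝ).contDiffAt.inv (by positivity)
        have hkk : ContDiffAt ℝ 1 kel x := hi.smul contDiffAt_id
        exact (hk1.contDiffAt.add (contDiffAt_const.mul (hi.mul
          (hk1.contDiffAt.comp x hkk)))).contDiffWithinAt
      obtain ⟨R, hR⟩ := (BS.of_test hk).far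
      have hEL' := hEL ζ hζ1 ⟨max R 2 + 1, fun x hx => by
        have h1 : R < ‖x‖ := by linarith [le_max_left R 2]
        have h2 : 2 < ‖x‖ := by linarith [le_max_right R 2]
        simp only [ζ]
        rw [hR x h1, hk.2.2 _ (norm_kel_lt h2).le]; simp⟩ (fun hs x hx => by
        simp only [ζ]; rw [hs, kel_eq_self hx, hx]; simp)
      have iE : IntegrableOn (fun x => S x * (2 * σ * (‖x‖ ^ 4)⁻¹ * k (kel x))) Omega :=
        LS _ ((BS.of_test_kel hk).mul (LB.mul (LB.mul (LB.const 2) (LB.const σ)) (LB.inv_pow 4)))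
      have iX : IntegrableOn (fun x => ∑ i, (F i x * fderiv ℝ k x (ek i) +
          (‖x‖ ^ 6)⁻¹ * (kref σ F i x * fderiv ℝ k (kel x) (ek i)))) Omega :=
        integrable_finsetSum _ fun i _ => (iL i).2.1.add (iL i).2.2.1
      have e1 : ∀ x ∈ Omega, ∑ i, F i x * fderiv ℝ ζ x (ek i) =
          ∑ i, (F i x * fderiv ℝ k x (ek i) +
          (‖x‖ ^ 6)⁻¹ * (kref σ F i x * fderiv ℝ k (kel x) (ek i))) -
          S x * (2 * σ * (‖x‖ ^ 4)⁻¹ * k (kel x)) := by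
        intro x hx
        have hxn := ne_zero_of_Omega hx
        have := norm_ne_zero_iff.2 hxn
        simp only [ζ, fderiv_kref_test hkd hxn, kref, hS, Fin.sum_univ_three]
        field_simp
        ring
      have e2 : ∀ x ∈ Omega, (∑ i, B i x * F i x - p x) * ζ x =
          (Q x * k x + (‖x‖ ^ 6)⁻¹ * (Q' x * k (kel x))) -
          S x * (2 * σ * (‖x‖ ^ 4)⁻¹ * k (kel x)) := by
        intro x hx
        have := norm_ne_zero_iff.2 (ne_zero_of_Omega hx)
        change Q x * ζ x = _
        simp only [ζ, hQ']
        field_simp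
        ring
      rw [setIntegral_congr_fun measurableSet_Omega e1,
        setIntegral_congr_fun measurableSet_Omega e2, integral_sub iX iE,
        integral_sub (f := fun x => Q x * k x + (‖x‖ ^ 6)⁻¹ * (Q' x * k (kel x)))
          (eR.2.1.add eR.2.2.1) iE] at hEL'
      linarith
    · have e1 := (hatI LV (LV.mul (LB.const σ)) (tF hk j))
      have e2 := (hatI (LF j) (LR j) hk)
      rw [eq_neg_iff_add_eq_zero, e1.2.2.2, e2.2.2.2, ← integral_add
        (f := fun x => V x * fderiv ℝ k x (ek j) +
          (‖x‖ ^ 6)⁻¹ * (σ * V x * fderiv ℝ k (kel x) (ek j)))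
        (g := fun x => F j x * k x + (‖x‖ ^ 6)⁻¹ * (kref σ F j x * k (kel x)))
        (e1.2.1.add e1.2.2.1) (e2.2.1.add e2.2.2.1), ← hG k hk j]
      refine setIntegral_congr_fun measurableSet_Omega fun x hx => ?_
      ring
  obtain ⟨Φ, h1, h2⟩ := hsol.exists_contDiff
  refine ⟨Φ, h1, h2.mono fun x hx hxO => ?_⟩
  have := hx (by have : 1 < ‖x‖ := hxO; linarith)
  simpa only [hat_of_mem hxO] using this

/-- Weak sequential compactness of bounded sequences in `L²`. -/
lemma exists_weak_limit {μ : Measure E3} [SigmaFinite μ] {h : ℕ → E3 → ℝ} {C : ℝ}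
    (hm : ∀ n, MemLp (h n) 2 μ) (hC : ∀ n, ∫ x, h n x ^ 2 ∂μ ≤ C) :
    ∃ φ : ℕ → ℕ, StrictMono φ ∧ ∃ g : E3 → ℝ, Measurable g ∧ MemLp g 2 μ ∧
      ∀ a, MemLp a 2 μ →
        Tendsto (fun n => ∫ x, h (φ n) x * a x ∂μ) atTop (𝓝 (∫ x, g x * a x ∂μ)) := by
  have : Fact ((2 : ℝ≥0∞) ≠ ⊤) := ⟨ENNReal.ofNat_ne_top⟩
  let T := InnerProductSpace.toDual ℝ (Lp ℝ 2 μ)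
  have key : ∀ (u v : E3 → ℝ) (hu : MemLp u 2 μ) (hv : MemLp v 2 μ),
      inner ℝ (hu.toLp u) (hv.toLp v) = ∫ x, u x * v x ∂μ := by
    intro u v hu hv
    rw [L2.inner_def]
    refine integral_congr_ae ?_
    filter_upwards [hu.coeFn_toLp, hv.coeFn_toLp] with x h1 h2
    rw [h1, h2]; simp [mul_comm]
  have hb : ∀ n, StrongDual.toWeakDual (T ((hm n).toLp (h n))) ∈
      WeakDual.toStrongDual ⁻¹' closedBall (0 : StrongDual ℝ (Lp ℝ 2 μ)) (√C) := by
    intro n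
    rw [mem_preimage, mem_closedBall_zero_iff]
    change ‖T ((hm n).toLp (h n))‖ ≤ _
    rw [LinearIsometryEquiv.norm_map]
    refine Real.le_sqrt_of_sq_le ?_
    rw [← real_inner_self_eq_norm_sq, key]
    simpa only [sq] using hC n
  obtain ⟨f, -, φ, hφ, hf⟩ := WeakDual.isSeqCompact_closedBall ℝ (Lp ℝ 2 μ) 0 (√C) hb
  obtain ⟨g₀, hg₀⟩ : ∃ g₀, T g₀ = WeakDual.toStrongDual f := T.surjective _
  have mg : MemLp g₀ 2 μ := Lp.memLp g₀
  obtain ⟨g, hg, hgg⟩ := mg.1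
  have mg' : MemLp g 2 μ := mg.ae_eq hgg
  refine ⟨φ, hφ, g, hg.measurable, mg', fun a ha => ?_⟩
  have h1 := ((WeakDual.eval_continuous (𝕜 := ℝ) (ha.toLp a)).tendsto f).comp hf
  have e1 : f (ha.toLp a) = ∫ x, g x * a x ∂μ := by
    change WeakDual.toStrongDual f (ha.toLp a) = _
    rw [← hg₀, ← key g a mg' ha]
    have : mg'.toLp g = g₀ := by
      rw [← Lp.toLp_coeFn g₀ mg]; exact (MemLp.toLp_eq_toLp_iff _ _).2 hgg.symm
    rw [this]; rfl
  rw [← e1]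
  refine h1.congr fun n => ?_
  rw [← key _ _ (hm _) ha]; rfl

/-- Weak sequential compactness for finite families of bounded sequences in `L²`. -/
lemma exists_weak_limit_family {ι : Type*} [Fintype ι] {μ : Measure E3} [SigmaFinite μ]
    {h : ι → ℕ → E3 → ℝ} {C : ℝ}
    (hm : ∀ i n, MemLp (h i n) 2 μ) (hC : ∀ i n, ∫ x, h i n x ^ 2 ∂μ ≤ C) :
    ∃ φ : ℕ → ℕ, StrictMono φ ∧ ∃ g : ι → E3 → ℝ, (∀ i, Measurable (g i)) ∧
      (∀ i, MemLp (g i) 2 μ) ∧ ∀ i a, MemLp a 2 μ →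
        Tendsto (fun n => ∫ x, h i (φ n) x * a x ∂μ) atTop (𝓝 (∫ x, g i x * a x ∂μ)) := by
  classical
  have : ∀ s : Finset ι, ∃ φ : ℕ → ℕ, StrictMono φ ∧ ∀ i ∈ s, ∃ g : E3 → ℝ, Measurable g ∧
      MemLp g 2 μ ∧ ∀ a, MemLp a 2 μ →
        Tendsto (fun n => ∫ x, h i (φ n) x * a x ∂μ) atTop (𝓝 (∫ x, g x * a x ∂μ)) := by
    intro s
    induction s using Finset.induction_on with
    | empty => exact ⟨id, strictMono_id, by simp⟩
    | insert j s _ ih =>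
      obtain ⟨φ, hφ, hs⟩ := ih
      obtain ⟨ψ, hψ, g, h1, h2, h3⟩ := exists_weak_limit (fun n => hm j (φ n)) fun n => hC j (φ n)
      refine ⟨φ ∘ ψ, hφ.comp hψ, fun i hi => ?_⟩
      rcases Finset.mem_insert.1 hi with rfl | hi
      · exact ⟨g, h1, h2, h3⟩
      · obtain ⟨g, h1, h2, h3⟩ := hs i hi
        exact ⟨g, h1, h2, fun a ha => (h3 a ha).comp hψ.tendsto_atTop⟩
  obtain ⟨φ, hφ, hs⟩ := this Finset.univ
  choose g h1 h2 h3 using fun i => hs i (Finset.mem_univ i)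
  exact ⟨φ, hφ, g, h1, h2, h3⟩

lemma BS.memLp {a : E3 → ℝ} (ha : BS a) : MemLp a 2 (volume.restrict Omega) := by
  rw [memLp_two_iff_integrable_sq ha.meas.aestronglyMeasurable]
  obtain ⟨K, hK⟩ := ha.bdd
  obtain ⟨R, hR⟩ := ha.far
  simp_rw [sq]
  exact integrableOn_mul_of_sq_le (C := K ^ 2) (K := K) (R := R) (A := fun _ => 0)
    (F := Omega.indicator a) (ha.meas.indicator measurableSet_Omega) ha.meas (integrable_zero _ _ _)
    (fun x => by
      by_cases hx : x ∈ Omega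
      · rw [indicator_of_mem hx, zero_add]
        exact sq_le_sq' (abs_le.1 (hK x hx)).1 (abs_le.1 (hK x hx)).2
      · rw [indicator_of_notMem hx, zero_pow two_ne_zero, zero_add]; positivity) hK hR |>.congr_fun
    (fun x hx => by simp only [indicator_of_mem hx]) measurableSet_Omega

/-- Weak convergence against the class `BS`. -/
def WC (h : ℕ → E3 → ℝ) (g : E3 → ℝ) : Prop := ∀ a, BS a →
  Tendsto (fun n => ∫ x in Omega, h n x * a x) atTop (𝓝 (∫ x in Omega, g x * a x))

lemma WC.mul {h : ℕ → E3 → ℝ} {g m : E3 → ℝ} (hw : WC h g) (hm : LB m) :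
    WC (fun n x => m x * h n x) fun x => m x * g x := fun a ha => by
  have := hw _ (ha.mul hm)
  simp only [← mul_assoc] at this
  simpa only [mul_comm (m _)] using this

lemma WC.add {h h' : ℕ → E3 → ℝ} {g g' : E3 → ℝ} (hw : WC h g) (hw' : WC h' g')
    (i1 : ∀ n, LI (h n)) (i2 : ∀ n, LI (h' n)) (i3 : LI g) (i4 : LI g') :
    WC (fun n x => h n x + h' n x) fun x => g x + g' x := fun a ha => by
  have := (hw a ha).add (hw' a ha)
  simp only [add_mul]
  rw [integral_add (i3 a ha) (i4 a ha)]
  exact this.congr fun n => (integral_add (i1 n a ha) (i2 n a ha)).symm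

lemma WC.const (h : E3 → ℝ) : WC (fun _ => h) h := fun _ _ => tendsto_const_nhds

lemma WC.comp {h : ℕ → E3 → ℝ} {g : E3 → ℝ} (hw : WC h g) {φ : ℕ → ℕ} (hφ : StrictMono φ) :
    WC (fun n => h (φ n)) g := fun a ha => (hw a ha).comp hφ.tendsto_atTop

lemma LI.of_memLp {h : E3 → ℝ} (hh : MemLp h 2 (volume.restrict Omega)) : LI h :=
  fun _ ha => hh.integrable_mul ha.memLp

lemma LI.of_abs_le {h : E3 → ℝ} (mh : AEStronglyMeasurable h (volume.restrict Omega)) {M : ℝ}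
    (hb : ∀ x ∈ Omega, |h x| ≤ M) : LI h := fun a ha => by
  have h1 : IntegrableOn (fun x => 1 * a x) Omega :=
    LI.of_bounded measurable_const (M := 1) (by simp) a ha
  refine (h1.norm.const_mul M).mono' (mh.mul ha.meas.aestronglyMeasurable) ?_
  refine (ae_restrict_mem measurableSet_Omega).mono fun x hx => ?_
  rw [norm_mul, one_mul]
  exact mul_le_mul_of_nonneg_right (hb x hx) (norm_nonneg _)

lemma exists_WC_of_bounded {ι : Type*} [Fintype ι] {h : ι → ℕ → E3 → ℝ} {M : ℝ}
    (mh : ∀ i n, AEStronglyMeasurable (h i n) (volume.restrict Omega))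
    (hb : ∀ i n, ∀ x ∈ Omega, |h i n x| ≤ M) :
    ∃ φ : ℕ → ℕ, StrictMono φ ∧ ∃ g : ι → E3 → ℝ, (∀ i, Measurable (g i)) ∧
      (∀ i x, |g i x| ≤ M) ∧ ∀ i, WC (fun n => h i (φ n)) (g i) := by
  have hM : 0 ≤ M ∨ IsEmpty ι := by
    rcases isEmpty_or_nonempty ι with hi | ⟨⟨i⟩⟩
    · exact .inr hi
    · exact .inl ((abs_nonneg _).trans (hb i 0 (ek 0 + ek 0) (by
        change 1 < ‖ek 0 + ek 0‖
        rw [← two_smul ℝ, norm_smul]; simp [ek])))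
  rcases hM with hM | hi
  swap
  · exact ⟨id, strictMono_id, fun i => hi.elim i, fun i => hi.elim i, fun i => hi.elim i,
      fun i => hi.elim i⟩
  set ρ : E3 → ℝ := fun x => (1 + ‖x‖ ^ 2)⁻¹ with hρ
  have ρ0 : ∀ x, 0 < ρ x := fun x => by simp only [hρ]; positivity
  have mρ : Measurable ρ := by simp only [hρ]; fun_prop
  have Lρ : MemLp ρ 2 (volume.restrict Omega) := by
    rw [memLp_two_iff_integrable_sq mρ.aestronglyMeasurable]
    refine Integrable.integrableOn ?_
    have := integrable_rpow_neg_one_add_norm_sq (μ := (volume : Measure E3)) (r := 4)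
      (by rw [finrank_E3]; norm_num)
    refine this.congr (Eventually.of_forall fun x => ?_)
    simp only [hρ]
    rw [show (-4 / 2 : ℝ) = -(2 : ℕ) by norm_num, Real.rpow_neg (by positivity), Real.rpow_natCast,
      inv_pow]
  have hL : ∀ i n, MemLp (fun x => h i n x * ρ x) 2 (volume.restrict Omega) := fun i n => by
    refine (Lρ.const_mul M).mono ((mh i n).mul mρ.aestronglyMeasurable) ?_
    refine (ae_restrict_mem measurableSet_Omega).mono fun x hx => ?_
    rw [norm_mul, norm_mul, Real.norm_of_nonneg hM]
    exact mul_le_mul_of_nonneg_right (hb i n x hx) (norm_nonneg _)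
  have iρ := (memLp_two_iff_integrable_sq mρ.aestronglyMeasurable).1 Lρ
  obtain ⟨φ, hφ, G, mG, LG, hG⟩ := exists_weak_limit_family (C := ∫ x in Omega, M ^ 2 * ρ x ^ 2) hL
    fun i n => by
      refine integral_mono_ae ((memLp_two_iff_integrable_sq (hL i n).1).1 (hL i n))
        (iρ.const_mul _) ?_
      refine (ae_restrict_mem measurableSet_Omega).mono fun x hx => ?_
      simp only [mul_pow]
      refine mul_le_mul_of_nonneg_right ?_ (sq_nonneg _)
      exact sq_le_sq' (abs_le.1 (hb i n x hx)).1 (abs_le.1 (hb i n x hx)).2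
  have test : ∀ {s : Set E3}, MeasurableSet s →
      MemLp (s.indicator ρ) 2 (volume.restrict Omega) := fun hs => Lρ.indicator hs
  have bound : ∀ i, ∀ᵐ x ∂volume.restrict Omega, |(ρ x)⁻¹ * G i x| ≤ M := by
    intro i
    have iG : Integrable (fun x => G i x * ρ x) (volume.restrict Omega) := (LG i).integrable_mul Lρ
    have iM : Integrable (fun x => M * ρ x ^ 2) (volume.restrict Omega) := iρ.const_mul _
    have ih : ∀ n, Integrable (fun x => h i n x * ρ x * ρ x) (volume.restrict Omega) :=
      fun n => (hL i n).integrable_mul Lρ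
    have lim : ∀ s, MeasurableSet s →
        Tendsto (fun n => ∫ x in s, h i (φ n) x * ρ x * ρ x ∂(volume.restrict Omega)) atTop
          (𝓝 (∫ x in s, G i x * ρ x ∂(volume.restrict Omega))) := by
      intro s hs
      have := hG i _ (test hs)
      have e : ∀ f : E3 → ℝ, ∫ x in Omega, f x * s.indicator ρ x =
          ∫ x in s, f x * ρ x ∂(volume.restrict Omega) := fun f => by
        rw [← integral_indicator hs]
        congr 1; ext x; by_cases hx : x ∈ s <;> simp [hx]
      simpa only [e] using this
    have h1 : ∀ᵐ x ∂volume.restrict Omega, G i x * ρ x ≤ M * ρ x ^ 2 := by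
      refine ae_le_of_forall_setIntegral_le iG iM fun s hs _ => ?_
      refine le_of_tendsto (lim s hs) (Eventually.of_forall fun n => ?_)
      refine integral_mono_ae (ih _).restrict iM.restrict (ae_restrict_of_ae ?_)
      refine (ae_restrict_mem measurableSet_Omega).mono fun x hx => ?_
      simp only
      rw [mul_assoc, ← sq]
      exact mul_le_mul_of_nonneg_right ((le_abs_self _).trans (hb i _ x hx)) (sq_nonneg _)
    have h2 : ∀ᵐ x ∂volume.restrict Omega, -(M * ρ x ^ 2) ≤ G i x * ρ x := by
      refine ae_le_of_forall_setIntegral_le iM.neg iG fun s hs _ => ?_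
      refine ge_of_tendsto (lim s hs) (Eventually.of_forall fun n => ?_)
      refine integral_mono_ae iM.neg.restrict (ih _).restrict (ae_restrict_of_ae ?_)
      refine (ae_restrict_mem measurableSet_Omega).mono fun x hx => ?_
      simp only [Pi.neg_apply]
      rw [mul_assoc, ← sq, ← neg_mul]
      exact mul_le_mul_of_nonneg_right (abs_le.1 (hb i _ x hx)).1 (sq_nonneg _)
    filter_upwards [h1, h2] with x h1 h2
    have := ρ0 x
    have e : (ρ x)⁻¹ * G i x = (G i x * ρ x) / ρ x ^ 2 := by field_simp
    rw [e, abs_le, le_div_iff₀ (by positivity), div_le_iff₀ (by positivity)]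
    exact ⟨by linarith, h1⟩
  refine ⟨φ, hφ, fun i x => max (-M) (min ((ρ x)⁻¹ * G i x) M), fun i => ?_, fun i x => ?_,
    fun i a ha => ?_⟩
  · exact measurable_const.max ((mρ.inv.mul (mG i)).min measurable_const)
  · exact abs_le.2 ⟨le_max_left _ _, max_le (by linarith) (min_le_right _ _)⟩
  · have hρ' : LB fun x => (ρ x)⁻¹ := by
      refine .of_continuousAt mρ.inv fun x _ => ?_
      simp only [hρ, inv_inv]; fun_prop
    have := hG i _ (ha.mul hρ').memLp
    have e : ∫ x in Omega, max (-M) (min ((ρ x)⁻¹ * G i x) M) * a x =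
        ∫ x in Omega, G i x * ((ρ x)⁻¹ * a x) := by
      refine integral_congr_ae ?_
      filter_upwards [bound i] with x hx
      rw [min_eq_left (abs_le.1 hx).2, max_eq_right (abs_le.1 hx).1]
      ring
    rw [e]
    refine this.congr fun n => integral_congr_ae (Eventually.of_forall fun x => ?_)
    have := (ρ0 x).ne'
    simp only
    field_simp

/-- Bounded continuous functions with bounded support on the exterior domain. -/
structure BO (a : E3 → ℝ) : Prop where
  cont : ContinuousOn a Omega
  bdd : ∃ K, ∀ x ∈ Omega, |a x| ≤ K
  far : ∃ R, ∀ x ∈ Omega, R < ‖x‖ → a x = 0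

lemma BO.bs {a : E3 → ℝ} (ha : BO a) : BS (Omega.indicator a) := by
  obtain ⟨K, hK⟩ := ha.bdd
  obtain ⟨R, hR⟩ := ha.far
  have hm : Measurable (Omega.indicator a) := by
    classical
    rw [← Set.piecewise_eq_indicator]
    exact ha.cont.measurable_piecewise continuousOn_const measurableSet_Omega
  refine ⟨hm, ⟨K, fun x hx => by rw [indicator_of_mem hx]; exact hK x hx⟩,
    ⟨R, fun x hx => ?_⟩⟩
  by_cases h : x ∈ Omega
  · rw [indicator_of_mem h, hR x h hx]
  · rw [indicator_of_notMem h]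

lemma integral_mul_indicator_Omega (h a : E3 → ℝ) :
    ∫ x in Omega, h x * Omega.indicator a x = ∫ x in Omega, h x * a x :=
  setIntegral_congr_fun measurableSet_Omega fun x hx => by simp only [indicator_of_mem hx]

lemma WC.tendsto {h : ℕ → E3 → ℝ} {g a : E3 → ℝ} (hw : WC h g) (ha : BO a) :
    Tendsto (fun n => ∫ x in Omega, h n x * a x) atTop (𝓝 (∫ x in Omega, g x * a x)) := by
  simpa only [integral_mul_indicator_Omega] using hw _ ha.bs

lemma LI.integrableOn {h a : E3 → ℝ} (hh : LI h) (ha : BO a) :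
    IntegrableOn (fun x => h x * a x) Omega :=
  (hh _ ha.bs).congr_fun (fun x hx => by simp only [indicator_of_mem hx]) measurableSet_Omega

lemma BO.integrableOn {a : E3 → ℝ} (ha : BO a) : IntegrableOn a Omega := by
  simpa using (LI.of_bounded (F := fun _ => 1) measurable_const (M := 1) (by simp)).integrableOn ha

lemma BO.mul {a m : E3 → ℝ} (ha : BO a) (hm : ContinuousOn m OmegaBar) :
    BO fun x => m x * a x := by
  obtain ⟨h1, ⟨K, hK⟩, ⟨R, hR⟩⟩ := ha
  obtain ⟨K', hK'⟩ := (isCompact_annulus R).exists_bound_of_continuousOn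
    (hm.mono inter_subset_left)
  refine ⟨(hm.mono Omega_subset).mul h1, ⟨|K'| * |K|, fun x hx => ?_⟩,
    ⟨R, fun x hx h => by rw [hR x hx h, mul_zero]⟩⟩
  rcases lt_or_ge R ‖x‖ with h | h
  · rw [hR x hx h]; simp; positivity
  · rw [abs_mul]
    exact mul_le_mul ((hK' x ⟨Omega_subset hx, by simpa using h⟩).trans (le_abs_self _))
      ((hK x hx).trans (le_abs_self _)) (abs_nonneg _) (abs_nonneg _)

/-- `C¹` functions on the closed exterior domain vanishing outside a ball. -/
structure CT (φ : E3 → ℝ) : Prop where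
  reg : ContDiffOn ℝ 1 φ OmegaBar
  far : ∃ R, ∀ x, R ≤ ‖x‖ → φ x = 0

lemma CT.bo {φ : E3 → ℝ} (h : CT φ) : BO φ := by
  obtain ⟨R, hR⟩ := h.far
  obtain ⟨M, -, -, hM⟩ := exists_fderiv_bound_of_far h.reg hR
  exact ⟨h.reg.continuousOn.mono Omega_subset, ⟨M, fun x hx => hM x (Omega_subset hx)⟩,
    ⟨R, fun x _ hx => hR x hx.le⟩⟩

lemma differentiableAt_of_Omega {φ : E3 → ℝ} (h : ContDiffOn ℝ 1 φ OmegaBar) {x : E3}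
    (hx : x ∈ Omega) : DifferentiableAt ℝ φ x :=
  (h.contDiffAt (OmegaBar_mem_nhds hx)).differentiableAt one_ne_zero

lemma continuousOn_fderiv_Omega {φ : E3 → ℝ} (h : ContDiffOn ℝ 1 φ OmegaBar) :
    ContinuousOn (fderiv ℝ φ) Omega := fun _ hx =>
  ((h.contDiffAt (OmegaBar_mem_nhds hx)).continuousAt_fderiv one_ne_zero).continuousWithinAt

lemma CT.bo_fderiv {φ : E3 → ℝ} (h : CT φ) (v : E3) : BO fun x => fderiv ℝ φ x v := by
  obtain ⟨R, hR⟩ := h.far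
  obtain ⟨M, -, hM, -⟩ := exists_fderiv_bound_of_far h.reg hR
  refine ⟨(continuousOn_fderiv_Omega h.reg).clm_apply continuousOn_const, ⟨M * ‖v‖, fun x hx => ?_⟩,
    ⟨R, fun x _ hx => ?_⟩⟩
  · exact (ContinuousLinearMap.le_opNorm _ _).trans
      (mul_le_mul_of_nonneg_right (hM x hx) (norm_nonneg _))
  · simp only [fderiv_eq_zero_of_far hR hx, _root_.zero_apply]

lemma CT.mul {φ m : E3 → ℝ} (h : CT φ) (hm : ContDiffOn ℝ 1 m OmegaBar) :
    CT fun x => m x * φ x := by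
  obtain ⟨R, hR⟩ := h.far
  exact ⟨hm.mul h.reg, ⟨R, fun x hx => by rw [hR x hx, mul_zero]⟩⟩

lemma eventually_eq_of_transition {x : E3} (hx : x ∈ Omega) :
    ∀ᶠ n : ℕ in atTop, Real.smoothTransition (n * (‖x‖ ^ 2 - 1) - 1) = 1 := by
  have h0 : 0 < ‖x‖ ^ 2 - 1 := by
    have : 1 < ‖x‖ := hx
    nlinarith
  filter_upwards [(tendsto_natCast_atTop_atTop.atTop_mul_const h0).eventually_ge_atTop 2] with n hn
  exact Real.smoothTransition.one_of_one_le (by linarith)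

/-- Integration by parts in the exterior domain against a vector field tangential to spheres. -/
lemma integral_tangential {D : Fin 3 → E3 → ℝ} {e φ : E3 → ℝ}
    (hD : ∀ k x, x ≠ 0 → ContDiffAt ℝ 1 (D k) x) (ht : ∀ x, ∑ k, x k * D k x = 0)
    (he : ∀ x, x ≠ 0 → ∑ k, fderiv ℝ (D k) x (ek k) = e x) (hφ : CT φ) :
    ∫ x in Omega, ∑ k, D k x * fderiv ℝ φ x (ek k) = -∫ x in Omega, e x * φ x := by
  obtain ⟨R, hR⟩ := hφ.far
  have hne : ∀ {x : E3}, x ∈ OmegaBar → x ≠ 0 := fun hx =>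
    norm_pos_iff.1 (zero_lt_one.trans_le hx)
  have cD : ∀ k, ContinuousOn (D k) OmegaBar := fun k x hx =>
    (hD k x (hne hx)).continuousAt.continuousWithinAt
  have ce : ContinuousOn e OmegaBar := by
    have : ContinuousOn (fun x => ∑ k, fderiv ℝ (D k) x (ek k)) OmegaBar :=
      continuousOn_finsetSum _ fun k _ x hx =>
        (((hD k x (hne hx)).continuousAt_fderiv one_ne_zero).clm_apply
          continuousAt_const).continuousWithinAt
    exact this.congr fun x hx => (he x (hne hx)).symm
  set η : ℕ → E3 → ℝ := fun n x => Real.smoothTransition (n * (‖x‖ ^ 2 - 1) - 1) with hη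
  have sη : ∀ n, ContDiff ℝ 1 (η n) := fun n =>
    Real.smoothTransition.contDiff.comp (((contDiff_const.mul
      ((contDiff_norm_sq ℝ).sub contDiff_const))).sub contDiff_const)
  have zη : ∀ (n : ℕ) x, ‖x‖ ^ 2 < 1 + (n + 1 : ℝ)⁻¹ → η n x = 0 := fun n x hx => by
    refine Real.smoothTransition.zero_of_nonpos ?_
    have h1 : (n : ℝ) * (n + 1 : ℝ)⁻¹ ≤ 1 := by
      rw [← div_eq_mul_inv, div_le_one (by positivity)]; linarith
    have h2 : (n : ℝ) * (‖x‖ ^ 2 - 1) ≤ n * (n + 1 : ℝ)⁻¹ :=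
      mul_le_mul_of_nonneg_left (by linarith) n.cast_nonneg
    linarith
  have zw : ∀ n x, x ∉ Omega → ∀ᶠ y in 𝓝 x, η n y = 0 := fun n x hx => by
    have hx' : ‖x‖ ^ 2 < 1 + (n + 1 : ℝ)⁻¹ := by
      have h1 : ‖x‖ ≤ 1 := not_lt.1 hx
      have h2 : 0 < (n + 1 : ℝ)⁻¹ := by positivity
      nlinarith [norm_nonneg x]
    filter_upwards [(isOpen_lt (continuous_norm.pow 2) continuous_const).mem_nhds hx'] with y hy
    exact zη n y hy
  have dη : ∀ n x, ∃ d : ℝ, ∀ k, fderiv ℝ (η n) x (ek k) = d * x k := fun n x => by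
    have h1 : HasFDerivAt (fun y : E3 => (n : ℝ) * (‖y‖ ^ 2 - 1) - 1) _ x :=
      (((hasStrictFDerivAt_norm_sq x).hasFDerivAt.sub_const 1).const_mul (n : ℝ)).sub_const 1
    have h2 := ((Real.smoothTransition.contDiff (n := 1)).differentiable one_ne_zero
      (n * (‖x‖ ^ 2 - 1) - 1)).hasDerivAt.comp_hasFDerivAt x h1
    refine ⟨deriv Real.smoothTransition (n * (‖x‖ ^ 2 - 1) - 1) * (n * 2), fun k => ?_⟩
    have h3 : fderiv ℝ (η n) x = _ := h2.fderiv
    rw [h3]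
    have hin : inner ℝ x (ek k) = x k := by simp [ek, EuclideanSpace.inner_single_right]
    simp only [_root_.smul_apply, innerSL_apply_apply, hin, smul_eq_mul, nsmul_eq_mul]
    push_cast; ring
  set P : E3 → ℝ := fun x => ∑ k, D k x * fderiv ℝ φ x (ek k) with hP
  have bP : IntegrableOn P Omega :=
    integrable_finsetSum _ fun k _ => ((hφ.bo_fderiv (ek k)).mul (cD k)).integrableOn
  have bE : IntegrableOn (fun x => e x * φ x) Omega := (hφ.bo.mul ce).integrableOn
  have step : ∀ n, ∫ x in Omega, η n x * (P x + e x * φ x) = 0 := by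
    intro n
    set w : Fin 3 → E3 → ℝ := fun k x => η n x * (φ x * D k x) with hw
    have sw : ∀ k, ContDiff ℝ 1 (w k) := fun k => by
      refine contDiff_iff_contDiffAt.2 fun x => ?_
      by_cases hx : x ∈ Omega
      · exact (sη n).contDiffAt.mul ((hφ.reg.contDiffAt (OmegaBar_mem_nhds hx)).mul
          (hD k x (ne_zero_of_Omega hx)))
      · refine contDiffAt_const (c := (0 : ℝ)) |>.congr_of_eventuallyEq ?_
        filter_upwards [zw n x hx] with y hy
        simp only [hw, hy, zero_mul]
    have zw' : ∀ k x, R ≤ ‖x‖ → w k x = 0 := fun k x hx => by simp only [hw, hR x hx]; ring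
    have cw : ∀ k, HasCompactSupport (w k) := fun k => hasCompactSupport_of_zero (zw' k)
    have iw : ∀ k, Integrable fun x => fderiv ℝ (w k) x (ek k) := fun k =>
      (((sw k).continuous_fderiv one_ne_zero).clm_apply
        continuous_const).integrable_of_hasCompactSupport ((cw k).fderiv_apply ℝ _)
    have h0 : ∀ k, ∫ x, fderiv ℝ (w k) x (ek k) = 0 := fun k => by
      have := integral_fderiv_mul_of_compact (sw k) (contDiff_const (c := (1 : ℝ))) (cw k) (ek k)
      simpa using this
    have h1 : ∫ x, ∑ k, fderiv ℝ (w k) x (ek k) = 0 := by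
      rw [integral_finsetSum _ fun k _ => iw k]
      simp [h0]
    have h2 : ∀ x ∉ Omega, ∑ k, fderiv ℝ (w k) x (ek k) = 0 := fun x hx => by
      refine Finset.sum_eq_zero fun k _ => ?_
      have : w k =ᶠ[𝓝 x] fun _ => 0 := by
        filter_upwards [zw n x hx] with y hy
        simp only [hw, hy, zero_mul]
      rw [this.fderiv_eq]; simp
    rw [← setIntegral_eq_integral_of_forall_compl_eq_zero h2] at h1
    rw [← h1]
    refine setIntegral_congr_fun measurableSet_Omega fun x hx => ?_
    obtain ⟨d, hd⟩ := dη n x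
    have hx0 := ne_zero_of_Omega hx
    have e1 : ∀ k, fderiv ℝ (w k) x (ek k) = η n x * (φ x * fderiv ℝ (D k) x (ek k) +
        D k x * fderiv ℝ φ x (ek k)) + φ x * d * (x k * D k x) := fun k => by
      have g1 := ((sη n).differentiable one_ne_zero x).hasFDerivAt.mul
        ((differentiableAt_of_Omega hφ.reg hx).hasFDerivAt.mul
          ((hD k x hx0).differentiableAt one_ne_zero).hasFDerivAt)
      have g2 : fderiv ℝ (w k) x = _ := g1.fderiv
      rw [g2]
      simp only [_root_.add_apply, _root_.smul_apply, smul_eq_mul, hd, Pi.mul_apply]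
      ring
    simp only [e1, hP]
    rw [Finset.sum_add_distrib, ← Finset.mul_sum, ← Finset.mul_sum, ht x, Finset.sum_add_distrib,
      ← Finset.mul_sum, he x hx0]
    ring
  have lim : Tendsto (fun n => ∫ x in Omega, η n x * (P x + e x * φ x)) atTop
      (𝓝 (∫ x in Omega, (P x + e x * φ x))) := by
    refine tendsto_integral_of_dominated_convergence (fun x => ‖P x + e x * φ x‖)
      (fun n => (sη n).continuous.aestronglyMeasurable.mul (bP.add bE).aestronglyMeasurable)
      (bP.add bE).norm (fun n => Eventually.of_forall fun x => ?_) ?_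
    · rw [norm_mul, Real.norm_of_nonneg (Real.smoothTransition.nonneg _)]
      exact mul_le_of_le_one_left (norm_nonneg _) (Real.smoothTransition.le_one _)
    · refine (ae_restrict_mem measurableSet_Omega).mono fun x hx => ?_
      refine tendsto_const_nhds.congr' ?_
      filter_upwards [eventually_eq_of_transition hx] with n hn
      simp only [hη, hn, one_mul]
  simp only [step] at lim
  have := tendsto_nhds_unique lim tendsto_const_nhds
  rw [integral_add bP bE] at this
  linarith

lemma kelD_kel {x : E3} (hx : x ≠ 0) (h : E3) :
    kelD (kel x) h = ‖x‖ ^ 2 • (h - (2 * (‖x‖ ^ 2)⁻¹ * inner ℝ x h) • x) := by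
  have hx0 := norm_pos_iff.2 hx
  rw [kelD_apply, norm_kel hx]
  unfold kel
  rw [inner_smul_left, smul_smul]
  simp only [inv_pow, inv_inv, conj_trivial]
  congr 3
  field_simp

lemma norm_kelD_le {y : E3} (hy : y ≠ 0) : ‖kelD y‖ ≤ 3 * (‖y‖ ^ 2)⁻¹ := by
  have hy0 := norm_pos_iff.2 hy
  refine ContinuousLinearMap.opNorm_le_bound _ (by positivity) fun h => ?_
  rw [kelD_apply, norm_smul, Real.norm_of_nonneg (by positivity)]
  have : ‖(2 * (‖y‖ ^ 2)⁻¹ * inner ℝ y h) • y‖ ≤ 2 * ‖h‖ := by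
    rw [norm_smul, norm_mul, Real.norm_of_nonneg (by positivity : 0 ≤ 2 * (‖y‖ ^ 2)⁻¹)]
    calc _ ≤ 2 * (‖y‖ ^ 2)⁻¹ * (‖y‖ * ‖h‖) * ‖y‖ := by
          gcongr; exact norm_inner_le_norm y h
      _ = _ := by field_simp
  calc _ ≤ (‖y‖ ^ 2)⁻¹ * (‖h‖ + 2 * ‖h‖) := by
        gcongr; exact (norm_sub_le _ _).trans (by gcongr)
    _ = _ := by ring

/-- Integration by parts for the reflection of a function across the unit sphere. -/
lemma integral_reflect_parts {σ : ℝ} {v : E3 → ℝ} (hv : ContDiffOn ℝ 1 v OmegaBar)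
    (hσ : |σ| = 1) (hS : ∀ x, ‖x‖ = 1 → σ * v x = v x) {k : E3 → ℝ} (hk : IsTest (1 / 2) k)
    (j : Fin 3) :
    ∫ x in Omega, (v x * (fderiv ℝ k x (ek j) +
      (‖x‖ ^ 6)⁻¹ * (σ * fderiv ℝ k (kel x) (ek j))) +
      (fderiv ℝ v x (ek j) * k x +
      (‖x‖ ^ 6)⁻¹ * (kref σ (fun i x => fderiv ℝ v x (ek i)) j x * k (kel x)))) = 0 := by
  have hk1 : ContDiff ℝ 1 k := hk.1.of_le (by norm_num)
  obtain ⟨R, hR⟩ := (BS.of_test hk).far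
  have hvk : CT fun x => v x * k x :=
    ⟨hv.mul hk1.contDiffOn, ⟨R + 1, fun x hx => by rw [hR x (by linarith), mul_zero]⟩⟩
  have hvk' : CT fun x => v x * k (kel x) := by
    refine ⟨hv.mul fun x hx => ?_, ⟨3, fun x hx => by
      rw [hk.2.2 _ (norm_kel_lt (by linarith)).le, mul_zero]⟩⟩
    have hx1 : 1 ≤ ‖x‖ := hx
    have hi : ContDiffAt ℝ 1 (fun x : E3 => (‖x‖ ^ 2)⁻¹) x :=
      (contDiff_norm_sq ℝ).contDiffAt.inv (by positivity)
    have hkk : ContDiffAt ℝ 1 kel x := hi.smul contDiffAt_id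
    exact (hk1.contDiffAt.comp x hkk).contDiffWithinAt
  set w : E3 → ℝ := fun y => if 1 ≤ ‖y‖ then v y * k y else σ * (v (kel y) * k y) with hw
  have w_out : ∀ {y}, 1 ≤ ‖y‖ → w y = v y * k y := fun h => if_pos h
  have w_in : ∀ {y}, ‖y‖ ≤ 1 → w y = σ * (v (kel y) * k y) := fun {y} h => by
    rcases h.lt_or_eq with h | h
    · exact if_neg (not_le.2 h)
    · rw [w_out h.ge, kel_eq_self h, ← mul_assoc, hS y h]
  have w_zero : ∀ {y}, ‖y‖ ≤ 1 / 2 → w y = 0 := fun h => by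
    rw [w_in (by linarith), hk.2.2 _ h]; simp
  have ev_out : ∀ {y : E3}, 1 < ‖y‖ → w =ᶠ[𝓝 y] fun y => v y * k y := fun h => by
    filter_upwards [(isOpen_lt continuous_const continuous_norm).mem_nhds h] with z hz
    exact w_out hz.le
  have ev_in : ∀ {y : E3}, ‖y‖ < 1 → w =ᶠ[𝓝 y] fun y => σ * (v (kel y) * k y) := fun h => by
    filter_upwards [(isOpen_lt continuous_norm continuous_const).mem_nhds h] with z hz
    exact w_in hz.le
  have ev_zero : ∀ {y : E3}, ‖y‖ < 1 / 2 → w =ᶠ[𝓝 y] fun _ => 0 := fun h => by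
    filter_upwards [(isOpen_lt continuous_norm continuous_const).mem_nhds h] with z hz
    exact w_zero hz.le
  have kel_Omega : ∀ {y : E3}, y ≠ 0 → ‖y‖ < 1 → kel y ∈ Omega := fun hy h => by
    show 1 < ‖kel _‖
    rw [norm_kel hy]; exact (one_lt_inv₀ (norm_pos_iff.2 hy)).2 h
  have d_out : ∀ {y : E3}, 1 < ‖y‖ → HasFDerivAt w (fderiv ℝ (fun y => v y * k y) y) y :=
    fun h => (differentiableAt_of_Omega hvk.reg h).hasFDerivAt.congr_of_eventuallyEq (ev_out h)
  have d_in : ∀ {y : E3}, y ≠ 0 → ‖y‖ < 1 →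
      HasFDerivAt w (σ • (fderiv ℝ (fun x => v x * k (kel x)) (kel y)).comp (kelD y)) y := by
    intro y hy h
    have := (((differentiableAt_of_Omega hvk'.reg (kel_Omega hy h)).hasFDerivAt.comp y
      (hasFDerivAt_kel hy)).const_mul σ)
    refine this.congr_of_eventuallyEq ?_
    filter_upwards [ev_in h, isOpen_ne.mem_nhds hy] with z hz hz0
    rw [hz]; simp only [Function.comp_apply, kel_kel hz0]
  obtain ⟨M₁, hM₁0, hM₁, -⟩ := exists_fderiv_bound_of_far hvk.reg hvk.far.choose_spec
  obtain ⟨M₂, hM₂0, hM₂, -⟩ := exists_fderiv_bound_of_far hvk'.reg hvk'.far.choose_spec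
  have wd : ∀ x, ‖x‖ ≠ 1 → DifferentiableAt ℝ w x ∧ ‖fderiv ℝ w x‖ ≤ M₁ + M₂ * 12 := by
    intro y hy
    rcases lt_or_gt_of_ne hy with h | h
    · rcases lt_or_ge ‖y‖ (1 / 2) with h2 | h2
      · have hz : HasFDerivAt w (0 : E3 →L[ℝ] ℝ) y := (hasFDerivAt_const (0 : ℝ) y).congr_of_eventuallyEq
          (ev_zero h2)
        refine ⟨hz.differentiableAt, ?_⟩
        rw [hz.fderiv, norm_zero]; positivity
      · have hy0 : y ≠ 0 := norm_pos_iff.1 (by linarith)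
        have hd := d_in hy0 h
        refine ⟨hd.differentiableAt, ?_⟩
        rw [hd.fderiv, norm_smul, Real.norm_eq_abs, hσ, one_mul]
        have h3 : (‖y‖ ^ 2)⁻¹ ≤ 4 := by
          have : (1 / 2 : ℝ) ^ 2 ≤ ‖y‖ ^ 2 := by gcongr
          exact (inv_anti₀ (by norm_num) this).trans (by norm_num)
        have h4 : ‖kelD y‖ ≤ 12 := (norm_kelD_le hy0).trans (by linarith)
        refine (ContinuousLinearMap.opNorm_comp_le _ _).trans ?_
        have := mul_le_mul (hM₂ _ (kel_Omega hy0 h)) h4 (norm_nonneg _) hM₂0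
        linarith
    · refine ⟨(d_out h).differentiableAt, ?_⟩
      rw [(d_out h).fderiv]
      have := hM₁ y h
      nlinarith
  have wc : Continuous w := by
    have h1 : ContinuousOn w OmegaBar := hvk.reg.continuousOn.congr fun y hy => w_out hy
    have h2 : ContinuousOn w (closedBall 0 1) := by
      intro y hy
      have hy1 : ‖y‖ ≤ 1 := by simpa using hy
      rcases lt_or_ge ‖y‖ (1 / 2) with h2 | h2
      · exact (continuousAt_const.congr (ev_zero h2).symm).continuousWithinAt
      · have hy0 : y ≠ 0 := norm_pos_iff.1 (by linarith)
        have hin : ContinuousOn (fun y => σ * (v (kel y) * k (kel (kel y))))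
            (closedBall 0 1 \ {0}) := by
          refine continuousOn_const.mul (hvk'.reg.continuousOn.comp (fun z hz =>
            (hasFDerivAt_kel hz.2).continuousAt.continuousWithinAt) fun z hz => ?_)
          have hz1 : ‖z‖ ≤ 1 := by simpa using hz.1
          show 1 ≤ ‖kel z‖
          rw [norm_kel hz.2]; exact (one_le_inv₀ (norm_pos_iff.2 hz.2)).2 hz1
        have h3 : ContinuousOn w (closedBall 0 1 \ {0}) := hin.congr fun z hz => by
          simp only [kel_kel hz.2]; exact w_in (by simpa using hz.1)
        refine (h3 y ⟨hy, hy0⟩).mono_of_mem_nhdsWithin ?_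
        exact inter_mem self_mem_nhdsWithin
          (mem_nhdsWithin_of_mem_nhds (isOpen_ne.mem_nhds hy0))
    have h3 := h1.union_of_isClosed h2 isClosed_OmegaBar isClosed_closedBall
    rw [← continuousOn_univ]
    refine h3.mono fun y _ => ?_
    rcases le_total 1 ‖y‖ with h | h
    · exact .inl h
    · exact .inr (by simpa using h)
  have wz : ∀ x, max R 1 + 1 ≤ ‖x‖ → w x = 0 := fun x hx => by
    have h1 := le_max_left R 1
    have h2 := le_max_right R 1
    rw [w_out (by linarith), hR x (by linarith), mul_zero]
  have wcs : HasCompactSupport w := hasCompactSupport_of_zero wz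
  have h0 := integral_fderiv_eq_zero_of_off_sphere wc wcs (M := ⟨M₁ + M₂ * 12, by positivity⟩)
    (fun x hx => (wd x hx).1) (fun x hx => (wd x hx).2) (ek j)
  have hint : Integrable fun x => fderiv ℝ w x (ek j) := by
    have hs : ∀ᵐ x : E3, ‖x‖ ≠ 1 := by
      have := Measure.addHaar_sphere (volume : Measure E3) 0 1
      rw [measure_eq_zero_iff_ae_notMem] at this
      exact this.mono fun x hx h => hx (by simpa using h)
    have hdom : Integrable ((closedBall (0 : E3) (max R 1 + 1)).indicator
        fun _ => M₁ + M₂ * 12) := by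
      rw [integrable_indicator_iff measurableSet_closedBall]
      exact integrableOn_const (measure_closedBall_lt_top).ne
    refine hdom.mono' (measurable_fderiv_apply_const ℝ w (ek j)).aestronglyMeasurable ?_
    filter_upwards [hs] with x hx
    rcases le_or_gt ‖x‖ (max R 1 + 1) with h | h
    · rw [indicator_of_mem (by simpa using h)]
      refine (ContinuousLinearMap.le_opNorm _ _).trans ?_
      have : ‖ek j‖ = 1 := by simp [ek]
      rw [this, mul_one]; exact (wd x hx).2
    · rw [indicator_of_notMem (by simpa using h), fderiv_eq_zero_of_far wz h]; simp
  rw [← h0, integral_eq_refl hint]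
  refine setIntegral_congr_fun measurableSet_Omega fun x hx => ?_
  have hx1 : 1 < ‖x‖ := hx
  have hx0 := ne_zero_of_Omega hx
  have hkx : ‖kel x‖ < 1 := by rw [norm_kel hx0]; exact inv_lt_one_of_one_lt₀ hx1
  have hvx := (differentiableAt_of_Omega hv hx).hasFDerivAt
  have hkd := hk1.differentiable one_ne_zero
  have e1 : fderiv ℝ w x (ek j) = fderiv ℝ v x (ek j) * k x + v x * fderiv ℝ k x (ek j) := by
    have : fderiv ℝ (fun y => v y * k y) x = _ := (hvx.mul (hkd x).hasFDerivAt).fderiv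
    rw [(d_out hx1).fderiv, this]
    simp only [_root_.add_apply, _root_.smul_apply, smul_eq_mul]
    ring
  have e2 : fderiv ℝ w (kel x) (ek j) = kref σ (fun i x => fderiv ℝ v x (ek i)) j x * k (kel x) +
      σ * (v x * fderiv ℝ k (kel x) (ek j)) := by
    have hky : kel x ≠ 0 := kel_ne_zero hx0
    have hvx' : HasFDerivAt v (fderiv ℝ v x) (kel (kel x)) := by rw [kel_kel hx0]; exact hvx
    have h3 : HasFDerivAt (fun y => σ * (v (kel y) * k y)) _ (kel x) :=
      ((hvx'.comp (kel x) (hasFDerivAt_kel hky)).mul (hkd (kel x)).hasFDerivAt).const_mul σ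
    rw [(h3.congr_of_eventuallyEq (ev_in hkx)).fderiv]
    have hin : inner ℝ x (ek j) = x j := by simp [ek, EuclideanSpace.inner_single_right]
    simp only [_root_.add_apply, _root_.smul_apply, smul_eq_mul, Function.comp_apply, kel_kel hx0,
      ContinuousLinearMap.comp_apply, kelD_kel hx0, map_smul, map_sub, hin, kref,
      clm_eq_sum (fderiv ℝ v x) x]
    ring
  rw [e1, e2]
  ring

lemma hasFDerivAt_norm_inv {x : E3} (hx : x ≠ 0) :
    HasFDerivAt (fun y : E3 => ‖y‖⁻¹) (-((‖x‖ ^ 3)⁻¹) • innerSL ℝ x) x := by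
  have hx0 := norm_pos_iff.2 hx
  have h1 := (hasStrictFDerivAt_norm_sq x).hasFDerivAt.sqrt (by positivity)
  have h2 := (hasDerivAt_inv (by positivity : √(‖x‖ ^ 2) ≠ 0)).comp_hasFDerivAt x h1
  simp only [Function.comp_def, Real.sqrt_sq (norm_nonneg _)] at h2
  refine h2.congr_fderiv ?_
  ext h
  simp only [_root_.smul_apply, innerSL_apply_apply, smul_eq_mul, nsmul_eq_mul]
  field_simp
  push_cast
  ring

lemma contDiffAt_norm_inv {n : WithTop ℕ∞} {x : E3} (hx : x ≠ 0) :
    ContDiffAt ℝ n (fun y : E3 => ‖y‖⁻¹) x := (contDiffAt_norm ℝ hx).inv (norm_ne_zero_iff.2 hx)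

/-- The exponential weight turning the Robin condition into a Neumann condition. -/
def ew (β : ℝ) (x : E3) : ℝ := Real.exp (-(β * (1 - ‖x‖⁻¹)))

lemma contDiffAt_ew {n : WithTop ℕ∞} (β : ℝ) {x : E3} (hx : x ≠ 0) : ContDiffAt ℝ n (ew β) x :=
  (contDiffAt_const.mul (contDiffAt_const.sub (contDiffAt_norm_inv hx))).neg.exp

lemma hasFDerivAt_ew (β : ℝ) {x : E3} (hx : x ≠ 0) :
    HasFDerivAt (ew β) (-(ew β x * β * (‖x‖ ^ 3)⁻¹) • innerSL ℝ x) x := by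
  have h := (((hasFDerivAt_norm_inv hx).const_sub 1).const_mul β).neg.exp
  refine h.congr_fderiv ?_
  ext v
  simp only [_root_.smul_apply, _root_.neg_apply, innerSL_apply_apply, smul_eq_mul, ew,
    Pi.neg_apply]
  ring

lemma ew_pos (β : ℝ) (x : E3) : 0 < ew β x := Real.exp_pos _

lemma ew_le_one {β : ℝ} (hβ : 0 ≤ β) {x : E3} (hx : x ∈ OmegaBar) : ew β x ≤ 1 := by
  have hx1 : 1 ≤ ‖x‖ := hx
  refine Real.exp_le_one_iff.2 (neg_nonpos.2 (mul_nonneg hβ ?_))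
  linarith [inv_le_one_of_one_le₀ hx1]

lemma ew_eq_one (β : ℝ) {x : E3} (hx : ‖x‖ = 1) : ew β x = 1 := by simp [ew, hx]

lemma measurable_ew (β : ℝ) : Measurable (ew β) := by unfold ew; fun_prop

lemma ne_zero_of_OmegaBar {x : E3} (hx : x ∈ OmegaBar) : x ≠ 0 :=
  norm_pos_iff.1 (zero_lt_one.trans_le hx)

lemma contDiffOn_ew (β : ℝ) : ContDiffOn ℝ 1 (ew β) OmegaBar := fun _ hx =>
  (contDiffAt_ew β (ne_zero_of_OmegaBar hx)).contDiffWithinAt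

lemma LB.ew (β : ℝ) : LB (ew β) :=
  .of_continuousAt (measurable_ew β) fun _ hx => (contDiffAt_ew (n := 1) β hx).continuousAt

/-- Scalar functions on the punctured space that are admissible boundary targets: radially
constant, twice differentiable, and bounded with their derivatives. -/
structure Tgt (s : E3 → ℝ) (K : ℝ) : Prop where
  meas : Measurable s
  reg : ∀ x, x ≠ 0 → ContDiffAt ℝ 2 s x
  tang : ∀ x, ∑ k, x k * fderiv ℝ s x (ek k) = 0
  bdd : ∀ x ∈ OmegaBar, |s x| ≤ K
  bdd' : ∀ x ∈ OmegaBar, ∀ k, |fderiv ℝ s x (ek k)| ≤ K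
  bdd'' : ∀ x ∈ OmegaBar, |∑ k, fderiv ℝ (fun y => fderiv ℝ s y (ek k)) x (ek k)| ≤ K

lemma Qsurf_apply (a b c : ℝ) (x : E3) (i j : Fin 3) : Qsurf a b c x i j =
    sstar a b c * ((‖x‖ ^ 2)⁻¹ * (x i * x j) - 1 / 3 * (1 : Mat3) i j) := by
  simp only [Qsurf, outer, er, Matrix.smul_apply, Matrix.sub_apply, Matrix.of_apply,
    PiLp.smul_apply, smul_eq_mul]
  ring

lemma inner_ek (x : E3) (k : Fin 3) : inner ℝ x (ek k) = x k := by
  simp [ek, EuclideanSpace.inner_single_right]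

lemma hasFDerivAt_coord (x : E3) (i : Fin 3) :
    HasFDerivAt (fun y : E3 => y i) (innerSL ℝ (ek i)) x := by
  have : (fun y : E3 => y i) = innerSL ℝ (ek i) := by
    ext y; rw [innerSL_apply_apply, real_inner_comm, inner_ek]
  rw [this]; exact (innerSL ℝ (ek i)).hasFDerivAt

lemma ek_apply (i k : Fin 3) : ek i k = if i = k then (1 : ℝ) else 0 := by
  simp [ek, PiLp.single_apply, eq_comm]

lemma hasFDerivAt_inv_norm_sq {x : E3} (hx : x ≠ 0) :
    HasFDerivAt (fun y : E3 => (‖y‖ ^ 2)⁻¹) (-(2 * (‖x‖ ^ 4)⁻¹) • innerSL ℝ x) x := by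
  have hx0 := norm_pos_iff.2 hx
  have h := (hasDerivAt_inv (by positivity : ‖x‖ ^ 2 ≠ 0)).comp_hasFDerivAt x
    (hasStrictFDerivAt_norm_sq x).hasFDerivAt
  refine h.congr_fderiv ?_
  ext v
  simp only [_root_.smul_apply, innerSL_apply_apply, smul_eq_mul, nsmul_eq_mul]
  field_simp
  push_cast
  ring

lemma fderiv_Qsurf (a b c : ℝ) {x : E3} (hx : x ≠ 0) (i j k : Fin 3) :
    fderiv ℝ (fun y => Qsurf a b c y i j) x (ek k) = sstar a b c * ((‖x‖ ^ 2)⁻¹ *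
      ((if i = k then 1 else 0) * x j + (if j = k then 1 else 0) * x i) -
      2 * ((‖x‖ ^ 2)⁻¹ * (‖x‖ ^ 2)⁻¹) * (x i * x j * x k)) := by
  have h : HasFDerivAt (fun y => Qsurf a b c y i j) _ x :=
    ((((hasFDerivAt_inv_norm_sq hx).mul ((hasFDerivAt_coord x i).mul
      (hasFDerivAt_coord x j))).sub_const (1 / 3 * (1 : Mat3) i j)).const_mul
      (sstar a b c)).congr_of_eventuallyEq (Eventually.of_forall fun y => Qsurf_apply a b c y i j)
  rw [h.fderiv]
  simp only [_root_.add_apply, _root_.smul_apply, innerSL_apply_apply, smul_eq_mul, inner_ek,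
    Pi.mul_apply, ek_apply]
  have : (‖x‖ ^ 4)⁻¹ = (‖x‖ ^ 2)⁻¹ * (‖x‖ ^ 2)⁻¹ := by rw [← mul_inv, ← pow_add]
  rw [this]
  ring

lemma contDiffAt_Qsurf {n : WithTop ℕ∞} (a b c : ℝ) {x : E3} (hx : x ≠ 0) (i j : Fin 3) :
    ContDiffAt ℝ n (fun y => Qsurf a b c y i j) x := by
  simp only [Qsurf_apply]
  have h1 : ContDiffAt ℝ n (fun x : E3 => (‖x‖ ^ 2)⁻¹) x :=
    (contDiff_norm_sq ℝ).contDiffAt.inv (by have := norm_pos_iff.2 hx; positivity)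
  have h2 : ∀ i : Fin 3, ContDiffAt ℝ n (fun x : E3 => x i) x := fun i => by fun_prop
  exact contDiffAt_const.mul ((h1.mul ((h2 i).mul (h2 j))).sub contDiffAt_const)

lemma abs_mul_le_one {s t : ℝ} (hs : |s| ≤ 1) (ht : |t| ≤ 1) : |s * t| ≤ 1 := by
  rw [abs_mul]; exact mul_le_one₀ hs (abs_nonneg _) ht

lemma tgt_Qsurf (a b c : ℝ) (i j : Fin 3) :
    Tgt (fun x => Qsurf a b c x i j) (|sstar a b c| * 100) := by
  have hd : ∀ i j : Fin 3, |(if i = j then (1 : ℝ) else 0)| ≤ 1 := fun i j => by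
    split_ifs <;> simp
  have hn : ∀ x ∈ OmegaBar, ∃ r : ℝ, ∃ t : Fin 3 → ℝ, 0 < r ∧ r ≤ 1 ∧ (‖x‖ ^ 2)⁻¹ = r ^ 2 ∧
      (∀ l, x l = t l * r⁻¹) ∧ ∀ l, |t l| ≤ 1 := fun x hx => by
    have hx1 : 1 ≤ ‖x‖ := hx
    refine ⟨‖x‖⁻¹, fun l => x l * ‖x‖⁻¹, by positivity, inv_le_one_of_one_le₀ hx1, by simp,
      fun l => by field_simp, fun l => ?_⟩
    rw [abs_mul, abs_inv, abs_norm, ← div_eq_mul_inv]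
    exact div_le_one_of_le₀ (abs_coord_le x l) (norm_nonneg _)
  have hbd : ∀ {r P : ℝ}, 0 < r → r ≤ 1 → |P| ≤ 100 → |sstar a b c * (r * P)| ≤
      |sstar a b c| * 100 := fun {r P} h0 h1 hP => by
    rw [abs_mul, abs_mul, abs_of_pos h0]
    exact mul_le_mul_of_nonneg_left ((mul_le_of_le_one_left (abs_nonneg _) h1).trans hP)
      (abs_nonneg _)
  refine ⟨?_, fun x hx => contDiffAt_Qsurf a b c hx i j, fun x => ?_, fun x hx => ?_,
    fun x hx k => ?_, fun x hx => ?_⟩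
  · simp only [Qsurf_apply]
    have : ∀ i : Fin 3, Measurable fun x : E3 => x i := fun i => by fun_prop
    exact ((((measurable_norm.pow_const 2).inv).mul ((this i).mul (this j))).sub_const _).const_mul _
  · rcases eq_or_ne x 0 with rfl | hx
    · simp
    · simp only [fderiv_Qsurf a b c hx]
      have h0 := norm_pos_iff.2 hx
      have h1 : (‖x‖ ^ 2)⁻¹ * ‖x‖ ^ 2 = 1 := inv_mul_cancel₀ (by positivity)
      have h2 : ∑ k, x k * (sstar a b c * ((‖x‖ ^ 2)⁻¹ *
          ((if i = k then 1 else 0) * x j + (if j = k then 1 else 0) * x i) -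
          2 * ((‖x‖ ^ 2)⁻¹ * (‖x‖ ^ 2)⁻¹) * (x i * x j * x k))) =
          sstar a b c * ((‖x‖ ^ 2)⁻¹ * (2 * (x i * x j)) -
          2 * ((‖x‖ ^ 2)⁻¹ * (‖x‖ ^ 2)⁻¹) * (x i * x j) * ∑ k, x k ^ 2) := by
        fin_cases i <;> fin_cases j <;> simp [Fin.sum_univ_three] <;> ring
      rw [h2, ← norm_sq_eq_sum]
      linear_combination (-2 * sstar a b c * (‖x‖ ^ 2)⁻¹ * (x i * x j)) * h1
  · obtain ⟨r, t, h0, h1, hr, ht, hb⟩ := hn x hx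
    have e : Qsurf a b c x i j = sstar a b c * (1 * (t i * t j - 1 / 3 * (1 : Mat3) i j)) := by
      rw [Qsurf_apply, hr, ht i, ht j]; field_simp
    rw [e]
    refine hbd one_pos le_rfl ?_
    have h3 := abs_le.1 (abs_mul_le_one (hb i) (hb j))
    have h4 := abs_le.1 (hd i j)
    rw [Matrix.one_apply, abs_le]
    constructor <;> linarith
  · obtain ⟨r, t, h0, h1, hr, ht, hb⟩ := hn x hx
    rw [fderiv_Qsurf a b c (ne_zero_of_OmegaBar hx), hr, ht i, ht j, ht k]
    have e : r ^ 2 * ((if i = k then 1 else 0) * (t j * r⁻¹) + (if j = k then 1 else 0) *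
        (t i * r⁻¹)) - 2 * (r ^ 2 * r ^ 2) * (t i * r⁻¹ * (t j * r⁻¹) * (t k * r⁻¹)) =
        r * ((if i = k then 1 else 0) * t j + (if j = k then 1 else 0) * t i -
          2 * (t i * t j * t k)) := by
      field_simp
    rw [e]
    refine hbd h0 h1 ?_
    have h3 := abs_le.1 (abs_mul_le_one (abs_mul_le_one (hb i) (hb j)) (hb k))
    have h4 := abs_le.1 (abs_mul_le_one (hd i k) (hb j))
    have h5 := abs_le.1 (abs_mul_le_one (hd j k) (hb i))
    rw [abs_le]
    constructor <;> linarith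
  · have hx0 := ne_zero_of_OmegaBar hx
    have e1 : ∀ k, fderiv ℝ (fun y => fderiv ℝ (fun z => Qsurf a b c z i j) y (ek k)) x (ek k) =
        sstar a b c * (-(2 * ((‖x‖ ^ 2)⁻¹ * (‖x‖ ^ 2)⁻¹) * x k) *
          ((if i = k then 1 else 0) * x j + (if j = k then 1 else 0) * x i) +
          (‖x‖ ^ 2)⁻¹ * (2 * ((if i = k then 1 else 0) * (if j = k then 1 else 0))) +
          8 * ((‖x‖ ^ 2)⁻¹ * (‖x‖ ^ 2)⁻¹ * (‖x‖ ^ 2)⁻¹) * x k * (x i * x j * x k) -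
          2 * ((‖x‖ ^ 2)⁻¹ * (‖x‖ ^ 2)⁻¹) * ((if i = k then 1 else 0) * (x j * x k) +
            (if j = k then 1 else 0) * (x i * x k) + x i * x j)) := fun k => by
      have h := hasFDerivAt_inv_norm_sq hx0
      have hi := hasFDerivAt_coord x i
      have hj := hasFDerivAt_coord x j
      have hk := hasFDerivAt_coord x k
      have H := ((h.mul ((hj.const_mul (if i = k then (1 : ℝ) else 0)).add
        (hi.const_mul (if j = k then (1 : ℝ) else 0)))).sub
        (((h.mul h).const_mul 2).mul ((hi.mul hj).mul hk))).const_mul (sstar a b c)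
      rw [(H.congr_of_eventuallyEq ((eventually_ne_nhds hx0).mono fun y hy =>
        fderiv_Qsurf a b c hy i j k)).fderiv]
      simp only [_root_.add_apply, _root_.sub_apply, _root_.smul_apply, innerSL_apply_apply,
        smul_eq_mul, inner_ek, Pi.mul_apply, Pi.add_apply, ek_apply, if_true]
      have : (‖x‖ ^ 4)⁻¹ = (‖x‖ ^ 2)⁻¹ * (‖x‖ ^ 2)⁻¹ := by rw [← mul_inv, ← pow_add]
      rw [this]
      ring
    simp only [e1]
    obtain ⟨r, t, h0, h1, hr, ht, hb⟩ := hn x hx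
    have e2 : ∀ k, |-2 * ((if i = k then 1 else 0) * (t k * t j) +
          (if j = k then 1 else 0) * (t k * t i)) +
          2 * ((if i = k then 1 else 0) * (if j = k then 1 else 0)) +
          8 * (t k * (t i * t j * t k)) - 2 * ((if i = k then 1 else 0) * (t j * t k) +
            (if j = k then 1 else 0) * (t i * t k) + t i * t j)| ≤ (33 : ℝ) := fun k => by
      have h3 := abs_le.1 (abs_mul_le_one (hb k) (abs_mul_le_one (abs_mul_le_one (hb i) (hb j)) (hb k)))
      have h4 := abs_le.1 (abs_mul_le_one (hd i k) (abs_mul_le_one (hb k) (hb j)))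
      have h5 := abs_le.1 (abs_mul_le_one (hd j k) (abs_mul_le_one (hb k) (hb i)))
      have h6 := abs_le.1 (abs_mul_le_one (hd i k) (hd j k))
      have h7 := abs_le.1 (abs_mul_le_one (hd i k) (abs_mul_le_one (hb j) (hb k)))
      have h8 := abs_le.1 (abs_mul_le_one (hd j k) (abs_mul_le_one (hb i) (hb k)))
      have h9 := abs_le.1 (abs_mul_le_one (hb i) (hb j))
      rw [abs_le]
      constructor <;> linarith
    rw [hr]
    simp only [ht]
    have e3 := fun k => abs_le.1 (e2 k)
    refine le_trans (le_of_eq ?_) (hbd (r := r ^ 2) (by positivity) (pow_le_one₀ h0.le h1)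
      ((Finset.abs_sum_le_sum_abs (fun k => -2 * ((if i = k then 1 else 0) * (t k * t j) +
          (if j = k then 1 else 0) * (t k * t i)) +
          2 * ((if i = k then 1 else 0) * (if j = k then 1 else 0)) +
          8 * (t k * (t i * t j * t k)) - 2 * ((if i = k then 1 else 0) * (t j * t k) +
            (if j = k then 1 else 0) * (t i * t k) + t i * t j)) Finset.univ).trans
        ((Finset.sum_le_sum fun k _ => e2 k).trans (by simp; norm_num))))
    rw [Finset.mul_sum, Finset.mul_sum]
    refine congrArg abs (Finset.sum_congr rfl fun k _ => ?_)
    field_simp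

lemma Tgt.diff {s : E3 → ℝ} {K : ℝ} (h : Tgt s K) {x : E3} (hx : x ≠ 0) :
    DifferentiableAt ℝ s x := (h.reg x hx).differentiableAt (by norm_num)

lemma Tgt.contDiffOn {s : E3 → ℝ} {K : ℝ} (h : Tgt s K) : ContDiffOn ℝ 1 s OmegaBar := fun x hx =>
  ((h.reg x (ne_zero_of_OmegaBar hx)).of_le (by norm_num)).contDiffWithinAt

lemma Tgt.contDiffAt_fderiv {s : E3 → ℝ} {K : ℝ} (h : Tgt s K) (k : Fin 3) {x : E3} (hx : x ≠ 0) :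
    ContDiffAt ℝ 1 (fun y => fderiv ℝ s y (ek k)) x :=
  ((h.reg x hx).fderiv_right (m := 1) (by norm_num)).clm_apply contDiffAt_const

lemma fderiv_apply_self (A : E3 →L[ℝ] ℝ) (x : E3) : A x = ∑ k, x k * A (ek k) := clm_eq_sum A x

lemma fderiv_ew_mul (β : ℝ) {u : E3 → ℝ} {x : E3} (hx : x ≠ 0) (hu : DifferentiableAt ℝ u x)
    (k : Fin 3) : fderiv ℝ (fun y => ew β y * u y) x (ek k) =
      ew β x * fderiv ℝ u x (ek k) - β * (x k * (‖x‖ ^ 3)⁻¹) * (ew β x * u x) := by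
  have h : fderiv ℝ (fun y => ew β y * u y) x = _ :=
    ((hasFDerivAt_ew β hx).mul hu.hasFDerivAt).fderiv
  rw [h]
  simp only [_root_.add_apply, _root_.smul_apply, smul_eq_mul, innerSL_apply_apply, inner_ek]
  ring

lemma integral_sub_sub_mul_sub {S : Set E3} {f g h l : E3 → ℝ} (hf : IntegrableOn f S)
    (hg : IntegrableOn g S) (hh : IntegrableOn h S) (hl : IntegrableOn l S) (β : ℝ) :
    (∫ x in S, f x) - (∫ x in S, g x) - β * (∫ x in S, h x) - ∫ x in S, l x =
      ∫ x in S, (f x - g x - β * h x - l x) := by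
  rw [integral_sub (f := fun x => f x - g x - β * h x) ((hf.sub hg).sub (hh.const_mul β)) hl,
    integral_sub (f := fun x => f x - g x) (hf.sub hg) (hh.const_mul β), integral_sub hf hg,
    integral_const_mul]

/-- The weighted form of the weak Robin problem. -/
lemma weighted_identity {q gr s ζ : E3 → ℝ} {β K M : ℝ} (hs : Tgt s K)
    (hq : ContDiffOn ℝ 1 q OmegaBar)
    (hq2 : ∀ k, MemLp (fun x => fderiv ℝ q x (ek k)) 2 (volume.restrict Omega))
    (mg : AEStronglyMeasurable gr (volume.restrict Omega)) (bg : ∀ x ∈ Omega, |gr x| ≤ M)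
    (hζ : CT ζ) :
    (∫ x in Omega, (∑ k, fderiv ℝ q x (ek k) * fderiv ℝ (fun y => ew β y * ζ y) x (ek k) +
        gr x * (ew β x * ζ x))) + β * ∫ w, (q w - s w) * (ew β w * ζ w) ∂sph =
      ∫ x in Omega, (∑ k, fderiv ℝ (fun y => ew β y * (q y - s y)) x (ek k) *
          (fderiv ℝ ζ x (ek k) - 2 * β * (x k * (‖x‖ ^ 3)⁻¹) * ζ x) +
        (ew β x * (gr x - ∑ k, fderiv ℝ (fun y => fderiv ℝ s y (ek k)) x (ek k)) -
          β ^ 2 * (‖x‖ ^ 4)⁻¹ * (ew β x * (q x - s x))) * ζ x) := by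
  set e : E3 → ℝ := fun x => ∑ k, fderiv ℝ (fun y => fderiv ℝ s y (ek k)) x (ek k) with he
  have hφ : CT fun y => ew β y * ζ y := hζ.mul (contDiffOn_ew β)
  set v : E3 → ℝ := fun y => ew β y * (q y - s y) with hv
  have sv : ContDiffOn ℝ 1 v OmegaBar := (contDiffOn_ew β).mul (hq.sub hs.contDiffOn)
  obtain ⟨R, hR⟩ := (hζ.mul sv).far
  obtain ⟨i2, e2⟩ := integral_sphere_eq (hζ.mul sv).reg hR
  have e1 := integral_tangential (D := fun k x => fderiv ℝ s x (ek k)) (e := e)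
    (fun k x hx => hs.contDiffAt_fderiv k hx) hs.tang (fun x _ => rfl) hφ
  have cs : ∀ k, ContinuousOn (fun x => fderiv ℝ s x (ek k)) OmegaBar := fun k x hx =>
    (hs.contDiffAt_fderiv k (ne_zero_of_OmegaBar hx)).continuousAt.continuousWithinAt
  have ce : ContinuousOn e OmegaBar := continuousOn_finsetSum _ fun k _ x hx =>
    (((hs.contDiffAt_fderiv k (ne_zero_of_OmegaBar hx)).continuousAt_fderiv one_ne_zero).clm_apply
      continuousAt_const).continuousWithinAt
  have i1 : IntegrableOn (fun x => ∑ k, fderiv ℝ s x (ek k) *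
      fderiv ℝ (fun y => ew β y * ζ y) x (ek k)) Omega :=
    integrable_finsetSum _ fun k _ => ((hφ.bo_fderiv (ek k)).mul (cs k)).integrableOn
  have i3 : IntegrableOn (fun x => e x * (ew β x * ζ x)) Omega := (hφ.bo.mul ce).integrableOn
  have i0 : IntegrableOn (fun x => ∑ k, fderiv ℝ q x (ek k) *
      fderiv ℝ (fun y => ew β y * ζ y) x (ek k) + gr x * (ew β x * ζ x)) Omega :=
    (integrable_finsetSum _ fun k _ => (LI.of_memLp (hq2 k)).integrableOn
      (hφ.bo_fderiv (ek k))).add ((LI.of_abs_le mg bg).integrableOn hφ.bo)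
  have eS : ∫ w, (q w - s w) * (ew β w * ζ w) ∂sph = ∫ w, v w * ζ w ∂sph := by
    refine integral_congr_ae (Eventually.of_forall fun w => ?_)
    have : ‖(w : E3)‖ = 1 := by simp
    simp only [hv, ew_eq_one β this]; ring
  have key : ∫ x in Omega, (∑ k, fderiv ℝ v x (ek k) *
          (fderiv ℝ ζ x (ek k) - 2 * β * (x k * (‖x‖ ^ 3)⁻¹) * ζ x) +
        (ew β x * (gr x - e x) - β ^ 2 * (‖x‖ ^ 4)⁻¹ * (ew β x * (q x - s x))) * ζ x) =
      ∫ x in Omega, ((∑ k, fderiv ℝ q x (ek k) *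
      fderiv ℝ (fun y => ew β y * ζ y) x (ek k) + gr x * (ew β x * ζ x)) -
      (∑ k, fderiv ℝ s x (ek k) * fderiv ℝ (fun y => ew β y * ζ y) x (ek k)) -
      β * (fderiv ℝ (fun y => v y * ζ y) x x / ‖x‖ ^ 3) - e x * (ew β x * ζ x)) := by
    refine setIntegral_congr_fun measurableSet_Omega fun x hx => ?_
    have hx0 := ne_zero_of_Omega hx
    have dq := differentiableAt_of_Omega hq hx
    have dz := differentiableAt_of_Omega hζ.reg hx
    have dv := differentiableAt_of_Omega sv hx
    have h1 : ∀ k, fderiv ℝ v x (ek k) = ew β x * (fderiv ℝ q x (ek k) - fderiv ℝ s x (ek k)) -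
        β * (x k * (‖x‖ ^ 3)⁻¹) * (ew β x * (q x - s x)) := fun k => by
      rw [hv, fderiv_ew_mul (u := fun y => q y - s y) β hx0 (dq.sub (hs.diff hx0)), fderiv_fun_sub dq (hs.diff hx0)]
      rfl
    have h2 : fderiv ℝ (fun y => v y * ζ y) x x = ∑ k, x k *
        (v x * fderiv ℝ ζ x (ek k) + ζ x * fderiv ℝ v x (ek k)) := by
      rw [fderiv_apply_self, fderiv_fun_mul dv dz]
      rfl
    have h3 : (‖x‖ ^ 4)⁻¹ = ∑ k, (x k * (‖x‖ ^ 3)⁻¹) ^ 2 := by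
      simp only [mul_pow]
      rw [← Finset.sum_mul, ← norm_sq_eq_sum]
      have := norm_pos_iff.2 hx0
      field_simp
    simp only [h2, h1]
    simp only [fderiv_ew_mul β hx0 dz, h3, Fin.sum_univ_three, div_eq_mul_inv, hv]
    ring
  rw [key, ← integral_sub_sub_mul_sub i0 i1 i2 i3 β, e1, e2, eS]
  ring

lemma LI.of_LB {m : E3 → ℝ} (hm : LB m) : LI m := by
  have := (LI.of_bounded (F := fun _ => 1) measurable_const (M := 1) (by simp)).mul hm
  simpa only [mul_one] using this

lemma LI.congr {h h' : E3 → ℝ} (i : LI h) (e : ∀ x ∈ Omega, h x = h' x) : LI h' := fun a ha =>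
  (i a ha).congr_fun (fun x hx => by simp only [e x hx]) measurableSet_Omega

lemma WC.congr {h h' : ℕ → E3 → ℝ} {g g' : E3 → ℝ} (hw : WC h g)
    (e : ∀ n, ∀ x ∈ Omega, h n x = h' n x) (e' : ∀ x ∈ Omega, g x = g' x) : WC h' g' := by
  intro a ha
  have h1 : ∀ n, ∫ x in Omega, h' n x * a x = ∫ x in Omega, h n x * a x := fun n =>
    setIntegral_congr_fun measurableSet_Omega fun x hx => by simp only [e n x hx]
  have h2 : ∫ x in Omega, g' x * a x = ∫ x in Omega, g x * a x :=
    setIntegral_congr_fun measurableSet_Omega fun x hx => by simp only [e' x hx]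
  simp only [h1, h2]
  exact hw a ha

lemma WC.affine {h h' k : ℕ → E3 → ℝ} {g g' l m m' r : E3 → ℝ} (hw : WC h g) (hw' : WC h' g')
    (hm : LB m) (hm' : LB m') (hr : LB r) (i : ∀ n, LI (h n)) (i' : ∀ n, LI (h' n)) (j : LI g)
    (j' : LI g') (e : ∀ n, ∀ x ∈ Omega, m x * h n x + m' x * h' n x + r x = k n x)
    (e' : ∀ x ∈ Omega, m x * g x + m' x * g' x + r x = l x) :
    WC k l ∧ (∀ n, LI (k n)) ∧ LI l := by
  have li : ∀ {h h' : E3 → ℝ}, LI h → LI h' → LI fun x => m x * h x + m' x * h' x + r x :=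
    fun i i' => ((i.mul hm).add (i'.mul hm')).add (.of_LB hr)
  exact ⟨(((hw.mul hm).add (hw'.mul hm') (fun n => (i n).mul hm) (fun n => (i' n).mul hm') (j.mul hm)
    (j'.mul hm')).add (WC.const r) (fun n => ((i n).mul hm).add ((i' n).mul hm'))
    (fun _ => .of_LB hr) ((j.mul hm).add (j'.mul hm')) (.of_LB hr)).congr e e',
    fun n => (li (i n) (i' n)).congr (e n), (li j j').congr e'⟩

lemma WC.tendsto_sum {F : Fin 3 → ℕ → E3 → ℝ} {G : Fin 3 → E3 → ℝ} {p : ℕ → E3 → ℝ} {p' : E3 → ℝ}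
    {a : Fin 3 → E3 → ℝ} {b : E3 → ℝ} (hF : ∀ k, WC (F k) (G k)) (hp : WC p p')
    (iF : ∀ k n, LI (F k n)) (iG : ∀ k, LI (G k)) (ip : ∀ n, LI (p n)) (ip' : LI p')
    (ha : ∀ k, BS (a k)) (hb : BS b) :
    Tendsto (fun n => ∫ x in Omega, (∑ k, F k n x * a k x + p n x * b x)) atTop
      (𝓝 (∫ x in Omega, (∑ k, G k x * a k x + p' x * b x))) := by
  have h1 : ∀ {F : Fin 3 → E3 → ℝ} {p : E3 → ℝ}, (∀ k, LI (F k)) → LI p →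
      ∫ x in Omega, (∑ k, F k x * a k x + p x * b x) =
        ∑ k, (∫ x in Omega, F k x * a k x) + ∫ x in Omega, p x * b x := fun h h' => by
    rw [integral_add (integrable_finsetSum _ fun k _ => h k _ (ha k)) (h' _ hb),
      integral_finsetSum _ fun k _ => h k _ (ha k)]
  simp only [h1 (fun k => iF k _) (ip _), h1 iG ip']
  exact (tendsto_finsetSum _ fun k _ => hF k _ (ha k)).add (hp _ hb)

lemma Tgt.lb {s : E3 → ℝ} {K : ℝ} (h : Tgt s K) : LB s := ⟨h.meas, fun _ => ⟨K, fun x hx _ =>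
  h.bdd x (Omega_subset hx)⟩⟩

lemma Tgt.lb_fderiv {s : E3 → ℝ} {K : ℝ} (h : Tgt s K) (k : Fin 3) :
    LB fun x => fderiv ℝ s x (ek k) :=
  ⟨measurable_fderiv_apply_const ℝ s _, fun _ => ⟨K, fun x hx _ => h.bdd' x (Omega_subset hx) k⟩⟩

lemma Tgt.lb_lap {s : E3 → ℝ} {K : ℝ} (h : Tgt s K) :
    LB fun x => ∑ k, fderiv ℝ (fun y => fderiv ℝ s y (ek k)) x (ek k) :=
  ⟨Finset.measurable_fun_sum _ fun _ _ => measurable_fderiv_apply_const ℝ _ _,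
    fun _ => ⟨K, fun x hx _ => h.bdd'' x (Omega_subset hx)⟩⟩

lemma indicator_abs_le {f : E3 → ℝ} {M : ℝ} (hM : 0 ≤ M) (h : ∀ x ∈ Omega, |f x| ≤ M) (x : E3) :
    |Omega.indicator f x| ≤ M := by
  by_cases hx : x ∈ Omega
  · rw [indicator_of_mem hx]; exact h x hx
  · rw [indicator_of_notMem hx]; simpa using hM

lemma kref_eq_sum (σ : ℝ) (F : Fin 3 → E3 → ℝ) (j : Fin 3) (x : E3) : kref σ F j x =
    ∑ i, F i x * ((if i = j then σ else 0) * ‖x‖ ^ 2 -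
      2 * σ * (‖x‖ ^ 2 * (‖x‖ ^ 2)⁻¹) * (x j * x i)) := by
  fin_cases j <;> simp [kref, Fin.sum_univ_three] <;> ring

/-- `C¹` regularity, up to the boundary, of weak limits of almost-critical sequences of the
scalar Robin (`σ = 1`) or Dirichlet (`σ = -1`) problem. -/
theorem limit_regularity {q gr : ℕ → E3 → ℝ} {U g s : E3 → ℝ} {G : Fin 3 → E3 → ℝ} {σ β M K : ℝ}
    (hσ : σ = 1 ∨ σ = -1) (hβ : 0 ≤ β) (hs : Tgt s K)
    (hD : σ = -1 → ∀ n x, ‖x‖ = 1 → q n x = s x)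
    (hq : ∀ n, ContDiffOn ℝ 1 (q n) OmegaBar) (bq : ∀ n, ∀ x ∈ OmegaBar, |q n x| ≤ M)
    (mg : ∀ n, AEStronglyMeasurable (gr n) (volume.restrict Omega))
    (bg : ∀ n, ∀ x ∈ Omega, |gr n x| ≤ M)
    (hq2 : ∀ n k, MemLp (fun x => fderiv ℝ (q n) x (ek k)) 2 (volume.restrict Omega))
    (mU : Measurable U) (bU : ∀ x, |U x| ≤ M) (mg' : Measurable g) (bg' : ∀ x, |g x| ≤ M)
    (mG : ∀ k, Measurable (G k)) (hG2 : ∀ k, MemLp (G k) 2 (volume.restrict Omega))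
    (wU : WC q U) (wG : ∀ k, WC (fun n x => fderiv ℝ (q n) x (ek k)) (G k)) (wg : WC gr g)
    (hEL : ∀ φ, CT φ → (σ = -1 → ∀ x, ‖x‖ = 1 → φ x = 0) → Tendsto (fun n =>
      (∫ x in Omega, (∑ k, fderiv ℝ (q n) x (ek k) * fderiv ℝ φ x (ek k) + gr n x * φ x)) +
        β * ∫ w, (q n w - s w) * φ w ∂sph) atTop (𝓝 0)) :
    ∃ Ψ : E3 → ℝ, ContDiffOn ℝ 1 Ψ OmegaBar ∧ ∀ᵐ x, x ∈ Omega → U x = Ψ x ∧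
      ∀ k, G k x = fderiv ℝ Ψ x (ek k) := by
  have hσ' : |σ| = 1 := by rcases hσ with h | h <;> simp [h]
  have hM : 0 ≤ M := (abs_nonneg _).trans (bU 0)
  have hK : 0 ≤ K := (abs_nonneg _).trans (hs.bdd (ek 0) (by simp [OmegaBar, ek]))
  set e : E3 → ℝ := fun x => ∑ k, fderiv ℝ (fun y => fderiv ℝ s y (ek k)) x (ek k) with he
  set X : Fin 3 → E3 → ℝ := fun k x => x k * (‖x‖ ^ 3)⁻¹ with hX
  have lX : ∀ k, LB (X k) := fun k => (LB.coord k).mul (LB.inv_pow 3)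
  have bX : ∀ k, ∀ x ∈ Omega, |X k x| ≤ 1 := fun k x hx => by
    have hx1 : 1 < ‖x‖ := hx
    have h0 : 0 < ‖x‖ := by linarith
    rw [abs_mul, abs_inv, abs_of_pos (pow_pos h0 3), ← div_eq_mul_inv, div_le_one (by positivity)]
    exact (abs_coord_le x k).trans (le_self_pow₀ hx1.le (by norm_num))
  have lE := LB.ew β
  have lneg : ∀ {m : E3 → ℝ}, LB m → LB fun x => -m x := fun h =>
    (by simpa only [neg_one_mul] using (LB.const (-1)).mul h)
  have bE : ∀ x ∈ Omega, |ew β x| ≤ 1 := fun x hx => by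
    rw [abs_of_pos (ew_pos β x)]; exact ew_le_one hβ (Omega_subset hx)
  have bEm : ∀ x ∈ Omega, ∀ {t c : ℝ}, |t| ≤ c → |ew β x * t| ≤ c := fun x hx t c h =>
    (abs_mul _ t).trans_le ((mul_le_of_le_one_left (abs_nonneg t) (bE x hx)).trans h)
  set v : ℕ → E3 → ℝ := fun n x => ew β x * (q n x - s x) with hv
  have sv : ∀ n, ContDiffOn ℝ 1 (v n) OmegaBar := fun n =>
    (contDiffOn_ew β).mul ((hq n).sub hs.contDiffOn)
  have iq : ∀ n, LI (q n) := fun n => LI.of_abs_le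
    (((hq n).continuousOn.mono Omega_subset).aestronglyMeasurable measurableSet_Omega)
    fun x hx => bq n x (Omega_subset hx)
  have iU : LI U := LI.of_bounded mU bU
  have idq : ∀ n k, LI fun x => fderiv ℝ (q n) x (ek k) := fun n k => LI.of_memLp (hq2 n k)
  have iG : ∀ k, LI (G k) := fun k => LI.of_memLp (hG2 k)
  have ig : ∀ n, LI (gr n) := fun n => LI.of_abs_le (mg n) (bg n)
  have ig' : LI g := LI.of_bounded mg' bg'
  -- the limit fields
  set V : E3 → ℝ := Omega.indicator fun x => ew β x * (U x - s x) with hV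
  set F : Fin 3 → E3 → ℝ := fun k => Omega.indicator fun x =>
    ew β x * (G k x - fderiv ℝ s x (ek k)) - β * X k x * (ew β x * (U x - s x)) with hF
  set P : (E3 → ℝ) → (E3 → ℝ) → E3 → ℝ := fun u h x =>
    ew β x * (h x - e x) - β ^ 2 * (‖x‖ ^ 4)⁻¹ * (ew β x * (u x - s x)) with hP
  set p : E3 → ℝ := Omega.indicator (P U g) with hp
  set B : Fin 3 → E3 → ℝ := fun k => Omega.indicator fun x => 2 * β * X k x with hB
  have dv : ∀ n k, ∀ x ∈ Omega, fderiv ℝ (v n) x (ek k) =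
      ew β x * fderiv ℝ (q n) x (ek k) + -(β * X k x * ew β x) * q n x +
        (β * X k x * (ew β x * s x) + -(ew β x * fderiv ℝ s x (ek k))) := fun n k x hx => by
    have dq := differentiableAt_of_Omega (hq n) hx
    have dsx := hs.diff (ne_zero_of_Omega hx)
    rw [hv, fderiv_ew_mul (u := fun y => q n y - s y) β (ne_zero_of_Omega hx) (dq.sub dsx),
      fderiv_fun_sub dq dsx, _root_.sub_apply]
    simp only [hX]; ring
  have lr1 : ∀ k, LB fun x => -(β * X k x * ew β x) := fun k =>
    lneg (((LB.const β).mul (lX k)).mul lE)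
  have lr2 : ∀ k, LB fun x =>
      (β * X k x * (ew β x * s x) + -(ew β x * fderiv ℝ s x (ek k))) := fun k =>
    (((LB.const β).mul (lX k)).mul (lE.mul hs.lb)).add (lneg (lE.mul (hs.lb_fderiv k)))
  have hF' : ∀ k, WC (fun n x => fderiv ℝ (v n) x (ek k)) (F k) ∧
      (∀ n, LI fun x => fderiv ℝ (v n) x (ek k)) ∧ LI (F k) := fun k =>
    (wG k).affine wU lE (lr1 k) (lr2 k) (fun n => idq n k) iq (iG k) iU
      (fun n x hx => (dv n k x hx).symm) fun x hx => by simp only [hF, indicator_of_mem hx]; ring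
  obtain ⟨wV, iv, iV⟩ : WC v V ∧ (∀ n, LI (v n)) ∧ LI V :=
    wU.affine wU lE (LB.const 0) (lneg (lE.mul hs.lb)) iq iq iU iU
      (fun n x _ => by simp only [hv]; ring)
      fun x hx => by simp only [hV, indicator_of_mem hx]; ring
  have l4 : LB fun x => β ^ 2 * (‖x‖ ^ 4)⁻¹ * ew β x :=
    ((LB.const (β ^ 2)).mul (LB.inv_pow 4)).mul lE
  have lr3 : LB fun x => -(ew β x * e x) + β ^ 2 * (‖x‖ ^ 4)⁻¹ * ew β x * s x :=
    (lneg (lE.mul hs.lb_lap)).add (l4.mul hs.lb)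
  have eP : ∀ {u h : E3 → ℝ} x, ew β x * h x + -(β ^ 2 * (‖x‖ ^ 4)⁻¹ * ew β x) * u x +
      (-(ew β x * e x) + β ^ 2 * (‖x‖ ^ 4)⁻¹ * ew β x * s x) = P u h x := fun x => by
    simp only [hP]; ring
  obtain ⟨wp, ipn, ip⟩ : WC (fun n => P (q n) (gr n)) p ∧ (∀ n, LI (P (q n) (gr n))) ∧ LI p :=
    wg.affine wU lE (lneg l4) lr3 ig iq ig' iU (fun n x _ => eP x)
      fun x hx => by rw [hp, indicator_of_mem hx, eP]
  -- bounds
  have bUs : ∀ x ∈ Omega, |ew β x * (U x - s x)| ≤ M + K := fun x hx =>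
    bEm x hx ((abs_sub _ _).trans (add_le_add (bU x) (hs.bdd x (Omega_subset hx))))
  set N := (M + K) * (1 + β ^ 2) + 2 * β with hN
  have hN1 : M + K ≤ N := by nlinarith [mul_nonneg (add_nonneg hM hK) (sq_nonneg β)]
  have hN2 : 2 * β ≤ N := by nlinarith [mul_nonneg (add_nonneg hM hK) (sq_nonneg β)]
  have mV : Measurable V := (lE.meas.mul (mU.sub hs.meas)).indicator measurableSet_Omega
  have mF : ∀ k, Measurable (F k) := fun k => ((lE.meas.mul ((mG k).sub (hs.lb_fderiv k).meas)).sub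
    (((lX k).meas.const_mul β).mul (lE.meas.mul (mU.sub hs.meas)))).indicator measurableSet_Omega
  have mp : Measurable p := ((lE.meas.mul (mg'.sub hs.lb_lap.meas)).sub
    (((LB.inv_pow 4).meas.const_mul (β ^ 2)).mul
      (lE.meas.mul (mU.sub hs.meas)))).indicator measurableSet_Omega
  have mB : ∀ k, Measurable (B k) := fun k =>
    ((lX k).meas.const_mul (2 * β)).indicator measurableSet_Omega
  have bp : ∀ x ∈ Omega, |P U g x| ≤ N := fun x hx => by
    have hx1 : 1 < ‖x‖ := hx
    have h1 : |ew β x * (g x - e x)| ≤ M + K :=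
      bEm x hx ((abs_sub _ _).trans (add_le_add (bg' x) (hs.bdd'' x (Omega_subset hx))))
    have h2 : |β ^ 2 * (‖x‖ ^ 4)⁻¹ * (ew β x * (U x - s x))| ≤ β ^ 2 * (M + K) := by
      rw [abs_mul, abs_mul, abs_of_nonneg (sq_nonneg β), abs_of_nonneg (a := (‖x‖ ^ 4)⁻¹)
        (by positivity), mul_assoc]
      exact mul_le_mul_of_nonneg_left ((mul_le_of_le_one_left (abs_nonneg _)
        (inv_le_one_of_one_le₀ (one_le_pow₀ hx1.le))).trans (bUs x hx)) (sq_nonneg β)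
    refine (abs_sub _ _).trans ((add_le_add h1 h2).trans ?_)
    rw [hN]; linarith
  have bB : ∀ k, ∀ x ∈ Omega, |2 * β * X k x| ≤ N := fun k x hx => by
    rw [abs_mul, abs_of_nonneg (by positivity)]
    exact (mul_le_of_le_one_right (by positivity) (bX k x hx)).trans hN2
  have hN0 : 0 ≤ N := by positivity
  set A : E3 → ℝ := Omega.indicator fun x => 2 * ∑ k, G k x ^ 2 with hA
  have iA : Integrable A := (integrable_indicator_iff measurableSet_Omega).2
    ((integrable_finsetSum _ fun k _ => (hG2 k).integrable_sq).const_mul 2)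
  have bF : ∀ x k, F k x ^ 2 ≤ A x + 2 * (K + β * (M + K)) ^ 2 := fun x k => by
    by_cases hx : x ∈ Omega
    · have h1 : G k x ^ 2 ≤ ∑ k, G k x ^ 2 :=
        Finset.single_le_sum (f := fun k => G k x ^ 2) (fun _ _ => sq_nonneg _) (Finset.mem_univ k)
      have h2 : |ew β x * fderiv ℝ s x (ek k) + β * X k x * (ew β x * (U x - s x))| ≤
          K + β * (M + K) := by
        refine (abs_add_le _ _).trans (add_le_add (bEm x hx (hs.bdd' x (Omega_subset hx) k)) ?_)
        rw [abs_mul, abs_mul, abs_of_nonneg hβ, mul_assoc]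
        exact mul_le_mul_of_nonneg_left ((mul_le_of_le_one_left (abs_nonneg _)
          (bX k x hx)).trans (bUs x hx)) hβ
      have h3 : (ew β x * G k x) ^ 2 ≤ G k x ^ 2 := by
        rw [mul_pow]
        refine mul_le_of_le_one_left (sq_nonneg _) ?_
        rw [← sq_abs]; exact pow_le_one₀ (abs_nonneg _) (bE x hx)
      have h4 := sq_le_sq' (abs_le.1 h2).1 (abs_le.1 h2).2
      simp only [hF, hA, indicator_of_mem hx]
      nlinarith [sq_nonneg (ew β x * G k x +
        (ew β x * fderiv ℝ s x (ek k) + β * X k x * (ew β x * (U x - s x))))]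
    · simp only [hF, hA, indicator_of_notMem hx, ne_eq, OfNat.ofNat_ne_zero,
        not_false_eq_true, zero_pow, zero_add]
      positivity
  have hreg : ∃ Φ, ContDiff ℝ 1 Φ ∧ ∀ᵐ x, x ∈ Omega → V x = Φ x ∧
      ∀ i, F i x = fderiv ℝ Φ x (ek i) := by
    refine boundary_regularity (V := V) (p := p) (F := F) (B := B) (σ := σ) (M := N)
      (C := 2 * (K + β * (M + K)) ^ 2) (A := A) hσ' mV mp mF mB
      (indicator_abs_le hN0 fun x hx => (bUs x hx).trans hN1) (indicator_abs_le hN0 bp)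
      (fun k => indicator_abs_le hN0 (bB k)) iA bF ?_ ?_
    · intro ζ sζ ⟨R, hR⟩ hζ0
      have cζ : CT ζ := ⟨sζ, R, hR⟩
      have h1 := hEL (fun x => ew β x * ζ x) (cζ.mul (contDiffOn_ew β)) fun h x hx => by
        rw [hζ0 h x hx, mul_zero]
      simp only [weighted_identity hs (hq _) (hq2 _) (mg _) (bg _) cζ] at h1
      have ba : ∀ k, BS fun x => Omega.indicator (fun x => fderiv ℝ ζ x (ek k)) x +
          -(2 * β * X k x) * Omega.indicator ζ x := fun k =>
        (cζ.bo_fderiv (ek k)).bs.add (cζ.bo.bs.mul (lneg ((LB.const (2 * β)).mul (lX k))))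
      have h2 := WC.tendsto_sum (fun k => (hF' k).1) wp (fun k => (hF' k).2.1)
        (fun k => (hF' k).2.2) ipn ip ba cζ.bo.bs
      have h3 := tendsto_nhds_unique h2 (h1.congr fun n =>
        setIntegral_congr_fun measurableSet_Omega fun x hx => by
          simp only [indicator_of_mem hx, hX, hP, hv, he]
          congr 1
          exact Finset.sum_congr rfl fun k _ => by ring)
      have i1 : IntegrableOn (fun x => ∑ k, F k x * fderiv ℝ ζ x (ek k)) Omega :=
        integrable_finsetSum _ fun k _ => (hF' k).2.2.integrableOn (cζ.bo_fderiv (ek k))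
      have i2 : IntegrableOn (fun x => (∑ k, B k x * F k x - p x) * ζ x) Omega := by
        have h : LI fun x => ∑ k, B k x * F k x - p x :=
          (LI.sum fun k _ => (hF' k).2.2.mul (.of_bounded (mB k) (indicator_abs_le hN0 (bB k)))).sub ip
        exact h.integrableOn cζ.bo
      rw [← sub_eq_zero, ← integral_sub i1 i2, ← h3]
      refine setIntegral_congr_fun measurableSet_Omega fun x hx => ?_
      simp only [indicator_of_mem hx, hB, Fin.sum_univ_three]
      ring
    · intro k hk j
      have hσs : ∀ n x, ‖x‖ = 1 → σ * v n x = v n x := fun n x hx => by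
        rcases hσ with h | h
        · rw [h, one_mul]
        · simp only [hv, hD h n x hx]; ring
      have l6 := LB.inv_pow 6
      set a : Fin 3 → E3 → ℝ := fun i x => (if i = j then 1 else 0) * k x +
        ((if i = j then σ else 0) * ‖x‖ ^ 2 + -(2 * σ * (‖x‖ ^ 2 * (‖x‖ ^ 2)⁻¹) * (x j * x i))) *
          ((‖x‖ ^ 6)⁻¹ * k (kel x)) with ha
      have ba : ∀ i, BS (a i) := fun i => ((BS.of_test hk).mul (LB.const _)).add
        (((BS.of_test_kel hk).mul l6).mul (((LB.const _).mul (LB.pow 2)).add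
          (lneg (((LB.const (2 * σ)).mul ((LB.pow 2).mul (LB.inv_pow 2))).mul
            ((LB.coord j).mul (LB.coord i))))))
      have hk' := hk.fderiv (by norm_num) (ek j)
      have bb : BS fun x => fderiv ℝ k x (ek j) + (‖x‖ ^ 6)⁻¹ * (σ * fderiv ℝ k (kel x) (ek j)) :=
        (BS.of_test hk').add (((BS.of_test_kel hk').mul (LB.const σ)).mul l6)
      have h1 := WC.tendsto_sum (fun k => (hF' k).1) wV (fun k => (hF' k).2.1)
        (fun k => (hF' k).2.2) iv iV ba bb
      have h2 : ∀ (u : E3 → ℝ) (f : Fin 3 → E3 → ℝ) x, ∑ i, f i x * a i x +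
          u x * (fderiv ℝ k x (ek j) + (‖x‖ ^ 6)⁻¹ * (σ * fderiv ℝ k (kel x) (ek j))) =
          u x * (fderiv ℝ k x (ek j) + (‖x‖ ^ 6)⁻¹ * (σ * fderiv ℝ k (kel x) (ek j))) +
          (f j x * k x + (‖x‖ ^ 6)⁻¹ * (kref σ f j x * k (kel x))) := fun u f x => by
        have h3 : f j x = ∑ i, f i x * (if i = j then 1 else 0) := by simp
        rw [add_comm, kref_eq_sum, h3, Finset.sum_mul, Finset.sum_mul, Finset.mul_sum,
          ← Finset.sum_add_distrib]
        congr 1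
        exact Finset.sum_congr rfl fun i _ => by simp only [ha]; ring
      have h3 : ∀ n, ∫ x in Omega, (∑ i, fderiv ℝ (v n) x (ek i) * a i x +
          v n x * (fderiv ℝ k x (ek j) + (‖x‖ ^ 6)⁻¹ * (σ * fderiv ℝ k (kel x) (ek j)))) = 0 :=
        fun n => (integral_congr_ae (Eventually.of_forall fun x =>
          h2 (v n) (fun i x => fderiv ℝ (v n) x (ek i)) x)).trans
          (integral_reflect_parts (sv n) hσ' (hσs n) hk j)
      simp only [h3] at h1
      have h4 := tendsto_nhds_unique h1 tendsto_const_nhds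
      simpa only [h2] using h4
  obtain ⟨Φ, sΦ, hΦ⟩ := hreg
  refine ⟨fun x => s x + (ew β x)⁻¹ * Φ x, hs.contDiffOn.add (((contDiffOn_ew β).inv fun x _ =>
    (ew_pos β x).ne').mul sΦ.contDiffOn), ?_⟩
  filter_upwards [hΦ] with x h hx
  obtain ⟨h1, h2⟩ := h hx
  have hx0 := ne_zero_of_Omega hx
  have hE := (ew_pos β x).ne'
  simp only [hV, indicator_of_mem hx] at h1
  refine ⟨by rw [← h1]; field_simp; ring, fun k => ?_⟩
  have h3 := h2 k
  simp only [hF, indicator_of_mem hx] at h3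
  have h4 := hasFDerivAt_ew β hx0
  have h5 : HasFDerivAt (fun x => s x + (ew β x)⁻¹ * Φ x) _ x := (hs.diff hx0).hasFDerivAt.add
    (((hasDerivAt_inv hE).comp_hasFDerivAt x h4).mul
      ((sΦ.differentiable one_ne_zero) x).hasFDerivAt)
  rw [h5.fderiv]
  simp only [_root_.add_apply, _root_.smul_apply, smul_eq_mul, innerSL_apply_apply, inner_ek,
    Function.comp_apply, ← h3, ← h1, hX]
  field_simp
  ring

/-- The integrand of the bulk energy. -/
def eden (a b c L : ℝ) (Q : E3 → Mat3) (x : E3) : ℝ := L / 2 * gradSq Q x + fpot a b c (Q x)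

/-- The anchoring energy with respect to the spherical measure. -/
def surf (a b c : ℝ) (Q : E3 → Mat3) : ℝ :=
  ∫ w, fr (Qsurf a b c w - Q w) (Qsurf a b c w - Q w) ∂sph

/-- Real-valued energy with surface weight `l`. -/
def Jen (a b c L l : ℝ) (Q : E3 → Mat3) : ℝ := (∫ x in Omega, eden a b c L Q x) + l * surf a b c Q

/-- Admissible fields of finite bulk energy. -/
def FA (a b c L : ℝ) (W : ℝ≥0∞) (Q : E3 → Mat3) : Prop :=
  Adm a b c W Q ∧ IntegrableOn (eden a b c L Q) Omega

/-- The matrix of partial derivatives in the direction `ek k`. -/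
def PD (Q : E3 → Mat3) (k : Fin 3) (x : E3) : Mat3 :=
  Matrix.of fun i j => fderiv ℝ (fun y => Q y i j) x (ek k)

lemma gradSq_eq (Q : E3 → Mat3) {x : E3} (hx : x ∈ Omega) :
    gradSq Q x = ∑ k, fr (PD Q k x) (PD Q k x) := by
  simp only [gradSq, fr, PD, Matrix.of_apply, pd_eq hx]
  rw [Finset.sum_comm_cycle]
  simp only [sq]

lemma gradSq_nonneg (Q : E3 → Mat3) (x : E3) : 0 ≤ gradSq Q x :=
  Finset.sum_nonneg fun _ _ => Finset.sum_nonneg fun _ _ => Finset.sum_nonneg fun _ _ => sq_nonneg _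

lemma continuous_fpot (a b c : ℝ) : Continuous (fpot a b c) := by
  unfold fpot gpot
  fun_prop

lemma RegC.continuousOn {Q : E3 → Mat3} (hr : RegC 1 Q) : ContinuousOn Q OmegaBar :=
  continuousOn_pi.2 fun i => continuousOn_pi.2 fun j => (hr i j).continuousOn

lemma RegC.diff {Q : E3 → Mat3} (hr : RegC 1 Q) {x : E3} (hx : x ∈ Omega) (i j : Fin 3) :
    DifferentiableAt ℝ (fun y => Q y i j) x := differentiableAt_of_Omega (hr i j) hx

lemma continuous_fr {X : Type*} [TopologicalSpace X] {f g : X → Mat3} {s : Set X}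
    (hf : ContinuousOn f s) (hg : ContinuousOn g s) : ContinuousOn (fun x => fr (f x) (g x)) s := by
  unfold fr
  have h : ∀ {f : X → Mat3}, ContinuousOn f s → ∀ i j, ContinuousOn (fun x => f x i j) s :=
    fun hf i j => continuousOn_pi.1 (continuousOn_pi.1 hf i) j
  exact continuousOn_finsetSum _ fun i _ => continuousOn_finsetSum _ fun j _ =>
    (h hf i j).mul (h hg i j)

lemma continuousOn_gradSq {Q : E3 → Mat3} (hr : RegC 1 Q) :
    ContinuousOn (gradSq Q) OmegaBar :=
  continuousOn_finsetSum _ fun i _ => continuousOn_finsetSum _ fun j _ =>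
    continuousOn_finsetSum _ fun _ _ =>
      (((hr i j).continuousOn_fderivWithin uniqueDiffOn_OmegaBar le_rfl).clm_apply
        continuousOn_const).pow 2

lemma continuousOn_eden {Q : E3 → Mat3} (a b c L : ℝ) (hr : RegC 1 Q) :
    ContinuousOn (eden a b c L Q) OmegaBar :=
  (continuousOn_const.mul (continuousOn_gradSq hr)).add
    ((continuous_fpot a b c).comp_continuousOn hr.continuousOn)

section
variable {a b c L : ℝ} {W : ℝ≥0∞} {Q : E3 → Mat3}

lemma eden_nonneg (ha : 0 ≤ a) (hb : 0 < b) (hc : 0 < c) (hL : 0 ≤ L) {x : E3} (hQ : isS0 (Q x)) :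
    0 ≤ eden a b c L Q x :=
  add_nonneg (mul_nonneg (by positivity) (gradSq_nonneg Q x)) (fpot_nonneg ha hb hc hQ)

lemma isSymm_Qsurf (a b c : ℝ) (x : E3) : (Qsurf a b c x).IsSymm := by
  refine Matrix.IsSymm.ext fun i j => ?_
  rw [Qsurf_apply, Qsurf_apply, mul_comm (x j), Matrix.one_apply, Matrix.one_apply]
  simp only [eq_comm]

lemma isS0_Qsurf (a b c : ℝ) {x : E3} (hx : x ≠ 0) : isS0 (Qsurf a b c x) := by
  refine ⟨isSymm_Qsurf a b c x, ?_⟩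
  have h1 : (‖x‖ ^ 2)⁻¹ * ∑ i, x i ^ 2 = 1 := by
    rw [← norm_sq_eq_sum]; exact inv_mul_cancel₀ (by have := norm_pos_iff.2 hx; positivity)
  simp only [Matrix.trace, Matrix.diag, Qsurf_apply, Fin.sum_univ_three, Matrix.one_apply_eq] at *
  linear_combination sstar a b c * h1

lemma fr_Qsurf (a b c : ℝ) {x : E3} (hx : x ≠ 0) :
    fr (Qsurf a b c x) (Qsurf a b c x) = 2 / 3 * sstar a b c ^ 2 := by
  have h1 : (‖x‖ ^ 2)⁻¹ * ∑ i, x i ^ 2 = 1 := by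
    rw [← norm_sq_eq_sum]; exact inv_mul_cancel₀ (by have := norm_pos_iff.2 hx; positivity)
  simp only [fr, Qsurf_apply, Fin.sum_univ_three, Matrix.one_apply] at *
  simp
  linear_combination sstar a b c ^ 2 *
    ((‖x‖ ^ 2)⁻¹ * (x 0 ^ 2 + x 1 ^ 2 + x 2 ^ 2) + 1 - 2 / 3) * h1

lemma coe_sphere_norm (w : sphere (0 : E3) 1) : ‖(w : E3)‖ = 1 := by simp

lemma sphere_mem (w : sphere (0 : E3) 1) : (w : E3) ∈ OmegaBar := (coe_sphere_norm w).ge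

lemma continuous_sphere {g : E3 → ℝ} (hg : ContinuousOn g OmegaBar) :
    Continuous fun w : sphere (0 : E3) 1 => g w :=
  continuousOn_univ.1 (hg.comp continuous_subtype_val.continuousOn fun w _ => sphere_mem w)

lemma integrable_sphere {g : E3 → ℝ} (hg : ContinuousOn g OmegaBar) :
    Integrable (fun w : sphere (0 : E3) 1 => g w) sph :=
  (continuous_sphere hg).integrable_of_hasCompactSupport (HasCompactSupport.of_compactSpace _)

lemma continuousOn_Qsurf (a b c : ℝ) : ContinuousOn (Qsurf a b c) OmegaBar :=
  continuousOn_pi.2 fun i => continuousOn_pi.2 fun j => (tgt_Qsurf a b c i j).contDiffOn.continuousOn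

lemma continuousOn_surf (a b c : ℝ) (hr : RegC 1 Q) : ContinuousOn
    (fun x => fr (Qsurf a b c x - Q x) (Qsurf a b c x - Q x)) OmegaBar :=
  continuous_fr ((continuousOn_Qsurf a b c).sub hr.continuousOn)
    ((continuousOn_Qsurf a b c).sub hr.continuousOn)

/-- The surface weight. -/
def lamW (W : ℝ≥0∞) (κ : ℝ≥0) : ℝ := (if W = ⊤ then 0 else W / 2).toReal * κ

lemma lamW_nonneg (W : ℝ≥0∞) (κ : ℝ≥0) : 0 ≤ lamW W κ := mul_nonneg ENNReal.toReal_nonneg κ.2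

lemma FW_eq (ha : 0 ≤ a) (hb : 0 < b) (hc : 0 < c) (hL : 0 ≤ L) {κ : ℝ≥0}
    (hκ : ∀ f : E3 → ℝ≥0∞, ∫⁻ x in sphere (0 : E3) 1, f x ∂μH[2] = κ * ∫⁻ w, f w ∂sph)
    (hQ : FA a b c L W Q) : FW a b c L W Q = ENNReal.ofReal (Jen a b c L (lamW W κ) Q) := by
  obtain ⟨⟨hr, hH, -⟩, hi⟩ := hQ
  have h1 : bulkE a b c L Q = ENNReal.ofReal (∫ x in Omega, eden a b c L Q x) := by
    rw [ofReal_integral_eq_lintegral_ofReal hi]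
    · rfl
    · exact (ae_restrict_iff' measurableSet_Omega).2 (Eventually.of_forall fun x hx =>
        eden_nonneg ha hb hc hL (hH.1 x (Omega_subset hx)))
  have h2 : surfE a b c Q = κ * ENNReal.ofReal (surf a b c Q) := by
    rw [surfE, hκ, surf, ofReal_integral_eq_lintegral_ofReal
      (integrable_sphere (continuousOn_surf a b c hr)) (Eventually.of_forall fun w => fr_self_nonneg _)]
    congr 1
    refine lintegral_congr fun w => ?_
    rw [mnormSq_eq_fr ((isSymm_Qsurf a b c w).sub (hH.1 w (sphere_mem w)).1)]
  have h3 : (if W = ⊤ then 0 else W / 2) ≠ ⊤ := by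
    split_ifs with h
    · exact ENNReal.zero_ne_top
    · exact ENNReal.div_ne_top h two_ne_zero
  have h4 : 0 ≤ surf a b c Q := integral_nonneg fun w => fr_self_nonneg _
  have h5 : 0 ≤ ∫ x in Omega, eden a b c L Q x :=
    setIntegral_nonneg measurableSet_Omega fun x hx =>
      eden_nonneg ha hb hc hL (hH.1 x (Omega_subset hx))
  rw [FW, h1, h2, Jen, ENNReal.ofReal_add h5 (mul_nonneg (lamW_nonneg W κ) h4),
    ENNReal.ofReal_mul (lamW_nonneg W κ), lamW, ENNReal.ofReal_mul ENNReal.toReal_nonneg,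
    ENNReal.ofReal_toReal h3, ENNReal.ofReal_coe_nnreal, mul_assoc]

lemma FW_eq_iInf (ha : 0 ≤ a) (hb : 0 < b) (hc : 0 < c) (hL : 0 < L) {κ : ℝ≥0}
    (hκ : ∀ f : E3 → ℝ≥0∞, ∫⁻ x in sphere (0 : E3) 1, f x ∂μH[2] = κ * ∫⁻ w, f w ∂sph)
    (hQ : FA a b c L W Q)
    (hmin : ∀ P, FA a b c L W P → Jen a b c L (lamW W κ) Q ≤ Jen a b c L (lamW W κ) P) :
    FW a b c L W Q = ⨅ (P : E3 → Mat3) (_ : Adm a b c W P), FW a b c L W P := by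
  refine le_antisymm (le_iInf₂ fun P hP => ?_) (iInf₂_le Q hQ.1)
  by_cases h : IntegrableOn (eden a b c L P) Omega
  · rw [FW_eq ha hb hc hL.le hκ hQ, FW_eq ha hb hc hL.le hκ ⟨hP, h⟩]
    exact ENNReal.ofReal_le_ofReal (hmin P ⟨hP, h⟩)
  · have h1 : bulkE a b c L P = ⊤ := by
      by_contra h2
      exact h ((lintegral_ofReal_ne_top_iff_integrable
        (((continuousOn_eden a b c L hP.1).mono Omega_subset).aestronglyMeasurable
          measurableSet_Omega) ((ae_restrict_iff' measurableSet_Omega).2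
          (Eventually.of_forall fun x hx => eden_nonneg ha hb hc hL.le
            (hP.2.1.1 x (Omega_subset hx))))).1 h2)
    rw [FW, FW, h1, top_add]
    exact le_top

lemma BO.of_continuousOn {g : E3 → ℝ} {R : ℝ} (hg : ContinuousOn g OmegaBar)
    (hR : ∀ x ∈ Omega, R < ‖x‖ → g x = 0) : BO g := by
  obtain ⟨K, hK⟩ := (isCompact_annulus R).exists_bound_of_continuousOn (hg.mono inter_subset_left)
  refine ⟨hg.mono Omega_subset, ⟨|K|, fun x hx => ?_⟩, ⟨R, hR⟩⟩
  rcases lt_or_ge R ‖x‖ with h | h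
  · rw [hR x hx h]; simp
  · exact (hK x ⟨Omega_subset hx, by simpa using h⟩).trans (le_abs_self _)

lemma exists_FA (ha : 0 ≤ a) (hb : 0 < b) (hc : 0 < c) : ∃ Q, FA a b c L W Q := by
  set P : E3 → Mat3 := fun x => Qinf a b c + cut 2 x • (Qsurf a b c x - Qinf a b c) with hP
  have hr : RegC 1 P := fun i j => by
    have : ContDiffOn ℝ 1 (fun x => Qinf a b c i j + cut 2 x *
        (Qsurf a b c x i j - Qinf a b c i j)) OmegaBar :=
      contDiffOn_const.add ((contDiff_cut (n := 1) 2).contDiffOn.mul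
        ((tgt_Qsurf a b c i j).contDiffOn.sub contDiffOn_const))
    exact this
  have hfar : ∀ x : E3, 4 ≤ ‖x‖ → P x = Qinf a b c := fun x hx => by
    simp only [hP, cut_eq_zero two_pos (show 2 * 2 ≤ ‖x‖ by linarith), zero_smul, add_zero]
  have hS0 : ∀ x ∈ OmegaBar, isS0 (P x) := fun x hx => isS0_add (isS0_Qinf a b c)
    (isS0_smul (isS0_sub (isS0_Qsurf a b c (ne_zero_of_OmegaBar hx)) (isS0_Qinf a b c)) _)
  have hg0 : ∀ x ∈ Omega, 4 < ‖x‖ → gradSq P x = 0 := fun x hx h4 => by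
    rw [gradSq_eq P hx]
    refine Finset.sum_eq_zero fun k _ => ?_
    have : PD P k x = 0 := by
      ext i j
      have h : (fun y => P y i j) =ᶠ[𝓝 x] fun _ => Qinf a b c i j := by
        filter_upwards [(isOpen_lt continuous_const continuous_norm).mem_nhds h4] with y hy
        rw [hfar y (le_of_lt hy)]
      rw [PD, Matrix.of_apply, h.fderiv_eq]; simp
    rw [this]; simp [fr]
  refine ⟨P, ⟨hr, ⟨hS0, ?_, ?_⟩, fun _ x hx => ?_⟩, ?_⟩
  · exact (BO.of_continuousOn (continuousOn_gradSq hr) hg0).integrableOn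
  · have : ContinuousOn (fun x => fr (P x - Qinf a b c) (P x - Qinf a b c) / ‖x‖ ^ 2) OmegaBar :=
      (continuous_fr (hr.continuousOn.sub continuousOn_const)
        (hr.continuousOn.sub continuousOn_const)).div (by fun_prop) fun x hx => by
          have := norm_pos_iff.2 (ne_zero_of_OmegaBar hx); positivity
    refine (BO.of_continuousOn (R := 4) this fun x _ h => ?_).integrableOn.congr_fun
      (fun x hx => ?_) measurableSet_Omega
    · simp only [hfar x h.le, sub_self]; simp [fr]
    · simp only
      rw [mnormSq_eq_fr ((hS0 x (Omega_subset hx)).1.sub (isS0_Qinf a b c).1)]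
  · simp only [hP, cut_eq_one two_pos (show ‖x‖ ≤ 2 by linarith), one_smul, add_sub_cancel]
  · refine (BO.of_continuousOn (R := 4) (continuousOn_eden a b c L hr) fun x hx h => ?_).integrableOn
    rw [eden, hg0 x hx h, hfar x h.le, fpot_eq ha hb hc]; simp

end

/-- Truncation of a field at the norm of the bulk minimisers. -/
def truncField (s : ℝ) (Q : E3 → Mat3) (x : E3) : Mat3 :=
  trunc (2 / 3 * s ^ 2) (fr (Q x) (Q x)) • Q x

section
variable {a b c L : ℝ} {W : ℝ≥0∞} {Q P : E3 → Mat3}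

lemma RegC.contDiffOn_fr {Q P : E3 → Mat3} (hr : RegC 1 Q) (hp : RegC 1 P) :
    ContDiffOn ℝ 1 (fun x => fr (Q x) (P x)) OmegaBar := by
  unfold fr
  exact ContDiffOn.sum fun i _ => ContDiffOn.sum fun j _ => (hr i j).mul (hp i j)

lemma RegC.truncField {s : ℝ} (hs : 0 < s) (hr : RegC 1 Q) : RegC 1 (truncField s Q) := fun i j => by
  have h0 : 0 < 2 / 3 * s ^ 2 := by positivity
  have : ContDiffOn ℝ 1 (fun x => trunc (2 / 3 * s ^ 2) (fr (Q x) (Q x)) * Q x i j) OmegaBar :=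
    ((contDiff_trunc h0).comp_contDiffOn (hr.contDiffOn_fr hr)).mul (hr i j)
  exact this

lemma fderiv_fr (hr : RegC 1 Q) {x : E3} (hx : x ∈ Omega) (k : Fin 3) :
    HasFDerivAt (fun x => fr (Q x) (Q x)) (fderiv ℝ (fun x => fr (Q x) (Q x)) x) x ∧
    fderiv ℝ (fun x => fr (Q x) (Q x)) x (ek k) = 2 * fr (Q x) (PD Q k x) := by
  have h : HasFDerivAt (fun x => fr (Q x) (Q x)) (∑ i, ∑ j,
      (Q x i j • fderiv ℝ (fun y => Q y i j) x + Q x i j • fderiv ℝ (fun y => Q y i j) x)) x := by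
    unfold fr
    exact HasFDerivAt.fun_sum fun i _ => HasFDerivAt.fun_sum fun j _ =>
      (hr.diff hx i j).hasFDerivAt.mul (hr.diff hx i j).hasFDerivAt
  refine ⟨h.differentiableAt.hasFDerivAt, ?_⟩
  rw [h.fderiv]
  simp only [_root_.sum_apply, _root_.add_apply, _root_.smul_apply, smul_eq_mul, fr, PD,
    Matrix.of_apply, Finset.mul_sum]
  exact Finset.sum_congr rfl fun i _ => Finset.sum_congr rfl fun j _ => by ring

lemma PD_truncField {s : ℝ} (hs : 0 < s) (hr : RegC 1 Q) {x : E3} (hx : x ∈ Omega) (k : Fin 3) :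
    PD (truncField s Q) k x = trunc (2 / 3 * s ^ 2) (fr (Q x) (Q x)) • PD Q k x +
      (deriv (trunc (2 / 3 * s ^ 2)) (fr (Q x) (Q x)) * (2 * fr (Q x) (PD Q k x))) • Q x := by
  have h0 : 0 < 2 / 3 * s ^ 2 := by positivity
  ext i j
  have h1 : HasFDerivAt (fun y => trunc (2 / 3 * s ^ 2) (fr (Q y) (Q y)))
      (deriv (trunc (2 / 3 * s ^ 2)) (fr (Q x) (Q x)) • fderiv ℝ (fun x => fr (Q x) (Q x)) x) x :=
    (((contDiff_trunc h0).differentiable (by norm_num) _).hasDerivAt).comp_hasFDerivAt x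
      (fderiv_fr hr hx k).1
  have h2 : fderiv ℝ (fun y => truncField s Q y i j) x = _ :=
    (h1.mul (hr.diff hx i j).hasFDerivAt).fderiv
  simp only [PD, Matrix.of_apply, Matrix.add_apply, Matrix.smul_apply, smul_eq_mul]
  rw [h2]
  simp only [_root_.add_apply, _root_.smul_apply, smul_eq_mul, (fderiv_fr hr hx k).2]
  simp only [PD]
  ring

lemma gradSq_truncField_le {s : ℝ} (hs : 0 < s) (hr : RegC 1 Q) {x : E3} (hx : x ∈ Omega) :
    gradSq (truncField s Q) x ≤ gradSq Q x := by
  rw [gradSq_eq _ hx, gradSq_eq _ hx]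
  refine Finset.sum_le_sum fun k _ => ?_
  rw [PD_truncField hs hr hx]
  exact fr_trunc_deriv_le (by positivity) _ _

lemma FA.truncField (ha : 0 ≤ a) (hb : 0 < b) (hc : 0 < c) (hL : 0 < L) {l : ℝ} (hl : 0 ≤ l)
    (hQ : FA a b c L W Q) :
    FA a b c L W (truncField (sstar a b c) Q) ∧
    Jen a b c L l (_root_.truncField (sstar a b c) Q) ≤ Jen a b c L l Q ∧
    ∀ x, fr (_root_.truncField (sstar a b c) Q x) (_root_.truncField (sstar a b c) Q x) ≤
      (2 * sstar a b c) ^ 2 := by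
  obtain ⟨⟨hr, ⟨hS, hg, hm⟩, hD⟩, hi⟩ := hQ
  have hs := sstar_pos (a := a) hb hc
  have h0 : 0 < 2 / 3 * sstar a b c ^ 2 := by positivity
  have hrt := hr.truncField hs
  have hSt : ∀ x ∈ OmegaBar, isS0 (_root_.truncField (sstar a b c) Q x) := fun x hx =>
    isS0_smul (hS x hx) _
  have he : ∀ x ∈ Omega, eden a b c L (_root_.truncField (sstar a b c) Q) x ≤ eden a b c L Q x :=
    fun x hx => add_le_add (mul_le_mul_of_nonneg_left (gradSq_truncField_le hs hr hx) (by positivity))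
      (fpot_trunc_le ha hb hc (hS x (Omega_subset hx)))
  have hie : IntegrableOn (eden a b c L (_root_.truncField (sstar a b c) Q)) Omega := by
    refine Integrable.mono' hi (((continuousOn_eden a b c L hrt).mono
      Omega_subset).aestronglyMeasurable measurableSet_Omega)
      ((ae_restrict_iff' measurableSet_Omega).2 (Eventually.of_forall fun x hx => ?_))
    rw [Real.norm_of_nonneg (eden_nonneg ha hb hc hL.le (hSt x (Omega_subset hx)))]
    exact he x hx
  refine ⟨⟨⟨hrt, ⟨hSt, ?_, ?_⟩, fun hW x hx => ?_⟩, hie⟩, ?_, fun x => ?_⟩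
  · refine Integrable.mono' hg (((continuousOn_gradSq hrt).mono
      Omega_subset).aestronglyMeasurable measurableSet_Omega)
      ((ae_restrict_iff' measurableSet_Omega).2 (Eventually.of_forall fun x hx => ?_))
    rw [Real.norm_of_nonneg (gradSq_nonneg _ _)]
    exact gradSq_truncField_le hs hr hx
  · have h1 : ∀ x ∈ OmegaBar, mnormSq (_root_.truncField (sstar a b c) Q x - Qinf a b c) =
        fr (_root_.truncField (sstar a b c) Q x - Qinf a b c)
          (_root_.truncField (sstar a b c) Q x - Qinf a b c) := fun x hx =>
      mnormSq_eq_fr ((hSt x hx).1.sub (isS0_Qinf a b c).1)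
    have h2 : ContinuousOn (fun x => mnormSq (_root_.truncField (sstar a b c) Q x - Qinf a b c) /
        ‖x‖ ^ 2) Omega := by
      refine ContinuousOn.div ?_ (by fun_prop) fun x hx => by
        have := norm_pos_iff.2 (ne_zero_of_Omega hx); positivity
      exact ((continuous_fr (hrt.continuousOn.sub continuousOn_const)
        (hrt.continuousOn.sub continuousOn_const)).congr h1).mono Omega_subset
    refine Integrable.mono' hm (h2.aestronglyMeasurable measurableSet_Omega)
      ((ae_restrict_iff' measurableSet_Omega).2 (Eventually.of_forall fun x hx => ?_))
    rw [h1 x (Omega_subset hx), mnormSq_eq_fr ((hS x (Omega_subset hx)).1.sub (isS0_Qinf a b c).1),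
      Real.norm_of_nonneg (div_nonneg (fr_self_nonneg _) (sq_nonneg _))]
    gcongr
    exact fr_trunc_sub_le h0 _ (fr_Qinf a b c)
  · have hx0 : x ≠ 0 := fun h => by simp [h] at hx
    rw [_root_.truncField, hD hW x hx, trunc_eq_one h0 (fr_Qsurf a b c hx0).le, one_smul]
  · refine add_le_add (setIntegral_mono_on hie hi measurableSet_Omega he)
      (mul_le_mul_of_nonneg_left (integral_mono (integrable_sphere (continuousOn_surf a b c hrt))
        (integrable_sphere (continuousOn_surf a b c hr)) fun w => ?_) hl)
    have hw : (w : E3) ≠ 0 := ne_zero_of_OmegaBar (sphere_mem w)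
    have h3 : ∀ A B : Mat3, fr (A - B) (A - B) = fr (B - A) (B - A) := fun A B => by
      simp only [fr, Matrix.sub_apply]
      exact Finset.sum_congr rfl fun i _ => Finset.sum_congr rfl fun j _ => by ring
    simp only
    rw [h3, h3 _ (Q w)]
    exact fr_trunc_sub_le h0 _ (fr_Qsurf a b c hw)
  · rw [_root_.truncField, fr_smul_left, fr_smul_right, ← mul_assoc, ← sq]
    refine (trunc_sq_mul_le h0 (fr_self_nonneg _)).trans ?_
    nlinarith [sq_nonneg (sstar a b c)]

lemma exists_minimizing_sequence (ha : 0 ≤ a) (hb : 0 < b) (hc : 0 < c) (hL : 0 < L) {l : ℝ}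
    (hl : 0 ≤ l) : ∃ (m : ℝ) (q : ℕ → E3 → Mat3), 0 ≤ m ∧ (∀ P, FA a b c L W P → m ≤ Jen a b c L l P) ∧
      (∀ n, FA a b c L W (q n)) ∧ (∀ n x, fr (q n x) (q n x) ≤ (2 * sstar a b c) ^ 2) ∧
      ∀ n, Jen a b c L l (q n) ≤ m + 1 / ((n : ℝ) + 1) := by
  set S := Jen a b c L l '' {P | FA a b c L W P} with hS
  have hpos : ∀ y ∈ S, 0 ≤ y := by
    rintro _ ⟨P, hP, rfl⟩
    exact add_nonneg (setIntegral_nonneg measurableSet_Omega fun x hx =>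
      eden_nonneg ha hb hc hL.le (hP.1.2.1.1 x (Omega_subset hx)))
      (mul_nonneg hl (integral_nonneg fun w => fr_self_nonneg _))
  obtain ⟨P0, hP0⟩ := exists_FA (L := L) (W := W) ha hb hc
  have hne : S.Nonempty := ⟨_, P0, hP0, rfl⟩
  have hex : ∀ n : ℕ, ∃ P, FA a b c L W P ∧ Jen a b c L l P ≤ sInf S + 1 / ((n : ℝ) + 1) := fun n => by
    obtain ⟨_, ⟨P, hP, rfl⟩, h⟩ := exists_lt_of_csInf_lt hne
      (lt_add_of_pos_right (sInf S) (show 0 < 1 / ((n : ℝ) + 1) by positivity))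
    exact ⟨P, hP, h.le⟩
  choose p hp hJ using hex
  refine ⟨sInf S, fun n => truncField (sstar a b c) (p n), le_csInf hne hpos, fun P hP =>
    csInf_le ⟨0, hpos⟩ ⟨P, hP, rfl⟩, fun n => ((hp n).truncField ha hb hc hL hl).1,
    fun n => ((hp n).truncField ha hb hc hL hl).2.2,
    fun n => ((hp n).truncField ha hb hc hL hl).2.1.trans (hJ n)⟩

/-- A field that differs from a finite-energy field on a bounded set only. -/
lemma FA.perturb (hQ : FA a b c L W Q) (hr : RegC 1 P) (hS : ∀ x ∈ OmegaBar, isS0 (P x))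
    (hD : W = ⊤ → ∀ x : E3, ‖x‖ = 1 → P x = Qsurf a b c x) {R : ℝ}
    (hR : ∀ x, R ≤ ‖x‖ → P x = Q x) : FA a b c L W P := by
  obtain ⟨⟨hr', ⟨hS', hg, hm⟩, -⟩, hi⟩ := hQ
  have hg0 : ∀ x ∈ Omega, R < ‖x‖ → gradSq P x = gradSq Q x := fun x hx h => by
    rw [gradSq_eq _ hx, gradSq_eq _ hx]
    refine Finset.sum_congr rfl fun k _ => ?_
    have : PD P k x = PD Q k x := by
      ext i j
      have h : (fun y => P y i j) =ᶠ[𝓝 x] fun y => Q y i j := by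
        filter_upwards [(isOpen_lt continuous_const continuous_norm).mem_nhds h] with y hy
        rw [hR y (le_of_lt hy)]
      rw [PD, PD, Matrix.of_apply, Matrix.of_apply, h.fderiv_eq]
    rw [this]
  have key : ∀ {f g : E3 → ℝ}, ContinuousOn f OmegaBar → ContinuousOn g OmegaBar →
      (∀ x ∈ Omega, R < ‖x‖ → f x = g x) → IntegrableOn g Omega → IntegrableOn f Omega :=
    fun {f g} hf hg h hi => by
      have := (BO.of_continuousOn (hf.sub hg) fun x hx hx' => by
        rw [Pi.sub_apply, h x hx hx', sub_self]).integrableOn.add hi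
      rwa [sub_add_cancel] at this
  refine ⟨⟨hr, ⟨hS, key (continuousOn_gradSq hr) (continuousOn_gradSq hr') hg0 hg, ?_⟩, hD⟩,
    key (continuousOn_eden a b c L hr) (continuousOn_eden a b c L hr')
      (fun x hx h => by rw [eden, eden, hg0 x hx h, hR x h.le]) hi⟩
  have hc : ∀ {P : E3 → Mat3}, RegC 1 P → (∀ x ∈ OmegaBar, isS0 (P x)) →
      ContinuousOn (fun x => mnormSq (P x - Qinf a b c) / ‖x‖ ^ 2) OmegaBar := fun {P} hr hS => by
    refine ContinuousOn.div ?_ (by fun_prop) fun x hx => by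
      have := norm_pos_iff.2 (ne_zero_of_OmegaBar hx); positivity
    exact (continuous_fr (hr.continuousOn.sub continuousOn_const)
      (hr.continuousOn.sub continuousOn_const)).congr fun x hx =>
        mnormSq_eq_fr ((hS x hx).1.sub (isS0_Qinf a b c).1)
  exact key (hc hr hS) (hc hr' hS') (fun x _ h => by simp only [hR x h.le]) hm

end

/-- Projection of a matrix unit onto the symmetric traceless matrices. -/
def unitS0 (i j : Fin 3) : Mat3 := Matrix.of fun k l =>
  ((if k = i ∧ l = j then 1 else 0) + (if k = j ∧ l = i then 1 else 0)) / 2 -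
    (if i = j then 1 else 0) * (if k = l then 1 else 0) / 3

lemma isS0_unitS0 (i j : Fin 3) : isS0 (unitS0 i j) := by
  refine ⟨Matrix.IsSymm.ext fun k l => ?_, ?_⟩
  · simp only [unitS0, Matrix.of_apply, eq_comm (a := l) (b := k)]
    rw [add_comm]; simp only [and_comm]
  · fin_cases i <;> fin_cases j <;>
      simp [unitS0, Matrix.trace, Fin.sum_univ_three]

lemma fr_unitS0 {A : Mat3} (hA : isS0 A) (i j : Fin 3) : fr A (unitS0 i j) = A i j := by
  have s1 := hA.1.apply 0 1
  have s2 := hA.1.apply 0 2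
  have s3 := hA.1.apply 1 2
  have ht := hA.2
  simp only [Matrix.trace, Matrix.diag, Fin.sum_univ_three] at ht
  fin_cases i <;> fin_cases j <;>
    simp [unitS0, fr, Fin.sum_univ_three] <;> linarith

lemma fr_unitS0_self_le (i j : Fin 3) : fr (unitS0 i j) (unitS0 i j) ≤ 1 := by
  rw [fr_unitS0 (isS0_unitS0 i j)]
  fin_cases i <;> fin_cases j <;> simp [unitS0] <;> norm_num

lemma isS0_gradf {a b c : ℝ} {Q : Mat3} (hQ : isS0 Q) : isS0 (gradf a b c Q) := by
  have h : (Q * Q - (mnormSq Q / 3) • (1 : Mat3)).IsSymm := by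
    refine Matrix.IsSymm.sub ?_ (Matrix.isSymm_one.smul _)
    rw [Matrix.IsSymm, Matrix.transpose_mul, hQ.1]
  refine ⟨((hQ.1.smul _).sub (h.smul _)).add (hQ.1.smul _), ?_⟩
  simp only [gradf, Matrix.trace_add, Matrix.trace_sub, Matrix.trace_smul, hQ.2, Matrix.trace_one,
    mnormSq, smul_eq_mul, Fintype.card_fin]
  push_cast; ring

section
variable {a b c L : ℝ} {W : ℝ≥0∞} {Q P : E3 → Mat3}

lemma isS0_PD (hr : RegC 1 Q) (hS : ∀ x ∈ OmegaBar, isS0 (Q x)) {x : E3} (hx : x ∈ Omega)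
    (k : Fin 3) : isS0 (PD Q k x) := by
  refine ⟨Matrix.IsSymm.ext fun i j => ?_, ?_⟩
  · simp only [PD, Matrix.of_apply]
    have : (fun y => Q y j i) =ᶠ[𝓝 x] fun y => Q y i j := by
      filter_upwards [OmegaBar_mem_nhds hx] with y hy using (hS y hy).1.apply i j
    rw [this.fderiv_eq]
  · have h0 : (fun y => ∑ i, Q y i i) =ᶠ[𝓝 x] fun _ => 0 := by
      filter_upwards [OmegaBar_mem_nhds hx] with y hy using (hS y hy).2
    have h1 : fderiv ℝ (fun y => ∑ i, Q y i i) x = ∑ i, fderiv ℝ (fun y => Q y i i) x :=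
      (HasFDerivAt.fun_sum fun i _ => (hr.diff hx i i).hasFDerivAt).fderiv
    rw [h0.fderiv_eq] at h1
    have h2 := congrArg (fun T : E3 →L[ℝ] ℝ => T (ek k)) h1
    simp only [_root_.sum_apply] at h2
    simp only [Matrix.trace, Matrix.diag, PD, Matrix.of_apply, ← h2]
    simp

lemma PD_add_smul {φ : E3 → ℝ} (hr : RegC 1 Q) (hφ : CT φ) {x : E3} (hx : x ∈ Omega) (k : Fin 3)
    (t : ℝ) (A : Mat3) :
    PD (fun y => Q y + (t * φ y) • A) k x = PD Q k x + (t * fderiv ℝ φ x (ek k)) • A := by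
  ext i j
  have h : fderiv ℝ (fun y => Q y i j + (t * φ y) * A i j) x = _ :=
    ((hr.diff hx i j).hasFDerivAt.add
      (((differentiableAt_of_Omega hφ.reg hx).hasFDerivAt.const_mul t).mul_const (A i j))).fderiv
  simp only [PD, Matrix.of_apply, Matrix.add_apply, Matrix.smul_apply, smul_eq_mul]
  rw [h]
  simp only [_root_.add_apply, _root_.smul_apply, smul_eq_mul]
  ring

/-- The first variation of the energy in the direction `φ • unitS0 i j`. -/
def firstVar (a b c L l : ℝ) (Q : E3 → Mat3) (i j : Fin 3) (φ : E3 → ℝ) : ℝ :=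
  (∫ x in Omega, (L * ∑ k, PD Q k x i j * fderiv ℝ φ x (ek k) + gradf a b c (Q x) i j * φ x)) +
    2 * l * ∫ w : sphere (0 : E3) 1, (Q w i j - Qsurf a b c w i j) * φ w ∂sph

lemma continuousOn_pd_bar {g : E3 → ℝ} (hg : ContDiffOn ℝ 1 g OmegaBar) (k : Fin 3) :
    ContinuousOn (pd g k) OmegaBar :=
  (hg.continuousOn_fderivWithin uniqueDiffOn_OmegaBar le_rfl).clm_apply continuousOn_const

lemma integrableOn_firstVar (hr : RegC 1 Q) {φ : E3 → ℝ} (hφ : CT φ) (i j : Fin 3) :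
    IntegrableOn (fun x => L * ∑ k, PD Q k x i j * fderiv ℝ φ x (ek k) +
      gradf a b c (Q x) i j * φ x) Omega := by
  have h1 : ∀ k, IntegrableOn (fun x => PD Q k x i j * fderiv ℝ φ x (ek k)) Omega := fun k =>
    ((hφ.bo_fderiv (ek k)).mul (continuousOn_pd_bar (hr i j) k)).integrableOn.congr_fun
      (fun x hx => by simp only [PD, Matrix.of_apply, pd_eq hx]) measurableSet_Omega
  exact ((integrable_finsetSum _ fun k _ => h1 k).const_mul L).add
    (hφ.bo.mul (continuousOn_pi.1 (continuousOn_pi.1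
      ((continuous_gradf a b c).comp_continuousOn hr.continuousOn) i) j)).integrableOn

lemma exists_variation_bound (ha : 0 ≤ a) (hb : 0 < b) (hc : 0 < c) (hL : 0 < L) {l : ℝ}
    (hl : 0 ≤ l) (M : ℝ) {φ : E3 → ℝ} (hφ : CT φ) (hD : W = ⊤ → ∀ x, ‖x‖ = 1 → φ x = 0)
    (i j : Fin 3) : ∃ C, 0 ≤ C ∧ ∀ Q, FA a b c L W Q → (∀ x, fr (Q x) (Q x) ≤ M ^ 2) →
      ∀ t, |t| ≤ 1 → ∃ P, FA a b c L W P ∧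
        Jen a b c L l P ≤ Jen a b c L l Q + t * firstVar a b c L l Q i j φ + C * t ^ 2 := by
  obtain ⟨K, hK⟩ := hφ.bo.bdd
  set M' := max |M| K with hM'
  have hM0 : 0 ≤ M' := (abs_nonneg M).trans (le_max_left _ _)
  obtain ⟨C, hC0, hC⟩ := exists_taylor_bound ha hb hc hM0
  set E : E3 → ℝ := fun x => L / 2 * ∑ k, fderiv ℝ φ x (ek k) ^ 2 + C * φ x ^ 2 with hE
  have iE : IntegrableOn E Omega := by
    have h1 : ∀ k, IntegrableOn (fun x => fderiv ℝ φ x (ek k) ^ 2) Omega := fun k =>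
      ((hφ.bo_fderiv (ek k)).mul (continuousOn_pd_bar hφ.reg k)).integrableOn.congr_fun
        (fun x hx => by simp only [pd_eq hx]; exact (sq _).symm) measurableSet_Omega
    exact ((integrable_finsetSum _ fun k _ => h1 k).const_mul _).add
      (((hφ.bo.mul hφ.reg.continuousOn).integrableOn.congr_fun
        (fun x _ => (sq (φ x)).symm) measurableSet_Omega).const_mul C)
  have hE0 : ∀ x, 0 ≤ E x := fun x => add_nonneg (mul_nonneg (by positivity)
    (Finset.sum_nonneg fun k _ => sq_nonneg _)) (mul_nonneg hC0 (sq_nonneg _))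
  have hφS : Integrable (fun w : sphere (0 : E3) 1 => φ w ^ 2) sph :=
    integrable_sphere (hφ.reg.continuousOn.pow 2)
  refine ⟨(∫ x in Omega, E x) + l * ∫ w : sphere (0 : E3) 1, φ w ^ 2 ∂sph,
    add_nonneg (setIntegral_nonneg measurableSet_Omega fun x _ => hE0 x)
      (mul_nonneg hl (integral_nonneg fun w => sq_nonneg _)), fun Q hQ hM t ht => ?_⟩
  have hr := hQ.1.1
  have hS := hQ.1.2.1.1
  have hrP : RegC 1 fun y => Q y + (t * φ y) • unitS0 i j := fun p q => by
    have : ContDiffOn ℝ 1 (fun y => Q y p q + (t * φ y) * unitS0 i j p q) OmegaBar :=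
      (show ContDiffOn ℝ 1 (fun y => Q y p q) OmegaBar from hr p q).add
        ((contDiffOn_const.mul hφ.reg).mul contDiffOn_const)
    exact this
  obtain ⟨R, hR⟩ := hφ.far
  have hP : FA a b c L W fun y => Q y + (t * φ y) • unitS0 i j :=
    hQ.perturb hrP (fun x hx => isS0_add (hS x hx) (isS0_smul (isS0_unitS0 i j) _))
      (fun hW x hx => by simp only [hD hW x hx, mul_zero, zero_smul, add_zero, hQ.1.2.2 hW x hx])
      (R := R) fun x hx => by simp only [hR x hx, mul_zero, zero_smul, add_zero]
  refine ⟨_, hP, ?_⟩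
  have hU := fr_unitS0_self_le i j
  have hU0 := fr_self_nonneg (unitS0 i j)
  have h1 : ∀ x ∈ Omega, eden a b c L (fun y => Q y + (t * φ y) • unitS0 i j) x ≤
      eden a b c L Q x + t * (L * ∑ k, PD Q k x i j * fderiv ℝ φ x (ek k) +
        gradf a b c (Q x) i j * φ x) + t ^ 2 * E x := fun x hx => by
    have hSx := hS x (Omega_subset hx)
    have g1 : gradSq (fun y => Q y + (t * φ y) • unitS0 i j) x ≤ gradSq Q x +
        2 * t * (∑ k, PD Q k x i j * fderiv ℝ φ x (ek k)) +
          t ^ 2 * ∑ k, fderiv ℝ φ x (ek k) ^ 2 := by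
      rw [gradSq_eq _ hx, gradSq_eq _ hx, Finset.mul_sum, Finset.mul_sum, ← Finset.sum_add_distrib,
        ← Finset.sum_add_distrib]
      refine Finset.sum_le_sum fun k _ => ?_
      rw [PD_add_smul hr hφ hx]
      simp only [fr_add_left, fr_add_right, fr_smul_left, fr_smul_right]
      rw [fr_comm (unitS0 i j) (PD Q k x), fr_unitS0 (isS0_PD hr hS hx k)]
      nlinarith [mul_le_mul_of_nonneg_left hU (sq_nonneg (t * fderiv ℝ φ x (ek k)))]
    have hH : fr ((t * φ x) • unitS0 i j) ((t * φ x) • unitS0 i j) ≤ t ^ 2 * φ x ^ 2 := by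
      rw [fr_smul_left, fr_smul_right]
      nlinarith [mul_le_mul_of_nonneg_left hU (sq_nonneg (t * φ x))]
    have ht2 : t ^ 2 ≤ 1 := by rw [← sq_abs]; exact pow_le_one₀ (abs_nonneg t) ht
    have hφM : φ x ^ 2 ≤ M' ^ 2 := by
      rw [← sq_abs]
      exact pow_le_pow_left₀ (abs_nonneg _) ((hK x hx).trans (le_max_right _ _)) 2
    have hQM : fr (Q x) (Q x) ≤ M' ^ 2 := (hM x).trans (by
      rw [← sq_abs]; exact pow_le_pow_left₀ (abs_nonneg _) (le_max_left _ _) 2)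
    have g2 := (abs_le.1 (hC (Q x) _ hSx (isS0_smul (isS0_unitS0 i j) (t * φ x)) hQM
      (hH.trans (by nlinarith [sq_nonneg (φ x)])))).2
    rw [fr_smul_right, fr_unitS0 (isS0_gradf hSx)] at g2
    have g3 := mul_le_mul_of_nonneg_left hH hC0
    have g4 := mul_le_mul_of_nonneg_left g1 (show 0 ≤ L / 2 by positivity)
    simp only [eden, hE]
    linarith
  have iB := integrableOn_firstVar (L := L) (a := a) (b := b) (c := c) hr hφ i j
  have h2 := setIntegral_mono_on hP.2 ((hQ.2.add (iB.const_mul t)).add (iE.const_mul (t ^ 2)))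
    measurableSet_Omega h1
  rw [integral_add' (hQ.2.add (iB.const_mul t)) (iE.const_mul (t ^ 2)),
    integral_add' hQ.2 (iB.const_mul t), integral_const_mul, integral_const_mul] at h2
  have cS : ContinuousOn (fun x => (Q x i j - Qsurf a b c x i j) * φ x) OmegaBar :=
    ((hr i j).continuousOn.sub (tgt_Qsurf a b c i j).contDiffOn.continuousOn).mul
      hφ.reg.continuousOn
  have iS := integrable_sphere cS
  have i0 := integrable_sphere (continuousOn_surf a b c hr)
  have h3 : surf a b c (fun y => Q y + (t * φ y) • unitS0 i j) ≤ surf a b c Q +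
      2 * t * (∫ w : sphere (0 : E3) 1, (Q w i j - Qsurf a b c w i j) * φ w ∂sph) +
        t ^ 2 * ∫ w : sphere (0 : E3) 1, φ w ^ 2 ∂sph := by
    rw [surf, surf, ← integral_const_mul, ← integral_const_mul, ← integral_add' i0 (iS.const_mul _),
      ← integral_add' (i0.add (iS.const_mul _)) (hφS.const_mul _)]
    refine integral_mono (integrable_sphere (continuousOn_surf a b c hrP))
      ((i0.add (iS.const_mul _)).add (hφS.const_mul _)) fun w => ?_
    simp only [Pi.add_apply]
    have hw := sphere_mem w
    have e1 : Qsurf a b c w - (Q w + (t * φ w) • unitS0 i j) =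
      (Qsurf a b c w - Q w) - (t * φ w) • unitS0 i j := by abel
    have e2 := fr_unitS0 (isS0_sub (isS0_Qsurf a b c (ne_zero_of_OmegaBar hw)) (hS w hw)) i j
    simp only [Matrix.sub_apply] at e2
    simp only [e1]
    rw [fr_sub_left, fr_sub_right, fr_sub_right (D := (t * φ w) • unitS0 i j)]
    simp only [fr_smul_left, fr_smul_right]
    rw [fr_comm (unitS0 i j) (Qsurf a b c w - Q w), e2]
    nlinarith [mul_le_mul_of_nonneg_left hU (sq_nonneg (t * φ w))]
  have h4 := mul_le_mul_of_nonneg_left h3 hl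
  simp only [Jen, firstVar]
  linarith

end

lemma OmegaBar_subset_closure : OmegaBar ⊆ closure Omega := fun x hx => by
  have h1 : 1 ≤ ‖x‖ := hx
  have h2 : Tendsto (fun t : ℝ => t • x) (𝓝[>] 1) (𝓝 x) := by
    have : Tendsto (fun t : ℝ => t • x) (𝓝 1) (𝓝 ((1 : ℝ) • x)) :=
      (continuous_id.smul continuous_const).tendsto 1
    rw [one_smul] at this
    exact this.mono_left nhdsWithin_le_nhds
  refine mem_closure_of_tendsto h2 (eventually_mem_nhdsWithin.mono fun t ht => ?_)
  have ht1 : 1 < t := ht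
  change 1 < ‖t • x‖
  rw [norm_smul, Real.norm_of_nonneg (by linarith)]
  nlinarith

lemma eqOn_OmegaBar_of_ae {f g : E3 → ℝ} (hf : ContinuousOn f OmegaBar) (hg : ContinuousOn g OmegaBar)
    (h : ∀ᵐ x, x ∈ Omega → f x = g x) : EqOn f g OmegaBar := by
  have h1 : f =ᵐ[volume.restrict Omega] g := (ae_restrict_iff' measurableSet_Omega).2 h
  exact (Measure.eqOn_open_of_ae_eq h1 Omega_isOpen (hf.mono Omega_subset)
    (hg.mono Omega_subset)).of_subset_closure hf hg Omega_subset OmegaBar_subset_closure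

lemma abs_le_of_ae {f : E3 → ℝ} {M : ℝ} (hf : ContinuousOn f OmegaBar)
    (h : ∀ᵐ x, x ∈ Omega → |f x| ≤ M) : ∀ x ∈ OmegaBar, |f x| ≤ M := fun x hx => by
  have := eqOn_OmegaBar_of_ae (hf.abs.sup continuousOn_const) (continuousOn_const (c := M))
    (h.mono fun y hy hy' => max_eq_right (hy hy'))
  exact max_eq_right_iff.1 (this hx)

lemma LI.of_continuousOn_bounded {f : E3 → ℝ} {M : ℝ} (hf : ContinuousOn f OmegaBar)
    (h : ∀ x ∈ OmegaBar, |f x| ≤ M) : LI f :=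
  .of_abs_le ((hf.mono Omega_subset).aestronglyMeasurable measurableSet_Omega) fun x hx =>
    h x (Omega_subset hx)

lemma WC.unique {h : ℕ → E3 → ℝ} {f g : E3 → ℝ} (hf : ContinuousOn f OmegaBar)
    (hg : ContinuousOn g OmegaBar) (lf : LI f) (lg : LI g) (h1 : WC h f) (h2 : WC h g) : EqOn f g OmegaBar := by
  have key : ∀ k : ℕ, ∀ᵐ x, x ∈ Omega → cut (k + 1) x * (f x - g x) ^ 2 = 0 := fun k => by
    have hk : (0 : ℝ) < k + 1 := by positivity
    have hbo : BO fun x => cut (k + 1) x * (f x - g x) :=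
      BO.of_continuousOn (R := 2 * (k + 1)) ((contDiff_cut (n := 1) _).continuous.continuousOn.mul
        (hf.sub hg)) fun x _ hx => by simp only [cut_eq_zero hk hx.le, zero_mul]
    have e := tendsto_nhds_unique (h1.tendsto hbo) (h2.tendsto hbo)
    have i1 := lf.integrableOn hbo
    have i2 := lg.integrableOn hbo
    have e2 : ∫ x in Omega, cut (k + 1) x * (f x - g x) ^ 2 = 0 := by
      rw [← sub_eq_zero, ← integral_sub i1 i2] at e
      rw [← e]
      exact integral_congr_ae (Eventually.of_forall fun x => by ring)
    have i3 : IntegrableOn (fun x => cut (k + 1) x * (f x - g x) ^ 2) Omega :=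
      (i1.sub i2).congr (Eventually.of_forall fun x => by simp only [Pi.sub_apply]; ring)
    exact (ae_restrict_iff' measurableSet_Omega).1 ((integral_eq_zero_iff_of_nonneg
      (fun x => mul_nonneg (cut_nonneg _ x) (sq_nonneg _)) i3).1 e2)
  refine eqOn_OmegaBar_of_ae hf hg ((ae_all_iff.2 key).mono fun x hx hxO => ?_)
  obtain ⟨k, hk⟩ := exists_nat_ge ‖x‖
  have := hx k hxO
  rw [cut_eq_one (by positivity) (by linarith), one_mul, sq_eq_zero_iff] at this
  linarith

section
variable {a b c L : ℝ} {W : ℝ≥0∞}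

/-- Limits of minimising sequences. -/
structure LimitField (q : ℕ → E3 → Mat3) (Q : E3 → Mat3) : Prop where
  reg : RegC 1 Q
  isS0 : ∀ x ∈ OmegaBar, isS0 (Q x)
  bdd : ∃ M, 0 ≤ M ∧ ∀ x ∈ OmegaBar, fr (Q x) (Q x) ≤ M ^ 2
  memLp : ∀ i j k, MemLp (fun x => fderiv ℝ (fun y => Q y i j) x (ek k)) 2 (volume.restrict Omega)
  weak : ∀ i j, WC (fun n x => q n x i j) fun x => Q x i j
  weak_fderiv : ∀ i j k α, MemLp α 2 (volume.restrict Omega) →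
    Tendsto (fun n => ∫ x in Omega, fderiv ℝ (fun y => q n y i j) x (ek k) * α x) atTop
      (𝓝 (∫ x in Omega, fderiv ℝ (fun y => Q y i j) x (ek k) * α x))

lemma FA.memLp_fderiv {Q : E3 → Mat3} (hQ : FA a b c L W Q) (i j k : Fin 3) :
    MemLp (fun x => fderiv ℝ (fun y => Q y i j) x (ek k)) 2 (volume.restrict Omega) := by
  rw [memLp_two_iff_integrable_sq (((continuousOn_fderiv_Omega (hQ.1.1 i j)).clm_apply
    continuousOn_const).aestronglyMeasurable measurableSet_Omega)]
  exact (hQ.1.2.1.integrable_pd_sq hQ.1.1 i j k).congr_fun (fun x hx => by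
    simp only [pd_eq hx]) measurableSet_Omega

lemma FA.integral_fderiv_sq_le (ha : 0 ≤ a) (hb : 0 < b) (hc : 0 < c) (hL : 0 < L) {l : ℝ}
    (hl : 0 ≤ l) {Q : E3 → Mat3} (hQ : FA a b c L W Q) (i j k : Fin 3) :
    ∫ x in Omega, fderiv ℝ (fun y => Q y i j) x (ek k) ^ 2 ≤ 2 / L * Jen a b c L l Q := by
  have h1 : ∫ x in Omega, fderiv ℝ (fun y => Q y i j) x (ek k) ^ 2 ≤
      ∫ x in Omega, 2 / L * eden a b c L Q x := by
    refine setIntegral_mono_on ((memLp_two_iff_integrable_sq (hQ.memLp_fderiv i j k).1).1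
      (hQ.memLp_fderiv i j k)) (hQ.2.const_mul _) measurableSet_Omega fun x hx => ?_
    have h2 := sq_pd_le_gradSq Q x i j k
    rw [pd_eq hx] at h2
    have h3 := fpot_nonneg ha hb hc (hQ.1.2.1.1 x (Omega_subset hx))
    calc _ ≤ gradSq Q x := h2
      _ = 2 / L * (L / 2 * gradSq Q x) := by field_simp
      _ ≤ _ := mul_le_mul_of_nonneg_left (by rw [eden]; linarith) (by positivity)
  rw [integral_const_mul] at h1
  refine h1.trans (mul_le_mul_of_nonneg_left ?_ (by positivity))
  exact le_add_of_nonneg_right (mul_nonneg hl (integral_nonneg fun w => fr_self_nonneg _))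

lemma tendsto_firstVar (ha : 0 ≤ a) (hb : 0 < b) (hc : 0 < c) (hL : 0 < L) {l m : ℝ}
    (hl : 0 ≤ l) (hm : ∀ P, FA a b c L W P → m ≤ Jen a b c L l P) {q : ℕ → E3 → Mat3} {M : ℝ}
    (hq : ∀ n, FA a b c L W (q n)) (hM : ∀ n x, fr (q n x) (q n x) ≤ M ^ 2)
    (hJ : ∀ n, Jen a b c L l (q n) ≤ m + 1 / ((n : ℝ) + 1)) {φ : E3 → ℝ} (hφ : CT φ)
    (hD : W = ⊤ → ∀ x, ‖x‖ = 1 → φ x = 0) (i j : Fin 3) :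
    Tendsto (fun n => firstVar a b c L l (q n) i j φ) atTop (𝓝 0) := by
  obtain ⟨C, -, hC⟩ := exists_variation_bound (W := W) ha hb hc hL hl M hφ hD i j
  have h0 : Tendsto (fun n : ℕ => (1 + C) * √(1 / ((n : ℝ) + 1))) atTop (𝓝 0) := by
    simpa using (tendsto_one_div_add_atTop_nhds_zero_nat (𝕜 := ℝ)).sqrt.const_mul (1 + C)
  refine squeeze_zero_norm (fun n => ?_) h0
  set ε := 1 / ((n : ℝ) + 1)
  have hε0 : 0 < ε := by positivity
  have hε1 : ε ≤ 1 := (div_le_one (by positivity)).2 (by simp)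
  set r := √ε
  have hr0 : 0 < r := Real.sqrt_pos.2 hε0
  have hr1 : r ≤ 1 := Real.sqrt_le_one.2 hε1
  have hr2 : r ^ 2 = ε := Real.sq_sqrt hε0.le
  have key : ∀ t, |t| = r → -(t * firstVar a b c L l (q n) i j φ) ≤ (1 + C) * r * r := fun t ht => by
    obtain ⟨P, hP, h1⟩ := hC (q n) (hq n) (hM n) t (ht.le.trans hr1)
    have h2 := hm P hP
    have h3 := hJ n
    have h4 : t ^ 2 = r ^ 2 := by rw [← sq_abs, ht]
    rw [h4] at h1
    nlinarith
  have k1 := key r (abs_of_pos hr0)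
  have k2 := key (-r) (by rw [abs_neg, abs_of_pos hr0])
  rw [Real.norm_eq_abs, abs_le]
  constructor <;> by_contra h <;> nlinarith

lemma exists_limitField (ha : 0 ≤ a) (hb : 0 < b) (hc : 0 < c) (hL : 0 < L) {κ : ℝ≥0} :
    ∃ (m : ℝ) (q : ℕ → E3 → Mat3) (Q : E3 → Mat3),
      (∀ P, FA a b c L W P → m ≤ Jen a b c L (lamW W κ) P) ∧ (∀ n, FA a b c L W (q n)) ∧
      (∀ n x, fr (q n x) (q n x) ≤ (2 * sstar a b c) ^ 2) ∧
      Tendsto (fun n => Jen a b c L (lamW W κ) (q n)) atTop (𝓝 m) ∧ LimitField q Q := by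
  have hl := lamW_nonneg W κ
  obtain ⟨m, q, -, hm, hq, hM, hJ⟩ := exists_minimizing_sequence (W := W) ha hb hc hL hl
  have hs := sstar_pos (a := a) hb hc
  have hJ1 : ∀ n, Jen a b c L (lamW W κ) (q n) ≤ m + 1 := fun n => (hJ n).trans (by
    have : 1 / ((n : ℝ) + 1) ≤ 1 := (div_le_one (by positivity)).2 (by simp)
    linarith)
  have hJm : Tendsto (fun n => Jen a b c L (lamW W κ) (q n)) atTop (𝓝 m) := by
    refine tendsto_of_tendsto_of_tendsto_of_le_of_le tendsto_const_nhds ?_ (fun n => hm _ (hq n)) hJ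
    simpa using (tendsto_one_div_add_atTop_nhds_zero_nat (𝕜 := ℝ)).const_add m
  obtain ⟨φ₁, hφ₁, G, mG, LG, hG⟩ := exists_weak_limit_family (μ := volume.restrict Omega)
    (ι := Fin 3 × Fin 3 × Fin 3) (C := 2 / L * (m + 1))
    (h := fun p n x => fderiv ℝ (fun y => q n y p.1 p.2.1) x (ek p.2.2))
    (fun p n => (hq n).memLp_fderiv _ _ _) fun p n =>
      ((hq n).integral_fderiv_sq_le ha hb hc hL hl _ _ _).trans
        (mul_le_mul_of_nonneg_left (hJ1 n) (by positivity))
  obtain ⟨Cg, hCg0, hCg⟩ := exists_gradf_bound a b c (2 * sstar a b c)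
  have bq : ∀ n x i j, |q n x i j| ≤ 2 * sstar a b c := fun n x i j =>
    abs_le_of_sq_le_sq ((sq_entry_le _ i j).trans (hM n x)) (by positivity)
  have bg : ∀ n, ∀ x ∈ Omega, ∀ i j, |gradf a b c (q n x) i j / L| ≤ Cg / L := fun n x hx i j => by
    rw [abs_div, abs_of_pos hL]
    exact div_le_div_of_nonneg_right (abs_le_of_sq_le_sq ((sq_entry_le _ i j).trans
      (hCg _ ((hq n).1.2.1.1 x (Omega_subset hx)) (hM n x))) hCg0) hL.le
  set M := max (2 * sstar a b c) (Cg / L)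
  have cq : ∀ n i j, ContinuousOn (fun x => q n x i j) OmegaBar := fun n i j =>
    ((hq n).1.1 i j).continuousOn
  have cg : ∀ n i j, ContinuousOn (fun x => gradf a b c (q n x) i j / L) OmegaBar := fun n i j =>
    (continuousOn_pi.1 (continuousOn_pi.1 ((continuous_gradf a b c).comp_continuousOn
      (hq n).1.1.continuousOn) i) j).div_const L
  obtain ⟨φ₂, hφ₂, V, mV, bV, hV⟩ := exists_WC_of_bounded (ι := Bool × Fin 3 × Fin 3) (M := M)
    (h := fun p n x => if p.1 then q (φ₁ n) x p.2.1 p.2.2 else gradf a b c (q (φ₁ n) x) p.2.1 p.2.2 / L)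
    (fun p n => by
      rcases p with ⟨_ | _, i, j⟩
      · exact ((cg (φ₁ n) i j).mono Omega_subset).aestronglyMeasurable measurableSet_Omega
      · exact ((cq (φ₁ n) i j).mono Omega_subset).aestronglyMeasurable measurableSet_Omega)
    (fun p n x hx => by
      rcases p with ⟨_ | _, i, j⟩
      · exact (bg (φ₁ n) x hx i j).trans (le_max_right _ _)
      · exact (bq (φ₁ n) x i j).trans (le_max_left _ _))
  set ψ : ℕ → ℕ := fun n => φ₁ (φ₂ n)
  have hψm : StrictMono ψ := hφ₁.comp hφ₂
  have wU : ∀ i j, WC (fun n x => q (ψ n) x i j) (V (true, i, j)) := fun i j => hV (true, i, j)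
  have wg : ∀ i j, WC (fun n x => gradf a b c (q (ψ n) x) i j / L) (V (false, i, j)) :=
    fun i j => hV (false, i, j)
  have wG : ∀ i j k α, MemLp α 2 (volume.restrict Omega) →
      Tendsto (fun n => ∫ x in Omega, fderiv ℝ (fun y => q (ψ n) y i j) x (ek k) * α x) atTop
        (𝓝 (∫ x in Omega, G (i, j, k) x * α x)) := fun i j k α hα =>
    (hG (i, j, k) α hα).comp hφ₂.tendsto_atTop
  have reg : ∀ i j, ∃ Ψ : E3 → ℝ, ContDiffOn ℝ 1 Ψ OmegaBar ∧ ∀ᵐ x, x ∈ Omega →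
      V (true, i, j) x = Ψ x ∧ ∀ k, G (i, j, k) x = fderiv ℝ Ψ x (ek k) := fun i j => by
    refine limit_regularity (q := fun n x => q (ψ n) x i j)
      (gr := fun n x => gradf a b c (q (ψ n) x) i j / L) (σ := if W = ⊤ then -1 else 1)
      (β := 2 * lamW W κ / L) (M := M) (by split_ifs <;> simp) (by positivity)
      (tgt_Qsurf a b c i j) (fun hσ n x hx => ?_) (fun n => (hq _).1.1 i j)
      (fun n x _ => (bq _ x i j).trans (le_max_left _ _))
      (fun n => ((cg _ i j).mono Omega_subset).aestronglyMeasurable measurableSet_Omega)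
      (fun n x hx => (bg _ x hx i j).trans (le_max_right _ _)) (fun n k => (hq _).memLp_fderiv i j k)
      (mV _) (bV _) (mV _) (bV _) (fun k => mG _) (fun k => LG _) (wU i j)
      (fun k α hα => wG i j k α hα.memLp) (wg i j) fun φ hφ hD => ?_
    · have hW : W = ⊤ := by by_contra h; rw [if_neg h] at hσ; norm_num at hσ
      simp only [(hq (ψ n)).1.2.2 hW x hx]
    · have h1 := ((tendsto_firstVar ha hb hc hL hl hm hq hM hJ hφ
        (fun hW => hD (by simp [hW])) i j).comp hψm.tendsto_atTop).const_mul L⁻¹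
      rw [mul_zero] at h1
      refine h1.congr fun n => ?_
      simp only [Function.comp, firstVar, mul_add, ← integral_const_mul]
      congr 1
      · refine integral_congr_ae (Eventually.of_forall fun x => ?_)
        simp only [PD, Matrix.of_apply]
        field_simp
      · refine integral_congr_ae (Eventually.of_forall fun w => ?_)
        simp only
        ring
  choose Ψ hΨ hΨe using reg
  have cΨ : ∀ i j, ContinuousOn (Ψ i j) OmegaBar := fun i j => (hΨ i j).continuousOn
  have ae_eq : ∀ {f g : E3 → ℝ}, (∀ᵐ x, x ∈ Omega → f x = g x) → ∀ α : E3 → ℝ,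
      ∫ x in Omega, f x * α x = ∫ x in Omega, g x * α x := fun {f g} h α =>
    setIntegral_congr_ae measurableSet_Omega (h.mono fun x hx hxO => by rw [hx hxO])
  have wΨ : ∀ i j, WC (fun n x => q (ψ n) x i j) (Ψ i j) := fun i j α hα => by
    have := wU i j α hα
    rwa [ae_eq ((hΨe i j).mono fun x hx hxO => (hx hxO).1)] at this
  have bΨ : ∀ i j, ∀ x ∈ OmegaBar, |Ψ i j x| ≤ M := fun i j =>
    abs_le_of_ae (cΨ i j) ((hΨe i j).mono fun x hx hxO => (hx hxO).1 ▸ bV _ x)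
  have lq : ∀ n i j, LI fun x => q (ψ n) x i j := fun n i j =>
    .of_continuousOn_bounded (cq _ i j) fun x _ => bq _ x i j
  have lΨ : ∀ i j, LI (Ψ i j) := fun i j => .of_continuousOn_bounded (cΨ i j) (bΨ i j)
  have symm : ∀ i j, EqOn (Ψ i j) (Ψ j i) OmegaBar := fun i j =>
    (wΨ i j).unique (cΨ i j) (cΨ j i) (lΨ i j) (lΨ j i) ((wΨ j i).congr
      (fun n x hx => ((hq (ψ n)).1.2.1.1 x (Omega_subset hx)).1.apply i j) fun _ _ => rfl)
  have trace : EqOn (fun x => Ψ 0 0 x + Ψ 1 1 x + Ψ 2 2 x) (fun _ => 0) OmegaBar := by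
    have l2 := (lΨ 0 0).add (lΨ 1 1)
    refine WC.unique (((cΨ 0 0).add (cΨ 1 1)).add (cΨ 2 2)) continuousOn_const (l2.add (lΨ 2 2))
      (.of_LB (LB.const 0)) (((wΨ 0 0).add (wΨ 1 1) (fun n => lq n 0 0) (fun n => lq n 1 1) (lΨ 0 0)
        (lΨ 1 1)).add (wΨ 2 2) (fun n => (lq n 0 0).add (lq n 1 1)) (fun n => lq n 2 2) l2 (lΨ 2 2))
      ((WC.const fun _ => 0).congr (fun n x hx => ?_) fun _ _ => rfl)
    have := ((hq (ψ n)).1.2.1.1 x (Omega_subset hx)).2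
    simp only [Matrix.trace, Matrix.diag, Fin.sum_univ_three] at this
    exact this.symm
  have eG : ∀ i j k, ∀ᵐ x, x ∈ Omega → G (i, j, k) x = fderiv ℝ (Ψ i j) x (ek k) := fun i j k =>
    (hΨe i j).mono fun x hx hxO => (hx hxO).2 k
  refine ⟨m, fun n => q (ψ n), fun x => Matrix.of fun i j => Ψ i j x, hm, fun n => hq _,
    fun n => hM _, hJm.comp hψm.tendsto_atTop, ⟨hΨ, fun x hx => ⟨Matrix.IsSymm.ext fun i j =>
      symm j i hx, ?_⟩, ⟨3 * M, by positivity, fun x hx => ?_⟩, fun i j k => ?_, wΨ,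
      fun i j k α hα => ?_⟩⟩
  · have := trace hx
    simp only [Matrix.trace, Matrix.diag, Fin.sum_univ_three]
    exact this
  · have h1 : ∀ i j, Ψ i j x * Ψ i j x ≤ M ^ 2 := fun i j => by
      rw [← sq, ← sq_abs]
      exact pow_le_pow_left₀ (abs_nonneg _) (bΨ i j x hx) 2
    calc _ ≤ ∑ _i : Fin 3, ∑ _j : Fin 3, M ^ 2 :=
          Finset.sum_le_sum fun i _ => Finset.sum_le_sum fun j _ => h1 i j
      _ = (3 * M) ^ 2 := by simp; ring
  · exact (memLp_congr_ae ((ae_restrict_iff' measurableSet_Omega).2 (eG i j k))).1 (LG _)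
  · have := wG i j k α hα
    rwa [ae_eq (eG i j k)] at this

end

lemma lintegral_sub_shift_le {v : E3 → ℝ} (hv : ContDiff ℝ 1 v) (z : E3) :
    ∫⁻ x, ‖v x - v (x - z)‖ₑ ≤ ‖z‖ₑ * ∫⁻ x, ‖fderiv ℝ v x‖ₑ := by
  have cf : Continuous (fderiv ℝ v) := hv.continuous_fderiv one_ne_zero
  have h1 : ∀ x, ‖v x - v (x - z)‖ₑ ≤ ∫⁻ t in Ioc (0 : ℝ) 1, ‖z‖ₑ * ‖fderiv ℝ v (x - t • z)‖ₑ :=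
    fun x => by
      have hd : ∀ t ∈ uIcc (0 : ℝ) 1,
          HasDerivAt (fun t : ℝ => v (x - t • z)) (fderiv ℝ v (x - t • z) (-z)) t := fun t _ => by
        have h2 : HasDerivAt (fun t : ℝ => x - t • z) (-z) t := by
          simpa using ((hasDerivAt_id t).smul_const z).const_sub x
        exact ((hv.differentiable one_ne_zero _).hasFDerivAt).comp_hasDerivAt t h2
      have h3 : Continuous fun t : ℝ => fderiv ℝ v (x - t • z) (-z) :=
        (cf.comp (by fun_prop)).clm_apply continuous_const
      have h4 := intervalIntegral.integral_eq_sub_of_hasDerivAt hd (h3.intervalIntegrable 0 1)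
      simp only [one_smul, zero_smul, sub_zero] at h4
      rw [intervalIntegral.integral_of_le zero_le_one] at h4
      rw [← enorm_neg, neg_sub, ← h4]
      refine (enorm_integral_le_lintegral_enorm _).trans (lintegral_mono fun t => ?_)
      rw [mul_comm, ← enorm_neg z]
      exact ContinuousLinearMap.le_opENorm _ _
  refine (lintegral_mono h1).trans ?_
  rw [lintegral_lintegral_swap ((continuous_const.enorm.measurable.mul
    ((cf.comp (by fun_prop)).enorm.measurable)).aemeasurable)]
  have h5 : ∀ t : ℝ, ∫⁻ x, ‖z‖ₑ * ‖fderiv ℝ v (x - t • z)‖ₑ = ‖z‖ₑ * ∫⁻ x, ‖fderiv ℝ v x‖ₑ :=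
    fun t => by
      have h6 : Continuous fun x => fderiv ℝ v (x - t • z) := cf.comp (by fun_prop)
      rw [lintegral_const_mul _ h6.enorm.measurable]
      congr 1
      exact lintegral_sub_right_eq_self (fun x => ‖fderiv ℝ v x‖ₑ) (t • z)
  simp only [h5]
  simp

lemma lintegral_le_average {v : E3 → ℝ} (hv : ContDiff ℝ 1 v) (ε : ℝ) :
    (∫⁻ x, ‖v x‖ₑ) * volume (ball (0 : E3) ε) ≤
      ENNReal.ofReal ε * volume (ball (0 : E3) ε) * (∫⁻ x, ‖fderiv ℝ v x‖ₑ) +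
        ∫⁻ x, ‖∫ z in ball (0 : E3) ε, v (x - z)‖ₑ := by
  have cv := hv.continuous
  have m2 : Measurable fun x => ∫⁻ z in ball (0 : E3) ε, ‖v x - v (x - z)‖ₑ := by
    refine Measurable.lintegral_prod_right' (f := fun p : E3 × E3 => ‖v p.1 - v (p.1 - p.2)‖ₑ) ?_
    exact (by fun_prop : Continuous fun p : E3 × E3 => v p.1 - v (p.1 - p.2)).enorm.measurable
  have hi : ∀ x, IntegrableOn (fun z => v (x - z)) (ball (0 : E3) ε) := fun x =>
    ((cv.comp (by fun_prop)).locallyIntegrable.integrableOn_isCompact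
      (isCompact_closedBall 0 ε)).mono_set ball_subset_closedBall
  have h1 : ∀ x, ‖v x‖ₑ * volume (ball (0 : E3) ε) ≤
      (∫⁻ z in ball (0 : E3) ε, ‖v x - v (x - z)‖ₑ) + ‖∫ z in ball (0 : E3) ε, v (x - z)‖ₑ := fun x => by
    have hfin : volume (ball (0 : E3) ε) ≠ ⊤ := measure_ball_lt_top.ne
    have h2 : ‖v x‖ₑ * volume (ball (0 : E3) ε) = ‖∫ _z in ball (0 : E3) ε, v x‖ₑ := by
      rw [setIntegral_const, smul_eq_mul, enorm_mul, mul_comm, Measure.real,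
        Real.enorm_of_nonneg ENNReal.toReal_nonneg, ENNReal.ofReal_toReal hfin]
    have h3 : ∫ _z in ball (0 : E3) ε, v x = (∫ z in ball (0 : E3) ε, (v x - v (x - z))) +
        ∫ z in ball (0 : E3) ε, v (x - z) := by
      have hs : IntegrableOn (fun z => v x - v (x - z)) (ball (0 : E3) ε) :=
        (integrableOn_const hfin).sub (hi x)
      rw [← integral_add hs (hi x)]
      simp
    rw [h2, h3]
    exact (enorm_add_le _ _).trans (add_le_add (enorm_integral_le_lintegral_enorm _) le_rfl)
  rw [← lintegral_mul_const _ cv.enorm.measurable]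
  refine (lintegral_mono h1).trans ?_
  rw [lintegral_add_left m2]
  refine add_le_add ?_ le_rfl
  rw [lintegral_lintegral_swap (by
    exact (by fun_prop : Continuous fun p : E3 × E3 =>
      v p.1 - v (p.1 - p.2)).enorm.measurable.aemeasurable)]
  calc ∫⁻ z in ball (0 : E3) ε, ∫⁻ x, ‖v x - v (x - z)‖ₑ
      ≤ ∫⁻ z in ball (0 : E3) ε, ENNReal.ofReal ε * ∫⁻ x, ‖fderiv ℝ v x‖ₑ := by
        refine setLIntegral_mono measurable_const fun z hz => ?_
        refine (lintegral_sub_shift_le hv z).trans (mul_le_mul' ?_ le_rfl)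
        rw [← ofReal_norm]
        exact ENNReal.ofReal_le_ofReal (by simpa using (mem_ball_zero_iff.1 hz).le)
    _ = _ := by
        rw [setLIntegral_const]; ring

/-- A form of Rellich's theorem: a bounded family of `C¹` functions with common support whose
local averages converge to zero converges to zero in `L¹`. -/
lemma tendsto_integral_abs_of_averages {v : ℕ → E3 → ℝ} {M R C : ℝ} (hv : ∀ n, ContDiff ℝ 1 (v n))
    (hM : ∀ n x, |v n x| ≤ M) (hR : ∀ n x, R ≤ ‖x‖ → v n x = 0)
    (hC : ∀ n, ∫ x, ‖fderiv ℝ (v n) x‖ ≤ C)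
    (ha : ∀ ε, 0 < ε → ∀ x, Tendsto (fun n => ∫ z in ball (0 : E3) ε, v n (x - z)) atTop (𝓝 0)) :
    Tendsto (fun n => ∫ x, |v n x|) atTop (𝓝 0) := by
  have hcs : ∀ n, HasCompactSupport (v n) := fun n => hasCompactSupport_of_zero (hR n)
  have iv : ∀ n, Integrable (v n) := fun n => (hv n).continuous.integrable_of_hasCompactSupport (hcs n)
  have ifd : ∀ n, Integrable (fderiv ℝ (v n)) := fun n =>
    ((hv n).continuous_fderiv one_ne_zero).integrable_of_hasCompactSupport ((hcs n).fderiv ℝ)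
  have e1 : ∀ n, ∫⁻ x, ‖v n x‖ₑ = ENNReal.ofReal (∫ x, |v n x|) := fun n =>
    (ofReal_integral_norm_eq_lintegral_enorm (iv n)).symm
  have e2 : ∀ n, ∫⁻ x, ‖fderiv ℝ (v n) x‖ₑ ≤ ENNReal.ofReal C := fun n => by
    rw [← ofReal_integral_norm_eq_lintegral_enorm (ifd n)]
    exact ENNReal.ofReal_le_ofReal (hC n)
  have h0 : Tendsto (fun n => ∫⁻ x, ‖v n x‖ₑ) atTop (𝓝 0) := by
    refine ENNReal.tendsto_nhds_zero.2 fun δ hδ => ?_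
    have hδ2 : 0 < δ / 2 := ENNReal.half_pos hδ.ne'
    obtain ⟨ε, hε, hεδ⟩ := ENNReal.exists_nnreal_pos_mul_lt (ENNReal.ofReal_ne_top (r := C)) hδ2.ne'
    set B := ball (0 : E3) ε
    have hB0 : volume B ≠ 0 := (measure_ball_pos volume 0 hε).ne'
    have hBt : volume B ≠ ⊤ := measure_ball_lt_top.ne
    have hI : Tendsto (fun n => ∫⁻ x, ‖∫ z in B, v n (x - z)‖ₑ) atTop (𝓝 0) := by
      have h1 := tendsto_lintegral_of_dominated_convergence (μ := (volume : Measure E3))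
        (F := fun n x => ‖∫ z in B, v n (x - z)‖ₑ) (f := fun _ => 0)
        ((ball (0 : E3) (R + ε)).indicator fun _ => ENNReal.ofReal M * volume B)
        (fun n => by
          have : StronglyMeasurable fun x => ∫ z in B, v n (x - z) := by
            refine StronglyMeasurable.integral_prod_right (f := fun x z => v n (x - z)) ?_
            exact ((hv n).continuous.comp (by fun_prop :
              Continuous fun p : E3 × E3 => p.1 - p.2)).stronglyMeasurable
          exact this.measurable.enorm)
        (fun n => Eventually.of_forall fun x => ?_) ?_ (Eventually.of_forall fun x => ?_)
      · simpa using h1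
      · by_cases hx : x ∈ ball (0 : E3) (R + ε)
        · rw [indicator_of_mem hx]
          refine (enorm_integral_le_lintegral_enorm _).trans ?_
          rw [← setLIntegral_const]
          refine lintegral_mono fun z => ?_
          rw [← ofReal_norm]
          exact ENNReal.ofReal_le_ofReal (hM n _)
        · have h1 : ∫ z in B, v n (x - z) = 0 := setIntegral_eq_zero_of_forall_eq_zero fun z hz => by
            refine hR n _ ?_
            have h2 := norm_sub_norm_le x z
            have h3 : ‖z‖ < ε := mem_ball_zero_iff.1 hz
            have h4 : R + ε ≤ ‖x‖ := by simpa using hx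
            linarith
          simp [h1]
      · rw [lintegral_indicator measurableSet_ball, setLIntegral_const]
        exact ENNReal.mul_ne_top (ENNReal.mul_ne_top ENNReal.ofReal_ne_top hBt)
          measure_ball_lt_top.ne
      · simpa using (ha ε hε x).enorm
    have hpos : 0 < volume B * (δ / 2) := ENNReal.mul_pos hB0 hδ2.ne'
    filter_upwards [ENNReal.tendsto_nhds_zero.1 hI _ hpos] with n hn
    have h6 : (∫⁻ x, ‖v n x‖ₑ) * volume B ≤ δ * volume B := by
      calc _ ≤ _ := lintegral_le_average (hv n) ε
        _ ≤ ENNReal.ofReal (ε : ℝ) * volume B * ENNReal.ofReal C + volume B * (δ / 2) :=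
          add_le_add (mul_le_mul' le_rfl (e2 n)) hn
        _ = (ε * ENNReal.ofReal C) * volume B + δ / 2 * volume B := by
          rw [ENNReal.ofReal_coe_nnreal]; ring
        _ ≤ δ / 2 * volume B + δ / 2 * volume B := add_le_add (mul_le_mul' hεδ.le le_rfl) le_rfl
        _ = δ * volume B := by rw [← add_mul, ENNReal.add_halves]
    exact (ENNReal.mul_le_mul_iff_left hB0 hBt).1 h6
  simp only [e1] at h0
  have := (ENNReal.tendsto_toReal ENNReal.zero_ne_top).comp h0
  simp only [ENNReal.toReal_zero] at this
  refine this.congr fun n => ?_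
  exact ENNReal.toReal_ofReal (integral_nonneg fun x => abs_nonneg _)

lemma exists_cutoff {K : Set E3} (hK : IsCompact K) (hKO : K ⊆ Omega) :
    ∃ χ : E3 → ℝ, ContDiff ℝ 1 χ ∧ HasCompactSupport χ ∧ tsupport χ ⊆ Omega ∧
      (∀ x ∈ K, χ x = 1) := by
  obtain ⟨S, hS, hKS, hSO⟩ := exists_compact_between hK Omega_isOpen hKO
  obtain ⟨f, h0, h1, -⟩ := exists_contMDiffMap_zero_one_of_isClosed (n := ⊤)
    (modelWithCornersSelf ℝ E3) isOpen_interior.isClosed_compl hK.isClosed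
    (disjoint_compl_left_iff_subset.2 hKS)
  have h2 : ∀ x, x ∉ S → f x = 0 := fun x hx => h0 fun h => hx (interior_subset h)
  exact ⟨f, f.contMDiff.contDiff.of_le (by exact_mod_cast le_top), .intro hS h2,
    (closure_minimal (Function.support_subset_iff'.2 h2) hS.isClosed).trans hSO, h1⟩

lemma tendsto_setIntegral_abs_of_WC {u : ℕ → E3 → ℝ} {M C : ℝ}
    (hu : ∀ n, ContDiffOn ℝ 1 (u n) OmegaBar) (hM0 : 0 ≤ M)
    (hM : ∀ n, ∀ x ∈ Omega, |u n x| ≤ M)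
    (hL : ∀ n k, MemLp (fun x => fderiv ℝ (u n) x (ek k)) 2 (volume.restrict Omega))
    (hC : ∀ n k, ∫ x in Omega, fderiv ℝ (u n) x (ek k) ^ 2 ≤ C) (hw : WC u fun _ => 0)
    {K : Set E3} (hK : IsCompact K) (hKO : K ⊆ Omega) :
    Tendsto (fun n => ∫ x in K, |u n x|) atTop (𝓝 0) := by
  obtain ⟨χ, hχ, hcs, hsup, h1⟩ := exists_cutoff hK hKO
  obtain ⟨B, hB0, hB⟩ := exists_abs_bound hχ.continuous hcs
  obtain ⟨R, hR⟩ := hcs.isCompact.isBounded.subset_ball (0 : E3)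
  have hoff : ∀ x, x ∉ Omega → χ x = 0 := fun x hx => image_eq_zero_of_notMem_tsupport fun h => hx (hsup h)
  have hfar : ∀ x, R ≤ ‖x‖ → χ x = 0 := fun x hx => image_eq_zero_of_notMem_tsupport fun h => by
    have := mem_ball_zero_iff.1 (hR h); linarith
  have hv : ∀ n, ContDiff ℝ 1 fun x => u n x * χ x := fun n => contDiff_mul_cutoff hχ
    fun x hx => (hu n).contDiffAt (OmegaBar_mem_nhds (hsup hx))
  have hiχ : Integrable fun x => |χ x| := (hχ.continuous.integrable_of_hasCompactSupport hcs).abs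
  have hidχ : Integrable fun x => ‖fderiv ℝ χ x‖ := ((hχ.continuous_fderiv
    one_ne_zero).integrable_of_hasCompactSupport (hcs.fderiv ℝ)).norm
  have hisq : ∀ n k, IntegrableOn (fun x => fderiv ℝ (u n) x (ek k) ^ 2) Omega := fun n k =>
    (memLp_two_iff_integrable_sq (hL n k).1).1 (hL n k)
  have key : Tendsto (fun n => ∫ x, |u n x * χ x|) atTop (𝓝 0) := by
    refine tendsto_integral_abs_of_averages (M := M * B) (R := R)
      (C := M * (∫ x, ‖fderiv ℝ χ x‖) + B * (∑ _k : Fin 3, C) + ∫ x, |χ x|) hv (fun n x => ?_)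
      (fun n x hx => by rw [hfar x hx, mul_zero]) (fun n => ?_) fun ε hε x => ?_
    · rw [abs_mul]
      by_cases hx : x ∈ Omega
      · exact mul_le_mul (hM n x hx) (hB x) (abs_nonneg _) hM0
      · rw [hoff x hx, abs_zero, mul_zero]; positivity
    · have i1 : IntegrableOn (fun x => B * ∑ k, fderiv ℝ (u n) x (ek k) ^ 2) Omega :=
        (integrable_finsetSum _ fun k _ => hisq n k).const_mul B
      have i2 : IntegrableOn (fun x => M * ‖fderiv ℝ χ x‖ + B * ∑ k, fderiv ℝ (u n) x (ek k) ^ 2)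
        Omega := (hidχ.integrableOn.const_mul M).add i1
      have e0 : ∫ x, ‖fderiv ℝ (fun x => u n x * χ x) x‖ =
          ∫ x in Omega, ‖fderiv ℝ (fun x => u n x * χ x) x‖ := by
        refine (setIntegral_eq_integral_of_forall_compl_eq_zero fun x hx => ?_).symm
        rw [image_eq_zero_of_notMem_tsupport (f := fderiv ℝ fun x => u n x * χ x), norm_zero]
        exact fun h => hx (hsup (closure_mono (Function.support_mul_subset_right _ _)
          (tsupport_fderiv_subset ℝ h)))
      have hle : ∀ x ∈ Omega, ‖fderiv ℝ (fun x => u n x * χ x) x‖ ≤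
          M * ‖fderiv ℝ χ x‖ + B * (∑ k, fderiv ℝ (u n) x (ek k) ^ 2) + |χ x| := fun x hx => by
        rw [((differentiableAt_of_Omega (hu n) hx).hasFDerivAt.fun_mul
          (hχ.differentiable one_ne_zero x).hasFDerivAt).fderiv]
        refine (norm_add_le _ _).trans ?_
        rw [norm_smul, norm_smul, Real.norm_eq_abs, Real.norm_eq_abs]
        have h2 := norm_sq_le_sum (fderiv ℝ (u n) x)
        have h3 : ‖fderiv ℝ (u n) x‖ ≤ ‖fderiv ℝ (u n) x‖ ^ 2 + 1 := by
          nlinarith [sq_nonneg (‖fderiv ℝ (u n) x‖ - 1)]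
        have h4 := mul_le_mul_of_nonneg_left h3 (abs_nonneg (χ x))
        have h5 := mul_le_mul (hB x) h2 (by positivity) hB0
        have h6 := mul_le_mul_of_nonneg_right (hM n x hx) (norm_nonneg (fderiv ℝ χ x))
        linarith
      rw [e0]
      have hcd := (hv n).continuous_fderiv one_ne_zero
      refine (setIntegral_mono_on (hcd.norm.integrable_of_hasCompactSupport
        (hcs.mul_left.fderiv ℝ).norm).integrableOn (i2.add hiχ.integrableOn)
        measurableSet_Omega hle).trans ?_
      rw [integral_add' i2 hiχ.integrableOn, integral_add (hidχ.integrableOn.const_mul M) i1,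
        integral_const_mul, integral_const_mul, integral_finsetSum _ fun k _ => hisq n k]
      refine add_le_add (add_le_add (mul_le_mul_of_nonneg_left ?_ hM0) (mul_le_mul_of_nonneg_left
        (Finset.sum_le_sum fun k _ => hC n k) hB0)) ?_
      · exact setIntegral_le_integral hidχ (Eventually.of_forall fun x => norm_nonneg _)
      · exact setIntegral_le_integral hiχ (Eventually.of_forall fun x => abs_nonneg _)
    · have hbs : BS ((ball x ε).indicator χ) := by
        refine ⟨hχ.continuous.measurable.indicator measurableSet_ball, ⟨B, fun y _ => ?_⟩,
          ⟨R, fun y hy => indicator_apply_eq_zero.2 fun _ => hfar y hy.le⟩⟩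
        rcases indicator_eq_zero_or_self (ball x ε) χ y with h | h <;> rw [h]
        · simpa using hB0
        · exact hB y
      have h2 := hw _ hbs
      simp only [zero_mul, integral_zero] at h2
      refine h2.congr fun n => ?_
      rw [← integral_indicator measurableSet_Omega, ← integral_indicator measurableSet_ball,
        ← integral_sub_left_eq_self (fun z => (ball (0 : E3) ε).indicator
          (fun z => u n (x - z) * χ (x - z)) z) volume x]
      refine integral_congr_ae (Eventually.of_forall fun y => ?_)
      have h3 : x - y ∈ ball (0 : E3) ε ↔ y ∈ ball x ε := by
        rw [mem_ball_zero_iff, mem_ball, dist_eq_norm, norm_sub_rev]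
      by_cases hy : y ∈ Omega <;> by_cases hb : y ∈ ball x ε <;>
        simp only [indicator, hy, hb, h3, if_true, if_false, sub_sub_cancel, hoff, mul_zero,
          not_false_eq_true]
  refine squeeze_zero (fun n => integral_nonneg fun x => abs_nonneg _) (fun n => ?_) key
  rw [setIntegral_congr_fun (g := fun x => |u n x * χ x|) hK.measurableSet fun x hx => by
    simp only [h1 x hx, mul_one]]
  exact setIntegral_le_integral ((hv n).continuous.integrable_of_hasCompactSupport hcs.mul_left).abs
    (Eventually.of_forall fun x => abs_nonneg _)

lemma continuousOn_coord_div (k : Fin 3) : ContinuousOn (fun x : E3 => x k / ‖x‖ ^ 3) OmegaBar :=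
  ContinuousOn.div (by fun_prop) (by fun_prop) fun x hx =>
    pow_ne_zero 3 (norm_ne_zero_iff.2 (ne_zero_of_OmegaBar hx))

/-- Fatou's lemma for functions converging in `L¹` on compact subsets of the exterior domain. -/
lemma integral_le_of_tendsto_compact {F : ℕ → E3 → ℝ} {G : E3 → ℝ} {B : ℕ → ℝ} {β : ℝ}
    (hG : ContinuousOn G OmegaBar) (hF : ∀ n, IntegrableOn (F n) Omega)
    (hF0 : ∀ n, ∀ x ∈ Omega, 0 ≤ F n x) (hG0 : ∀ x ∈ Omega, 0 ≤ G x)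
    (h : ∀ K, IsCompact K → K ⊆ Omega → Tendsto (fun n => ∫ x in K, F n x) atTop (𝓝 (∫ x in K, G x)))
    (hB : ∀ n, ∫ x in Omega, F n x ≤ B n) (hβ : Tendsto B atTop (𝓝 β)) :
    IntegrableOn G Omega ∧ ∫ x in Omega, G x ≤ β := by
  set K : ℕ → Set E3 := fun k => closedBall 0 (k + 1 : ℝ) \ ball 0 (1 + 1 / (k + 1 : ℝ)) with hK
  have hKc : ∀ k, IsCompact (K k) := fun k => (isCompact_closedBall _ _).diff isOpen_ball
  have hKO : ∀ k, K k ⊆ Omega := fun k x hx => by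
    have h1 : 1 + 1 / (k + 1 : ℝ) ≤ ‖x‖ := by simpa using hx.2
    have h2 : 0 < 1 / (k + 1 : ℝ) := by positivity
    change 1 < ‖x‖
    linarith
  have hres : ∀ k, (volume.restrict Omega).restrict (K k) = volume.restrict (K k) := fun k => by
    rw [Measure.restrict_restrict (hKc k).measurableSet, inter_eq_left.2 (hKO k)]
  have hcov : AECover (volume.restrict Omega) atTop K := by
    refine ⟨?_, fun k => (hKc k).measurableSet⟩
    refine (ae_restrict_mem measurableSet_Omega).mono fun x hx => ?_
    have h1 : 0 < ‖x‖ - 1 := sub_pos.2 hx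
    filter_upwards [(tendsto_one_div_add_atTop_nhds_zero_nat (𝕜 := ℝ)).eventually_le_const h1,
      (tendsto_natCast_atTop_atTop (R := ℝ)).eventually_ge_atTop ‖x‖] with k h2 h3
    exact ⟨by simpa using h3.trans (by linarith), by simpa using (by linarith : 1 + 1 / (k + 1 : ℝ) ≤ ‖x‖)⟩
  have hle : ∀ k, ∫ x in K k, G x ≤ β := fun k => by
    refine le_of_tendsto_of_tendsto' (h _ (hKc k) (hKO k)) hβ fun n => ?_
    exact (setIntegral_mono_set (hF n) ((ae_restrict_mem measurableSet_Omega).mono (hF0 n))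
      (hKO k).eventuallyLE).trans (hB n)
  have hi : IntegrableOn G Omega := by
    refine hcov.integrable_of_integral_bounded_of_nonneg_ae β (fun k => ?_)
      ((ae_restrict_mem measurableSet_Omega).mono hG0) (Eventually.of_forall fun k => ?_)
    · rw [IntegrableOn, hres]
      exact (hG.mono ((hKO k).trans Omega_subset)).integrableOn_compact (hKc k)
    · rw [hres]; exact hle k
  refine ⟨hi, le_of_tendsto' (hcov.integral_tendsto_of_countably_generated hi) fun k => ?_⟩
  rw [hres]; exact hle k

lemma integral_sphere_mul {u φ : E3 → ℝ} (hu : ContDiffOn ℝ 1 u OmegaBar)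
    (hL : ∀ k, MemLp (fun x => fderiv ℝ u x (ek k)) 2 (volume.restrict Omega)) (hφ : CT φ) :
    ∫ w, u w * φ w ∂sph = -∑ k, ((∫ x in Omega, fderiv ℝ u x (ek k) * (x k / ‖x‖ ^ 3 * φ x)) +
      ∫ x in Omega, u x * (x k / ‖x‖ ^ 3 * fderiv ℝ φ x (ek k))) := by
  obtain ⟨R, hR⟩ := (hφ.mul hu).far
  have hm := continuousOn_coord_div
  have i1 := fun k => (LI.of_memLp (hL k)).integrableOn (hφ.bo.mul (hm k))
  have i2 := fun k => (((hφ.bo_fderiv (ek k)).mul (hm k)).mul hu.continuousOn).integrableOn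
  have i3 : ∀ k, IntegrableOn (fun x => fderiv ℝ u x (ek k) * (x k / ‖x‖ ^ 3 * φ x) +
      u x * (x k / ‖x‖ ^ 3 * fderiv ℝ φ x (ek k))) Omega := fun k => (i1 k).add (i2 k)
  rw [← neg_eq_iff_eq_neg, ← (integral_sphere_eq (hφ.mul hu).reg hR).2]
  rw [← Finset.sum_congr rfl fun k _ => integral_add (i1 k) (i2 k),
    ← integral_finsetSum _ fun k _ => i3 k]
  refine setIntegral_congr_fun measurableSet_Omega fun x hx => ?_
  simp only []
  rw [((differentiableAt_of_Omega hu hx).hasFDerivAt.fun_mul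
    (differentiableAt_of_Omega hφ.reg hx).hasFDerivAt).fderiv, clm_eq_sum, Finset.sum_div]
  refine Finset.sum_congr rfl fun k _ => ?_
  simp only [_root_.add_apply, _root_.smul_apply, smul_eq_mul]
  ring

lemma LimitField.tendsto_sphere {q : ℕ → E3 → Mat3} {Q : E3 → Mat3} (hQ : LimitField q Q)
    (hq : ∀ n, RegC 1 (q n)) (hL : ∀ n i j k, MemLp (fun x => fderiv ℝ (fun y => q n y i j) x (ek k)) 2
      (volume.restrict Omega)) {φ : E3 → ℝ} (hφ : CT φ) (i j : Fin 3) :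
    Tendsto (fun n => ∫ w, q n w i j * φ w ∂sph) atTop (𝓝 (∫ w, Q w i j * φ w ∂sph)) := by
  rw [integral_sphere_mul (u := fun x => Q x i j) (hQ.reg i j) (hQ.memLp i j) hφ]
  simp only [fun n => integral_sphere_mul (u := fun x => q n x i j) (hq n i j) (hL n i j) hφ]
  have hm := continuousOn_coord_div
  refine (tendsto_finsetSum _ fun k _ => Tendsto.add ?_ ?_).neg
  · simpa only [integral_mul_indicator_Omega] using
      hQ.weak_fderiv i j k _ (hφ.bo.mul (hm k)).bs.memLp
  · exact (hQ.weak i j).tendsto ((hφ.bo_fderiv (ek k)).mul (hm k))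

lemma tendsto_sq_of_weak {μ : Measure E3} {h : ℕ → E3 → ℝ} {g : E3 → ℝ} (hh : ∀ n, MemLp (h n) 2 μ)
    (hg : MemLp g 2 μ) (hw : Tendsto (fun n => ∫ x, h n x * g x ∂μ) atTop (𝓝 (∫ x, g x * g x ∂μ))) :
    ∃ r : ℕ → ℝ, (∀ n, r n ≤ ∫ x, h n x ^ 2 ∂μ) ∧ Tendsto r atTop (𝓝 (∫ x, g x ^ 2 ∂μ)) := by
  refine ⟨fun n => 2 * (∫ x, h n x * g x ∂μ) - ∫ x, g x ^ 2 ∂μ, fun n => ?_, ?_⟩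
  · have i : Integrable (fun x => 2 * (h n x * g x)) μ := ((hh n).integrable_mul hg).const_mul 2
    beta_reduce
    rw [← integral_const_mul, ← integral_sub i hg.integrable_sq]
    exact integral_mono (i.sub hg.integrable_sq)
      (hh n).integrable_sq fun x => by nlinarith [sq_nonneg (h n x - g x)]
  · convert (hw.const_mul 2).sub_const (∫ x, g x ^ 2 ∂μ) using 2
    simp only [← sq]
    ring

lemma abs_entry_le_sum (A : Mat3) (i j : Fin 3) : |A i j| ≤ ∑ i, ∑ j, |A i j| :=
  (Finset.single_le_sum (fun j _ => abs_nonneg (A i j)) (Finset.mem_univ j)).trans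
    (Finset.single_le_sum (f := fun i => ∑ j, |A i j|)
      (fun _ _ => Finset.sum_nonneg fun _ _ => abs_nonneg _) (Finset.mem_univ i))

lemma sqrt_fr_le (A : Mat3) : √(fr A A) ≤ ∑ i, ∑ j, |A i j| := by
  refine Real.sqrt_le_iff.2 ⟨(abs_nonneg _).trans (abs_entry_le_sum A 0 0), ?_⟩
  rw [sq, Finset.sum_mul]
  simp only [Finset.sum_mul]
  refine Finset.sum_le_sum fun i _ => Finset.sum_le_sum fun j _ => ?_
  rw [← abs_mul_abs_self]
  exact mul_le_mul_of_nonneg_left (abs_entry_le_sum A i j) (abs_nonneg _)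

section
variable {a b c L C M : ℝ} {W : ℝ≥0∞} {q : ℕ → E3 → Mat3} {Q : E3 → Mat3}

lemma LimitField.tendsto_entry (hQ : LimitField q Q) (hq : ∀ n, FA a b c L W (q n))
    (hM0 : 0 ≤ M) (hM : ∀ n x, fr (q n x) (q n x) ≤ M ^ 2)
    (hC : ∀ n i j k, ∫ x in Omega, fderiv ℝ (fun y => q n y i j) x (ek k) ^ 2 ≤ C)
    {K : Set E3} (hK : IsCompact K) (hKO : K ⊆ Omega) (i j : Fin 3) :
    Tendsto (fun n => ∫ x in K, |q n x i j - Q x i j|) atTop (𝓝 0) := by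
  obtain ⟨M', hM'0, hM'⟩ := hQ.bdd
  have hqb : ∀ n x, |q n x i j| ≤ M := fun n x =>
    abs_le_of_sq_le_sq ((sq_entry_le _ i j).trans (hM n x)) hM0
  have hQb : ∀ x ∈ OmegaBar, |Q x i j| ≤ M' := fun x hx =>
    abs_le_of_sq_le_sq ((sq_entry_le _ i j).trans (hM' x hx)) hM'0
  have hd : ∀ n k, ∀ x ∈ Omega, fderiv ℝ (fun x => q n x i j - Q x i j) x (ek k) =
      fderiv ℝ (fun y => q n y i j) x (ek k) - fderiv ℝ (fun y => Q y i j) x (ek k) :=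
    fun n k x hx => by
      rw [fderiv_fun_sub ((hq n).1.1.diff hx i j) (hQ.reg.diff hx i j)]; rfl
  have h1 := fun n k => ((hq n).memLp_fderiv i j k)
  have h2 := hQ.memLp i j
  refine tendsto_setIntegral_abs_of_WC (M := M + M')
    (C := 2 * C + 2 * ∑ k, ∫ x in Omega, fderiv ℝ (fun y => Q y i j) x (ek k) ^ 2)
    (fun n => ((hq n).1.1 i j).sub (hQ.reg i j)) (by positivity)
    (fun n x hx => (abs_sub _ _).trans (add_le_add (hqb n x) (hQb x (Omega_subset hx))))
    (fun n k => ((h1 n k).sub (h2 k)).ae_eq ?_) (fun n k => ?_) (fun α hα => ?_) hK hKO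
  · exact (ae_restrict_iff' measurableSet_Omega).2 (Eventually.of_forall fun x hx => (hd n k x hx).symm)
  · have i1 := (h1 n k).integrable_sq.const_mul 2
    have i2 := (h2 k).integrable_sq.const_mul 2
    rw [setIntegral_congr_fun measurableSet_Omega fun x hx => by rw [hd n k x hx]]
    refine (integral_mono ((h1 n k).sub (h2 k)).integrable_sq (i1.add i2) fun x => ?_).trans ?_
    · simp only [Pi.add_apply, Pi.sub_apply]
      nlinarith [sq_nonneg (fderiv ℝ (fun y => q n y i j) x (ek k) + fderiv ℝ (fun y => Q y i j) x (ek k))]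
    · rw [integral_add' i1 i2, integral_const_mul, integral_const_mul]
      exact add_le_add (mul_le_mul_of_nonneg_left (hC n i j k) two_pos.le) (mul_le_mul_of_nonneg_left
        (Finset.single_le_sum (f := fun k => ∫ x in Omega, fderiv ℝ (fun y => Q y i j) x (ek k) ^ 2)
          (fun k _ => integral_nonneg fun x => sq_nonneg _) (Finset.mem_univ k)) two_pos.le)
  · have l1 := fun n => LI.of_continuousOn_bounded ((hq n).1.1 i j).continuousOn
      (fun x _ => hqb n x) α hα
    have l2 := LI.of_continuousOn_bounded (hQ.reg i j).continuousOn hQb α hα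
    have := (hQ.weak i j α hα).sub_const (∫ x in Omega, Q x i j * α x)
    simp only [sub_self, ← integral_sub (l1 _) l2, ← sub_mul] at this
    simpa using this

lemma LimitField.tendsto_setIntegral (hQ : LimitField q Q) (hq : ∀ n, FA a b c L W (q n))
    (hM0 : 0 ≤ M) (hM : ∀ n x, fr (q n x) (q n x) ≤ M ^ 2)
    (hC : ∀ n i j k, ∫ x in Omega, fderiv ℝ (fun y => q n y i j) x (ek k) ^ 2 ≤ C)
    {F : ℕ → E3 → ℝ} {G : E3 → ℝ} {D : ℝ} (hF : ∀ n, IntegrableOn (F n) Omega)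
    (hG : ContinuousOn G OmegaBar)
    (h : ∀ n, ∀ x ∈ Omega, |F n x - G x| ≤ D * ∑ i, ∑ j, |q n x i j - Q x i j|)
    (K : Set E3) (hK : IsCompact K) (hKO : K ⊆ Omega) :
    Tendsto (fun n => ∫ x in K, F n x) atTop (𝓝 (∫ x in K, G x)) := by
  have hKB := hKO.trans Omega_subset
  have i1 : ∀ n i j, IntegrableOn (fun x => |q n x i j - Q x i j|) K := fun n i j =>
    ((((hq n).1.1 i j).sub (hQ.reg i j)).continuousOn.abs.mono hKB).integrableOn_compact hK
  have i2 : ∀ n i, IntegrableOn (fun x => ∑ j, |q n x i j - Q x i j|) K := fun n i =>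
    integrable_finsetSum _ fun j _ => i1 n i j
  have i3 : IntegrableOn G K := (hG.mono hKB).integrableOn_compact hK
  have i4 : ∀ n, IntegrableOn (F n) K := fun n => (hF n).mono_set hKO
  have h0 : Tendsto (fun n => D * ∑ i, ∑ j, ∫ x in K, |q n x i j - Q x i j|) atTop (𝓝 0) := by
    simpa using (tendsto_finsetSum Finset.univ fun i _ => tendsto_finsetSum Finset.univ fun j _ =>
      hQ.tendsto_entry hq hM0 hM hC hK hKO i j).const_mul D
  rw [tendsto_iff_norm_sub_tendsto_zero]
  refine squeeze_zero (fun n => norm_nonneg _) (fun n => ?_) h0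
  rw [← integral_sub (i4 n) i3]
  refine (norm_integral_le_integral_norm _).trans ((setIntegral_mono_on ((i4 n).sub i3).norm
    ((integrable_finsetSum _ fun i _ => i2 n i).const_mul D) hK.measurableSet
    fun x hx => h n x (hKO hx)).trans_eq ?_)
  rw [integral_const_mul, integral_finsetSum _ fun i _ => i2 n i]
  simp only [integral_finsetSum _ fun j _ => i1 _ _ j]

end

lemma integral_gradSq {Q : E3 → Mat3} (hL : ∀ i j k,
    MemLp (fun x => fderiv ℝ (fun y => Q y i j) x (ek k)) 2 (volume.restrict Omega)) :
    IntegrableOn (gradSq Q) Omega ∧ ∫ x in Omega, gradSq Q x =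
      ∑ i, ∑ j, ∑ k, ∫ x in Omega, fderiv ℝ (fun y => Q y i j) x (ek k) ^ 2 := by
  have e : EqOn (fun x => ∑ i, ∑ j, ∑ k, fderiv ℝ (fun y => Q y i j) x (ek k) ^ 2) (gradSq Q) Omega :=
    fun x hx => by simp only [gradSq, pd_eq hx]
  have i1 := fun i j k => (hL i j k).integrable_sq
  have i2 := fun i j => integrable_finsetSum Finset.univ fun k _ => i1 i j k
  have i3 := fun i => integrable_finsetSum Finset.univ fun j _ => i2 i j
  refine ⟨IntegrableOn.congr_fun (integrable_finsetSum _ fun i _ => i3 i) e measurableSet_Omega, ?_⟩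
  rw [← setIntegral_congr_fun measurableSet_Omega e, integral_finsetSum _ fun i _ => i3 i]
  simp only [integral_finsetSum _ fun j _ => i2 _ j, integral_finsetSum _ fun k _ => i1 _ _ k]

section
variable {a b c L C M : ℝ} {W : ℝ≥0∞} {q : ℕ → E3 → Mat3} {Q : E3 → Mat3}

lemma LimitField.memH (hQ : LimitField q Q) (hq : ∀ n, FA a b c L W (q n))
    (hM0 : 0 ≤ M) (hM : ∀ n x, fr (q n x) (q n x) ≤ M ^ 2)
    (hC : ∀ n i j k, ∫ x in Omega, fderiv ℝ (fun y => q n y i j) x (ek k) ^ 2 ≤ C) :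
    memH a b c Q := by
  obtain ⟨M', hM'0, hM'⟩ := hQ.bdd
  refine ⟨hQ.isS0, (integral_gradSq hQ.memLp).1, ?_⟩
  have key : ∀ i j, IntegrableOn (fun x => (Q x i j - Qinf a b c i j) ^ 2 / ‖x‖ ^ 2) Omega :=
    fun i j => by
      have hG : ContinuousOn (fun x => (Q x i j - Qinf a b c i j) ^ 2 / ‖x‖ ^ 2) OmegaBar :=
        (((hQ.reg i j).continuousOn.sub continuousOn_const).pow 2).div (by fun_prop) fun x hx =>
          pow_ne_zero 2 (norm_ne_zero_iff.2 (ne_zero_of_OmegaBar hx))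
      have hi := fun n => (hq n).1.2.1.integrable_entry (hq n).1.1 i j
      refine (integral_le_of_tendsto_compact (B := fun _ => 4 * ∑ _k : Fin 3, C) hG hi
        (fun n x _ => by positivity) (fun x _ => by positivity)
        (hQ.tendsto_setIntegral hq hM0 hM hC (D := M + M' + 2 * |Qinf a b c i j|) hi hG fun n x hx => ?_)
        (fun n => ?_) tendsto_const_nhds).1
      · have h1 := abs_le.1 (abs_le_of_sq_le_sq ((sq_entry_le _ i j).trans (hM n x)) hM0)
        have h2 := abs_le.1 (abs_le_of_sq_le_sq
          ((sq_entry_le _ i j).trans (hM' x (Omega_subset hx))) hM'0)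
        have h3 := abs_le.1 (le_refl |Qinf a b c i j|)
        have h4 : |q n x i j + Q x i j - 2 * Qinf a b c i j| ≤ M + M' + 2 * |Qinf a b c i j| :=
          abs_le.2 ⟨by linarith, by linarith⟩
        have h5 : (1 : ℝ) ≤ ‖x‖ ^ 2 := one_le_pow₀ (Omega_subset hx)
        rw [← sub_div, abs_div, abs_of_pos (one_pos.trans_le h5),
          show (q n x i j - Qinf a b c i j) ^ 2 - (Q x i j - Qinf a b c i j) ^ 2 =
            (q n x i j + Q x i j - 2 * Qinf a b c i j) * (q n x i j - Q x i j) by ring, abs_mul]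
        exact (div_le_self (by positivity) h5).trans (mul_le_mul h4
          (abs_entry_le_sum (q n x - Q x) i j) (abs_nonneg _) (by positivity))
      · have h1 := (hq n).1.2.1.integrable_norm_fderiv_sq (hq n).1.1 i j
        refine (hardy (((hq n).1.1 i j).sub contDiffOn_const) (hi n) h1).trans
          (mul_le_mul_of_nonneg_left ?_ (by norm_num))
        have i1 := fun k => ((hq n).memLp_fderiv i j k).integrable_sq
        refine (integral_mono h1 (integrable_finsetSum Finset.univ fun k _ => i1 k) fun x =>
          (norm_sq_le_sum _).trans_eq ?_).trans ?_
        · simp only [fderiv_sub_const]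
        · rw [integral_finsetSum _ fun k _ => i1 k]
          exact Finset.sum_le_sum fun k _ => hC n i j k
  refine IntegrableOn.congr_fun (integrable_finsetSum Finset.univ fun i _ =>
    integrable_finsetSum Finset.univ fun j _ => key i j) (fun x hx => ?_) measurableSet_Omega
  rw [mnormSq_eq_fr ((hQ.isS0 x (Omega_subset hx)).1.sub (isS0_Qinf a b c).1), fr]
  simp only [Finset.sum_div, Matrix.sub_apply, sq]

lemma LimitField.exists_surf_le (hQ : LimitField q Q) (hq : ∀ n, FA a b c L W (q n)) :
    ∃ s : ℕ → ℝ, (∀ n, s n ≤ surf a b c (q n)) ∧ Tendsto s atTop (𝓝 (surf a b c Q)) := by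
  set φ : Fin 3 → Fin 3 → E3 → ℝ := fun i j x => cut 1 x * (Qsurf a b c x i j - Q x i j) with hφ
  have hCT : ∀ i j, CT (φ i j) := fun i j =>
    ⟨(contDiff_cut (n := 1) 1).contDiffOn.mul ((tgt_Qsurf a b c i j).contDiffOn.sub (hQ.reg i j)),
      2, fun x hx => by rw [hφ]; simp only [cut_eq_zero one_pos (by linarith : 2 * 1 ≤ ‖x‖), zero_mul]⟩
  have iφ : ∀ {f : E3 → Mat3}, RegC 1 f → ∀ i j, Integrable
      (fun w : sphere (0 : E3) 1 => f w i j * φ i j w) sph := fun hf i j =>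
    integrable_sphere ((hf i j).continuousOn.mul (hCT i j).reg.continuousOn)
  have id : ∀ n i j, Integrable (fun w : sphere (0 : E3) 1 => Q w i j * φ i j w - q n w i j * φ i j w)
    sph := fun n i j => (iφ hQ.reg i j).sub (iφ (hq n).1.1 i j)
  have is := fun n => (integrable_finsetSum Finset.univ fun i _ =>
    integrable_finsetSum Finset.univ fun j _ => id n i j).const_mul 2
  refine ⟨fun n => surf a b c Q + 2 * ∑ i, ∑ j, ((∫ w, Q w i j * φ i j w ∂sph) -
    ∫ w, q n w i j * φ i j w ∂sph), fun n => ?_, ?_⟩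
  · have i1 := integrable_sphere (continuousOn_surf a b c hQ.reg)
    beta_reduce
    simp only [← integral_sub (iφ hQ.reg _ _) (iφ (hq n).1.1 _ _)]
    simp only [← integral_finsetSum Finset.univ fun j _ => id n _ j]
    rw [← integral_finsetSum Finset.univ fun i _ => integrable_finsetSum Finset.univ fun j _ => id n i j,
      ← integral_const_mul, surf, surf, ← integral_add i1 (is n)]
    refine integral_mono (i1.add (is n)) (integrable_sphere (continuousOn_surf a b c (hq n).1.1))
      fun w => ?_
    have h := fr_self_nonneg (Q w - q n w)
    have e : ∑ i, ∑ j, (Q w i j * φ i j w - q n w i j * φ i j w) =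
        fr (Q w - q n w) (Qsurf a b c w - Q w) := by
      simp only [fr, hφ, cut_eq_one one_pos (coe_sphere_norm w).le, Matrix.sub_apply]
      exact Finset.sum_congr rfl fun i _ => Finset.sum_congr rfl fun j _ => by ring
    have e2 : Qsurf a b c w - q n w = (Qsurf a b c w - Q w) + (Q w - q n w) := by abel
    simp only []
    rw [e, e2, fr_add_left, fr_add_right, fr_add_right, fr_comm (Qsurf a b c w - Q w) (Q w - q n w)]
    linarith
  · have := (tendsto_finsetSum Finset.univ fun i _ => tendsto_finsetSum Finset.univ fun j _ =>
      (hQ.tendsto_sphere (fun n => (hq n).1.1) (fun n => (hq n).memLp_fderiv) (hCT i j) i j).const_sub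
        (∫ w, Q w i j * φ i j w ∂sph)).const_mul 2
    simpa using this.const_add (surf a b c Q)

lemma eq_Qsurf_of_surf_nonpos (hr : RegC 1 Q) (h : surf a b c Q ≤ 0) (x : E3) (hx : ‖x‖ = 1) :
    Q x = Qsurf a b c x := by
  have hc := continuous_sphere (continuousOn_surf a b c hr)
  have h0 : (fun w : sphere (0 : E3) 1 => fr (Qsurf a b c w - Q w) (Qsurf a b c w - Q w)) = 0 := by
    rw [← hc.ae_eq_iff_eq sph continuous_zero, ← integral_eq_zero_iff_of_nonneg
      (fun w => fr_self_nonneg _) (integrable_sphere (continuousOn_surf a b c hr))]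
    exact le_antisymm h (integral_nonneg fun w => fr_self_nonneg _)
  ext i j
  have h1 := (sq_entry_le _ i j).trans_eq (congrFun h0 ⟨x, by simpa using hx⟩)
  have h2 := pow_eq_zero_iff two_ne_zero |>.1 (le_antisymm h1 (sq_nonneg _))
  exact (sub_eq_zero.1 h2).symm

lemma exists_minimizer (ha : 0 ≤ a) (hb : 0 < b) (hc : 0 < c) (hL : 0 < L) {κ : ℝ≥0} :
    ∃ Q, FA a b c L W Q ∧
      ∀ P, FA a b c L W P → Jen a b c L (lamW W κ) Q ≤ Jen a b c L (lamW W κ) P := by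
  obtain ⟨m, q, Q, hm, hq, hM, hJ, hQ⟩ := exists_limitField (W := W) (κ := κ) ha hb hc hL
  have hl := lamW_nonneg W κ
  have hs := sstar_pos (a := a) hb hc
  obtain ⟨J, hJb⟩ := hJ.bddAbove_range
  have hC : ∀ n i j k, ∫ x in Omega, fderiv ℝ (fun y => q n y i j) x (ek k) ^ 2 ≤ 2 / L * J :=
    fun n i j k => ((hq n).integral_fderiv_sq_le ha hb hc hL hl i j k).trans
      (mul_le_mul_of_nonneg_left (hJb ⟨n, rfl⟩) (by positivity))
  have hM0 : 0 ≤ 2 * sstar a b c := by positivity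
  have hH := hQ.memH hq hM0 hM hC
  obtain ⟨s, hs1, hs2⟩ := hQ.exists_surf_le hq
  choose r hr1 hr2 using fun i j k => tendsto_sq_of_weak (fun n => (hq n).memLp_fderiv i j k)
    (hQ.memLp i j k) (hQ.weak_fderiv i j k _ (hQ.memLp i j k))
  obtain ⟨M', hM'0, hM'⟩ := hQ.bdd
  obtain ⟨D, hD0, hD⟩ := exists_fpot_lipschitz (a := a) ha hb hc
    (show 0 ≤ 2 * sstar a b c + M' by positivity)
  have hg := integral_gradSq hQ.memLp
  have hgn := fun n => integral_gradSq (hq n).memLp_fderiv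
  have hif : ∀ n, IntegrableOn (fun x => fpot a b c (q n x)) Omega := fun n =>
    ((hq n).2.sub ((hgn n).1.const_mul (L / 2))).congr_fun (fun x _ => by
      simp only [Pi.sub_apply, eden, add_sub_cancel_left]) measurableSet_Omega
  have hen : ∀ n, ∫ x in Omega, eden a b c L (q n) x =
      L / 2 * (∫ x in Omega, gradSq (q n) x) + ∫ x in Omega, fpot a b c (q n x) := fun n => by
    rw [← integral_const_mul, ← integral_add ((hgn n).1.const_mul _) (hif n)]; rfl
  have hfc : ContinuousOn (fun x => fpot a b c (Q x)) OmegaBar :=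
    (continuous_fpot a b c).comp_continuousOn hQ.reg.continuousOn
  have hB : ∀ n, ∫ x in Omega, fpot a b c (q n x) ≤ Jen a b c L (lamW W κ) (q n) -
      L / 2 * (∑ i, ∑ j, ∑ k, r i j k n) - lamW W κ * s n := fun n => by
    have h1 : ∑ i, ∑ j, ∑ k, r i j k n ≤ ∫ x in Omega, gradSq (q n) x := by
      rw [(hgn n).2]
      exact Finset.sum_le_sum fun i _ => Finset.sum_le_sum fun j _ => Finset.sum_le_sum fun k _ =>
        hr1 i j k n
    have h2 := mul_le_mul_of_nonneg_left h1 (show 0 ≤ L / 2 by positivity)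
    have h3 := mul_le_mul_of_nonneg_left (hs1 n) hl
    rw [Jen, hen]
    linarith
  obtain ⟨hi, hle⟩ := integral_le_of_tendsto_compact hfc hif
    (fun n x hx => fpot_nonneg ha hb hc ((hq n).1.2.1.1 x (Omega_subset hx)))
    (fun x hx => fpot_nonneg ha hb hc (hQ.isS0 x (Omega_subset hx)))
    (hQ.tendsto_setIntegral hq hM0 hM hC hif hfc fun n x hx =>
      (hD _ _ ((hq n).1.2.1.1 x (Omega_subset hx)) (hQ.isS0 x (Omega_subset hx))
        ((hM n x).trans (by gcongr; linarith)) ((hM' x (Omega_subset hx)).trans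
          (by gcongr; linarith))).trans (mul_le_mul_of_nonneg_left (sqrt_fr_le _) hD0))
    hB ((hJ.sub ((tendsto_finsetSum _ fun i _ =>
        tendsto_finsetSum _ fun j _ => tendsto_finsetSum _ fun k _ => hr2 i j k).const_mul _)).sub
          (hs2.const_mul _))
  have hi' : IntegrableOn (eden a b c L Q) Omega := (hg.1.const_mul (L / 2)).add hi
  refine ⟨Q, ⟨⟨hQ.reg, hH, fun hW => ?_⟩, hi'⟩, fun P hP => le_trans ?_ (hm P hP)⟩
  · refine eq_Qsurf_of_surf_nonpos hQ.reg (le_of_tendsto' hs2 fun n => (hs1 n).trans_eq ?_)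
    refine integral_eq_zero_of_ae (Eventually.of_forall fun w => ?_)
    simp only [(hq n).1.2.2 hW w (coe_sphere_norm w), sub_self]
    simp [fr]
  · have : ∫ x in Omega, eden a b c L Q x =
        L / 2 * (∫ x in Omega, gradSq Q x) + ∫ x in Omega, fpot a b c (Q x) := by
      rw [← integral_const_mul, ← integral_add (hg.1.const_mul _) hi]; rfl
    rw [Jen, this, hg.2]
    linarith

end

/-- Proposition 2.1: for every `L > 0` and `W ∈ [0,∞]` the free energy
attains its infimum over `H_∞`; moreover any solution of the Euler–Lagrange equations in
`H_∞` satisfies the strong far-field condition `Q(x) → Q_∞` as `|x| → ∞`. -/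
theorem existence_of_minimizer_and_farfield
    (a b c : ℝ) (ha : 0 ≤ a) (hb : 0 < b) (hc : 0 < c)
    (L : ℝ) (hL : 0 < L) (W : ℝ≥0∞) :
    (∃ Q : E3 → Mat3, Adm a b c W Q ∧
      FW a b c L W Q = ⨅ (P : E3 → Mat3) (_ : Adm a b c W P), FW a b c L W P) ∧
    (∀ Q : E3 → Mat3, RegC 2 Q → memH a b c Q → isEL a b c L Q →
      ∀ ε : ℝ, 0 < ε → ∃ R : ℝ, ∀ x : E3, R ≤ ‖x‖ → mnorm (Q x - Qinf a b c) ≤ ε) := by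
  obtain ⟨κ, hκ⟩ := exists_area_eq
  obtain ⟨Q, hQ, hmin⟩ := exists_minimizer (W := W) (κ := κ) ha hb hc hL
  exact ⟨⟨Q, hQ.1, FW_eq_iInf ha hb hc hL hκ hQ hmin⟩,
    fun Q hr hQ hEL ε hε => farfield ha hb hc hL hr hQ hEL hε⟩
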